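/- For every B > 0 the one-sided derivatives λ′_{1,±}(B) = lim_{ε→0±} (λ₁(H(B+ε)) − λ₁(H(B)))/ε exist and satisfy λ′_{1,+}(B) ≤ λ′_{1,−}(B); moreover Θ₀ − δ₀/2 > 0, liminf_{B→∞} λ′_{1,+}(B) ≥ Θ₀ − δ₀/2, and limsup_{B→∞} λ′_{1,−}(B) ≤ Θ₀ + δ₀/2. In particular there exists B₀ > 0 such that the function B ↦ λ₁(H(B)) is monotonically increasing on (B₀, ∞). -/

import Mathlib

noncomputable section
open MeasureTheory Real Filter Set Topology

/-- Euclidean 3-space. -/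
abbrev E3 := EuclideanSpace ℝ (Fin 3)

/-- The magnetic vector potential `A(x) = (B/2)(-x₂, x₁, 0)`. -/
def Avec (B : ℝ) (x : E3) : Fin 3 → ℝ := ![-(B / 2) * x 1, B / 2 * x 0, 0]

/-- The `j`-th component of `(-i∇ + A)Ψ`. -/
def magD (B : ℝ) (Ψ : E3 → ℂ) (j : Fin 3) (x : E3) : ℂ :=
  -Complex.I * fderiv ℝ Ψ x (EuclideanSpace.single j 1) + (Avec B x j : ℂ) * Ψ x

/-- The magnetic energy density `|(-i∇ + A)Ψ|²`. -/
def magEnergyDensity (B : ℝ) (Ψ : E3 → ℂ) (x : E3) : ℝ :=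
  ∑ j : Fin 3, ‖magD B Ψ j x‖ ^ 2

/-- The open unit ball in `ℝ³`. -/
def ball3 : Set E3 := Metric.ball 0 1

/-- The Neumann ground-state energy `λ₁(H(B))` of `(-i∇ + A)²` in the unit ball,
as the infimum of the Rayleigh quotients. -/
def lambda1H (B : ℝ) : ℝ :=
  sInf { q : ℝ | ∃ Ψ : E3 → ℂ, ContDiff ℝ 1 Ψ ∧
    0 < (∫ x in ball3, ‖Ψ x‖ ^ 2) ∧
    q = (∫ x in ball3, magEnergyDensity B Ψ x) / ∫ x in ball3, ‖Ψ x‖ ^ 2 }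

/-- The de Gennes energy `λ₁^𝒢(ξ)`. -/
def deGennes (ξ : ℝ) : ℝ :=
  sInf { q : ℝ | ∃ u : ℝ → ℂ, ContDiff ℝ 1 u ∧
    IntegrableOn (fun t => ‖u t‖ ^ 2) (Ioi 0) ∧
    IntegrableOn (fun t => ‖deriv u t‖ ^ 2 + (t + ξ) ^ 2 * ‖u t‖ ^ 2) (Ioi 0) ∧
    0 < (∫ t in Ioi (0:ℝ), ‖u t‖ ^ 2) ∧
    q = (∫ t in Ioi (0:ℝ), (‖deriv u t‖ ^ 2 + (t + ξ) ^ 2 * ‖u t‖ ^ 2)) /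
        ∫ t in Ioi (0:ℝ), ‖u t‖ ^ 2 }

/-- `Θ₀`, the infimum of the de Gennes energy. -/
def Theta0 : ℝ := ⨅ ξ : ℝ, deGennes ξ

/-- The Montgomery energy `λ₁^ℳ(ζ)`. -/
def montgomery (ζ : ℝ) : ℝ :=
  sInf { q : ℝ | ∃ u : ℝ → ℂ, ContDiff ℝ 1 u ∧
    Integrable (fun ρ => ‖u ρ‖ ^ 2) ∧
    Integrable (fun ρ => ‖deriv u ρ‖ ^ 2 + (ζ + ρ ^ 2) ^ 2 * ‖u ρ‖ ^ 2) ∧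
    0 < (∫ ρ : ℝ, ‖u ρ‖ ^ 2) ∧
    q = (∫ ρ : ℝ, (‖deriv u ρ‖ ^ 2 + (ζ + ρ ^ 2) ^ 2 * ‖u ρ‖ ^ 2)) / ∫ ρ : ℝ, ‖u ρ‖ ^ 2 }

/-- `ν̂₀`, the infimum of the Montgomery energy. -/
def nu0 : ℝ := ⨅ ζ : ℝ, montgomery ζ

/-- The magnetic operator `H(B)Ψ = (-i∇ + A)²Ψ`. -/
def magLap (B : ℝ) (Ψ : E3 → ℂ) (x : E3) : ℂ :=
  ∑ j : Fin 3, (-Complex.I * fderiv ℝ (magD B Ψ j) x (EuclideanSpace.single j 1)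
    + (Avec B x j : ℂ) * magD B Ψ j x)

/-- A Neumann eigenfunction of `H(B)` with eigenvalue `lam`: a nonzero (in `L²(Ω)`)
twice continuously differentiable function satisfying the eigenvalue equation in the ball
and the magnetic Neumann condition `N(x)·(-i∇+A)Ψ = 0` on the boundary sphere,
`N(x) = -x` being the interior normal. -/
def IsNeumannEigenfunction (B lam : ℝ) (Ψ : E3 → ℂ) : Prop :=
  ContDiff ℝ 2 Ψ ∧
  0 < (∫ x in ball3, ‖Ψ x‖ ^ 2) ∧
  (∀ x ∈ ball3, magLap B Ψ x = (lam : ℂ) * Ψ x) ∧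
  (∀ x ∈ Metric.sphere (0 : E3) 1, ∑ j : Fin 3, ((-x j : ℝ) : ℂ) * magD B Ψ j x = 0)

/-- Distance to the boundary of the unit ball. -/
def distBd (x : E3) : ℝ := 1 - ‖x‖

/-- Distance along the boundary (on the unit sphere, after radial projection)
to the equator `Γ`. -/
def distEq (x : E3) : ℝ := Real.arcsin (|x 2| / ‖x‖)

set_option linter.all false

section
theorem ibp0 {F F' : ℝ → ℝ} {a : ℝ} (hd : ∀ x ∈ Ici a, HasDerivAt F (F' x) x)
    (h' : IntegrableOn F' (Ioi a)) (h : IntegrableOn F (Ioi a)) : ∫ x in Ioi a, F' x = - F a := by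
  rw [integral_Ioi_of_hasDerivAt_of_tendsto' hd h'
    (tendsto_zero_of_hasDerivAt_of_integrableOn_Ioi (fun x hx => hd x hx.out.le) h' h)]
  ring

def gk (x p s : ℝ) : ℝ := s ^ p * exp (-s ^ 2 / 4 - x * s)
def gI (x p : ℝ) : ℝ := ∫ s in Ioi (0:ℝ), gk x p s

theorem gk_pos {x p s : ℝ} (hs : 0 < s) : 0 < gk x p s := by unfold gk; positivity

theorem gk_meas (x p : ℝ) : Measurable (gk x p) := by unfold gk; fun_prop

theorem gk_int (x : ℝ) {p : ℝ} (hp : -1 < p) : IntegrableOn (gk x p) (Ioi 0) := by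
  have h := (integrableOn_rpow_mul_exp_neg_mul_sq (b := 1/8) (by norm_num) hp).const_mul
    (exp (2 * x ^ 2))
  refine h.mono' (gk_meas x p).aestronglyMeasurable ?_
  filter_upwards [self_mem_ae_restrict measurableSet_Ioi] with s hs
  have hs : 0 < s := hs
  rw [Real.norm_of_nonneg (gk_pos hs).le, gk, mul_left_comm, ← exp_add]
  gcongr
  nlinarith [sq_nonneg (s + 4 * x)]

theorem gI_pos (x : ℝ) {p : ℝ} (hp : -1 < p) : 0 < gI x p := by
  rw [gI, setIntegral_pos_iff_support_of_nonneg_ae]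
  · have : (Function.support (gk x p) ∩ Ioi 0) = Ioi 0 := by
      apply inter_eq_right.2
      intro s hs; exact (gk_pos hs).ne'
    rw [this]; simp
  · filter_upwards [self_mem_ae_restrict measurableSet_Ioi] with s hs using (gk_pos hs).le
  · exact gk_int x hp

theorem gk_succ {x p s : ℝ} (hs : 0 < s) : gk x (p + 1) s = s * gk x p s := by
  unfold gk; rw [rpow_add hs, rpow_one]; ring

theorem gk_anti {x y p s : ℝ} (hs : 0 < s) (h : x ≤ y) : gk y p s ≤ gk x p s := by
  unfold gk; gcongr

theorem gI_anti {x y p : ℝ} (hp : -1 < p) (h : x ≤ y) : gI y p ≤ gI x p :=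
  setIntegral_mono_on (gk_int y hp) (gk_int x hp) measurableSet_Ioi
    fun s hs => gk_anti hs h

theorem gI_deriv (x : ℝ) {p : ℝ} (hp : -1 < p) :
    HasDerivAt (fun x => gI x p) (- gI x (p + 1)) x := by
  have h := hasDerivAt_integral_of_dominated_loc_of_deriv_le (μ := volume.restrict (Ioi (0:ℝ)))
    (F := fun x s => gk x p s) (F' := fun x s => - gk x (p + 1) s) (x₀ := x)
    (bound := gk (x - 1) (p + 1)) (s := Ioi (x - 1)) (Ioi_mem_nhds (by linarith))
    (Eventually.of_forall fun y => (gk_meas y p).aestronglyMeasurable)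
    (gk_int x hp) (gk_meas x (p+1)).neg.aestronglyMeasurable ?_ (gk_int _ (by linarith)) ?_
  · have := h.2
    rw [integral_neg] at this
    exact this
  · filter_upwards [self_mem_ae_restrict measurableSet_Ioi] with s hs y hy
    rw [norm_neg, Real.norm_of_nonneg (gk_pos hs).le]
    exact gk_anti hs (le_of_lt hy)
  · filter_upwards [self_mem_ae_restrict measurableSet_Ioi] with s hs y hy
    rw [gk_succ hs]
    unfold gk
    have h1 : HasDerivAt (fun y : ℝ => -s ^ 2 / 4 - y * s) (-s) y := by
      simpa using ((hasDerivAt_id y).mul_const s).const_sub (-s^2/4)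
    exact (h1.exp.const_mul (s ^ p)).congr_deriv (by ring)

theorem gI_rec (x : ℝ) {p : ℝ} (hp : -1 < p) :
    gI x (p + 2) + 2 * x * gI x (p + 1) = 2 * (p + 1) * gI x p := by
  have e : ∀ s ∈ Ioi (0:ℝ), HasDerivAt (gk x (p+1))
      ((p + 1) * gk x p s - (1/2) * gk x (p + 2) s - x * gk x (p+1) s) s := by
    intro s hs
    have hs : 0 < s := hs
    have h1 : HasDerivAt (fun s : ℝ => -s ^ 2 / 4 - x * s) (-s/2 - x) s := by
      have := (((hasDerivAt_id s).pow 2).neg.div_const 4).sub ((hasDerivAt_id s).const_mul x)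
      exact this.congr_deriv (by simp; ring)
    have h2 := (Real.hasDerivAt_rpow_const (x := s) (p := p + 1) (Or.inl hs.ne')).mul h1.exp
    refine h2.congr_deriv ?_
    rw [show p + 2 = (p + 1) + 1 by ring, gk_succ hs, gk_succ hs]
    unfold gk
    rw [show p + 1 - 1 = p by ring, rpow_add hs, rpow_one]
    ring
  have i1 := gk_int x hp
  have i2 := gk_int x (p := p+1) (by linarith)
  have i3 := gk_int x (p := p+2) (by linarith)
  have hint : IntegrableOn (fun s => (p + 1) * gk x p s - (1/2) * gk x (p + 2) s - x * gk x (p+1) s)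
    (Ioi 0) := ((i1.const_mul _).sub (i3.const_mul _)).sub (i2.const_mul _)
  have h := integral_Ioi_of_hasDerivAt_of_tendsto (a := 0) ?_ e hint
    (tendsto_zero_of_hasDerivAt_of_integrableOn_Ioi e hint i2)
  · rw [integral_sub (f := fun s => (p + 1) * gk x p s - (1/2) * gk x (p + 2) s)
        ((i1.const_mul _).sub (i3.const_mul _)) (i2.const_mul _),
      integral_sub (i1.const_mul _) (i3.const_mul _), integral_const_mul, integral_const_mul,
      integral_const_mul] at h
    have h0 : gk x (p+1) 0 = 0 := by
      unfold gk; rw [zero_rpow (by linarith)]; simp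
    rw [h0] at h
    unfold gI
    linarith
  · have : ContinuousAt (gk x (p+1)) 0 := by
      unfold gk
      apply ContinuousAt.mul
      · exact Real.continuousAt_rpow_const _ _ (Or.inr (by linarith))
      · fun_prop
    exact this.continuousWithinAt

theorem rpow_le_add {s p a b : ℝ} (hs : 0 < s) (h1 : a ≤ p) (h2 : p ≤ b) :
    s ^ p ≤ s ^ a + s ^ b := by
  rcases le_total s 1 with h | h
  · have := Real.rpow_le_rpow_of_exponent_ge hs h h1
    have := rpow_pos_of_pos hs b
    linarith
  · have := Real.rpow_le_rpow_of_exponent_le h h2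
    have := rpow_pos_of_pos hs a
    linarith

theorem gk_bd {x y s p a b : ℝ} (hs : 0 < s) (hx : y ≤ x) (h1 : a ≤ p) (h2 : p ≤ b) :
    gk x p s ≤ gk y a s + gk y b s := by
  refine (gk_anti hs hx).trans ?_
  unfold gk
  rw [← add_mul]
  gcongr
  exact rpow_le_add hs h1 h2

theorem gI_bd {x y p a b : ℝ} (ha : -1 < a) (hx : y ≤ x) (h1 : a ≤ p) (h2 : p ≤ b) :
    gI x p ≤ gI y a + gI y b := by
  unfold gI
  rw [← integral_add (gk_int y ha) (gk_int y (by linarith))]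
  exact setIntegral_mono_on (gk_int x (by linarith)) ((gk_int y ha).add (gk_int y (by linarith)))
    measurableSet_Ioi fun s hs => gk_bd hs hx h1 h2

theorem gI_cont {x p : ℝ} (hp : -1 < p) : ContinuousAt (fun z : ℝ × ℝ => gI z.1 z.2) (x, p) := by
  unfold gI
  apply continuousAt_of_dominated
    (bound := fun s => gk (x - 1) ((p-1)/2) s + gk (x-1) (p+1) s)
  · exact Eventually.of_forall fun z => (gk_meas _ _).aestronglyMeasurable
  · have : ∀ᶠ z : ℝ × ℝ in 𝓝 (x, p), x - 1 < z.1 ∧ (p-1)/2 < z.2 ∧ z.2 < p + 1 := by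
      refine (continuousAt_fst.eventually (Ioi_mem_nhds (by simp))).and
        ((continuousAt_snd.eventually (Ioi_mem_nhds (by simp; linarith))).and
          (continuousAt_snd.eventually (Iio_mem_nhds (by simp))))
    filter_upwards [this] with z hz
    filter_upwards [self_mem_ae_restrict measurableSet_Ioi] with s hs
    rw [Real.norm_of_nonneg (gk_pos hs).le]
    exact gk_bd hs hz.1.le hz.2.1.le hz.2.2.le
  · exact (gk_int _ (by linarith)).add (gk_int _ (by linarith))
  · filter_upwards [self_mem_ae_restrict measurableSet_Ioi] with s hs
    have hs : 0 < s := hs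
    unfold gk
    apply ContinuousAt.mul
    · exact ContinuousAt.rpow continuousAt_const continuousAt_snd (Or.inl hs.ne')
    · fun_prop

/-- decaying solution of `f'' = (x²-E) f` -/
def fE (E x : ℝ) : ℝ := exp (-x ^ 2 / 2) * gI x (-(1 + E) / 2)
def QE (E x : ℝ) : ℝ := gI x (-(1 + E) / 2 + 1) / gI x (-(1 + E) / 2)
def hE (E x : ℝ) : ℝ := - x - QE E x

section
variable {E : ℝ} (hE1 : E < 1)
include hE1

theorem fE_pos (x : ℝ) : 0 < fE E x := mul_pos (exp_pos _) (gI_pos x (by linarith))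
theorem QE_pos (x : ℝ) : 0 < QE E x := div_pos (gI_pos x (by linarith)) (gI_pos x (by linarith))

theorem fE_deriv (x : ℝ) : HasDerivAt (fE E) (hE E x * fE E x) x := by
  have h1 : HasDerivAt (fun x : ℝ => -x ^ 2 / 2) (-x) x := by
    have := (((hasDerivAt_id x).pow 2).neg.div_const 2)
    exact this.congr_deriv (by simp; ring)
  have h := h1.exp.mul (gI_deriv x (p := -(1 + E) / 2) (by linarith))
  refine h.congr_deriv ?_
  have := (gI_pos x (p := -(1 + E) / 2) (by linarith)).ne'
  unfold hE fE QE
  generalize gI x (-(1 + E) / 2) = a at *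
  field_simp
  ring

theorem hE_deriv (x : ℝ) : HasDerivAt (hE E) (x ^ 2 - E - hE E x ^ 2) x := by
  have hp : -1 < -(1 + E) / 2 := by linarith
  have h0 := (gI_pos x hp).ne'
  have h := (hasDerivAt_id x).neg.sub ((gI_deriv x (p := -(1 + E) / 2 + 1) (by linarith)).div
    (gI_deriv x hp) h0)
  refine h.congr_deriv ?_
  have hr := gI_rec x hp
  rw [show -(1 + E) / 2 + 1 + 1 = -(1 + E) / 2 + 2 by ring]
  have : gI x (-(1 + E) / 2 + 2) = (1 - E) * gI x (-(1 + E) / 2)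
    - 2 * x * gI x (-(1 + E) / 2 + 1) := by linarith
  rw [this]
  unfold hE QE
  generalize gI x (-(1 + E) / 2) = a at *
  generalize gI x (-(1 + E) / 2 + 1) = b at *
  field_simp
  ring

theorem hE_cont : Continuous (hE E) :=
  continuous_iff_continuousAt.2 fun x => (hE_deriv hE1 x).continuousAt

theorem fE_cont : Continuous (fE E) :=
  continuous_iff_continuousAt.2 fun x => (fE_deriv hE1 x).continuousAt

theorem QE_bd {x : ℝ} (hx : 0 < x) : x * QE E x ≤ (1 - E) / 2 := by
  have hp : -1 < -(1 + E) / 2 := by linarith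
  have h0 := (gI_pos x hp)
  have := gI_rec x hp
  have h2 := gI_pos x (p := -(1 + E) / 2 + 2) (by linarith)
  unfold QE
  rw [mul_div_assoc', div_le_iff₀ h0]
  linarith

theorem fE_ratio {x t : ℝ} (h : x ≤ t) : fE E t ≤ fE E x * exp (x^2/2 - t^2/2) := by
  have := gI_anti (x := x) (y := t) (p := -(1 + E) / 2) (by linarith) h
  unfold fE
  rw [mul_right_comm, ← exp_add, show -x^2/2 + (x^2/2-t^2/2) = -t^2/2 by ring]
  gcongr

theorem QE_bdd (a : ℝ) : ∃ K, 0 < K ∧ ∀ x, a ≤ x → QE E x ≤ K := by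
  have hc : Continuous (QE E) := by
    have : QE E = fun x => - x - hE E x := by ext x; unfold hE; ring
    rw [this]
    have := hE_cont hE1
    fun_prop
  obtain ⟨C, hC⟩ := (isCompact_Icc (a := a) (b := 1)).exists_bound_of_continuousOn hc.continuousOn
  refine ⟨max C 1 + (1 - E) / 2, by have := le_max_right C 1; linarith, fun x hx => ?_⟩
  rcases le_total x 1 with h | h
  · have := hC x ⟨hx, h⟩
    have := le_abs_self (QE E x)
    have := le_max_left C 1
    simp only [Real.norm_eq_abs] at *
    linarith
  · have h1 := QE_bd hE1 (x := x) (by linarith)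
    have h2 := QE_pos hE1 x
    have := le_max_right C 1
    nlinarith
end
end

section
theorem not_ev_ge {Φ : ℝ → ℝ} {c : ℝ} (hc : 0 < c) (hi : IntegrableOn Φ (Ioi 0))
    (h : ∀ᶠ T in atTop, c ≤ Φ T) : False := by
  obtain ⟨T0, hT⟩ := eventually_atTop.1 h
  have h1 : IntegrableOn (fun _ : ℝ => c) (Ioi (max T0 0)) := by
    refine (hi.mono_set (Ioi_subset_Ioi (le_max_right T0 0))).mono' aestronglyMeasurable_const ?_
    filter_upwards [self_mem_ae_restrict measurableSet_Ioi] with s hs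
    rw [Real.norm_of_nonneg hc.le]
    exact hT s ((le_max_left _ _).trans (le_of_lt hs))
  rw [integrableOn_const_iff (by simp)] at h1
  simp [hc.ne'] at h1

theorem dg_bdd (ξ : ℝ) : BddBelow { q : ℝ | ∃ u : ℝ → ℂ, ContDiff ℝ 1 u ∧
    IntegrableOn (fun t => ‖u t‖ ^ 2) (Ioi 0) ∧
    IntegrableOn (fun t => ‖deriv u t‖ ^ 2 + (t + ξ) ^ 2 * ‖u t‖ ^ 2) (Ioi 0) ∧
    0 < (∫ t in Ioi (0:ℝ), ‖u t‖ ^ 2) ∧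
    q = (∫ t in Ioi (0:ℝ), (‖deriv u t‖ ^ 2 + (t + ξ) ^ 2 * ‖u t‖ ^ 2)) /
        ∫ t in Ioi (0:ℝ), ‖u t‖ ^ 2 } := by
  refine ⟨0, ?_⟩
  rintro q ⟨u, _, _, _, h, rfl⟩
  exact div_nonneg (integral_nonneg fun t => by positivity) h.le

theorem dg_low_aux {ξ E K : ℝ} {H H' : ℝ → ℝ} (hd : ∀ x, HasDerivAt H (H' x) x)
    (hc : Continuous H') (h0 : H ξ ≤ 0) (hK : ∀ x, ξ ≤ x → |H x| ≤ K * (1 + |x|))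
    (hE : ∀ x, ξ ≤ x → E ≤ x ^ 2 - H' x - H x ^ 2) {u : ℝ → ℂ} (hu : ContDiff ℝ 1 u)
    (i1 : IntegrableOn (fun t => ‖u t‖ ^ 2) (Ioi 0))
    (i2 : IntegrableOn (fun t => ‖deriv u t‖ ^ 2 + (t + ξ) ^ 2 * ‖u t‖ ^ 2) (Ioi 0)) :
    E * (∫ t in Ioi (0:ℝ), ‖u t‖ ^ 2) ≤
      ∫ t in Ioi (0:ℝ), (‖deriv u t‖ ^ 2 + (t + ξ) ^ 2 * ‖u t‖ ^ 2) := by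
  have hud : ∀ t, HasDerivAt u (deriv u t) t := fun t =>
    (hu.differentiable (by norm_num)).differentiableAt.hasDerivAt
  have huc : Continuous (deriv u) := hu.continuous_deriv (by norm_num)
  have hucc : Continuous u := hu.continuous
  have hHc : Continuous H := continuous_iff_continuousAt.2 fun x => (hd x).continuousAt
  have hderiv : ∀ t, HasDerivAt (fun t => H (t + ξ) * ‖u t‖ ^ 2)
      (H' (t + ξ) * ‖u t‖ ^ 2 + H (t + ξ) * (2 * inner ℝ (u t) (deriv u t))) t := by
    intro t
    exact ((hd (t + ξ)).comp_add_const t ξ).mul (hud t).norm_sq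
  have hpt : ∀ t, 0 ≤ t → H' (t + ξ) * ‖u t‖ ^ 2 + H (t + ξ) * (2 * inner ℝ (u t) (deriv u t))
      ≤ (‖deriv u t‖ ^ 2 + (t + ξ) ^ 2 * ‖u t‖ ^ 2) - E * ‖u t‖ ^ 2 := by
    intro t ht
    have h1 := hE (t + ξ) (by linarith)
    have h2 : 0 ≤ ‖deriv u t - H (t+ξ) • u t‖ ^ 2 := by positivity
    rw [norm_sub_sq_real, norm_smul, inner_smul_right, mul_pow, Real.norm_eq_abs, sq_abs,
      real_inner_comm] at h2
    have h3 := mul_le_mul_of_nonneg_right h1 (sq_nonneg ‖u t‖)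
    linarith
  have hint : IntegrableOn (fun t => (‖deriv u t‖ ^ 2 + (t + ξ) ^ 2 * ‖u t‖ ^ 2) - E * ‖u t‖ ^ 2)
    (Ioi 0) := i2.sub (i1.const_mul E)
  have hT : ∀ T, 0 ≤ T → H (T + ξ) * ‖u T‖ ^ 2 ≤ ∫ t in (0:ℝ)..T,
      ((‖deriv u t‖ ^ 2 + (t + ξ) ^ 2 * ‖u t‖ ^ 2) - E * ‖u t‖ ^ 2) := by
    intro T h
    have hcd : Continuous fun t => (H' (t + ξ) * ‖u t‖ ^ 2
      + H (t + ξ) * (2 * inner ℝ (u t) (deriv u t))) := by fun_prop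
    have e1 := intervalIntegral.integral_eq_sub_of_hasDerivAt (a := 0) (b := T)
      (fun t _ => hderiv t) (hcd.intervalIntegrable _ _)
    have e2 := intervalIntegral.integral_mono_on (μ := volume) h (hcd.intervalIntegrable 0 T)
      ((by fun_prop : Continuous fun t => (‖deriv u t‖ ^ 2 + (t + ξ) ^ 2 * ‖u t‖ ^ 2)
        - E * ‖u t‖ ^ 2).intervalIntegrable 0 T) (fun t ht => hpt t ht.1)
    rw [e1] at e2
    have : H (0 + ξ) * ‖u 0‖ ^ 2 ≤ 0 := by
      rw [zero_add]; exact mul_nonpos_of_nonpos_of_nonneg h0 (by positivity)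
    linarith
  have hlim := intervalIntegral_tendsto_integral_Ioi 0 hint tendsto_id
  have e : ∫ t in Ioi (0:ℝ), ((‖deriv u t‖ ^ 2 + (t + ξ) ^ 2 * ‖u t‖ ^ 2) - E * ‖u t‖ ^ 2)
    = (∫ t in Ioi (0:ℝ), (‖deriv u t‖ ^ 2 + (t + ξ) ^ 2 * ‖u t‖ ^ 2)) -
      E * (∫ t in Ioi (0:ℝ), ‖u t‖ ^ 2) := by
    rw [integral_sub i2 (i1.const_mul E), integral_const_mul]
  rw [e] at hlim
  by_contra hcon
  push Not at hcon
  set L := (∫ t in Ioi (0:ℝ), (‖deriv u t‖ ^ 2 + (t + ξ) ^ 2 * ‖u t‖ ^ 2)) -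
      E * (∫ t in Ioi (0:ℝ), ‖u t‖ ^ 2) with hL
  have hLneg : L < 0 := by linarith
  have hev := hlim.eventually (Iio_mem_nhds (show L < L / 2 by linarith))
  have hi2 : IntegrableOn (fun t => |K| * 2 * (‖u t‖ ^ 2 +
    (‖deriv u t‖ ^ 2 + (t + ξ) ^ 2 * ‖u t‖ ^ 2))) (Ioi 0) := (i1.add i2).const_mul _
  refine not_ev_ge (c := - (L / 2)) (by linarith) hi2 ?_
  filter_upwards [hev, eventually_ge_atTop 0] with T h1 h2
  have h3 := hT T h2
  have h4 := hK (T + ξ) (by linarith)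
  have h5 := neg_abs_le (H (T + ξ))
  have h1 : ∫ t in (0:ℝ)..T,
      ((‖deriv u t‖ ^ 2 + (t + ξ) ^ 2 * ‖u t‖ ^ 2) - E * ‖u t‖ ^ 2) < L / 2 := h1
  have h6 : K * (1 + |T + ξ|) ≤ |K| * 2 * (1 + (T + ξ) ^ 2) := by
    have := le_abs_self K
    have h7 : 1 + |T + ξ| ≤ 2 * (1 + (T + ξ) ^ 2) := by
      rw [← sq_abs (T + ξ)]; nlinarith [sq_nonneg (|T + ξ| - 1)]
    calc K * (1 + |T + ξ|) ≤ |K| * (1 + |T + ξ|) := by gcongr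
      _ ≤ |K| * (2 * (1 + (T + ξ) ^ 2)) := by gcongr
      _ = _ := by ring
  have h8 : - H (T + ξ) * ‖u T‖ ^ 2 ≤ |K| * 2 * (1 + (T + ξ) ^ 2) * ‖u T‖ ^ 2 := by
    gcongr; linarith
  have h9 : 0 ≤ |K| * 2 * ‖deriv u T‖ ^ 2 := by positivity
  linarith

/-- weighted integrability -/
theorem fE_int {E a K : ℝ} (hE : E < 1) {φ : ℝ → ℝ} (hφ : Continuous φ)
    (hb : ∀ x, a < x → |φ x| ≤ K * (1 + x ^ 4)) :
    IntegrableOn (fun x => φ x * fE E x ^ 2) (Ioi a) := by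
  have hc := fE_cont hE
  have i0 : Integrable (fun x : ℝ => exp (-1 * x ^ 2)) := integrable_exp_neg_mul_sq one_pos
  have i4 : Integrable (fun x : ℝ => x ^ (4:ℝ) * exp (-1 * x ^ 2)) :=
    integrable_rpow_mul_exp_neg_mul_sq one_pos (by norm_num)
  have hi : IntegrableOn (fun x : ℝ => |K| * (gI a (-(1+E)/2)) ^ 2 * (exp (-1 * x ^ 2) +
    x ^ (4:ℝ) * exp (-1 * x ^ 2))) (Ioi a) := ((i0.add i4).const_mul _).integrableOn
  refine hi.mono' (by fun_prop : Continuous _).aestronglyMeasurable ?_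
  filter_upwards [self_mem_ae_restrict measurableSet_Ioi] with x hx
  have h1 := hb x hx
  have h2 : fE E x ≤ gI a (-(1+E)/2) * exp (-x^2/2) := by
    unfold fE; rw [mul_comm]; gcongr; exact gI_anti (by linarith) (le_of_lt hx)
  have h3 := (fE_pos hE x).le
  have h4 : fE E x ^ 2 ≤ (gI a (-(1+E)/2) * exp (-x^2/2)) ^ 2 := by gcongr
  rw [mul_pow, ← exp_nat_mul, show ((2:ℕ):ℝ) * (-x^2/2) = -1 * x^2 by push_cast; ring] at h4
  rw [norm_mul, Real.norm_eq_abs, Real.norm_of_nonneg (sq_nonneg _)]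
  rw [show x ^ (4:ℝ) = x ^ 4 by norm_cast]
  calc |φ x| * fE E x ^ 2 ≤ (|K| * (1 + x ^ 4)) * ((gI a (-(1+E)/2)) ^ 2 * exp (-1 * x^2)) := by
        gcongr
        exact h1.trans (by gcongr; exact le_abs_self K)
    _ = _ := by ring

def NE (E a : ℝ) : ℝ := ∫ x in Ioi a, fE E x ^ 2

theorem NE_pos {E : ℝ} (hE : E < 1) (a : ℝ) : 0 < NE E a := by
  have hi : IntegrableOn (fun x => fE E x ^ 2) (Ioi a) := by
    simpa using fE_int (a := a) (K := 1) hE (φ := fun _ => 1) (by fun_prop)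
      (fun x _ => by simp; positivity)
  rw [NE, setIntegral_pos_iff_support_of_nonneg_ae (Eventually.of_forall fun x => by positivity) hi]
  have : (Function.support (fun x => fE E x ^ 2) ∩ Ioi a) = Ioi a := by
    apply inter_eq_right.2
    intro s _; exact (pow_pos (fE_pos hE s) 2).ne'
  rw [this]; simp

theorem hE_bd {E : ℝ} (hE1 : E < 1) (a : ℝ) : ∃ K, 0 < K ∧
    ∀ x, a ≤ x → |hE E x| ≤ K * (1 + |x|) := by
  obtain ⟨K, hK, h⟩ := QE_bdd hE1 a
  refine ⟨K + 1, by linarith, fun x hx => ?_⟩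
  have h1 := h x hx
  have h2 := QE_pos hE1 x
  unfold hE
  have : |-x - QE E x| ≤ |x| + QE E x := by
    rw [abs_le]; constructor <;> cases abs_cases x <;> linarith
  nlinarith [abs_nonneg x]

theorem sq_bd {A K x : ℝ} (h : |A| ≤ K * (1 + |x|)) : A ^ 2 ≤ 4 * K ^ 2 * (1 + x ^ 4) := by
  have h1 : A ^ 2 ≤ (K * (1 + |x|)) ^ 2 := by
    rw [← sq_abs A]; gcongr
  have h2 : (1 + |x|) ^ 2 ≤ 4 * (1 + x ^ 4) := by
    have : x ^ 4 = |x| ^ 4 := by rw [← abs_pow]; exact (abs_of_nonneg (by positivity)).symm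
    rw [this]; nlinarith [sq_nonneg (|x| - 1), sq_nonneg (|x| ^ 2 - 1), abs_nonneg x]
  calc A ^ 2 ≤ K ^ 2 * (1 + |x|) ^ 2 := by rw [← mul_pow]; exact h1
    _ ≤ K ^ 2 * (4 * (1 + x ^ 4)) := by gcongr
    _ = _ := by ring

theorem setInt_shift (g : ℝ → ℝ) (ξ : ℝ) :
    ∫ t in Ioi (0:ℝ), g (t + ξ) = ∫ x in Ioi ξ, g x := by
  have := (measurePreserving_add_right (volume : Measure ℝ) ξ).setIntegral_preimage_emb
    (MeasurableEquiv.addRight ξ).measurableEmbedding g (Ioi ξ)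
  simpa using this

theorem intOn_shift {g : ℝ → ℝ} {ξ : ℝ} (h : IntegrableOn g (Ioi ξ)) :
    IntegrableOn (fun t => g (t + ξ)) (Ioi 0) := by
  have := (measurePreserving_add_right (volume : Measure ℝ) ξ).integrableOn_comp_preimage
    (MeasurableEquiv.addRight ξ).measurableEmbedding (f := g) (s := Ioi ξ)
  simp only [preimage_add_const_Ioi, sub_self] at this
  exact this.2 h

/-- basic trial quotient -/
theorem dg_trial {E : ℝ} (hE1 : E < 1) (ξ ξ' : ℝ) :
    (∃ u : ℝ → ℂ, ContDiff ℝ 1 u ∧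
    IntegrableOn (fun t => ‖u t‖ ^ 2) (Ioi 0) ∧
    IntegrableOn (fun t => ‖deriv u t‖ ^ 2 + (t + ξ') ^ 2 * ‖u t‖ ^ 2) (Ioi 0) ∧
    0 < (∫ t in Ioi (0:ℝ), ‖u t‖ ^ 2)) ∧
    deGennes ξ' ≤ E - hE E ξ * fE E ξ ^ 2 / NE E ξ + (ξ' - ξ) *
      ((hE E ξ ^ 2 - ξ ^ 2 + E) * fE E ξ ^ 2 / NE E ξ) + (ξ' - ξ) ^ 2 := by
  obtain ⟨K, hK, hb⟩ := hE_bd hE1 ξ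
  have hc := hE_cont hE1
  have fc := fE_cont hE1
  have hN := NE_pos hE1 ξ
  have p4 : ∀ x : ℝ, x ^ 2 ≤ 1 + x ^ 4 := fun x => by nlinarith [sq_nonneg (x^2 - 1)]
  have iN : IntegrableOn (fun x => fE E x ^ 2) (Ioi ξ) := by
    simpa using fE_int (a := ξ) (K := 1) hE1 (φ := fun _ => 1) (by fun_prop)
      (fun x _ => by simp; positivity)
  have ix : IntegrableOn (fun x => x * fE E x ^ 2) (Ioi ξ) :=
    fE_int (K := 1) hE1 (by fun_prop) (fun x _ => by
      have := p4 x; have := p4 (|x|); rw [abs_le]; constructor <;>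
        nlinarith [sq_nonneg (x^2-1), sq_nonneg (x-1), sq_nonneg (x+1)])
  have ix2 : IntegrableOn (fun x => x ^ 2 * fE E x ^ 2) (Ioi ξ) :=
    fE_int (K := 1) hE1 (by fun_prop) (fun x _ => by
      rw [abs_of_nonneg (by positivity)]; have := p4 x; linarith)
  have ih2 : IntegrableOn (fun x => hE E x ^ 2 * fE E x ^ 2) (Ioi ξ) :=
    fE_int (K := 4 * K ^ 2) hE1 (by fun_prop) (fun x hx => by
      rw [abs_of_nonneg (by positivity)]; exact sq_bd (hb x hx.le))
  have ih : IntegrableOn (fun x => hE E x * fE E x ^ 2) (Ioi ξ) :=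
    fE_int (K := 4 * K ^ 2 + 1) hE1 (by fun_prop) (fun x hx => by
      have := sq_bd (hb x hx.le)
      have h1 : |hE E x| ≤ 1 + hE E x ^ 2 := by
        rw [← sq_abs]; nlinarith [sq_nonneg (|hE E x| - 1)]
      nlinarith [sq_nonneg (x^2)])
  -- identities
  have I1 : ∫ x in Ioi ξ, ((hE E x ^ 2 + x ^ 2) * fE E x ^ 2) = E * NE E ξ - hE E ξ * fE E ξ ^ 2 := by
    have hd : ∀ x ∈ Ici ξ, HasDerivAt (fun x => hE E x * fE E x ^ 2)
        ((hE E x ^ 2 * fE E x ^ 2 + x ^ 2 * fE E x ^ 2) - E * fE E x ^ 2) x := fun x _ =>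
      ((hE_deriv hE1 x).mul ((fE_deriv hE1 x).pow 2)).congr_deriv (by simp; ring)
    have := ibp0 hd ((ih2.add ix2).sub (iN.const_mul E)) ih
    have j : Integrable (fun x => hE E x ^ 2 * fE E x ^ 2 + x ^ 2 * fE E x ^ 2)
      (volume.restrict (Ioi ξ)) := ih2.add ix2
    rw [integral_sub j (iN.const_mul E), integral_const_mul] at this
    simp only [add_mul]
    unfold NE
    linarith
  have I2 : ∫ x in Ioi ξ, (2 * (x * fE E x ^ 2)) = (hE E ξ ^ 2 - ξ ^ 2 + E) * fE E ξ ^ 2 := by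
    have hd : ∀ x ∈ Ici ξ, HasDerivAt (fun x => (x ^ 2 - hE E x ^ 2 - E) * fE E x ^ 2)
        (2 * (x * fE E x ^ 2)) x := fun x _ =>
      (((((hasDerivAt_id x).pow 2).sub ((hE_deriv hE1 x).pow 2)).sub_const E).mul
        ((fE_deriv hE1 x).pow 2)).congr_deriv (by simp; ring)
    rw [ibp0 hd (ix.const_mul 2) (by
      exact ((ix2.sub ih2).sub (iN.const_mul E)).congr_fun (fun x _ => by simp; ring)
        measurableSet_Ioi)]
    ring
  have hud : ∀ t, HasDerivAt (fun t : ℝ => ((fE E (t + ξ) : ℝ) : ℂ))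
      ((hE E (t+ξ) * fE E (t+ξ) : ℝ) : ℂ) t := fun t =>
    ((fE_deriv hE1 (t+ξ)).comp_add_const t ξ).ofReal_comp
  have hder : deriv (fun t : ℝ => ((fE E (t + ξ) : ℝ) : ℂ)) =
    fun t => ((hE E (t+ξ) * fE E (t+ξ) : ℝ) : ℂ) := funext fun t => (hud t).deriv
  have hu : ContDiff ℝ 1 (fun t : ℝ => ((fE E (t + ξ) : ℝ) : ℂ)) := by
    rw [contDiff_one_iff_deriv]
    refine ⟨fun t => (hud t).differentiableAt, ?_⟩
    rw [hder]; fun_prop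
  have n1 : ∀ t, ‖((fE E (t + ξ) : ℝ) : ℂ)‖ ^ 2 = fE E (t+ξ) ^ 2 := fun t => by
    rw [Complex.norm_real, Real.norm_eq_abs, sq_abs]
  have n2 : ∀ t, ‖deriv (fun t : ℝ => ((fE E (t + ξ) : ℝ) : ℂ)) t‖ ^ 2 + (t + ξ') ^ 2 *
      ‖((fE E (t + ξ) : ℝ) : ℂ)‖ ^ 2 = (fun x => (hE E x ^ 2 + x ^ 2) * fE E x ^ 2 +
        (ξ' - ξ) * (2 * (x * fE E x ^ 2)) + (ξ' - ξ) ^ 2 * fE E x ^ 2) (t + ξ) := fun t => by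
    rw [n1, hder, Complex.norm_real, Real.norm_eq_abs, sq_abs]; ring
  have a1 : IntegrableOn (fun x => (hE E x ^ 2 + x ^ 2) * fE E x ^ 2) (Ioi ξ) := by
    exact (ih2.add ix2).congr_fun (fun x _ => by simp; ring) measurableSet_Ioi
  have a2 : IntegrableOn (fun x => (hE E x ^ 2 + x ^ 2) * fE E x ^ 2 +
        (ξ' - ξ) * (2 * (x * fE E x ^ 2))) (Ioi ξ) := a1.add ((ix.const_mul 2).const_mul _)
  have a3 : IntegrableOn (fun x => (hE E x ^ 2 + x ^ 2) * fE E x ^ 2 +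
        (ξ' - ξ) * (2 * (x * fE E x ^ 2)) + (ξ' - ξ) ^ 2 * fE E x ^ 2) (Ioi ξ) :=
    a2.add (iN.const_mul _)
  have b1 : IntegrableOn (fun t => ‖((fE E (t + ξ) : ℝ) : ℂ)‖ ^ 2) (Ioi 0) := by
    simp only [n1]; exact intOn_shift iN
  have b2 : IntegrableOn (fun t => ‖deriv (fun t : ℝ => ((fE E (t + ξ) : ℝ) : ℂ)) t‖ ^ 2 +
      (t + ξ') ^ 2 * ‖((fE E (t + ξ) : ℝ) : ℂ)‖ ^ 2) (Ioi 0) := by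
    simp only [n2]; exact intOn_shift a3
  have b3 : ∫ t in Ioi (0:ℝ), ‖((fE E (t + ξ) : ℝ) : ℂ)‖ ^ 2 = NE E ξ := by
    simp only [n1]; exact setInt_shift (fun x => fE E x ^ 2) ξ
  refine ⟨⟨_, hu, b1, b2, b3 ▸ hN⟩, ?_⟩
  have := csInf_le (dg_bdd ξ') ⟨_, hu, b1, b2, b3 ▸ hN, rfl⟩
  refine (show deGennes ξ' ≤ _ from this).trans (le_of_eq ?_)
  rw [b3]
  simp only [n2]
  rw [setInt_shift (fun x => (hE E x ^ 2 + x ^ 2) * fE E x ^ 2 +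
        (ξ' - ξ) * (2 * (x * fE E x ^ 2)) + (ξ' - ξ) ^ 2 * fE E x ^ 2) ξ,
    integral_add a2 (iN.const_mul _), integral_add a1 ((ix.const_mul 2).const_mul _), I1,
    integral_const_mul (ξ' - ξ), I2, integral_const_mul ((ξ' - ξ)^2)]
  change (_ + _ + _ * NE E ξ) / _ = _
  field_simp

theorem dg_low {ξ E K : ℝ} {H H' : ℝ → ℝ} (hd : ∀ x, HasDerivAt H (H' x) x)
    (hc : Continuous H') (h0 : H ξ ≤ 0) (hK : ∀ x, ξ ≤ x → |H x| ≤ K * (1 + |x|))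
    (hE : ∀ x, ξ ≤ x → E ≤ x ^ 2 - H' x - H x ^ 2) : E ≤ deGennes ξ := by
  obtain ⟨⟨u, hu, i1, i2, hp⟩, _⟩ := dg_trial (E := 0) one_pos ξ ξ
  refine le_csInf ⟨_, u, hu, i1, i2, hp, rfl⟩ ?_
  rintro q ⟨u, hu, i1, i2, hp, rfl⟩
  rw [le_div_iff₀ hp]
  exact dg_low_aux hd hc h0 hK hE hu i1 i2

theorem dg_ge {ξ E : ℝ} (hE1 : E < 1) (h : hE E ξ ≤ 0) : E ≤ deGennes ξ := by
  obtain ⟨K, _, hK⟩ := hE_bd hE1 ξ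
  have := hE_cont hE1
  exact dg_low (hE_deriv hE1) (by fun_prop) h hK (fun x _ => by linarith)

theorem dg_lt {ξ E : ℝ} (hE1 : E < 1) (h : 0 < hE E ξ) : deGennes ξ < E := by
  have := (dg_trial hE1 ξ ξ).2
  have h1 : 0 < hE E ξ * fE E ξ ^ 2 / NE E ξ :=
    div_pos (mul_pos h (pow_pos (fE_pos hE1 _) 2)) (NE_pos hE1 ξ)
  simp at this
  linarith

theorem dg_eq {ξ E : ℝ} (hE1 : E < 1) (h : hE E ξ = 0) : deGennes ξ = E := by
  have := (dg_trial hE1 ξ ξ).2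
  simp [h] at this
  exact le_antisymm this (dg_ge hE1 h.le)

/-- sign characterization -/
theorem hE_root {ξ : ℝ} (h : deGennes ξ < 1) : hE (deGennes ξ) ξ = 0 := by
  have hcont : ContinuousAt (fun E => hE E ξ) (deGennes ξ) := by
    have hp : -1 < -(1 + deGennes ξ) / 2 := by linarith
    unfold hE QE
    apply ContinuousAt.sub continuousAt_const
    apply ContinuousAt.div
    · exact ContinuousAt.comp (g := fun z : ℝ × ℝ => gI z.1 z.2)
        (f := fun E : ℝ => (ξ, -(1+E)/2+1)) (gI_cont (by linarith)) (by fun_prop)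
    · exact ContinuousAt.comp (g := fun z : ℝ × ℝ => gI z.1 z.2)
        (f := fun E : ℝ => (ξ, -(1+E)/2)) (gI_cont (by linarith)) (by fun_prop)
    · exact (gI_pos ξ hp).ne'
  rcases lt_trichotomy (hE (deGennes ξ) ξ) 0 with h0 | h0 | h0
  · exfalso
    have h1 := hcont.eventually (Iio_mem_nhds h0)
    have h2 := (h1.and (Iio_mem_nhds h)).filter_mono (nhdsWithin_le_nhds (s := Ioi (deGennes ξ)))
    obtain ⟨E, ⟨h3, h4⟩, h5⟩ := (h2.and self_mem_nhdsWithin).exists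
    have := dg_ge h4 (le_of_lt h3)
    have h5 : deGennes ξ < E := h5
    linarith
  · exact h0
  · exact absurd (dg_lt h h0) (lt_irrefl _)
end

section
theorem dg_nonneg (ξ : ℝ) : 0 ≤ deGennes ξ := by
  apply Real.sInf_nonneg
  rintro q ⟨u, _, _, _, h, rfl⟩
  exact div_nonneg (integral_nonneg fun t => by positivity) h.le

theorem Theta0_le (ξ : ℝ) : Theta0 ≤ deGennes ξ :=
  ciInf_le ⟨0, by rintro _ ⟨x, rfl⟩; exact dg_nonneg x⟩ ξ

theorem exists_dg_lt_one : ∃ ξ, deGennes ξ < 1 := by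
  have j0 : IntegrableOn (fun t : ℝ => exp (-t^2)) (Ioi 0) := by
    simpa using (integrable_exp_neg_mul_sq one_pos).integrableOn (s := Ioi (0:ℝ))
  have j1 : IntegrableOn (fun t : ℝ => t * exp (-t^2)) (Ioi 0) := by
    simpa using (integrable_mul_exp_neg_mul_sq one_pos).integrableOn (s := Ioi (0:ℝ))
  have j2 : IntegrableOn (fun t : ℝ => t^2 * exp (-t^2)) (Ioi 0) := by
    have := (integrable_rpow_mul_exp_neg_mul_sq one_pos (s := 2) (by norm_num)).integrableOn
      (s := Ioi (0:ℝ))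
    simpa using this
  set N := ∫ t in Ioi (0:ℝ), exp (-t^2) with hN
  have hNpos : 0 < N := by
    rw [hN, setIntegral_pos_iff_support_of_nonneg_ae (Eventually.of_forall fun x => (exp_pos _).le) j0]
    have : (Function.support (fun x:ℝ => exp (-x^2)) ∩ Ioi 0) = Ioi 0 :=
      inter_eq_right.2 fun s _ => (exp_pos _).ne'
    rw [this]; simp
  have hde : ∀ t : ℝ, HasDerivAt (fun t : ℝ => exp (-t^2)) (-(2 * (t * exp (-t^2)))) t := fun t =>
    (((hasDerivAt_id t).pow 2).neg.exp).congr_deriv (by simp; ring)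
  have I1 : ∫ t in Ioi (0:ℝ), (-(2 * (t * exp (-t^2)))) = -1 := by
    rw [ibp0 (fun t _ => hde t) (j1.const_mul 2).neg j0]; simp
  have I2 : ∫ t in Ioi (0:ℝ), (exp (-t^2) - 2 * (t^2 * exp (-t^2))) = 0 := by
    rw [ibp0 (F := fun t => t * exp (-t^2)) (F' := fun t => exp (-t^2) - 2 * (t^2 * exp (-t^2)))
      (fun t _ =>
      ((hasDerivAt_id t).mul (hde t)).congr_deriv (by simp; ring)) (j0.sub (j2.const_mul 2)) j1]
    simp
  rw [integral_neg, integral_const_mul] at I1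
  rw [integral_sub j0 (j2.const_mul 2), integral_const_mul] at I2
  set ξ := -(1/(2*N)) with hξ
  refine ⟨ξ, ?_⟩
  have hud : ∀ t : ℝ, HasDerivAt (fun t : ℝ => ((exp (-t^2/2) : ℝ) : ℂ))
      ((-t * exp (-t^2/2) : ℝ) : ℂ) t := fun t =>
    ((((hasDerivAt_id t).pow 2).neg.div_const 2).exp).ofReal_comp.congr_deriv
      (by congr 1; simp; ring)
  have hder : deriv (fun t : ℝ => ((exp (-t^2/2) : ℝ) : ℂ)) =
    fun t => ((-t * exp (-t^2/2) : ℝ) : ℂ) := funext fun t => (hud t).deriv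
  have hu : ContDiff ℝ 1 (fun t : ℝ => ((exp (-t^2/2) : ℝ) : ℂ)) := by
    rw [contDiff_one_iff_deriv]
    refine ⟨fun t => (hud t).differentiableAt, ?_⟩
    rw [hder]; fun_prop
  have ee : ∀ t : ℝ, exp (-t^2/2) ^ 2 = exp (-t^2) := fun t => by
    rw [← exp_nat_mul]; congr 1; push_cast; ring
  have n1 : ∀ t : ℝ, ‖((exp (-t^2/2) : ℝ) : ℂ)‖ ^ 2 = exp (-t^2) := fun t => by
    rw [Complex.norm_real, Real.norm_eq_abs, sq_abs, ee]
  have n2 : ∀ t : ℝ, ‖deriv (fun t : ℝ => ((exp (-t^2/2) : ℝ) : ℂ)) t‖ ^ 2 + (t + ξ) ^ 2 *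
      ‖((exp (-t^2/2) : ℝ) : ℂ)‖ ^ 2 = 2 * (t ^ 2 * exp (-t^2)) + 2 * ξ * (t * exp (-t^2)) +
        ξ ^ 2 * exp (-t^2) := fun t => by
    rw [n1, hder, Complex.norm_real, Real.norm_eq_abs, sq_abs, mul_pow, ee]; ring
  have a1 : Integrable (fun t : ℝ => 2 * (t ^ 2 * exp (-t^2)) + 2 * ξ * (t * exp (-t^2)))
    (volume.restrict (Ioi 0)) := (j2.const_mul 2).add (j1.const_mul _)
  have a2 : Integrable (fun t : ℝ => 2 * (t ^ 2 * exp (-t^2)) + 2 * ξ * (t * exp (-t^2)) +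
        ξ ^ 2 * exp (-t^2)) (volume.restrict (Ioi 0)) := a1.add (j0.const_mul _)
  have b3 : ∫ t in Ioi (0:ℝ), ‖((exp (-t^2/2) : ℝ) : ℂ)‖ ^ 2 = N := by simp only [n1]; rfl
  have := csInf_le (dg_bdd ξ) ⟨_, hu, by simp only [n1]; exact j0, by simp only [n2]; exact a2,
    by rw [b3]; exact hNpos, rfl⟩
  refine (show deGennes ξ ≤ _ from this).trans_lt ?_
  rw [b3]
  simp only [n2]
  rw [integral_add a1 (j0.const_mul _), integral_add (j2.const_mul 2) (j1.const_mul _),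
    integral_const_mul, integral_const_mul, integral_const_mul, ← hN, div_lt_one hNpos]
  have e1 : 2 * ξ * (∫ t in Ioi (0:ℝ), t * exp (-t^2)) = ξ := by linear_combination -ξ * I1
  have e2 : ξ ^ 2 * N = - ξ / 2 := by rw [hξ]; field_simp
  have : ξ < 0 := by rw [hξ]; simp; positivity
  rw [e1, e2]
  linarith

theorem Theta0_lt_one : Theta0 < 1 := by
  obtain ⟨ξ, h⟩ := exists_dg_lt_one
  exact (Theta0_le ξ).trans_lt h

theorem fE_cont2 {E x : ℝ} (hE : E < 1) : ContinuousAt (fun z : ℝ × ℝ => fE z.1 z.2) (E, x) := by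
  unfold fE
  apply ContinuousAt.mul (by fun_prop)
  exact ContinuousAt.comp (g := fun z : ℝ × ℝ => gI z.1 z.2)
        (f := fun z : ℝ × ℝ => (z.2, -(1+z.1)/2)) (gI_cont (by linarith)) (by fun_prop)

theorem NE_cont2 {E a : ℝ} (hE : E < 1) : ContinuousAt (fun z : ℝ × ℝ => NE z.1 z.2) (E, a) := by
  have e : ∀ z : ℝ × ℝ, NE z.1 z.2 = ∫ t in Ioi (0:ℝ), fE z.1 (t + z.2) ^ 2 := fun z =>
    (setInt_shift (fun x => fE z.1 x ^ 2) z.2).symm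
  simp only [e]
  set C := gI (a - 1) (-(1 + (E+1)/2)/2) + gI (a-1) (-(1 + (E-1))/2) with hC
  have hC0 : 0 < C := add_pos (gI_pos _ (by linarith)) (gI_pos _ (by linarith))
  have hev : ∀ᶠ z : ℝ × ℝ in 𝓝 (E, a), (E - 1 < z.1 ∧ z.1 < (E+1)/2) ∧ a - 1 < z.2 ∧ z.2 < a + 1 := by
    refine ((continuousAt_fst.eventually (Ioi_mem_nhds (by simp))).and
      (continuousAt_fst.eventually (Iio_mem_nhds (by simp; linarith)))).and
        ((continuousAt_snd.eventually (Ioi_mem_nhds (by simp))).and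
          (continuousAt_snd.eventually (Iio_mem_nhds (by simp))))
  apply continuousAt_of_dominated
    (bound := fun t => C ^ 2 * exp ((|a| + 1) ^ 2) * exp (-(1/2) * t ^ 2))
  · filter_upwards [hev] with z hz
    have := fE_cont (E := z.1) (by linarith [hz.1.2])
    exact (by fun_prop : Continuous fun t => fE z.1 (t + z.2) ^ 2).aestronglyMeasurable
  · filter_upwards [hev] with z hz
    obtain ⟨⟨h1, h2⟩, h3, h4⟩ := hz
    filter_upwards [self_mem_ae_restrict measurableSet_Ioi] with t ht
    have ht : 0 < t := ht
    have h5 := (fE_pos (E := z.1) (by linarith) (t + z.2)).le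
    have h6 : gI (t + z.2) (-(1 + z.1)/2) ≤ C :=
      gI_bd (by linarith) (by linarith) (by linarith) (by linarith)
    have h7 : fE z.1 (t + z.2) ≤ exp (-(t+z.2)^2/2) * C := by unfold fE; gcongr
    have h8 : z.2 ^ 2 ≤ (|a| + 1) ^ 2 := by
      rw [← sq_abs z.2]; gcongr
      cases abs_cases z.2 <;> cases abs_cases a <;> linarith
    rw [Real.norm_of_nonneg (by positivity)]
    calc fE z.1 (t + z.2) ^ 2 ≤ (exp (-(t+z.2)^2/2) * C) ^ 2 := by gcongr
      _ = C ^ 2 * exp (-(t+z.2)^2) := by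
        rw [mul_pow, ← exp_nat_mul, mul_comm]; congr 2; push_cast; ring
      _ ≤ C ^ 2 * exp ((|a| + 1) ^ 2 + -(1/2) * t ^ 2) := by
        gcongr; nlinarith [sq_nonneg (t + 2 * z.2)]
      _ = _ := by rw [exp_add]; ring
  · exact ((integrable_exp_neg_mul_sq (by norm_num)).const_mul _).integrableOn
  · refine Eventually.of_forall fun t => ?_
    apply ContinuousAt.pow
    exact ContinuousAt.comp (g := fun z : ℝ × ℝ => fE z.1 z.2)
      (f := fun z : ℝ × ℝ => (z.1, t + z.2)) (fE_cont2 hE) (by fun_prop)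

theorem dg_cont {ξ : ℝ} (h : deGennes ξ < 1) : ContinuousAt deGennes ξ := by
  rw [ContinuousAt, tendsto_order]
  constructor
  · intro a ha
    obtain ⟨b, hb1, hb2⟩ := exists_between ha
    have hb : b < 1 := by linarith
    have : hE b ξ < 0 := by
      rcases lt_trichotomy (hE b ξ) 0 with h0 | h0 | h0
      · exact h0
      · have := dg_eq hb h0; linarith
      · have := dg_lt hb h0; linarith
    filter_upwards [(hE_cont hb).continuousAt.eventually (Iio_mem_nhds this)] with y hy
    exact hb1.trans_le (dg_ge hb (le_of_lt hy))
  · intro a ha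
    obtain ⟨b, hb1, hb2⟩ := exists_between (lt_min ha h)
    have hb : b < 1 := hb2.trans_le (min_le_right _ _)
    have : 0 < hE b ξ := by
      by_contra hc
      have := dg_ge hb (not_lt.1 hc); linarith
    filter_upwards [(hE_cont hb).continuousAt.eventually (Ioi_mem_nhds this)] with y hy
    exact (dg_lt hb hy).trans (hb2.trans_le (min_le_left _ _))

def rE (ξ : ℝ) : ℝ := fE (deGennes ξ) ξ ^ 2 / NE (deGennes ξ) ξ

theorem rE_cont {ξ : ℝ} (h : deGennes ξ < 1) : ContinuousAt rE ξ := by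
  have h1 : ContinuousAt (fun x => (deGennes x, x)) ξ := (dg_cont h).prodMk continuousAt_id
  unfold rE
  apply ContinuousAt.div
  · apply ContinuousAt.pow
    exact ContinuousAt.comp_of_eq (g := fun z : ℝ × ℝ => fE z.1 z.2)
      (f := fun x => (deGennes x, x)) (fE_cont2 h) h1 rfl
  · exact ContinuousAt.comp_of_eq (g := fun z : ℝ × ℝ => NE z.1 z.2)
      (f := fun x => (deGennes x, x)) (NE_cont2 h) h1 rfl
  · exact (NE_pos h ξ).ne'

theorem dg_sup {ξ : ℝ} (h : deGennes ξ < 1) (ξ' : ℝ) :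
    deGennes ξ' ≤ deGennes ξ + (ξ' - ξ) * ((deGennes ξ - ξ ^ 2) * rE ξ) + (ξ' - ξ) ^ 2 := by
  have := (dg_trial h ξ ξ').2
  rw [hE_root h] at this
  unfold rE
  calc _ ≤ _ := this
    _ = _ := by ring

theorem hasDerivAt_of_sup {μ D : ℝ → ℝ} {a : ℝ} (hD : ContinuousAt D a)
    (h : ∀ᶠ x in 𝓝 a, ∀ y, μ y ≤ μ x + (y - x) * D x + (y - x) ^ 2) : HasDerivAt μ (D a) a := by
  rw [hasDerivAt_iff_isLittleO, Asymptotics.isLittleO_iff]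
  intro c hc
  have h0 := h.self_of_nhds
  have h1 := (Metric.continuousAt_iff.1 hD) (c/2) (by linarith)
  obtain ⟨δ, hδ, h1⟩ := h1
  filter_upwards [h, Metric.ball_mem_nhds a (lt_min hδ (half_pos hc))] with x hx hxa
  have hd : dist x a < min δ (c/2) := hxa
  have h2 := h1 (hd.trans_le (min_le_left _ _))
  have h3 := hd.trans_le (min_le_right _ _)
  rw [Real.dist_eq] at h2 h3
  have h4 := h0 x
  have h5 := hx a
  have h6 : |x - a| * |D x - D a| ≤ |x - a| * (c/2) := by gcongr
  have h7 : |x - a| * |x - a| ≤ |x - a| * (c/2) := by gcongr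
  rw [← abs_mul] at h6
  have h8 : |x - a| * |x - a| = (x - a) ^ 2 := by rw [← sq, sq_abs]
  have h9 := abs_le.1 (le_refl |(x - a) * (D x - D a)|)
  simp only [smul_eq_mul, Real.norm_eq_abs]
  rw [abs_le]
  constructor <;> nlinarith

theorem dg_deriv {ξ : ℝ} (h : deGennes ξ < 1) :
    HasDerivAt deGennes ((deGennes ξ - ξ ^ 2) * rE ξ) ξ := by
  apply hasDerivAt_of_sup (D := fun ξ => (deGennes ξ - ξ ^ 2) * rE ξ)
  · have := dg_cont h
    have := rE_cont h
    fun_prop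
  · filter_upwards [(dg_cont h).eventually (Iio_mem_nhds h)] with x hx y
    exact dg_sup hx y

theorem hasDerivAt_mul_zero {a b : ℝ → ℝ} {x a' : ℝ} (ha : HasDerivAt a a' x) (h0 : a x = 0)
    (hb : ContinuousAt b x) : HasDerivAt (fun y => a y * b y) (a' * b x) x := by
  rw [hasDerivAt_iff_tendsto_slope] at *
  have := ha.mul (hb.tendsto.mono_left (nhdsWithin_le_nhds (s := {x}ᶜ)))
  refine this.congr fun y => ?_
  simp [slope_def_field, h0]; ring

theorem hmax_sign {x : ℝ} : hE Theta0 x ≤ 0 := by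
  by_contra hc
  have := dg_lt Theta0_lt_one (not_le.1 hc)
  linarith [Theta0_le x]

theorem xi0_facts {ξ₀ δ₀ : ℝ} (hξ : deGennes ξ₀ = Theta0)
    (hδ : δ₀ = (1/2) * iteratedDeriv 2 deGennes ξ₀) :
    hE Theta0 ξ₀ = 0 ∧ ξ₀ ^ 2 = Theta0 ∧ ξ₀ < 0 ∧ δ₀ = - ξ₀ * fE Theta0 ξ₀ ^ 2 / NE Theta0 ξ₀ := by
  have hlt : deGennes ξ₀ < 1 := hξ ▸ Theta0_lt_one
  have h0 : hE Theta0 ξ₀ = 0 := hξ ▸ hE_root hlt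
  have h1 : ξ₀ ^ 2 = Theta0 := by
    have hm : IsLocalMax (hE Theta0) ξ₀ := Eventually.of_forall fun x => by
      rw [h0]; exact hmax_sign
    have := hm.hasDerivAt_eq_zero (hE_deriv Theta0_lt_one ξ₀)
    rw [h0] at this; linarith
  have h2 : ξ₀ < 0 := by
    have := QE_pos Theta0_lt_one ξ₀
    unfold hE at h0; linarith
  refine ⟨h0, h1, h2, ?_⟩
  have hd : HasDerivAt (deriv deGennes) (-2 * ξ₀ * rE ξ₀) ξ₀ := by
    have e : (fun ξ => (deGennes ξ - ξ ^ 2) * rE ξ) =ᶠ[𝓝 ξ₀] deriv deGennes := by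
      filter_upwards [(dg_cont hlt).eventually (Iio_mem_nhds hlt)] with x hx
      exact (dg_deriv hx).deriv.symm
    refine HasDerivAt.congr_of_eventuallyEq ?_ e.symm
    apply hasDerivAt_mul_zero _ (by rw [hξ, h1]; ring) (rE_cont hlt)
    refine ((dg_deriv hlt).sub ((hasDerivAt_id ξ₀).pow 2)).congr_deriv ?_
    rw [hξ, h1]; simp
  rw [iteratedDeriv_succ, iteratedDeriv_one, hd.deriv] at hδ
  rw [hδ, rE, hξ]; ring
end

section
def Adm (H H' : ℝ → ℝ) : Prop := (∀ x, HasDerivAt H (H' x) x) ∧ Continuous H' ∧ (∀ x, H x ≤ 0) ∧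
  ∃ K, ∀ x, |H x| ≤ K * (1 + |x|) ∧ |H' x| ≤ K * (1 + |x|)

theorem glue {φ φ' : ℝ → ℝ} {a : ℝ} (h : ∀ x, HasDerivAt φ (φ' x) x) (h0 : φ' a = 0) (x : ℝ) :
    HasDerivAt (fun x => φ (max x a)) (φ' (max x a)) x := by
  rcases lt_trichotomy x a with hx | hx | hx
  · rw [max_eq_right hx.le, h0]
    refine (hasDerivAt_const x (φ a)).congr_of_eventuallyEq ?_
    filter_upwards [Iio_mem_nhds hx] with y hy
    rw [max_eq_right (le_of_lt hy)]
  · subst hx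
    rw [max_self, h0]
    have h1 := (hasDerivAt_iff_isLittleO.1 (h x))
    rw [hasDerivAt_iff_isLittleO]
    rw [h0] at h1
    simp only [smul_zero, sub_zero, max_self] at h1 ⊢
    rw [Asymptotics.isLittleO_iff] at *
    intro c hc
    filter_upwards [h1 hc] with y hy
    rcases le_total y x with hyx | hyx
    · rw [max_eq_right hyx]; simp; positivity
    · rw [max_eq_left hyx]; exact hy
  · rw [max_eq_left hx.le]
    refine (h x).congr_of_eventuallyEq ?_
    filter_upwards [Ioi_mem_nhds hx] with y hy
    rw [max_eq_left (le_of_lt hy)]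

def kE (E x : ℝ) : ℝ := x ^ 2 - E - hE E x ^ 2

section
variable {E : ℝ} (hE1 : E < 1)

theorem kE_cont (hE1 : E < 1) : Continuous (kE E) := by
  have := hE_cont hE1; unfold kE; fun_prop

theorem hE_deriv' (hE1 : E < 1) (x : ℝ) : HasDerivAt (hE E) (kE E x) x := hE_deriv hE1 x

theorem kE_deriv (hE1 : E < 1) (x : ℝ) : HasDerivAt (kE E) (2 * x - 2 * hE E x * kE E x) x :=
  ((((hasDerivAt_id x).pow 2).sub_const E).sub ((hE_deriv' hE1 x).pow 2)).congr_deriv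
    (by simp)

theorem f2_deriv (hE1 : E < 1) (x : ℝ) : HasDerivAt (fun x => fE E x ^ 2) (2 * hE E x * fE E x ^ 2) x :=
  ((fE_deriv hE1 x).pow 2).congr_deriv (by simp; ring)

theorem kE_bd (hE1 : E < 1) (a : ℝ) : ∃ K, 0 < K ∧ ∀ x, a ≤ x → |kE E x| ≤ K := by
  obtain ⟨K, hK, h⟩ := QE_bdd hE1 a
  refine ⟨|E| + (1 - E) + 2 * |a| * K + K ^ 2, by
    have := abs_nonneg E; have : 0 < 1 - E := by linarith
    positivity, fun x hx => ?_⟩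
  have h1 := h x hx
  have h2 := QE_pos hE1 x
  have e : kE E x = -E - 2 * (x * QE E x) - QE E x ^ 2 := by unfold kE hE; ring
  have h3 : x * QE E x ≤ (1 - E) / 2 := by
    rcases le_or_gt x 0 with h0 | h0
    · have : x * QE E x ≤ 0 := mul_nonpos_of_nonpos_of_nonneg h0 h2.le
      linarith
    · exact QE_bd hE1 h0
  have h4 : -(|a| * K) ≤ x * QE E x := by
    have h5 : -|a| ≤ x := (neg_abs_le a).trans hx
    have h6 : -|a| * QE E x ≤ x * QE E x := by gcongr
    have h7 : |a| * QE E x ≤ |a| * K := by gcongr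
    linarith
  have h8 : QE E x ^ 2 ≤ K ^ 2 := by gcongr
  rw [e, abs_le]
  have := abs_nonneg E
  have := le_abs_self E
  have := neg_abs_le E
  have : 0 ≤ |a| * K := by positivity
  constructor <;> nlinarith
end

theorem bd4 {A K x : ℝ} (hK : 0 ≤ K) (h : |A| ≤ K * (1 + |x|)) : |A| ≤ 2 * K * (1 + x ^ 4) := by
  have h2 : (1 + |x|) ≤ 2 * (1 + x ^ 4) := by
    have : x ^ 4 = |x| ^ 4 := by rw [← abs_pow]; exact (abs_of_nonneg (by positivity)).symm
    rw [this]; nlinarith [sq_nonneg (|x| - 1), sq_nonneg (|x| ^ 2 - 1), abs_nonneg x]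
  calc |A| ≤ K * (1 + |x|) := h
    _ ≤ K * (2 * (1 + x ^ 4)) := by gcongr
    _ = _ := by ring

theorem p4a (x : ℝ) : |x| ≤ 1 + x ^ 4 := by
  rw [abs_le]; constructor <;>
        nlinarith [sq_nonneg (x^2-1), sq_nonneg (x-1), sq_nonneg (x+1)]

theorem delta_facts {ξ₀ δ₀ : ℝ} (hξ : deGennes ξ₀ = Theta0)
    (hδ : δ₀ = (1/2) * iteratedDeriv 2 deGennes ξ₀) :
    (∫ x in Ioi ξ₀, kE Theta0 x ^ 2 * fE Theta0 x ^ 2) = (1 - δ₀) * NE Theta0 ξ₀ ∧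
    0 < Theta0 - δ₀ / 2 ∧ 0 < Theta0 := by
  obtain ⟨h0, h1, h2, h3⟩ := xi0_facts hξ hδ
  have hE1 := Theta0_lt_one
  have hN := NE_pos hE1 ξ₀
  have hpos : 0 < Theta0 := by rw [← h1]; nlinarith
  obtain ⟨K, hK, hb⟩ := hE_bd hE1 ξ₀
  obtain ⟨M, hM, hkb⟩ := kE_bd hE1 ξ₀
  have hc := hE_cont hE1
  have fc := fE_cont hE1
  have kc := kE_cont hE1
  have k0 : kE Theta0 ξ₀ = 0 := by unfold kE; rw [h0, h1]; ring
  have iN : IntegrableOn (fun x => fE Theta0 x ^ 2) (Ioi ξ₀) := by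
    simpa using fE_int (a := ξ₀) (K := 1) hE1 (φ := fun _ => 1) (by fun_prop)
      (fun x _ => by simp; positivity)
  have ik : IntegrableOn (fun x => kE Theta0 x ^ 2 * fE Theta0 x ^ 2) (Ioi ξ₀) :=
    fE_int (K := M ^ 2) hE1 (by fun_prop) (fun x hx => by
      rw [abs_of_nonneg (by positivity), ← sq_abs]
      calc |kE Theta0 x| ^ 2 ≤ M ^ 2 := by gcongr; exact hkb x hx.le
        _ ≤ M ^ 2 * (1 + x ^ 4) := by nlinarith [sq_nonneg (M * x ^ 2)])
  have ix2 : IntegrableOn (fun x => x ^ 2 * fE Theta0 x ^ 2) (Ioi ξ₀) :=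
    fE_int (K := 1) hE1 (by fun_prop) (fun x _ => by
      rw [abs_of_nonneg (by positivity)]; nlinarith [sq_nonneg (x^2-1)])
  have ih2 : IntegrableOn (fun x => hE Theta0 x ^ 2 * fE Theta0 x ^ 2) (Ioi ξ₀) :=
    fE_int (K := 4 * K ^ 2) hE1 (by fun_prop) (fun x hx => by
      rw [abs_of_nonneg (by positivity)]; exact sq_bd (hb x hx.le))
  have ih : IntegrableOn (fun x => hE Theta0 x * fE Theta0 x ^ 2) (Ioi ξ₀) :=
    fE_int (K := 2 * K) hE1 (by fun_prop) (fun x hx => bd4 hK.le (hb x hx.le))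
  have mulk : ∀ {A C x : ℝ}, 0 ≤ C → |A| ≤ C * (1 + x ^ 4) → ξ₀ < x →
      |A * kE Theta0 x| ≤ C * M * (1 + x ^ 4) := fun {A C x} hC hA hx => by
    rw [abs_mul]
    calc |A| * |kE Theta0 x| ≤ (C * (1 + x ^ 4)) * M := by
          gcongr; exact hkb x hx.le
      _ = _ := by ring
  have ihk : IntegrableOn (fun x => (hE Theta0 x * kE Theta0 x) * fE Theta0 x ^ 2) (Ioi ξ₀) :=
    fE_int (K := 2 * K * M) hE1 (by fun_prop) (fun x hx => mulk (by positivity)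
      (bd4 hK.le (hb x hx.le)) hx)
  have ix : IntegrableOn (fun x => x * fE Theta0 x ^ 2) (Ioi ξ₀) :=
    fE_int (K := 1) hE1 (by fun_prop) (fun x _ => by simpa using p4a x)
  have ixk : IntegrableOn (fun x => (x * kE Theta0 x) * fE Theta0 x ^ 2) (Ioi ξ₀) :=
    fE_int (K := 1 * M) hE1 (by fun_prop) (fun x hx => mulk (by positivity)
      (by simpa using p4a x) hx)
  have A1 : (∫ x in Ioi ξ₀, kE Theta0 x ^ 2 * fE Theta0 x ^ 2) = (1 - δ₀) * NE Theta0 ξ₀ := by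
    have := ibp0 (F := fun x => (hE Theta0 x * kE Theta0 x) * fE Theta0 x ^ 2 - x * fE Theta0 x ^ 2)
      (F' := fun x => kE Theta0 x ^ 2 * fE Theta0 x ^ 2 - fE Theta0 x ^ 2) (a := ξ₀)
      (fun x _ => ((((hE_deriv' hE1 x).mul (kE_deriv hE1 x)).mul (f2_deriv hE1 x)).sub
        ((hasDerivAt_id x).mul (f2_deriv hE1 x))).congr_deriv (by simp; ring))
      (ik.sub iN) (ihk.sub ix)
    rw [integral_sub ik iN] at this
    change _ - NE Theta0 ξ₀ = _ at this
    simp only [h0] at this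
    rw [h3]; field_simp; linarith
  have A2 : (∫ x in Ioi ξ₀, hE Theta0 x ^ 2 * fE Theta0 x ^ 2) +
      (∫ x in Ioi ξ₀, x ^ 2 * fE Theta0 x ^ 2) = Theta0 * NE Theta0 ξ₀ := by
    have := ibp0 (F := fun x => hE Theta0 x * fE Theta0 x ^ 2)
      (F' := fun x => ((hE Theta0 x ^ 2 * fE Theta0 x ^ 2 + x ^ 2 * fE Theta0 x ^ 2)
        - Theta0 * fE Theta0 x ^ 2)) (a := ξ₀)
      (fun x _ => ((hE_deriv hE1 x).mul (f2_deriv hE1 x)).congr_deriv (by ring))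
      ((ih2.add ix2).sub (iN.const_mul _)) ih
    have j : Integrable (fun x => hE Theta0 x ^ 2 * fE Theta0 x ^ 2 + x ^ 2 * fE Theta0 x ^ 2)
      (volume.restrict (Ioi ξ₀)) := ih2.add ix2
    rw [integral_sub j (iN.const_mul _), integral_add ih2 ix2, integral_const_mul, h0] at this
    change _ - Theta0 * NE Theta0 ξ₀ = _ at this
    linarith
  have A3 : 3 * (∫ x in Ioi ξ₀, x ^ 2 * fE Theta0 x ^ 2) - Theta0 * NE Theta0 ξ₀ -
      (∫ x in Ioi ξ₀, hE Theta0 x ^ 2 * fE Theta0 x ^ 2) = 0 := by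
    have j : Integrable (fun x => 3 * (x ^ 2 * fE Theta0 x ^ 2) - Theta0 * fE Theta0 x ^ 2)
      (volume.restrict (Ioi ξ₀)) := (ix2.const_mul 3).sub (iN.const_mul _)
    have := ibp0 (F := fun x => (x * kE Theta0 x) * fE Theta0 x ^ 2)
      (F' := fun x => (3 * (x ^ 2 * fE Theta0 x ^ 2) - Theta0 * fE Theta0 x ^ 2) -
        hE Theta0 x ^ 2 * fE Theta0 x ^ 2) (a := ξ₀)
      (fun x _ => (((hasDerivAt_id x).mul (kE_deriv hE1 x)).mul (f2_deriv hE1 x)).congr_deriv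
        (by simp; unfold kE; ring))
      (Integrable.congr (j.sub ih2) (Eventually.of_forall fun x => rfl)) ixk
    rw [integral_sub j ih2, integral_sub (ix2.const_mul 3) (iN.const_mul _), integral_const_mul,
      integral_const_mul, k0] at this
    change _ - Theta0 * NE Theta0 ξ₀ - _ = _ at this
    linarith
  have A4 : fE Theta0 ξ₀ ^ 2 ≤ (3/2) * (-ξ₀) * NE Theta0 ξ₀ := by
    have := ibp0 (a := ξ₀) (fun x _ => f2_deriv hE1 x)
      (by simp only [mul_assoc]; exact ih.const_mul 2) iN
    have h5 : ∫ x in Ioi ξ₀, -(2 * hE Theta0 x * fE Theta0 x ^ 2) ≤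
        ∫ x in Ioi ξ₀, ((-ξ₀)⁻¹ * (hE Theta0 x ^ 2 * fE Theta0 x ^ 2) + (-ξ₀) * fE Theta0 x ^ 2) := by
      apply integral_mono
      · have := (ih.const_mul 2).neg
        exact this.congr (Eventually.of_forall fun x => by simp; ring)
      · exact (ih2.const_mul _).add (iN.const_mul _)
      · intro x
        have hb0 : 0 < -ξ₀ := by linarith
        have : -(2 * hE Theta0 x) ≤ (-ξ₀)⁻¹ * hE Theta0 x ^ 2 + (-ξ₀) := by
          rw [← sub_nonneg]
          have : (-ξ₀)⁻¹ * hE Theta0 x ^ 2 + (-ξ₀) - -(2 * hE Theta0 x) =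
            (-ξ₀)⁻¹ * (hE Theta0 x - ξ₀) ^ 2 := by
              have : ξ₀ ≠ 0 := by linarith
              field_simp; ring
          rw [this]; positivity
        have := mul_le_mul_of_nonneg_right this (sq_nonneg (fE Theta0 x))
        simp only
        linarith
    rw [integral_neg, this, integral_add (ih2.const_mul _) (iN.const_mul _), integral_const_mul,
      integral_const_mul] at h5
    change _ ≤ _ + (-ξ₀) * NE Theta0 ξ₀ at h5
    have h6 : (∫ x in Ioi ξ₀, hE Theta0 x ^ 2 * fE Theta0 x ^ 2) = Theta0 * NE Theta0 ξ₀ / 2 := by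
      linarith
    rw [h6, ← h1] at h5
    have h7 : (-ξ₀)⁻¹ * (ξ₀ ^ 2 * NE (ξ₀^2) ξ₀ / 2) = -ξ₀ * NE (ξ₀^2) ξ₀ / 2 := by
      have : ξ₀ ≠ 0 := by linarith
      field_simp
    rw [h7] at h5
    rw [← h1]
    linarith
  refine ⟨A1, ?_, hpos⟩
  have : δ₀ ≤ (3/2) * Theta0 := by
    rw [h3, div_le_iff₀ hN]
    calc -ξ₀ * fE Theta0 ξ₀ ^ 2 ≤ -ξ₀ * ((3/2) * (-ξ₀) * NE Theta0 ξ₀) := by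
          gcongr; linarith
      _ = 3/2 * ξ₀ ^ 2 * NE Theta0 ξ₀ := by ring
      _ = _ := by rw [h1]
  linarith

theorem admA {ξ₀ : ℝ} (hξ : deGennes ξ₀ = Theta0) : ∃ H H' : ℝ → ℝ, Adm H H' ∧
    ∀ x, Theta0 ≤ x ^ 2 - H' x - H x ^ 2 := by
  obtain ⟨h0, h1, h2, h3⟩ := xi0_facts hξ rfl
  have hE1 := Theta0_lt_one
  obtain ⟨K, hK, hb⟩ := hE_bd hE1 ξ₀
  obtain ⟨M, hM, hkb⟩ := kE_bd hE1 ξ₀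
  have kc := kE_cont hE1
  have k0 : kE Theta0 ξ₀ = 0 := by unfold kE; rw [h0, h1]; ring
  refine ⟨fun x => hE Theta0 (max x ξ₀), fun x => kE Theta0 (max x ξ₀),
    ⟨glue (hE_deriv' hE1) k0, by fun_prop, fun x => hmax_sign, K + M, fun x => ?_⟩, fun x => ?_⟩
  · have := abs_nonneg x
    dsimp only
    constructor
    · rcases le_total x ξ₀ with hx | hx
      · rw [max_eq_right hx, h0]; simp; positivity
      · rw [max_eq_left hx]; refine (hb x hx).trans ?_; gcongr; linarith
    · refine (hkb _ (le_max_right _ _)).trans ?_; nlinarith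
  · dsimp only
    rcases le_total x ξ₀ with hx | hx
    · rw [max_eq_right hx, h0, k0]; rw [← h1]; nlinarith
    · rw [max_eq_left hx]; unfold kE; linarith
end

section
/-- data of the model solution -/
structure MDat (f h k : ℝ → ℝ) (a E : ℝ) : Prop where
  fpos : ∀ x, 0 < f x
  f2 : ∀ x, HasDerivAt (fun x => f x ^ 2) (2 * h x * f x ^ 2) x
  hd : ∀ x, HasDerivAt h (k x) x
  kd : ∀ x, HasDerivAt k (2 * x - 2 * h x * k x) x
  kdef : ∀ x, k x = x ^ 2 - E - h x ^ 2
  ha : h a = 0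
  ka : k a = 0
  aneg : a < 0
  aE : a ^ 2 = E
  hneg : ∀ x, a < x → h x < 0
  hle : ∀ x, 0 ≤ x → h x ≤ -x
  rat : ∀ x t, x ≤ t → f t ^ 2 ≤ f x ^ 2 * exp (x ^ 2 - t ^ 2)
  hint : ∀ (φ : ℝ → ℝ) (K : ℝ), Continuous φ → (∀ x, a < x → |φ x| ≤ K * (1 + x ^ 4)) →
    IntegrableOn (fun x => φ x * f x ^ 2) (Ioi a)
  hb : ∃ K, 0 < K ∧ ∀ x, a ≤ x → |h x| ≤ K * (1 + |x|)
  kb : ∃ M, 0 < M ∧ ∀ x, a ≤ x → |k x| ≤ M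

theorem mod_Theta {ξ₀ : ℝ} (hξ : deGennes ξ₀ = Theta0)
    (hu : ∀ ξ : ℝ, deGennes ξ = Theta0 → ξ = ξ₀) :
    MDat (fE Theta0) (hE Theta0) (kE Theta0) ξ₀ Theta0 := by
  obtain ⟨h0, h1, h2, h3⟩ := xi0_facts hξ rfl
  have hE1 := Theta0_lt_one
  refine ⟨fE_pos hE1, f2_deriv hE1, hE_deriv' hE1, kE_deriv hE1, fun _ => rfl, h0,
    by unfold kE; rw [h0, h1]; ring, h2, h1, fun x hx => ?_, fun x hx => ?_, fun x t hxt => ?_,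
    fun φ K hφ hb => fE_int hE1 hφ hb, hE_bd hE1 _, kE_bd hE1 _⟩
  · refine lt_of_le_of_ne hmax_sign fun h => ?_
    have := hu x (dg_eq hE1 h); linarith
  · have := QE_pos hE1 x; unfold hE; linarith
  · have := fE_ratio hE1 hxt
    have h4 := (fE_pos hE1 t).le
    calc fE Theta0 t ^ 2 ≤ (fE Theta0 x * exp (x^2/2 - t^2/2)) ^ 2 := by gcongr
      _ = _ := by rw [mul_pow, ← exp_nat_mul]; congr 2; push_cast; ring

theorem MDat.hc {f h k : ℝ → ℝ} {a E : ℝ} (m : MDat f h k a E) : Continuous h :=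
  continuous_iff_continuousAt.2 fun x => (m.hd x).continuousAt
theorem MDat.kc {f h k : ℝ → ℝ} {a E : ℝ} (m : MDat f h k a E) : Continuous k :=
  continuous_iff_continuousAt.2 fun x => (m.kd x).continuousAt
theorem MDat.f2c {f h k : ℝ → ℝ} {a E : ℝ} (m : MDat f h k a E) : Continuous (fun x => f x ^ 2) :=
  continuous_iff_continuousAt.2 fun x => (m.f2 x).continuousAt

/-- the correction `y` -/
theorem MDat.yex {f h k G : ℝ → ℝ} {a E d K1 : ℝ} (m : MDat f h k a E) (Gc : Continuous G)
    (hK1 : 0 ≤ K1)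
    (Gb : ∀ x, a ≤ x → |G x - d| ≤ K1 * (1 + |x|))
    (GO : (fun x => G x - d) =O[𝓝[≥] a] (fun x => x - a))
    (Gint : ∫ x in Ioi a, (G x - d) * f x ^ 2 = 0) :
    ∃ y : ℝ → ℝ, (∀ x, HasDerivAt y (-(G x - d) - 2 * h x * y x) x) ∧ y a = 0 ∧
      (∃ Y, 0 < Y ∧ ∀ x, a ≤ x → |y x| ≤ Y) ∧ ∃ K0, 0 < K0 ∧ ∀ x, a ≤ x → y x ≤ K0 * (- h x) := by
  have hc := m.hc
  have f2c := m.f2c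
  have fne : ∀ x, f x ^ 2 ≠ 0 := fun x => (pow_pos (m.fpos x) 2).ne'
  have gc : Continuous fun x => (G x - d) * f x ^ 2 := by fun_prop
  set I : ℝ → ℝ := fun x => ∫ t in a..x, (G t - d) * f t ^ 2 with hI
  have Id : ∀ x, HasDerivAt I ((G x - d) * f x ^ 2) x := fun x =>
    intervalIntegral.integral_hasDerivAt_right (gc.intervalIntegrable _ _)
      gc.aestronglyMeasurable.stronglyMeasurableAtFilter gc.continuousAt
  set y : ℝ → ℝ := fun x => - I x / f x ^ 2 with hy
  have yd : ∀ x, HasDerivAt y (-(G x - d) - 2 * h x * y x) x := fun x =>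
    ((Id x).neg.div (m.f2 x) (fne x)).congr_deriv (by
      have := (m.fpos x).ne'; simp only [hy, Pi.neg_apply]; field_simp)
  have ya : y a = 0 := by simp [hy, hI]
  have yc : Continuous y := continuous_iff_continuousAt.2 fun x => (yd x).continuousAt
  have gi : IntegrableOn (fun x => (G x - d) * f x ^ 2) (Ioi a) :=
    m.hint (fun x => G x - d) (2 * K1) (by fun_prop) fun x hx => bd4 hK1 (Gb x hx.le)
  have ytail : ∀ x, 1 ≤ x → |y x| ≤ K1 := by
    intro x hx
    have hax : a ≤ x := by linarith [m.aneg]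
    have e1 : I x = - ∫ t in Ioi x, (G t - d) * f t ^ 2 := by
      have h1 : I x + ∫ t in Ioi x, (G t - d) * f t ^ 2 = ∫ t in Ioi a, (G t - d) * f t ^ 2 := by
        rw [hI]; exact intervalIntegral.integral_interval_add_Ioi gi (gi.mono_set (Ioi_subset_Ioi hax))
      rw [Gint] at h1; linarith
    have d1 : ∀ t : ℝ, HasDerivAt (fun t => - exp (x^2 - t^2)) (2 * (t * exp (x^2 - t^2))) t :=
      fun t => ((((hasDerivAt_id t).pow 2).const_sub (x^2)).exp.neg).congr_deriv (by simp; ring)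
    have ex : ∀ t : ℝ, exp (x^2 - t^2) = exp (x^2) * exp (-1 * t^2) := fun t => by
      rw [← exp_add]; ring_nf
    have j0 : IntegrableOn (fun t : ℝ => -exp (x^2 - t^2)) (Ioi x) := by
      simp only [ex]
      exact ((integrable_exp_neg_mul_sq one_pos).const_mul _).neg.integrableOn
    have j1 : IntegrableOn (fun t : ℝ => 2 * (t * exp (x^2 - t^2))) (Ioi x) := by
      have := (((integrable_mul_exp_neg_mul_sq one_pos).const_mul (exp (x^2))).const_mul 2).integrableOn
        (s := Ioi x)
      refine this.congr_fun (fun t _ => ?_) measurableSet_Ioi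
      simp only [ex]; ring
    have e2 := ibp0 (fun t _ => d1 t) j1 j0
    simp only [sub_self, exp_zero, neg_neg] at e2
    have e3 : |∫ t in Ioi x, (G t - d) * f t ^ 2| ≤ K1 * f x ^ 2 := by
      rw [← Real.norm_eq_abs]
      calc ‖∫ t in Ioi x, (G t - d) * f t ^ 2‖
          ≤ ∫ t in Ioi x, (K1 * f x ^ 2) * (2 * (t * exp (x^2 - t^2))) := by
            apply norm_integral_le_of_norm_le (j1.const_mul _)
            filter_upwards [self_mem_ae_restrict measurableSet_Ioi] with t ht
            have ht : x < t := ht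
            rw [norm_mul, Real.norm_eq_abs, Real.norm_of_nonneg (sq_nonneg _)]
            calc |G t - d| * f t ^ 2 ≤ (K1 * (1 + |t|)) * (f x ^ 2 * exp (x^2-t^2)) := by
                  gcongr
                  · exact Gb t (by linarith)
                  · exact m.rat x t ht.le
              _ ≤ (K1 * (2 * t)) * (f x ^ 2 * exp (x^2-t^2)) := by
                  gcongr; rw [abs_of_pos (by linarith)]; linarith
              _ = _ := by ring
        _ = K1 * f x ^ 2 := by rw [integral_const_mul, e2, mul_one]
    rw [hy]
    simp only [abs_div, abs_neg, e1]
    rw [abs_of_pos (pow_pos (m.fpos x) 2), div_le_iff₀ (pow_pos (m.fpos x) 2)]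
    exact e3
  obtain ⟨C, hC⟩ := (isCompact_Icc (a := a) (b := 1)).exists_bound_of_continuousOn yc.continuousOn
  -- near a
  set φ : ℝ → ℝ := fun x => E - x ^ 2 - h x ^ 2 with hφ
  have φa : φ a = 0 := by simp only [hφ, m.ha, m.aE]; ring
  have φd : HasDerivAt φ (-2 * a) a :=
    ((((hasDerivAt_id a).pow 2).const_sub E).sub ((m.hd a).pow 2)).congr_deriv (by
      simp [m.ha])
  have φlow : ∀ᶠ x in 𝓝[≥] a, (-a) * (x - a) ≤ φ x := by
    have h1 := (hasDerivAt_iff_isLittleO.1 φd)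
    rw [Asymptotics.isLittleO_iff] at h1
    have h2 := h1 (c := -a) (by linarith [m.aneg])
    filter_upwards [h2.filter_mono nhdsWithin_le_nhds, self_mem_nhdsWithin] with x hx hxa
    have hxa : a ≤ x := hxa
    rw [φa, Real.norm_eq_abs, Real.norm_eq_abs, abs_of_nonneg (by linarith : 0 ≤ x - a)] at hx
    have := (abs_le.1 hx).1
    simp only [smul_eq_mul] at this
    linarith
  obtain ⟨C2, hC2p, hC2⟩ := GO.exists_pos
  rw [Asymptotics.IsBigOWith] at hC2
  have hev := φlow.and hC2
  obtain ⟨b, hab, hb⟩ := mem_nhdsGE_iff_exists_Ico_subset.1 hev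
  have hab : a < b := hab
  set K2 := C2 / (-a) with hK2
  have hK2p : 0 < K2 := div_pos hC2p (by linarith [m.aneg])
  have near : ∀ x, a ≤ x → x < b → y x ≤ K2 * (- h x) := by
    intro x hax hxb
    have φc : Continuous φ := by fun_prop
    have e1 : - h x * f x ^ 2 = ∫ t in a..x, φ t * f t ^ 2 := by
      have := intervalIntegral.integral_eq_sub_of_hasDerivAt (a := a) (b := x)
        (f := fun t => - h t * f t ^ 2) (f' := fun t => φ t * f t ^ 2)
        (fun t _ => ((m.hd t).neg.mul (m.f2 t)).congr_deriv (by rw [m.kdef]; simp [hφ]; ring))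
        ((φc.mul f2c).intervalIntegrable _ _)
      rw [this, m.ha]; ring
    have e2 : - I x ≤ K2 * ∫ t in a..x, φ t * f t ^ 2 := by
      rw [hI, ← intervalIntegral.integral_neg, ← intervalIntegral.integral_const_mul]
      apply intervalIntegral.integral_mono_on hax (gc.neg.intervalIntegrable _ _)
        ((continuous_const.mul (φc.mul f2c)).intervalIntegrable _ _)
      intro t ht
      obtain ⟨h1, h2⟩ := hb (show t ∈ Ico a b from ⟨ht.1, ht.2.trans_lt hxb⟩)
      rw [Real.norm_eq_abs, Real.norm_eq_abs, abs_of_nonneg (by linarith [ht.1] : 0 ≤ t - a)] at h2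
      have h3 : K2 * (-a * (t - a)) = C2 * (t - a) := by
        rw [hK2]; have := m.aneg.ne; field_simp
      have h4 : -(G t - d) ≤ K2 * φ t := by
        have h5 := mul_le_mul_of_nonneg_left h1 hK2p.le
        have := neg_abs_le (G t - d)
        linarith
      have := mul_le_mul_of_nonneg_right h4 (sq_nonneg (f t))
      change -((G t - d) * f t ^ 2) ≤ K2 * (φ t * f t ^ 2); linarith
    rw [← e1] at e2
    rw [hy]
    simp only
    rw [div_le_iff₀ (pow_pos (m.fpos x) 2)]
    linarith
  have hqc : ContinuousOn (fun x => y x / (- h x)) (Icc b 1) := by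
    apply ContinuousOn.div yc.continuousOn hc.neg.continuousOn
    intro x hx; have := m.hneg x (hab.trans_le hx.1); simp; linarith
  obtain ⟨C3, hC3⟩ := (isCompact_Icc (a := b) (b := 1)).exists_bound_of_continuousOn hqc
  have hC' := le_abs_self C
  have hC3' := le_abs_self C3
  refine ⟨y, yd, ya, ⟨|C| + K1 + 1, by positivity, fun x hx => ?_⟩,
    K2 + |C3| + K1, by positivity, fun x hx => ?_⟩
  · rcases le_total x 1 with h1 | h1
    · have := hC x ⟨hx, h1⟩
      rw [Real.norm_eq_abs] at this; linarith
    · have := ytail x h1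
      have := abs_nonneg C
      linarith
  · have hh : 0 ≤ - h x := by
      rcases hx.eq_or_lt with rfl | hx
      · rw [m.ha]; simp
      · linarith [m.hneg x hx]
    have p1 : 0 ≤ |C3| * (- h x) := by positivity
    have p2 : 0 ≤ K1 * (- h x) := by positivity
    have p3 : 0 ≤ K2 * (- h x) := by positivity
    rcases lt_or_ge x b with h1 | h1
    · have := near x hx h1; nlinarith
    · rcases le_total x 1 with h2 | h2
      · have h3 := hC3 x ⟨h1, h2⟩
        have h4 : 0 < - h x := by have := m.hneg x (hab.trans_le h1); linarith
        rw [Real.norm_eq_abs] at h3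
        have h5 := (le_abs_self _).trans (h3.trans hC3')
        rw [div_le_iff₀ h4] at h5
        nlinarith
      · have h3 := (le_abs_self _).trans (ytail x h2)
        have h4 := m.hle x (by linarith)
        have h5 : K1 * 1 ≤ K1 * (- h x) := by gcongr; linarith
        nlinarith
end

section
theorem ar1 {h y s K0 : ℝ} (h1 : h ≤ 0) (hy : y ≤ K0 * -h) (s0 : 0 < s) (s1 : s * K0 ≤ 1) :
    h + s * y ≤ 0 := by nlinarith
theorem ar2 {K M h sy z : ℝ} (h1 : h ≤ K * (1 + z)) (h2 : sy ≤ M) (hM : 0 ≤ M * z) :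
    h + sy ≤ (K + M) * (1 + z) := by nlinarith
theorem ar3 {w x a δ d η : ℝ} (w0 : 0 ≤ w) (hx : x ≤ a) (h1 : 4 * w * a = d - 1)
    (h2 : d ≤ δ + η / 2) (hη : 0 < η) : 1 + 0 ^ 2 + 4 * w * x - δ - η ≤ 0 := by nlinarith
theorem ar4 {a x s q : ℝ} (hx : x ≤ a) (ha : a < 0) (hs : 0 < s) (hq : q ≤ 0) :
    a ^ 2 + s * q ≤ x ^ 2 - 0 - 0 ^ 2 := by nlinarith
theorem ar5 {k M s z A g : ℝ} (h1 : k ≤ M) (h2 : s * g ≤ s * (A * (1 + z))) (hM : 0 ≤ M * z) :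
    k + s * g ≤ (M + s * A) * (1 + z) := by nlinarith
theorem ar6 {a M p z W : ℝ} (h1 : p ≤ M + 4 * W * z) (hz : 0 ≤ a * z) (q2 : 0 ≤ M * z)
    (hW : 0 ≤ W) : a + p ≤ (a + M + 4 * W) * (1 + z) := by nlinarith

set_option maxHeartbeats 1600000 in
theorem lemD {ξ₀ δ₀ : ℝ} (hξ : deGennes ξ₀ = Theta0)
    (hu : ∀ ξ : ℝ, deGennes ξ = Theta0 → ξ = ξ₀)
    (hδ : δ₀ = (1/2) * iteratedDeriv 2 deGennes ξ₀) {η : ℝ} (hη : 0 < η) :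
    ∃ s > 0, ∃ w w' H H' : ℝ → ℝ, Adm H H' ∧ (∀ x, HasDerivAt w (w' x) x) ∧ Continuous w' ∧
      (∃ K, ∀ x, |w x| ≤ K) ∧ (∃ K, ∀ x, |w' x| ≤ K ∧ |x * w' x| ≤ K) ∧
      ∀ x, Theta0 + s * (1 + w' x ^ 2 + 4 * w x * x - δ₀ - η) ≤ x ^ 2 - H' x - H x ^ 2 := by
  have m := mod_Theta hξ hu
  have hN := NE_pos Theta0_lt_one ξ₀
  have hI := (delta_facts hξ hδ).1
  unfold NE at hN hI
  generalize Theta0 = E at *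
  generalize fE E = f at *
  generalize hE E = h at *
  generalize kE E = k at *
  generalize ξ₀ = a at *
  set N := ∫ x in Ioi a, f x ^ 2 with hNdef
  have hc := m.hc
  have kc := m.kc
  have f2c := m.f2c
  obtain ⟨Kh, hKh, hb⟩ := m.hb
  obtain ⟨M, hM, kb⟩ := m.kb
  have one4 : ∀ x : ℝ, (0:ℝ) ≤ x ^ 4 := fun x => by positivity
  have ik : IntegrableOn (fun x => k x ^ 2 * f x ^ 2) (Ioi a) :=
    m.hint (fun x => k x ^ 2) (M^2) (by fun_prop) fun x hx => by
      rw [abs_pow]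
      calc |k x| ^ 2 ≤ M ^ 2 := by gcongr; exact kb x hx.le
        _ ≤ _ := by nlinarith only [one4 x, sq_nonneg M]
  have if2 : IntegrableOn (fun x => f x ^ 2) (Ioi a) := by
    have := m.hint (fun x => 1) 1 (by fun_prop) fun x hx => by simp; positivity
    simpa using this
  -- choose T
  have ht := intervalIntegral_tendsto_integral_Ioi a ik tendsto_id
  have hev := ht.eventually (lt_mem_nhds (show (∫ x in Ioi a, k x ^ 2 * f x ^ 2) - η * N / 2
      < ∫ x in Ioi a, k x ^ 2 * f x ^ 2 by have : 0 < η * N := by positivity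
                                           linarith))
  obtain ⟨T, hT1, hT2⟩ := (hev.and (eventually_ge_atTop (a + 1))).exists
  simp only [id] at hT1 hT2
  set c : ℝ → ℝ := fun x => max 0 (min 1 (T + 1 - x)) with hcdef
  have cc : Continuous c := by fun_prop
  have c0 : ∀ x, 0 ≤ c x := fun x => le_max_left _ _
  have c1 : ∀ x, c x ≤ 1 := fun x => max_le zero_le_one (min_le_left _ _)
  have cT : ∀ x, x ≤ T → c x = 1 := fun x hx => by
    simp only [hcdef]; rw [min_eq_left (by linarith), max_eq_right zero_le_one]
  have cT' : ∀ x, T + 1 ≤ x → c x = 0 := fun x hx => by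
    simp only [hcdef]; rw [max_eq_left]; exact (min_le_right _ _).trans (by linarith)
  set w' : ℝ → ℝ := fun x => c x * k (max x a) with hw'
  have w'c : Continuous w' := by fun_prop
  have w'le : ∀ x, x ≤ a → w' x = 0 := fun x hx => by
    simp only [hw']; rw [max_eq_right hx, m.ka, mul_zero]
  have w'ge : ∀ x, a ≤ x → w' x = c x * k x := fun x hx => by
    simp only [hw']; rw [max_eq_left hx]
  have w's : HasCompactSupport w' := by
    apply HasCompactSupport.intro (isCompact_Icc (a := a) (b := T + 1))
    intro x hx
    rw [mem_Icc, not_and_or, not_le, not_le] at hx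
    rcases hx with hx | hx
    · exact w'le x hx.le
    · simp only [hw', cT' x hx.le, zero_mul]
  have w'i := w'c.integrable_of_hasCompactSupport w's (μ := volume)
  set δG : ℝ := 1 - (∫ x in Ioi a, (2 * c x - c x ^ 2) * k x ^ 2 * f x ^ 2) / N with hδG
  have i2 : IntegrableOn (fun x => (2 * c x - c x ^ 2) * k x ^ 2 * f x ^ 2) (Ioi a) :=
    m.hint (fun x => (2 * c x - c x ^ 2) * k x ^ 2) (M^2) (by fun_prop) fun x hx => by
      have e1 : 0 ≤ 2 * c x - c x ^ 2 := by nlinarith only [c0 x, c1 x]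
      have e2 : 2 * c x - c x ^ 2 ≤ 1 := by nlinarith only [sq_nonneg (c x - 1)]
      rw [abs_mul, abs_pow, abs_of_nonneg e1]
      calc (2 * c x - c x ^ 2) * |k x| ^ 2 ≤ 1 * M ^ 2 := by gcongr; exact kb x hx.le
        _ ≤ _ := by nlinarith only [one4 x, sq_nonneg M]
  have J0 : 0 ≤ ∫ x in Ioi a, (2 * c x - c x ^ 2) * k x ^ 2 * f x ^ 2 := by
    apply setIntegral_nonneg measurableSet_Ioi
    intro x _
    have e1 : 0 ≤ 2 * c x - c x ^ 2 := by nlinarith only [c0 x, c1 x]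
    positivity
  have J1 : (∫ x in a..T, k x ^ 2 * f x ^ 2) ≤ ∫ x in Ioi a, (2 * c x - c x ^ 2) * k x ^ 2 * f x ^ 2 := by
    rw [intervalIntegral.integral_of_le (by linarith)]
    calc (∫ x in Ioc a T, k x ^ 2 * f x ^ 2) = ∫ x in Ioc a T, (2 * c x - c x ^ 2) * k x ^ 2 * f x ^ 2 := by
          apply setIntegral_congr_fun measurableSet_Ioc
          intro x hx
          simp only [cT x hx.2]; ring
      _ ≤ _ := by
          apply setIntegral_mono_set i2
          · refine Eventually.of_forall fun x => ?_
            have e1 : 0 ≤ 2 * c x - c x ^ 2 := by nlinarith only [c0 x, c1 x]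
            simp only [Pi.zero_apply]
            positivity
          · exact Ioc_subset_Ioi_self.eventuallyLE
  have hδN : (1 - δG) * N = ∫ x in Ioi a, (2 * c x - c x ^ 2) * k x ^ 2 * f x ^ 2 := by
    rw [hδG]; field_simp; ring
  have dG1 : 0 ≤ 1 - δG := by
    by_contra hh; push Not at hh; nlinarith
  have dG2 : δG ≤ δ₀ + η / 2 := by
    by_contra hh; push Not at hh; nlinarith
  set w₀ : ℝ := (1 - δG) / (-4 * a) with hw0
  have an := m.aneg
  have w00 : 0 ≤ w₀ := div_nonneg dG1 (by linarith)
  have w0a : 4 * w₀ * a = δG - 1 := by rw [hw0]; have := an.ne; field_simp; ring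
  set w : ℝ → ℝ := fun x => w₀ + ∫ t in a..x, w' t with hw
  have wd : ∀ x, HasDerivAt w (w' x) x := fun x =>
    (intervalIntegral.integral_hasDerivAt_right (w'c.intervalIntegrable _ _)
      w'c.aestronglyMeasurable.stronglyMeasurableAtFilter w'c.continuousAt).const_add _
  have wc : Continuous w := continuous_iff_continuousAt.2 fun x => (wd x).continuousAt
  have wa : w a = w₀ := by simp [hw]
  have wle : ∀ x, x ≤ a → w x = w₀ := fun x hx => by
    simp only [hw]
    rw [intervalIntegral.integral_symm, intervalIntegral.integral_of_le hx,
      setIntegral_congr_fun (g := fun _ => (0:ℝ)) measurableSet_Ioc (fun t ht => w'le t ht.2)]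
    simp
  set W := |w₀| + ∫ t, ‖w' t‖ with hW
  have wb : ∀ x, |w x| ≤ W := fun x => by
    simp only [hw, hW]
    refine (abs_add_le _ _).trans ?_
    gcongr
    rw [← Real.norm_eq_abs]
    refine (intervalIntegral.norm_integral_le_integral_norm_uIoc).trans ?_
    exact setIntegral_le_integral w'i.norm (Eventually.of_forall fun _ => norm_nonneg _)
  have W0 : 0 ≤ W := (abs_nonneg _).trans (wb a)
  obtain ⟨M1, hM1⟩ := w's.exists_bound_of_continuous w'c
  obtain ⟨M2, hM2⟩ := (w's.mul_left (f := fun x => x)).exists_bound_of_continuous (by fun_prop)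
  have hM1' : 0 ≤ M1 := (norm_nonneg _).trans (hM1 0)
  set G : ℝ → ℝ := fun x => 1 + w' x ^ 2 + 4 * w x * x with hG
  have Gc : Continuous G := by fun_prop
  have Ga : G a - δG = 0 := by
    simp only [hG]; rw [w'le a le_rfl, wa, w0a]; ring
  set K1 := |1 - δG| + M1 ^ 2 + 4 * W with hK1
  have Gb : ∀ x, |G x - δG| ≤ K1 * (1 + |x|) := fun x => by
    have e : G x - δG = (1 - δG) + (w' x ^ 2 + 4 * w x * x) := by simp only [hG]; ring
    rw [e]
    refine (abs_add_le _ _).trans ?_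
    have e2 : |w' x ^ 2 + 4 * w x * x| ≤ M1 ^ 2 + 4 * W * |x| := by
      refine (abs_add_le _ _).trans ?_
      rw [abs_pow, abs_mul (4 * w x), abs_mul 4, abs_of_pos (by norm_num : (0:ℝ) < 4)]
      gcongr
      · exact hM1 x
      · exact wb x
    have := abs_nonneg x
    have := abs_nonneg (1 - δG)
    have q1 : 0 ≤ |1 - δG| * |x| := by positivity
    have q2 : 0 ≤ M1 ^ 2 * |x| := by positivity
    rw [hK1]; exact ar6 e2 q1 q2 W0
  have GO : (fun x => G x - δG) =O[𝓝[≥] a] (fun x => x - a) := by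
    have b1 : (fun x => w x * x - w a * a) =O[𝓝 a] (fun x => x - a) :=
      ((wd a).mul (hasDerivAt_id a)).isBigO_sub
    have b2 : (fun x => k x - k a) =O[𝓝 a] (fun x => x - a) := (m.kd a).isBigO_sub
    simp only [m.ka, sub_zero] at b2
    have b3 : k =O[𝓝 a] (fun _ => (1:ℝ)) := kc.continuousAt.isBigO_one ℝ
    have b4 := (b2.mul b3)
    simp only [mul_one] at b4
    have b5 : (fun x => w' x ^ 2) =O[𝓝[≥] a] (fun x => x - a) := by
      refine Asymptotics.IsBigO.trans ?_ (b4.mono nhdsWithin_le_nhds)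
      apply Asymptotics.IsBigO.of_bound 1
      filter_upwards [self_mem_nhdsWithin] with x hx
      rw [w'ge x hx, one_mul, ← sq, norm_pow, norm_pow, norm_mul]
      have : ‖c x‖ ≤ 1 := by rw [Real.norm_of_nonneg (c0 x)]; exact c1 x
      gcongr
      calc ‖c x‖ * ‖k x‖ ≤ 1 * ‖k x‖ := by gcongr
        _ = _ := one_mul _
    have b6 := b5.add ((b1.mono (nhdsWithin_le_nhds (s := Ici a))).const_mul_left 4)
    refine b6.congr (fun x => ?_) (fun x => rfl)
    simp only [hG, wa]; linarith
  have K10 : 0 ≤ K1 := by positivity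
  have gi : IntegrableOn (fun x => (G x - δG) * f x ^ 2) (Ioi a) :=
    m.hint (fun x => G x - δG) (2 * K1) (by fun_prop) fun x hx => bd4 K10 (Gb x)
  have Gint : ∫ x in Ioi a, (G x - δG) * f x ^ 2 = 0 := by
    have d1 : ∀ x ∈ Ici a, HasDerivAt (fun x => 2 * w x * k x * f x ^ 2)
        ((2 * c x * k x ^ 2 + 4 * w x * x) * f x ^ 2) x := fun x hx =>
      ((((wd x).const_mul 2).mul (m.kd x)).mul (m.f2 x)).congr_deriv (by
        simp only [w'ge x hx, Pi.mul_apply]; ring)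
    have j1 : IntegrableOn (fun x => (2 * c x * k x ^ 2 + 4 * w x * x) * f x ^ 2) (Ioi a) := by
      refine m.hint (fun x => 2 * c x * k x ^ 2 + 4 * w x * x) (2 * (2 * M ^ 2 + 4 * W)) (by fun_prop) fun x hx => bd4 (by positivity) ?_
      refine (abs_add_le _ _).trans ?_
      rw [abs_mul, abs_mul, abs_mul, abs_mul, abs_pow, abs_of_nonneg (c0 x), abs_of_pos (by norm_num : (0:ℝ) < 4), abs_of_pos (by norm_num : (0:ℝ) < 2)]
      have e3 : 2 * c x * |k x| ^ 2 ≤ 2 * 1 * M ^ 2 := by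
        gcongr
        · exact c1 x
        · exact kb x hx.le
      have e4 : 4 * |w x| * |x| ≤ 4 * W * |x| := by gcongr; exact wb x
      have := abs_nonneg x
      have q2 : 0 ≤ M ^ 2 * |x| := by positivity
      have q3 : (2 * M ^ 2 + 4 * W) * (1 + |x|) = 2 * 1 * M ^ 2 + 4 * W * |x| + (4 * W + 2 * (M ^ 2 * |x|)) := by ring
      rw [q3]; linarith
    have j0 : IntegrableOn (fun x => 2 * w x * k x * f x ^ 2) (Ioi a) := by
      refine m.hint (fun x => 2 * w x * k x) (2 * W * M) (by fun_prop) fun x hx => ?_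
      rw [abs_mul, abs_mul, abs_of_pos (by norm_num : (0:ℝ) < 2)]
      calc 2 * |w x| * |k x| ≤ 2 * W * M := by
            gcongr
            · exact wb x
            · exact kb x hx.le
        _ ≤ _ := by
          have : 0 ≤ 2 * W * M := by positivity
          nlinarith only [one4 x, this]
    have e1 := ibp0 d1 j1 j0
    rw [m.ka] at e1
    simp only [mul_zero, zero_mul, neg_zero] at e1
    have e2 : ∫ x in Ioi a, (G x - δG) * f x ^ 2 = ∫ x in Ioi a, ((1 - δG) * f x ^ 2
        + ((2 * c x * k x ^ 2 + 4 * w x * x) * f x ^ 2 - (2 * c x - c x ^ 2) * k x ^ 2 * f x ^ 2)) := by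
      apply setIntegral_congr_fun measurableSet_Ioi
      intro x hx
      simp only [hG, w'ge x (le_of_lt hx)]; ring
    have j3 : Integrable (fun x => (2 * c x * k x ^ 2 + 4 * w x * x) * f x ^ 2 - (2 * c x - c x ^ 2) * k x ^ 2 * f x ^ 2) (volume.restrict (Ioi a)) := j1.sub i2
    rw [e2, integral_add (if2.const_mul _) j3, integral_sub j1 i2, e1, integral_const_mul, ← hδN]
    ring
  obtain ⟨y, yd, ya, ⟨Y, hY, yb⟩, K0, hK0, yK⟩ := m.yex Gc K10 (fun x _ => Gb x) GO Gint
  set s : ℝ := min (1 / K0) (η / 2 / Y ^ 2) with hs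
  have s0 : 0 < s := by rw [hs]; positivity
  have s1 : s * K0 ≤ 1 := by
    have : s ≤ 1 / K0 := min_le_left _ _
    rwa [le_div_iff₀ hK0] at this
  have s2 : s * Y ^ 2 ≤ η / 2 := by
    have : s ≤ η / 2 / Y ^ 2 := min_le_right _ _
    rwa [le_div_iff₀ (by positivity)] at this
  set P : ℝ → ℝ := fun x => h x + s * y x with hP
  set P' : ℝ → ℝ := fun x => k x + s * (-(G x - δG) - 2 * h x * y x) with hP'
  have Pd : ∀ x, HasDerivAt P (P' x) x := fun x => (m.hd x).add ((yd x).const_mul s)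
  have Pa : P a = 0 := by simp [hP, m.ha, ya]
  have P'a : P' a = 0 := by simp only [hP', m.ha, ya, m.ka, Ga]; ring
  have yc : Continuous y := continuous_iff_continuousAt.2 fun x => (yd x).continuousAt
  have P'c : Continuous P' := by fun_prop
  have hneg : ∀ x, a ≤ x → h x ≤ 0 := fun x hx => by
    rcases hx.eq_or_lt with rfl | hx
    · rw [m.ha]
    · exact (m.hneg x hx).le
  refine ⟨s, s0, w, w', fun x => P (max x a), fun x => P' (max x a), ⟨glue Pd P'a, by fun_prop, fun x => ?_,
    (Kh + s * Y) + (M + s * (K1 + 2 * Kh * Y)), fun x => ?_⟩, wd, w'c, ⟨W, wb⟩, ⟨max M1 M2, fun x => ⟨?_, ?_⟩⟩, fun x => ?_⟩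
  · have := yK _ (le_max_right x a)
    have h1 := hneg _ (le_max_right x a)
    exact ar1 h1 this s0 s1
  · have hx0 := abs_nonneg x
    have A : ∀ z, a ≤ z → |P z| ≤ (Kh + s * Y) * (1 + |z|) ∧ |P' z| ≤ (M + s * (K1 + 2 * Kh * Y)) * (1 + |z|) := by
      intro z hz
      have hz0 := abs_nonneg z
      constructor
      · simp only [hP]
        refine (abs_add_le _ _).trans ?_
        rw [abs_mul, abs_of_pos s0]
        have e1 := hb z hz
        have e2 : s * |y z| ≤ s * Y := by gcongr; exact yb z hz
        exact ar2 e1 e2 (by positivity)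
      · simp only [hP']
        refine (abs_add_le _ _).trans ?_
        rw [abs_mul, abs_of_pos s0]
        have e1 := kb z hz
        have e2 : |(-(G z - δG) - 2 * h z * y z)| ≤ (K1 + 2 * Kh * Y) * (1 + |z|) := by
          refine (abs_sub _ _).trans ?_
          rw [abs_neg, abs_mul, abs_mul, abs_of_pos (by norm_num : (0:ℝ) < 2)]
          have e3 : 2 * |h z| * |y z| ≤ 2 * (Kh * (1 + |z|)) * Y := by
            gcongr
            · exact hb z hz
            · exact yb z hz
          have := Gb z
          have e5 : (K1 + 2 * Kh * Y) * (1 + |z|) = K1 * (1 + |z|) + 2 * (Kh * (1 + |z|)) * Y := by ring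
          rw [e5]; exact add_le_add this e3
        have e4 := mul_le_mul_of_nonneg_left e2 s0.le
        exact ar5 e1 e4 (by positivity)
    have p1 : 0 ≤ Kh + s * Y := by positivity
    have p2 : 0 ≤ M + s * (K1 + 2 * Kh * Y) := by positivity
    rcases le_total x a with hx | hx
    · dsimp only
      rw [max_eq_right hx, Pa, P'a, abs_zero]
      constructor <;> positivity
    · dsimp only
      rw [max_eq_left hx]
      obtain ⟨A1, A2⟩ := A x hx
      constructor
      · refine A1.trans (mul_le_mul_of_nonneg_right ?_ (by positivity)); linarith
      · refine A2.trans (mul_le_mul_of_nonneg_right ?_ (by positivity)); linarith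
  · exact (hM1 x).trans (le_max_left _ _)
  · exact (hM2 x).trans (le_max_right _ _)
  · dsimp only
    rcases le_total x a with hx | hx
    · rw [max_eq_right hx, Pa, P'a, w'le x hx, wle x hx, ← m.aE]
      have e1 : 1 + 0 ^ 2 + 4 * w₀ * x - δ₀ - η ≤ 0 := ar3 w00 hx w0a dG2 hη
      exact ar4 hx an s0 e1
    · rw [max_eq_left hx]
      have e1 : x ^ 2 - P' x - P x ^ 2 = E + s * (G x - δG) - s * (s * y x ^ 2) := by
        simp only [hP, hP', m.kdef]; ring
      have e2 : s * y x ^ 2 ≤ η / 2 := by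
        refine le_trans ?_ s2
        rw [← sq_abs (y x)]
        gcongr
        exact yb x hx
      have e3 : G x - δ₀ - η ≤ G x - δG - s * y x ^ 2 := by linarith
      have e4 := mul_le_mul_of_nonneg_left e3 s0.le
      rw [e1]
      have : 1 + w' x ^ 2 + 4 * w x * x = G x := rfl
      rw [this]; linarith
end

section
def pim (B : ℝ) (m : ℤ) (r : ℝ) : ℝ := B * r / 2 - m / r
def xxm (B : ℝ) (m : ℤ) (r : ℝ) : ℝ := -(√B / 2) * (r - max (2 * m / B) 0 / r)

def AdmK (K : ℝ) (H H' : ℝ → ℝ) : Prop := (∀ x, HasDerivAt H (H' x) x) ∧ Continuous H' ∧ (∀ x, H x ≤ 0) ∧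
  ∀ x, |H x| ≤ K * (1 + |x|) ∧ |H' x| ≤ K * (1 + |x|)

def Cut (K : ℝ) (p p' : ℝ → ℝ) : Prop := (∀ x, HasDerivAt p (p' x) x) ∧ Continuous p' ∧
  (∀ r, r ≤ 1/8 → p r = p (1/8)) ∧ ∀ x, |p x| ≤ K ∧ |p' x| ≤ K

structure GoodNu (lam : ℝ → ℝ) (B K τ : ℝ) (m : ℤ) (ν : Measure ℝ) : Prop where
  prob : IsProbabilityMeasure ν
  supp : ∀ᵐ r ∂ν, 0 < r ∧ r ≤ 1
  int : Integrable (fun r => pim B m r ^ 2) ν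
  c1 : ∀ KH H H', AdmK KH H H' → ∀ p p', Cut K p p' →
    ∫ r, (B * ((1 - r ^ 2) + r ^ 2 * (xxm B m r ^ 2 - H' (xxm B m r) - H (xxm B m r) ^ 2))
      - 10 * (KH + 1) * √B * (1 + xxm B m r ^ 2)) * p r ^ 2 ∂ν
      ≤ lam B * (∫ r, p r ^ 2 ∂ν) + (∫ r, p' r ^ 2 ∂ν) + τ
  c2 : ∀ p p', Cut K p p' →
    ∫ r, pim B m r ^ 2 * p r ^ 2 ∂ν ≤ lam B * (∫ r, p r ^ 2 ∂ν) + (∫ r, p' r ^ 2 ∂ν) + τ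
  d : ∀ p p', Cut K p p' → p (1/8) = 0 → ∀ B' : ℝ, 0 < B' → ∀ k : ℤ,
    lam B' * (∫ r, p r ^ 2 ∂ν) ≤ lam B * (∫ r, p r ^ 2 ∂ν) + (∫ r, p' r ^ 2 ∂ν) + τ
      + ∫ r, ((pim B m r + (B' - B) * r / 2 - k / r) ^ 2 - pim B m r ^ 2) * p r ^ 2 ∂ν

theorem Cut.mono {K K' : ℝ} {p p' : ℝ → ℝ} (h : Cut K p p') (hK : K ≤ K') : Cut K' p p' :=
  ⟨h.1, h.2.1, h.2.2.1, fun x => ⟨(h.2.2.2 x).1.trans hK, (h.2.2.2 x).2.trans hK⟩⟩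

theorem Cut.one : Cut 1 (fun _ => 1) (fun _ => 0) :=
  ⟨fun x => hasDerivAt_const _ _, continuous_const, fun _ _ => rfl, fun x => by simp⟩

theorem Cut.c {K : ℝ} {p p' : ℝ → ℝ} (h : Cut K p p') : Continuous p :=
  continuous_iff_continuousAt.2 fun x => (h.1 x).continuousAt

theorem pim_meas (B : ℝ) (m : ℤ) : Measurable (pim B m) := by unfold pim; fun_prop
theorem xxm_meas (B : ℝ) (m : ℤ) : Measurable (xxm B m) := by unfold xxm; fun_prop

theorem xxm_sq {B r : ℝ} {m : ℤ} (hB : 0 < B) (hr : 0 < r) : B * xxm B m r ^ 2 ≤ pim B m r ^ 2 := by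
  have e1 : pim B m r = B / 2 * (r - (2 * m / B) / r) := by unfold pim; field_simp
  have e2 : B * xxm B m r ^ 2 = (B / 2 * (r - max (2 * m / B) 0 / r)) ^ 2 := by
    unfold xxm
    have : B = √B ^ 2 := (sq_sqrt hB.le).symm
    rw [mul_pow, mul_pow]
    have e3 : (-(√B / 2)) ^ 2 = B / 4 := by rw [neg_sq, div_pow, sq_sqrt hB.le]; norm_num
    rw [e3]; ring
  rw [e1, e2, mul_pow, mul_pow]
  refine mul_le_mul_of_nonneg_left ?_ (by positivity)
  rcases le_total (2 * m / B) 0 with h | h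
  · rw [max_eq_right h, zero_div, sub_zero]
    have : (2 * m / B) / r ≤ 0 := div_nonpos_of_nonpos_of_nonneg h hr.le
    nlinarith
  · rw [max_eq_left h]

theorem xxm_eq {B r : ℝ} {m : ℤ} (hB : 0 < B) (hm : 0 ≤ m) : xxm B m r = - pim B m r / √B := by
  have hm' : (0:ℝ) ≤ m := by exact_mod_cast hm
  have : 0 ≤ 2 * (m:ℝ) / B := by positivity
  unfold xxm pim
  rw [max_eq_left this]
  have hs : 0 < √B := sqrt_pos.2 hB
  have : B = √B ^ 2 := (sq_sqrt hB.le).symm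
  rw [eq_div_iff hs.ne']
  have e : -(√B / 2) * (r - 2 * m / B / r) * √B = -(√B ^ 2 / 2) * (r - 2 * m / B / r) := by ring
  rw [e, sq_sqrt hB.le]
  have : B ≠ 0 := hB.ne'
  field_simp

variable {lam : ℝ → ℝ} {B K τ : ℝ} {m : ℤ} {ν : Measure ℝ}

theorem GoodNu.integ (g : GoodNu lam B K τ m ν) {f : ℝ → ℝ} {C : ℝ} (hf : Measurable f)
    (hb : ∀ r, 0 < r → r ≤ 1 → |f r| ≤ C * (1 + pim B m r ^ 2)) : Integrable f ν := by
  have := g.prob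
  refine (((integrable_const 1).add g.int).const_mul C).mono' hf.aestronglyMeasurable ?_
  filter_upwards [g.supp] with r hr
  exact hb r hr.1 hr.2

theorem GoodNu.mono (g : GoodNu lam B K τ m ν) {f h : ℝ → ℝ} (hf : Integrable f ν) (hh : Integrable h ν)
    (hb : ∀ r, 0 < r → r ≤ 1 → f r ≤ h r) : ∫ r, f r ∂ν ≤ ∫ r, h r ∂ν := by
  refine integral_mono_ae hf hh ?_
  filter_upwards [g.supp] with r hr using hb r hr.1 hr.2

theorem GoodNu.ip (g : GoodNu lam B K τ m ν) {p p' : ℝ → ℝ} (hp : Cut K p p') :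
    Integrable (fun r => p r ^ 2) ν := by
  have hc := hp.c
  refine g.integ (C := K ^ 2) (by fun_prop) fun r _ _ => ?_
  rw [abs_pow]
  have := (hp.2.2.2 r).1
  have h2 : |p r| ^ 2 ≤ K ^ 2 := by gcongr
  nlinarith [sq_nonneg (pim B m r), sq_nonneg K]

theorem GoodNu.ip' (g : GoodNu lam B K τ m ν) {p p' : ℝ → ℝ} (hp : Cut K p p') :
    Integrable (fun r => p' r ^ 2) ν := by
  have hc := hp.2.1
  refine g.integ (C := K ^ 2) (by fun_prop) fun r _ _ => ?_
  rw [abs_pow]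
  have := (hp.2.2.2 r).2
  have h2 : |p' r| ^ 2 ≤ K ^ 2 := by gcongr
  nlinarith [sq_nonneg (pim B m r), sq_nonneg K]

theorem GoodNu.ipi (g : GoodNu lam B K τ m ν) {p p' : ℝ → ℝ} (hp : Cut K p p') :
    Integrable (fun r => pim B m r ^ 2 * p r ^ 2) ν := by
  have hc := hp.c
  have := pim_meas B m
  refine g.integ (C := K ^ 2) (by fun_prop) fun r _ _ => ?_
  rw [abs_mul, abs_pow, abs_pow, sq_abs]
  have := (hp.2.2.2 r).1
  have h2 : |p r| ^ 2 ≤ K ^ 2 := by gcongr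
  nlinarith [sq_nonneg (pim B m r), sq_nonneg K, mul_le_mul_of_nonneg_left h2 (sq_nonneg (pim B m r))]

theorem ar7 {x K a : ℝ} (hK : 0 ≤ K) (h : a ≤ K * (1 + |x|)) : a ≤ 2 * K * (1 + x ^ 2) := by
  rw [← sq_abs x]; nlinarith [sq_nonneg (|x| - 1), abs_nonneg x]

theorem AdmK.pos {KH : ℝ} {H H' : ℝ → ℝ} (h : AdmK KH H H') : 0 ≤ KH := by
  have := (h.2.2.2 0).1; simp at this; exact (abs_nonneg _).trans this

theorem AdmK.Pb {KH : ℝ} {H H' : ℝ → ℝ} (h : AdmK KH H H') (x : ℝ) :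
    |x ^ 2 - H' x - H x ^ 2| ≤ (1 + 2 * KH + 2 * KH ^ 2) * (1 + x ^ 2) := by
  have hK := h.pos
  obtain ⟨h1, h2⟩ := h.2.2.2 x
  have h3 := ar7 hK h2
  have h4 : H x ^ 2 ≤ 2 * KH ^ 2 * (1 + x ^ 2) := by
    rw [← sq_abs]
    calc |H x| ^ 2 ≤ (KH * (1 + |x|)) ^ 2 := by gcongr
      _ = KH ^ 2 * (1 + |x|) ^ 2 := by ring
      _ ≤ KH ^ 2 * (2 * (1 + x ^ 2)) := by
          gcongr; rw [← sq_abs x]; nlinarith [sq_nonneg (|x| - 1)]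
      _ = _ := by ring
  obtain ⟨h5, h6⟩ := abs_le.1 h3
  rw [abs_le]
  have e : (1 + 2 * KH + 2 * KH ^ 2) * (1 + x ^ 2) = 1 + x ^ 2 + 2 * KH * (1 + x ^ 2) + 2 * KH ^ 2 * (1 + x ^ 2) := by ring
  constructor <;> nlinarith [sq_nonneg (H x), sq_nonneg x]

/-- the basic consequence of `c1` and `c2` -/
theorem GoodNu.star (g : GoodNu lam B K τ m ν) (hB : 1 ≤ B) {KH : ℝ} {H H' : ℝ → ℝ} (hH : AdmK KH H H')
    {G : ℝ → ℝ} (Gc : Continuous G) {CG : ℝ} (CG0 : 0 ≤ CG) (Gb : ∀ x, |G x| ≤ CG * (1 + x ^ 2))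
    (hG : ∀ x, G x ≤ x ^ 2 - H' x - H x ^ 2) {p p' : ℝ → ℝ} (hp : Cut K p p') :
    B * (∫ r, ((1 - r ^ 2) + r ^ 2 * G (xxm B m r)) * p r ^ 2 ∂ν) ≤
      (1 + 10 * (KH + 1) / √B) * (lam B * (∫ r, p r ^ 2 ∂ν) + (∫ r, p' r ^ 2 ∂ν) + τ)
        + 10 * (KH + 1) * √B * ∫ r, p r ^ 2 ∂ν := by
  have B0 : 0 < B := by linarith
  have hs : 0 < √B := sqrt_pos.2 B0
  have hK := hH.pos
  have hK' : 0 ≤ K := (abs_nonneg _).trans (hp.2.2.2 0).1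
  have h1 := g.c1 KH H H' hH p p' hp
  have h2 := g.c2 p p' hp
  have pc := hp.c
  have Hc : Continuous H := continuous_iff_continuousAt.2 fun x => (hH.1 x).continuousAt
  have H'c := hH.2.1
  have xm := xxm_meas B m
  have pm := pim_meas B m
  set x := xxm B m with hx
  have xb : ∀ r, 0 < r → x r ^ 2 ≤ pim B m r ^ 2 := fun r hr => by
    have := xxm_sq (m := m) B0 hr
    nlinarith [sq_nonneg (x r)]
  have pb : ∀ r, p r ^ 2 ≤ K ^ 2 := fun r => by
    rw [← sq_abs]; have := (hp.2.2.2 r).1; gcongr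
  -- generic integrability
  have gen : ∀ (f : ℝ → ℝ) (C : ℝ), 0 ≤ C → Measurable f → (∀ r, |f r| ≤ C * (1 + x r ^ 2)) →
      ∀ a : ℝ, 0 ≤ a → Integrable (fun r => a * (((1 - r ^ 2) + r ^ 2 * f r)) * p r ^ 2) ν := by
    intro f C hC hf hfb a ha
    refine g.integ (C := a * (1 + C) * K ^ 2) (by fun_prop) fun r hr hr1 => ?_
    rw [abs_mul, abs_mul, abs_of_nonneg ha, abs_of_nonneg (sq_nonneg (p r))]
    have e1 : |1 - r ^ 2 + r ^ 2 * f r| ≤ (1 + C) * (1 + pim B m r ^ 2) := by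
      refine (abs_add_le _ _).trans ?_
      rw [abs_of_nonneg (by nlinarith), abs_mul, abs_of_nonneg (sq_nonneg r)]
      have e2 := hfb r
      have e3 : r ^ 2 * |f r| ≤ 1 * (C * (1 + pim B m r ^ 2)) := by
        gcongr
        · nlinarith
        · have := xb r hr
          refine e2.trans ?_; gcongr
      nlinarith [sq_nonneg r, sq_nonneg (pim B m r)]
    calc a * |1 - r ^ 2 + r ^ 2 * f r| * p r ^ 2 ≤ a * ((1 + C) * (1 + pim B m r ^ 2)) * K ^ 2 := by
          have := pb r
          gcongr
      _ = _ := by ring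
  have i1 := gen (fun r => x r ^ 2 - H' (x r) - H (x r) ^ 2) (1 + 2 * KH + 2 * KH ^ 2) (by positivity)
    (by fun_prop) (fun r => hH.Pb _) B B0.le
  have i2 := gen (fun r => G (x r)) CG CG0 (by fun_prop) (fun r => Gb _) B B0.le
  have i3 : Integrable (fun r => 10 * (KH + 1) * √B * (1 + x r ^ 2) * p r ^ 2) ν := by
    refine g.integ (C := 10 * (KH + 1) * √B * K ^ 2) (by fun_prop) fun r hr _ => ?_
    rw [abs_of_nonneg (by positivity)]
    calc _ ≤ 10 * (KH + 1) * √B * (1 + pim B m r ^ 2) * K ^ 2 := by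
          have := pb r
          have := xb r hr
          gcongr
      _ = _ := by ring
  have e0 : (fun r => (B * ((1 - r ^ 2) + r ^ 2 * (x r ^ 2 - H' (x r) - H (x r) ^ 2))
      - 10 * (KH + 1) * √B * (1 + x r ^ 2)) * p r ^ 2) = fun r =>
      B * ((1 - r ^ 2) + r ^ 2 * (x r ^ 2 - H' (x r) - H (x r) ^ 2)) * p r ^ 2
      - 10 * (KH + 1) * √B * (1 + x r ^ 2) * p r ^ 2 := by ext r; ring
  rw [e0, integral_sub i1 i3] at h1
  have h3 : ∫ r, B * ((1 - r ^ 2) + r ^ 2 * G (x r)) * p r ^ 2 ∂ν ≤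
      ∫ r, B * ((1 - r ^ 2) + r ^ 2 * (x r ^ 2 - H' (x r) - H (x r) ^ 2)) * p r ^ 2 ∂ν := by
    refine g.mono i2 i1 fun r hr _ => ?_
    have := hG (x r)
    gcongr
  have h4 : ∫ r, 10 * (KH + 1) * √B * (1 + x r ^ 2) * p r ^ 2 ∂ν ≤
      ∫ r, (10 * (KH + 1) * √B * p r ^ 2 + 10 * (KH + 1) / √B * (pim B m r ^ 2 * p r ^ 2)) ∂ν := by
    refine g.mono i3 (((g.ip hp).const_mul _).add ((g.ipi hp).const_mul _)) fun r hr _ => ?_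
    have e1 : √B * x r ^ 2 ≤ pim B m r ^ 2 / √B := by
      rw [le_div_iff₀ hs]
      calc √B * x r ^ 2 * √B = √B ^ 2 * x r ^ 2 := by ring
        _ = B * x r ^ 2 := by rw [sq_sqrt B0.le]
        _ ≤ _ := xxm_sq B0 hr
    have e2 := mul_le_mul_of_nonneg_right (mul_le_mul_of_nonneg_left e1 (by positivity : 0 ≤ 10 * (KH + 1))) (sq_nonneg (p r))
    have e3 : 10 * (KH + 1) / √B * (pim B m r ^ 2 * p r ^ 2) = 10 * (KH + 1) * (pim B m r ^ 2 / √B) * p r ^ 2 := by ring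
    rw [e3]; nlinarith
  rw [integral_add ((g.ip hp).const_mul _) ((g.ipi hp).const_mul _), integral_const_mul, integral_const_mul] at h4
  have h5 : 10 * (KH + 1) / √B * (∫ r, pim B m r ^ 2 * p r ^ 2 ∂ν) ≤
     10 * (KH + 1) / √B * (lam B * (∫ r, p r ^ 2 ∂ν) + (∫ r, p' r ^ 2 ∂ν) + τ) := by gcongr
  have h6 : ∫ r, B * ((1 - r ^ 2) + r ^ 2 * G (x r)) * p r ^ 2 ∂ν =
      B * (∫ r, ((1 - r ^ 2) + r ^ 2 * G (x r)) * p r ^ 2 ∂ν) := by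
    rw [← integral_const_mul]; congr 1; ext r; ring
  rw [h6] at h3
  linarith

theorem cut_ex (a b : ℝ) (hab : a < b) : ∃ K, 0 ≤ K ∧ ∃ z z' : ℝ → ℝ, (∀ x, HasDerivAt z (z' x) x) ∧
    Continuous z' ∧ (∀ r, r ≤ a → z r = 0) ∧ (∀ r, b ≤ r → z r = 1) ∧ (∀ r, 0 ≤ z r ∧ z r ≤ 1) ∧
    (∀ r, |z' r| ≤ K) ∧ (∀ r, r ≤ a → z' r = 0) ∧ (∀ r, b ≤ r → z' r = 0) := by
  have hd : ContDiff ℝ 1 (fun r : ℝ => Real.smoothTransition ((r - a) / (b - a))) :=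
    Real.smoothTransition.contDiff.comp (by fun_prop)
  have hz0 : ∀ r, r ≤ a → Real.smoothTransition ((r - a) / (b - a)) = 0 := fun r hr =>
    Real.smoothTransition.zero_of_nonpos (div_nonpos_of_nonpos_of_nonneg (by linarith) (by linarith))
  have hz1 : ∀ r, b ≤ r → Real.smoothTransition ((r - a) / (b - a)) = 1 := fun r hr =>
    Real.smoothTransition.one_of_one_le ((one_le_div (by linarith)).2 (by linarith))
  set z := (fun r : ℝ => Real.smoothTransition ((r - a) / (b - a))) with hz
  have dc : Continuous (deriv z) := hd.continuous_deriv le_rfl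
  have d0 : ∀ r, r < a → deriv z r = 0 := fun r hr => by
    have : z =ᶠ[𝓝 r] fun _ => 0 := by
      filter_upwards [Iio_mem_nhds hr] with y hy using hz0 y (le_of_lt hy)
    rw [this.deriv_eq]; simp
  have d1 : ∀ r, b < r → deriv z r = 0 := fun r hr => by
    have : z =ᶠ[𝓝 r] fun _ => 1 := by
      filter_upwards [Ioi_mem_nhds hr] with y hy using hz1 y (le_of_lt hy)
    rw [this.deriv_eq]; simp
  have d0' : ∀ r, r ≤ a → deriv z r = 0 := by
    have hcl : IsClosed {r | deriv z r = 0} := isClosed_eq dc continuous_const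
    have : closure (Iio a) ⊆ {r | deriv z r = 0} := hcl.closure_subset_iff.2 fun r hr => d0 r hr
    rw [closure_Iio] at this
    exact fun r hr => this hr
  have d1' : ∀ r, b ≤ r → deriv z r = 0 := by
    have hcl : IsClosed {r | deriv z r = 0} := isClosed_eq dc continuous_const
    have : closure (Ioi b) ⊆ {r | deriv z r = 0} := hcl.closure_subset_iff.2 fun r hr => d1 r hr
    rw [closure_Ioi] at this
    exact fun r hr => this hr
  have cs : HasCompactSupport (deriv z) := by
    apply HasCompactSupport.intro (isCompact_Icc (a := a) (b := b))
    intro x hx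
    rw [mem_Icc, not_and_or, not_le, not_le] at hx
    rcases hx with hx | hx
    · exact d0 x hx
    · exact d1 x hx
  obtain ⟨K, hK⟩ := cs.exists_bound_of_continuous dc
  exact ⟨K, (norm_nonneg _).trans (hK 0), z, deriv z, fun x => (hd.differentiable one_ne_zero x).hasDerivAt, dc, hz0, hz1,
    fun r => ⟨Real.smoothTransition.nonneg _, Real.smoothTransition.le_one _⟩, hK, d0', d1'⟩
end

section
structure Sq (lam : ℝ → ℝ) (θ : ℝ) (B K τ : ℕ → ℝ) (m : ℕ → ℤ) (ν : ℕ → Measure ℝ) : Prop where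
  th0 : 0 < θ
  th1 : θ < 1
  hA : ∃ KH H H', AdmK KH H H' ∧ ∀ x, θ ≤ x ^ 2 - H' x - H x ^ 2
  hlam : Tendsto (fun B => lam B / B) atTop (𝓝 θ)
  hB : Tendsto B atTop atTop
  hB1 : ∀ n, 1 ≤ B n
  hK : Tendsto K atTop atTop
  hK1 : ∀ n, 1 ≤ K n
  hτ : Tendsto τ atTop (𝓝 0)
  hτ0 : ∀ n, 0 ≤ τ n
  good : ∀ n, GoodNu lam (B n) (K n) (τ n) (m n) (ν n)

section
variable {lam : ℝ → ℝ} {B K τ : ℝ} {m : ℤ} {ν : Measure ℝ}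

theorem GoodNu.starθ (g : GoodNu lam B K τ m ν) (hB : 1 ≤ B) {KH θ : ℝ} {H H' : ℝ → ℝ} (hH : AdmK KH H H')
    (hG : ∀ x, θ ≤ x ^ 2 - H' x - H x ^ 2) {p p' : ℝ → ℝ} (hp : Cut K p p') :
    B * (∫ r, ((1 - r ^ 2) + r ^ 2 * θ) * p r ^ 2 ∂ν) ≤
      (1 + 10 * (KH + 1) / √B) * (lam B * (∫ r, p r ^ 2 ∂ν) + (∫ r, p' r ^ 2 ∂ν) + τ)
        + 10 * (KH + 1) * √B * ∫ r, p r ^ 2 ∂ν :=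
  g.star hB hH (G := fun _ => θ) continuous_const (abs_nonneg θ)
    (fun x => by nlinarith [abs_nonneg θ, sq_nonneg x]) hG hp

theorem GoodNu.ir2 (g : GoodNu lam B K τ m ν) : Integrable (fun r => 1 - r ^ 2) ν :=
  g.integ (C := 1) (by fun_prop) fun r h0 h1 => by
    rw [abs_of_nonneg (by nlinarith)]; nlinarith [sq_nonneg (pim B m r)]

theorem GoodNu.one_star (g : GoodNu lam B K τ m ν) (hB : 1 ≤ B) (hK : 1 ≤ K) {KH θ : ℝ} {H H' : ℝ → ℝ}
    (hH : AdmK KH H H') (hG : ∀ x, θ ≤ x ^ 2 - H' x - H x ^ 2) :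
    B * (θ + (1 - θ) * ∫ r, (1 - r ^ 2) ∂ν) ≤
      (1 + 10 * (KH + 1) / √B) * (lam B + τ) + 10 * (KH + 1) * √B := by
  have := g.prob
  have h := g.starθ hB hH hG (Cut.one.mono hK)
  have e : ∫ r, ((1 - r ^ 2) + r ^ 2 * θ) * (1:ℝ) ^ 2 ∂ν = θ + (1 - θ) * ∫ r, (1 - r ^ 2) ∂ν := by
    have e1 : (fun r : ℝ => ((1 - r ^ 2) + r ^ 2 * θ) * (1:ℝ) ^ 2) = fun r => θ + (1 - θ) * (1 - r ^ 2) := by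
      ext r; ring
    rw [e1, integral_add (integrable_const _) (g.ir2.const_mul _), integral_const_mul]
    simp
  rw [e] at h
  simpa using h

theorem GoodNu.e0 (g : GoodNu lam B K τ m ν) : 0 ≤ ∫ r, (1 - r ^ 2) ∂ν := by
  apply integral_nonneg_of_ae
  filter_upwards [g.supp] with r hr
  have := hr.1; have := hr.2
  simp only [Pi.zero_apply]; nlinarith

theorem GoodNu.V1 (g : GoodNu lam B K τ m ν) (hK : 1 ≤ K) : ∫ r, pim B m r ^ 2 ∂ν ≤ lam B + τ := by
  have := g.prob
  have h := g.c2 _ _ (Cut.one.mono hK)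
  simpa using h
end

variable {lam : ℝ → ℝ} {θ : ℝ} {B K τ : ℕ → ℝ} {m : ℕ → ℤ} {ν : ℕ → Measure ℝ}

theorem Sq.y (S : Sq lam θ B K τ m ν) : Tendsto (fun n => 1 / √(B n)) atTop (𝓝 0) := by
  simp only [one_div]
  exact tendsto_inv_atTop_zero.comp (Real.tendsto_sqrt_atTop.comp S.hB)

theorem Sq.a (S : Sq lam θ B K τ m ν) : Tendsto (fun n => lam (B n) / B n) atTop (𝓝 θ) :=
  S.hlam.comp S.hB

theorem Sq.B0 (S : Sq lam θ B K τ m ν) (n : ℕ) : 0 < B n := by linarith [S.hB1 n]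

theorem Sq.tB (S : Sq lam θ B K τ m ν) {f : ℕ → ℝ} {a : ℝ} (hf : Tendsto f atTop (𝓝 a)) :
    Tendsto (fun n => f n / B n) atTop (𝓝 0) := hf.div_atTop S.hB

theorem sqB {B : ℝ} (hB : 0 < B) : √B / B = 1 / √B := by
  have hs : 0 < √B := sqrt_pos.2 hB
  rw [div_eq_div_iff hB.ne' hs.ne', one_mul, ← sq, sq_sqrt hB.le]

theorem Sq.e (S : Sq lam θ B K τ m ν) : Tendsto (fun n => ∫ r, (1 - r ^ 2) ∂(ν n)) atTop (𝓝 0) := by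
  obtain ⟨KH, H, H', hH, hG⟩ := S.hA
  have l1 : Tendsto (fun n => ((1 + 10 * (KH + 1) * (1 / √(B n))) * (lam (B n) / B n + τ n / B n)
      + 10 * (KH + 1) * (1 / √(B n)) - θ) / (1 - θ)) atTop (𝓝 0) := by
    have := ((((S.y.const_mul (10 * (KH + 1))).const_add 1).mul (S.a.add (S.tB S.hτ))).add
      (S.y.const_mul (10 * (KH + 1)))).sub_const θ |>.div_const (1 - θ)
    simpa using this
  refine squeeze_zero (fun n => (S.good n).e0) (fun n => ?_) l1
  have h := (S.good n).one_star (S.hB1 n) (S.hK1 n) hH hG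
  have B0 := S.B0 n
  rw [le_div_iff₀ (by linarith [S.th1])]
  have h2 := div_le_div_of_nonneg_right h B0.le
  rw [mul_div_cancel_left₀ _ B0.ne', add_div, mul_div_assoc, mul_div_assoc (10 * (KH + 1)), sqB B0, add_div,
    ← mul_one_div (10 * (KH + 1))] at h2
  linarith

theorem Sq.V (S : Sq lam θ B K τ m ν) : ∀ᶠ n in atTop, ∫ r, pim (B n) (m n) r ^ 2 ∂(ν n) ≤ 2 * B n := by
  have l1 := S.a.add (S.tB S.hτ)
  rw [add_zero] at l1
  filter_upwards [l1.eventually (gt_mem_nhds (show θ < 2 by linarith [S.th1]))] with n hn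
  have h := (S.good n).V1 (S.hK1 n)
  have B0 := S.B0 n
  rw [← add_div, div_lt_iff₀ B0] at hn
  linarith

theorem Sq.iabs (S : Sq lam θ B K τ m ν) (n : ℕ) : Integrable (fun r => |pim (B n) (m n) r|) (ν n) := by
  have := pim_meas (B n) (m n)
  refine (S.good n).integ (C := 1) (by fun_prop) fun r _ _ => ?_
  rw [abs_abs, ← sq_abs (pim (B n) (m n) r)]
  nlinarith [sq_nonneg (|pim (B n) (m n) r| - 1), abs_nonneg (pim (B n) (m n) r)]

theorem Sq.Iabs (S : Sq lam θ B K τ m ν) :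
    Tendsto (fun n => (∫ r, |pim (B n) (m n) r| ∂(ν n)) / B n) atTop (𝓝 0) := by
  have l2 : Tendsto (fun n => 2 * (1 / √(B n))) atTop (𝓝 0) := by simpa using S.y.const_mul 2
  refine squeeze_zero' (Eventually.of_forall fun n => div_nonneg (integral_nonneg fun r => abs_nonneg _) (S.B0 n).le) ?_ l2
  filter_upwards [S.V] with n hV
  have B0 := S.B0 n
  have hs : 0 < √(B n) := sqrt_pos.2 B0
  have := (S.good n).prob
  have h1 : ∫ r, |pim (B n) (m n) r| ∂(ν n) ≤ ∫ r, (√(B n) / 2 + 1 / (2 * √(B n)) * pim (B n) (m n) r ^ 2) ∂(ν n) := by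
    refine (S.good n).mono (S.iabs n) ((integrable_const _).add ((S.good n).int.const_mul _)) fun r _ _ => ?_
    rw [← sq_abs (pim (B n) (m n) r)]
    set q := |pim (B n) (m n) r|
    have e : √(B n) / 2 + 1 / (2 * √(B n)) * q ^ 2 - q = (√(B n) - q) ^ 2 / (2 * √(B n)) := by
      field_simp; ring
    have : 0 ≤ (√(B n) - q) ^ 2 / (2 * √(B n)) := by positivity
    linarith
  rw [integral_add (integrable_const _) ((S.good n).int.const_mul _), integral_const_mul] at h1
  simp only [integral_const, probReal_univ, smul_eq_mul, one_mul] at h1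
  have h2 : 1 / (2 * √(B n)) * ∫ r, pim (B n) (m n) r ^ 2 ∂(ν n) ≤ 1 / (2 * √(B n)) * (2 * B n) := by gcongr
  have h3 : 1 / (2 * √(B n)) * (2 * B n) = √(B n) := by
    field_simp; exact (sq_sqrt B0.le).symm
  rw [div_le_iff₀ B0]
  have h4 : 2 * (1 / √(B n)) * B n = 2 * √(B n) := by
    field_simp; exact (sq_sqrt B0.le).symm
  rw [h4]; linarith

theorem Sq.irpi (S : Sq lam θ B K τ m ν) (n : ℕ) : Integrable (fun r => r * pim (B n) (m n) r) (ν n) := by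
  have := pim_meas (B n) (m n)
  refine (S.good n).integ (C := 1) (by fun_prop) fun r h0 h1 => ?_
  rw [abs_mul, abs_of_pos h0, ← sq_abs (pim (B n) (m n) r)]
  nlinarith [sq_nonneg (|pim (B n) (m n) r| - 1), abs_nonneg (pim (B n) (m n) r)]

theorem Sq.rho (S : Sq lam θ B K τ m ν) : Tendsto (fun n => 2 * (m n : ℝ) / B n) atTop (𝓝 1) := by
  have key : ∀ n, 2 * (m n : ℝ) / B n = 1 - (∫ r, (1 - r ^ 2) ∂(ν n))
      - 2 * ((∫ r, r * pim (B n) (m n) r ∂(ν n)) / B n) := by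
    intro n
    have B0 := S.B0 n
    have := (S.good n).prob
    have e1 : ∫ r, r * pim (B n) (m n) r ∂(ν n) = ∫ r, ((B n / 2 - m n) - B n / 2 * (1 - r ^ 2)) ∂(ν n) := by
      apply integral_congr_ae
      filter_upwards [(S.good n).supp] with r hr
      have := hr.1.ne'
      unfold pim; field_simp; ring
    rw [e1, integral_sub (integrable_const _) ((S.good n).ir2.const_mul _), integral_const_mul]
    simp only [integral_const, probReal_univ, smul_eq_mul, one_mul]
    field_simp; ring
  have l1 : Tendsto (fun n => (∫ r, r * pim (B n) (m n) r ∂(ν n)) / B n) atTop (𝓝 0) := by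
    refine squeeze_zero_norm (fun n => ?_) S.Iabs
    have B0 := S.B0 n
    rw [norm_div, Real.norm_of_nonneg B0.le]
    gcongr
    refine (norm_integral_le_integral_norm _).trans ?_
    refine (S.good n).mono (S.irpi n).norm (S.iabs n) fun r h0 h1 => ?_
    rw [norm_mul, Real.norm_of_nonneg h0.le, Real.norm_eq_abs]
    nlinarith [abs_nonneg (pim (B n) (m n) r)]
  simp_rw [key]
  simpa using (S.e.const_sub 1).sub (l1.const_mul 2)

theorem Sq.mpos (S : Sq lam θ B K τ m ν) : ∀ᶠ n in atTop, 0 < m n := by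
  filter_upwards [S.rho.eventually (lt_mem_nhds (show (0:ℝ) < 1 by norm_num))] with n hn
  have B0 := S.B0 n
  have : (0:ℝ) < 2 * m n := by
    by_contra h; push Not at h
    exact absurd hn (not_lt.2 (div_nonpos_of_nonpos_of_nonneg h B0.le))
  have : (0:ℝ) < m n := by linarith
  exact_mod_cast this

theorem Sq.agm (S : Sq lam θ B K τ m ν) : ∀ᶠ n in atTop, ∀ p p', Cut (K n) p p' → (∀ r, 3/4 ≤ r → p r = 0) →
    B n * (∫ r, p r ^ 2 ∂(ν n)) ≤ 8 / (1 - θ) * ((∫ r, p' r ^ 2 ∂(ν n)) + τ n) := by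
  obtain ⟨KH, H, H', hH, hG⟩ := S.hA
  have t1 : 0 < 1 - θ := by linarith [S.th1]
  have l0 : Tendsto (fun n => 1 + 10 * (KH + 1) * (1 / √(B n))) atTop (𝓝 1) := by
    simpa using (S.y.const_mul (10 * (KH + 1))).const_add 1
  have l1 : Tendsto (fun n => θ + (1 - θ) * (7/16) - (1 + 10 * (KH + 1) * (1 / √(B n))) * (lam (B n) / B n)
      - 10 * (KH + 1) * (1 / √(B n))) atTop (𝓝 ((1 - θ) * (7/16))) := by
    have := ((l0.mul S.a).const_sub (θ + (1 - θ) * (7/16))).sub (S.y.const_mul (10 * (KH + 1)))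
    refine this.congr' (Eventually.of_forall fun n => rfl) |>.trans (le_of_eq (by congr 1; ring))
  filter_upwards [l1.eventually (lt_mem_nhds (show (1 - θ) / 4 < (1 - θ) * (7/16) by linarith)),
    l0.eventually (gt_mem_nhds (show (1:ℝ) < 2 by norm_num))] with n h1 h2 p p' hp hp0
  have g := S.good n
  have h := g.starθ (S.hB1 n) hH hG hp
  have B0 := S.B0 n
  have pc := hp.c
  have hs : 0 < √(B n) := sqrt_pos.2 B0
  have ip := g.ip hp
  have D0 : 0 ≤ ∫ r, p' r ^ 2 ∂(ν n) := integral_nonneg fun r => sq_nonneg _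
  have P0 : 0 ≤ ∫ r, p r ^ 2 ∂(ν n) := integral_nonneg fun r => sq_nonneg _
  have h3 : ∫ r, (θ + (1 - θ) * (7/16)) * p r ^ 2 ∂(ν n) ≤ ∫ r, ((1 - r ^ 2) + r ^ 2 * θ) * p r ^ 2 ∂(ν n) := by
    refine g.mono (ip.const_mul _) ?_ fun r h0 h1 => ?_
    · refine g.integ (C := K n ^ 2 * (1 + |θ|)) (by fun_prop) fun r h0 h1 => ?_
      rw [abs_mul, abs_pow]
      have e1 := (hp.2.2.2 r).1
      have e2 : |p r| ^ 2 ≤ K n ^ 2 := by gcongr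
      have e3 : |1 - r ^ 2 + r ^ 2 * θ| ≤ 1 + |θ| := by
        refine (abs_add_le _ _).trans ?_
        rw [abs_of_nonneg (by nlinarith), abs_mul, abs_of_nonneg (sq_nonneg r)]
        have h2 : r ^ 2 ≤ 1 := by nlinarith
        nlinarith [mul_le_mul_of_nonneg_right h2 (abs_nonneg θ), sq_nonneg r]
      calc |1 - r ^ 2 + r ^ 2 * θ| * |p r| ^ 2 ≤ (1 + |θ|) * K n ^ 2 := by gcongr
        _ ≤ _ := by nlinarith [sq_nonneg (pim (B n) (m n) r), show 0 ≤ (1 + |θ|) * K n ^ 2 by positivity]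
    · rcases le_total (3/4) r with h | h
      · rw [hp0 r h]; simp
      · refine mul_le_mul_of_nonneg_right ?_ (sq_nonneg _)
        have : r ^ 2 ≤ 9/16 := by nlinarith
        nlinarith
  rw [integral_const_mul] at h3
  set P := ∫ r, p r ^ 2 ∂(ν n)
  set D := ∫ r, p' r ^ 2 ∂(ν n)
  have h4 := mul_le_mul_of_nonneg_left h3 B0.le
  have h5 : (1 - θ) / 4 * (B n * P) ≤ 2 * (D + τ n) := by
    have e1 : (θ + (1 - θ) * (7/16) - (1 + 10 * (KH + 1) * (1 / √(B n))) * (lam (B n) / B n)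
      - 10 * (KH + 1) * (1 / √(B n))) * (B n * P) ≤ (1 + 10 * (KH + 1) * (1 / √(B n))) * (D + τ n) := by
      have e2 : lam (B n) / B n * (B n * P) = lam (B n) * P := by field_simp
      have e3 : (1 / √(B n)) * (B n * P) = √(B n) * P := by
        rw [← sqB B0]; field_simp
      have e4 : (θ + (1 - θ) * (7/16) - (1 + 10 * (KH + 1) * (1 / √(B n))) * (lam (B n) / B n)
        - 10 * (KH + 1) * (1 / √(B n))) * (B n * P) = B n * ((θ + (1 - θ) * (7/16)) * P)
          - (1 + 10 * (KH + 1) * (1 / √(B n))) * (lam (B n) * P) - 10 * (KH + 1) * (√(B n) * P) := by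
        rw [← e2, ← e3]; ring
      rw [e4]
      have e5 : 10 * (KH + 1) / √(B n) = 10 * (KH + 1) * (1 / √(B n)) := by ring
      rw [e5] at h
      linarith
    have hBP : 0 ≤ B n * P := by positivity
    calc (1 - θ) / 4 * (B n * P) ≤ _ := mul_le_mul_of_nonneg_right h1.le hBP
      _ ≤ _ := e1
      _ ≤ _ := mul_le_mul_of_nonneg_right h2.le (by linarith [S.hτ0 n])
  rw [div_mul_eq_mul_div, le_div_iff₀ t1]
  linarith
end

section
structure Zc (Kz : ℝ) (ω ζ ζ' : ℝ → ℝ) : Prop where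
  k1 : 1 ≤ Kz
  cz : Cut Kz ζ ζ'
  z0 : ∀ r, r ≤ 1/8 → ζ r = 0
  z1 : ∀ r, 1/4 ≤ r → ζ r = 1
  z1' : ∀ r, 1/4 ≤ r → ζ' r = 0
  z01 : ∀ r, 0 ≤ ζ r ∧ ζ r ≤ 1
  wc : Continuous ω
  w1 : ∀ r, r ≤ 1/4 → ω r = 1
  w01 : ∀ r, 0 ≤ ω r ∧ ω r ≤ 1

variable {lam : ℝ → ℝ} {θ : ℝ} {B K τ : ℕ → ℝ} {m : ℕ → ℤ} {ν : ℕ → Measure ℝ}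

theorem Sq.W (S : Sq lam θ B K τ m ν) : ∃ Kz ω ζ ζ', Zc Kz ω ζ ζ' ∧
    Tendsto (fun n => ∫ r, ω r ^ 2 * (1 + pim (B n) (m n) r ^ 2) ∂(ν n)) atTop (𝓝 0) := by
  obtain ⟨K1, hK1, a, a', ad, ac, a0, a1, a01, ab, a0', a1'⟩ := cut_ex (1/2) (3/4) (by norm_num)
  obtain ⟨K2, hK2, b, b', bd, bc, b0, b1, b01, bb, b0', b1'⟩ := cut_ex (1/4) (1/2) (by norm_num)
  obtain ⟨K3, hK3, z, z', zd, zc, z0, z1, z01, zb, z0', z1'⟩ := cut_ex (1/8) (1/4) (by norm_num)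
  have cb : Continuous b := continuous_iff_continuousAt.2 fun x => (bd x).continuousAt
  have ca : Continuous a := continuous_iff_continuousAt.2 fun x => (ad x).continuousAt
  refine ⟨1 + K3, fun r => 1 - b r, z, z', ⟨by linarith, ⟨zd, zc, fun r hr => by rw [z0 r hr, z0 _ le_rfl], fun x => ⟨?_, (zb x).trans (by linarith)⟩⟩,
    z0, z1, z1', z01, by fun_prop, fun r hr => by rw [b0 r hr, sub_zero], fun r => ⟨by linarith [(b01 r).2], by linarith [(b01 r).1]⟩⟩, ?_⟩
  · rw [abs_of_nonneg (z01 x).1]; linarith [(z01 x).2]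
  have cA : Cut (1 + K1) (fun r => 1 - a r) (fun r => - a' r) := by
    refine ⟨fun x => ?_, by fun_prop, fun r hr => ?_, fun x => ⟨?_, ?_⟩⟩
    · simpa using (ad x).const_sub 1
    · dsimp only; rw [a0 r (by linarith), a0 (1/8) (by norm_num)]
    · rw [abs_of_nonneg (by linarith [(a01 x).2])]; linarith [(a01 x).1]
    · rw [abs_neg]; linarith [ab x]
  have cB : Cut (1 + K2) (fun r => 1 - b r) (fun r => - b' r) := by
    refine ⟨fun x => ?_, by fun_prop, fun r hr => ?_, fun x => ⟨?_, ?_⟩⟩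
    · simpa using (bd x).const_sub 1
    · dsimp only; rw [b0 r (by linarith), b0 (1/8) (by norm_num)]
    · rw [abs_of_nonneg (by linarith [(b01 x).2])]; linarith [(b01 x).1]
    · rw [abs_neg]; linarith [bb x]
  set c := 8 / (1 - θ) with hc
  have t1 : 0 < 1 - θ := by linarith [S.th1]
  have c0 : 0 < c := by positivity
  have lA : Tendsto (fun n => c * (K1 ^ 2 + τ n) / B n) atTop (𝓝 0) := S.tB ((tendsto_const_nhds.add S.hτ).const_mul c)
  have bnd : ∀ᶠ n in atTop, ∫ r, (1 - a r) ^ 2 ∂(ν n) ≤ c * (K1 ^ 2 + τ n) / B n := by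
    filter_upwards [S.agm, S.hK.eventually_ge_atTop (1 + K1)] with n h1 h2
    have B0 := S.B0 n
    have g := S.good n
    have := g.prob
    have h3 := h1 _ _ (cA.mono h2) (fun r hr => by rw [a1 r hr, sub_self])
    have h4 : ∫ r, (- a' r) ^ 2 ∂(ν n) ≤ ∫ r, K1 ^ 2 ∂(ν n) := by
      refine g.mono (g.ip' (cA.mono h2)) (integrable_const _) fun r _ _ => ?_
      rw [neg_sq, ← sq_abs]; have := ab r; gcongr
    simp only [integral_const, probReal_univ, smul_eq_mul, one_mul] at h4
    rw [le_div_iff₀ B0, mul_comm]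
    exact h3.trans (by gcongr)
  have lB : Tendsto (fun n => c * (K2 ^ 2 * (c * (K1 ^ 2 + τ n) / B n) + τ n)) atTop (𝓝 0) := by
    simpa using ((lA.const_mul (K2 ^ 2)).add S.hτ).const_mul c
  have l1 : Tendsto (fun n => (lam (B n) / B n + 1) * (c * (K2 ^ 2 * (c * (K1 ^ 2 + τ n) / B n) + τ n)) +
      K2 ^ 2 * (c * (K1 ^ 2 + τ n) / B n) + τ n) atTop (𝓝 0) := by
    simpa using (((S.a.add_const 1).mul lB).add (lA.const_mul (K2 ^ 2))).add S.hτ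
  refine squeeze_zero' (Eventually.of_forall fun n => integral_nonneg fun r => by positivity) ?_ l1
  filter_upwards [S.agm, S.hK.eventually_ge_atTop (1 + K2), bnd, S.hK.eventually_ge_atTop (1 + K1), S.a.eventually (lt_mem_nhds S.th0)] with n h1 h2 hA hA2 ha
  have B0 := S.B0 n
  have g := S.good n
  have := g.prob
  have h3 := h1 _ _ (cB.mono h2) (fun r hr => by rw [b1 r (by linarith), sub_self])
  have h4 : ∫ r, (- b' r) ^ 2 ∂(ν n) ≤ ∫ r, K2 ^ 2 * (1 - a r) ^ 2 ∂(ν n) := by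
    refine g.mono (g.ip' (cB.mono h2)) ((g.ip (cA.mono hA2)).const_mul _) fun r _ _ => ?_
    rcases le_total r (1/2) with h | h
    · rw [a0 r h, neg_sq, ← sq_abs]; have := bb r; simp only [sub_zero, one_pow, mul_one]; gcongr
    · rw [b1' r h, neg_zero, zero_pow two_ne_zero]; positivity
  rw [integral_const_mul] at h4
  have h5 := g.c2 _ _ (cB.mono h2)
  have ib := g.ip (cB.mono h2)
  have ipb := g.ipi (cB.mono h2)
  have e : ∫ r, (1 - b r) ^ 2 * (1 + pim (B n) (m n) r ^ 2) ∂(ν n) = (∫ r, (1 - b r) ^ 2 ∂(ν n)) + ∫ r, pim (B n) (m n) r ^ 2 * (1 - b r) ^ 2 ∂(ν n) := by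
    rw [← integral_add ib ipb]; congr 1; ext r; ring
  rw [e]
  set P := ∫ r, (1 - b r) ^ 2 ∂(ν n)
  have P0 : 0 ≤ P := integral_nonneg fun r => sq_nonneg _
  set D := ∫ r, (- b' r) ^ 2 ∂(ν n)
  set A := ∫ r, (1 - a r) ^ 2 ∂(ν n)
  set X := c * (K1 ^ 2 + τ n) / B n
  have h6 : D ≤ K2 ^ 2 * X := h4.trans (by gcongr)
  have h7 : B n * P ≤ c * (K2 ^ 2 * X + τ n) := h3.trans (by gcongr)
  have h8 : P ≤ B n * P := by nlinarith [S.hB1 n]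
  have h9 : lam (B n) * P = lam (B n) / B n * (B n * P) := by field_simp
  have h10 : lam (B n) / B n * (B n * P) ≤ lam (B n) / B n * (c * (K2 ^ 2 * X + τ n)) := by gcongr
  rw [h9] at h5
  linarith

variable {Kz : ℝ} {ω ζ ζ' : ℝ → ℝ}

theorem Zc.om (z : Zc Kz ω ζ ζ') (r : ℝ) : 1 - ζ r ^ 2 ≤ ω r ^ 2 := by
  rcases le_total r (1/4) with h | h
  · rw [z.w1 r h]; nlinarith [sq_nonneg (ζ r)]
  · rw [z.z1 r h]; nlinarith [sq_nonneg (ω r)]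

theorem Sq.iW (S : Sq lam θ B K τ m ν) (z : Zc Kz ω ζ ζ') (n : ℕ) :
    Integrable (fun r => ω r ^ 2 * (1 + pim (B n) (m n) r ^ 2)) (ν n) := by
  have := pim_meas (B n) (m n)
  have := z.wc
  refine (S.good n).integ (C := 1) (by fun_prop) fun r _ _ => ?_
  rw [abs_of_nonneg (by positivity)]
  have := z.w01 r
  have : ω r ^ 2 ≤ 1 := by nlinarith only [this.1, this.2]
  gcongr

theorem Sq.Z (S : Sq lam θ B K τ m ν) (z : Zc Kz ω ζ ζ')
    (hW : Tendsto (fun n => ∫ r, ω r ^ 2 * (1 + pim (B n) (m n) r ^ 2) ∂(ν n)) atTop (𝓝 0)) :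
    Tendsto (fun n => ∫ r, ζ r ^ 2 ∂(ν n)) atTop (𝓝 1) := by
  have l : Tendsto (fun n => 1 - ∫ r, ω r ^ 2 * (1 + pim (B n) (m n) r ^ 2) ∂(ν n)) atTop (𝓝 1) := by
    simpa using hW.const_sub 1
  refine tendsto_of_tendsto_of_tendsto_of_le_of_le' l tendsto_const_nhds ?_ ?_
  · filter_upwards [S.hK.eventually_ge_atTop Kz] with n hn
    have g := S.good n
    have := g.prob
    have h : ∫ r, (1 - ω r ^ 2 * (1 + pim (B n) (m n) r ^ 2)) ∂(ν n) ≤ ∫ r, ζ r ^ 2 ∂(ν n) := by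
      refine g.mono ((integrable_const _).sub (S.iW z n)) (g.ip (z.cz.mono hn)) fun r _ _ => ?_
      have := z.om r
      nlinarith only [this, sq_nonneg (ω r * pim (B n) (m n) r)]
    rw [integral_sub (integrable_const _) (S.iW z n)] at h
    simpa using h
  · filter_upwards [S.hK.eventually_ge_atTop Kz] with n hn
    have g := S.good n
    have := g.prob
    have h : ∫ r, ζ r ^ 2 ∂(ν n) ≤ ∫ r, 1 ∂(ν n) := by
      refine g.mono (g.ip (z.cz.mono hn)) (integrable_const _) fun r _ _ => ?_
      have := z.z01 r
      nlinarith only [this.1, this.2]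
    simpa using h

theorem vir_pt {h κ q r z : ℝ} (h1 : |h| < 1) (hk : |κ| ≤ 1/2) (hr : 1/8 ≤ r) (z1 : z ^ 2 ≤ 1) :
    (((1 + h) * q - κ / r) ^ 2 - q ^ 2) * z ^ 2 ≤ (2 * h + h ^ 2) * (q ^ 2 * z ^ 2) + 16 * |q| + 16 := by
  have r0 : 0 < r := by linarith
  have e : (((1 + h) * q - κ / r) ^ 2 - q ^ 2) * z ^ 2 = (2 * h + h ^ 2) * (q ^ 2 * z ^ 2) + (- (2 * (1 + h) * (κ / r)) * q + (κ / r) ^ 2) * z ^ 2 := by ring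
  have k : |κ / r| ≤ 4 := by
    rw [abs_div, abs_of_pos r0, div_le_iff₀ r0]; linarith
  have k2 : (κ / r) ^ 2 ≤ 16 := by rw [← sq_abs]; nlinarith only [abs_nonneg (κ / r), k]
  have k3 : - (2 * (1 + h) * (κ / r)) * q ≤ 16 * |q| := by
    refine (le_abs_self _).trans ?_
    rw [abs_mul, abs_neg, abs_mul]
    refine mul_le_mul_of_nonneg_right ?_ (abs_nonneg q)
    have : |2 * (1 + h)| ≤ 4 := by rw [abs_le]; rw [abs_lt] at h1; constructor <;> linarith
    have : |2 * (1 + h)| * |κ / r| ≤ 4 * 4 := by gcongr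
    linarith
  rw [e]
  have : (- (2 * (1 + h) * (κ / r)) * q + (κ / r) ^ 2) * z ^ 2 ≤ 16 * |q| + 16 := by
    nlinarith only [sq_nonneg z, abs_nonneg q, k2, k3, z1]
  linarith

theorem Sq.vir1 (S : Sq lam θ B K τ m ν) (z : Zc Kz ω ζ ζ')
    (hW : Tendsto (fun n => ∫ r, ω r ^ 2 * (1 + pim (B n) (m n) r ^ 2) ∂(ν n)) atTop (𝓝 0)) {h ε : ℝ} (h1 : |h| < 1) (hε : 0 < ε) :
    ∀ᶠ n in atTop, h * θ - ε ≤ (2 * h + h ^ 2) * ((∫ r, pim (B n) (m n) r ^ 2 * ζ r ^ 2 ∂(ν n)) / B n) := by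
  have hh := abs_lt.1 h1
  have t : Tendsto (fun n => (1 + h) * B n) atTop atTop := S.hB.const_mul_atTop (by linarith)
  have l1 : Tendsto (fun n => ((1 + h) * (lam ((1 + h) * B n) / ((1 + h) * B n)) - lam (B n) / B n) * (∫ r, ζ r ^ 2 ∂(ν n))
      - (Kz ^ 2 + τ n) / B n - 16 * ((∫ r, |pim (B n) (m n) r| ∂(ν n)) / B n) - 16 / B n) atTop (𝓝 (h * θ)) := by
    have := ((((((S.hlam.comp t).const_mul (1 + h)).sub S.a).mul (S.Z z hW)).sub (S.tB (tendsto_const_nhds (x := Kz^2).add S.hτ))).sub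
      (S.Iabs.const_mul 16)).sub (S.tB (tendsto_const_nhds (x := 16)))
    have e : ((1 + h) * θ - θ) * 1 - 0 - 16 * 0 - 0 = h * θ := by ring
    rw [e] at this
    exact this
  filter_upwards [l1.eventually (lt_mem_nhds (show h * θ - ε < h * θ by linarith)), S.hK.eventually_ge_atTop Kz] with n hn hK
  refine hn.le.trans ?_
  have g := S.good n
  have := g.prob
  have B0 := S.B0 n
  have B1 : 0 < (1 + h) * B n := mul_pos (by linarith) B0
  have cz := z.cz.mono hK
  have hd := g.d _ _ cz (z.z0 _ le_rfl) _ B1 (round (h * m n))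
  set κ : ℝ := round (h * m n) - h * m n with hκ
  have k1 : |κ| ≤ 1/2 := by rw [hκ, abs_sub_comm]; exact abs_sub_round _
  have pm := pim_meas (B n) (m n)
  have cc := z.cz.c
  have ptw : ∀ r, 0 < r → ((pim (B n) (m n) r + ((1 + h) * B n - B n) * r / 2 - (round (h * m n) : ℤ) / r) ^ 2 - pim (B n) (m n) r ^ 2) * ζ r ^ 2
      = (((1 + h) * pim (B n) (m n) r - κ / r) ^ 2 - pim (B n) (m n) r ^ 2) * ζ r ^ 2 := by
    intro r hr
    congr 3
    rw [hκ]; unfold pim; field_simp; ring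
  have zz : ∀ r, ζ r ^ 2 ≤ 1 := fun r => by have := z.z01 r; nlinarith only [this.1, this.2]
  have i2 : Integrable (fun r => (2 * h + h ^ 2) * (pim (B n) (m n) r ^ 2 * ζ r ^ 2) + 16 * |pim (B n) (m n) r|) (ν n) :=
    ((g.ipi cz).const_mul _).add ((S.iabs n).const_mul _)
  have i3 : Integrable (fun r => (2 * h + h ^ 2) * (pim (B n) (m n) r ^ 2 * ζ r ^ 2) + 16 * |pim (B n) (m n) r| + 16) (ν n) :=
    i2.add (integrable_const _)
  have h2 : ∫ r, ((pim (B n) (m n) r + ((1 + h) * B n - B n) * r / 2 - (round (h * m n) : ℤ) / r) ^ 2 - pim (B n) (m n) r ^ 2) * ζ r ^ 2 ∂(ν n)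
      ≤ ∫ r, ((2 * h + h ^ 2) * (pim (B n) (m n) r ^ 2 * ζ r ^ 2) + 16 * |pim (B n) (m n) r| + 16) ∂(ν n) := by
    refine g.mono ?_ i3 fun r r0 r1 => ?_
    · refine g.integ (C := 300) (by fun_prop) fun r r0 r1 => ?_
      rw [ptw r r0]
      rcases le_total r (1/8) with hr | hr
      · rw [z.z0 r hr]; simp; positivity
      · rw [abs_mul, abs_of_nonneg (sq_nonneg (ζ r))]
        have k : |κ / r| ≤ 4 := by
          rw [abs_div, abs_of_pos r0, div_le_iff₀ r0]; linarith
        set q := pim (B n) (m n) r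
        set b := κ / r
        have a1 : |((1 + h) * q - b) ^ 2 - q ^ 2| ≤ 100 * (1 + q ^ 2) := by
          have b2 : b ^ 2 ≤ 16 := by rw [← sq_abs]; nlinarith only [abs_nonneg b, k]
          have e1 : ((1 + h) * q - b) ^ 2 ≤ 2 * (4 * q ^ 2) + 2 * b ^ 2 := by
            have : (1 + h) ^ 2 ≤ 4 := by nlinarith only [hh.1, hh.2]
            linarith only [sq_nonneg ((1 + h) * q + b), mul_le_mul_of_nonneg_right this (sq_nonneg q)]
          rw [abs_le]; constructor <;> linarith only [sq_nonneg ((1 + h) * q - b), sq_nonneg q, e1, b2]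
        nlinarith only [zz r, a1, sq_nonneg (ζ r), abs_nonneg (((1 + h) * q - b) ^ 2 - q ^ 2), sq_nonneg q]
    · rw [ptw r r0]
      rcases le_total r (1/8) with hr | hr
      · rw [z.z0 r hr]; simp; positivity
      · exact vir_pt h1 k1 hr (zz r)
  rw [integral_add i2 (integrable_const _), integral_add ((g.ipi cz).const_mul _) ((S.iabs n).const_mul _),
    integral_const_mul, integral_const_mul] at h2
  simp only [integral_const, probReal_univ, smul_eq_mul, one_mul] at h2
  have h4 : ∫ r, (ζ' r) ^ 2 ∂(ν n) ≤ ∫ r, Kz ^ 2 ∂(ν n) := by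
    refine g.mono (g.ip' cz) (integrable_const _) fun r _ _ => ?_
    rw [← sq_abs]; have := (z.cz.2.2.2 r).2; gcongr
  simp only [integral_const, probReal_univ, smul_eq_mul, one_mul] at h4
  set Z := ∫ r, ζ r ^ 2 ∂(ν n)
  set V := ∫ r, pim (B n) (m n) r ^ 2 * ζ r ^ 2 ∂(ν n)
  set I := ∫ r, |pim (B n) (m n) r| ∂(ν n)
  set L' := lam ((1 + h) * B n)
  set L := lam (B n)
  have e1 : (1 + h) * (L' / ((1 + h) * B n)) = L' / B n := by
    have : 1 + h ≠ 0 := by linarith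
    field_simp
  rw [e1]
  have e2 : (L' / B n - L / B n) * Z - (Kz ^ 2 + τ n) / B n - 16 * (I / B n) - 16 / B n = (L' * Z - L * Z - Kz ^ 2 - τ n - 16 * I - 16) / B n := by ring
  rw [e2, ← mul_div_assoc]
  refine div_le_div_of_nonneg_right ?_ B0.le
  linarith

theorem Sq.vir (S : Sq lam θ B K τ m ν) (z : Zc Kz ω ζ ζ')
    (hW : Tendsto (fun n => ∫ r, ω r ^ 2 * (1 + pim (B n) (m n) r ^ 2) ∂(ν n)) atTop (𝓝 0)) {h : ℝ} (h0 : 0 < h) (h1 : h < 1) :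
    ∀ᶠ n in atTop, |(∫ r, pim (B n) (m n) r ^ 2 * ζ r ^ 2 ∂(ν n)) / B n - θ / 2| ≤ 2 * h := by
  have t0 := S.th0
  have t1 := S.th1
  filter_upwards [S.vir1 z hW (h := h) (ε := h ^ 2) (abs_lt.2 ⟨by linarith, h1⟩) (by positivity),
    S.vir1 z hW (h := -h) (ε := h ^ 2) (abs_lt.2 ⟨by linarith, by linarith⟩) (by positivity)] with n a b
  set v := (∫ r, pim (B n) (m n) r ^ 2 * ζ r ^ 2 ∂(ν n)) / B n
  have a' : θ - h ≤ (2 + h) * v := by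
    have : h * (θ - h) ≤ h * ((2 + h) * v) := by linarith
    exact le_of_mul_le_mul_left this h0
  have b' : (2 - h) * v ≤ θ + h := by
    have : h * ((2 - h) * v) ≤ h * (θ + h) := by linarith
    exact le_of_mul_le_mul_left this h0
  rw [abs_le]
  constructor
  · by_contra hc
    push Not at hc
    nlinarith
  · by_contra hc
    push Not at hc
    nlinarith
end

section
theorem abs_le_ks {k a C : ℝ} (hk : |k| = 1) (h : |a| ≤ C) : k * a ≤ C := by
  refine (le_abs_self _).trans ?_
  rw [abs_mul, hk, one_mul]; exact h

set_option maxHeartbeats 400000 in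
theorem jptB {K y r k w w' x q : ℝ} (hK : 1 ≤ K) (y0 : 0 < y) (y1 : y ≤ 1) (r0 : 1/4 ≤ r) (r1 : r ≤ 1)
    (hk : |k| = 1) (hw : |w| ≤ K) (hw' : |w'| ≤ K) (hxw : |x * w'| ≤ K) (hq : y * q = - x) :
    (-(k * (w' * (1 + y * x / r)))) ^ 2 + (-2 * k * q / r + 1 / r ^ 2) * (1 + k * y * w) ^ 2 ≤
      1 + w' ^ 2 + 4 * w * x - 2 * k * q / r + 100 * K ^ 2 * (y * (1 + x ^ 2) + (1 - r ^ 2) * (1 + |x|)) := by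
  have rp : 0 < r := by linarith
  set u := 1 / r with hu
  have u1 : 1 ≤ u := by rw [hu, le_div_iff₀ rp]; linarith
  have u4 : u ≤ 4 := by rw [hu, div_le_iff₀ rp]; linarith
  have ur : u * r = 1 := by rw [hu]; field_simp
  have hr2 : 0 ≤ 1 - r ^ 2 := by nlinarith only [r0, r1]
  have ud2 : u ^ 2 - 1 ≤ 16 * (1 - r ^ 2) := by
    have e : u ^ 2 - 1 = u ^ 2 * (1 - r ^ 2) := by
      have : u ^ 2 * r ^ 2 = 1 := by rw [← mul_pow, ur, one_pow]
      linarith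
    rw [e]
    exact mul_le_mul_of_nonneg_right (by nlinarith only [u1, u4]) hr2
  have ud : u - 1 ≤ 4 * (1 - r ^ 2) := by
    have e : u - 1 = u * (1 - r) := by linarith
    rw [e]
    exact mul_le_mul u4 (by nlinarith only [r0, r1]) (by linarith) (by norm_num)
  have k2 : k ^ 2 = 1 := by rw [← sq_abs, hk, one_pow]
  have e : (-(k * (w' * (1 + y * x / r)))) ^ 2 + (-2 * k * q / r + 1 / r ^ 2) * (1 + k * y * w) ^ 2 =
      w' ^ 2 + 2 * (y * u * ((x * w') * w')) + (y * u * (x * w')) ^ 2 + u ^ 2 + k * (2 * u ^ 2 * y * w) + u ^ 2 * y ^ 2 * w ^ 2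
        - 2 * k * q / r + 4 * w * x + 4 * (w * x) * (u - 1) + k * (2 * x * y * w ^ 2 * u) := by
    have e1 : (-(k * (w' * (1 + y * x / r)))) ^ 2 = k ^ 2 * (w' * (1 + y * x * u)) ^ 2 := by rw [hu]; ring
    have e2 : (-2 * k * q / r + 1 / r ^ 2) * (1 + k * y * w) ^ 2 = -2 * k * q * u + u ^ 2 * (1 + 2 * k * y * w + k ^ 2 * y ^ 2 * w ^ 2)
      + (-4 * k ^ 2 * (y * q) * w * u - 2 * k ^ 2 * k * (y * q) * y * w ^ 2 * u) := by rw [hu]; ring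
    rw [e1, e2, k2, hq, hu]; ring
  have w2 : w ^ 2 ≤ K ^ 2 := by rw [← sq_abs]; gcongr
  have b1 : y * u * ((x * w') * w') ≤ 4 * y * K ^ 2 := by
    have : (x * w') * w' ≤ K ^ 2 := by
      refine (le_abs_self _).trans ?_
      rw [abs_mul, sq]; gcongr
    calc y * u * ((x * w') * w') ≤ y * u * K ^ 2 := by gcongr
      _ ≤ y * 4 * K ^ 2 := by gcongr
      _ = _ := by ring
  have b2 : (y * u * (x * w')) ^ 2 ≤ 16 * y * K ^ 2 := by
    have : (x * w') ^ 2 ≤ K ^ 2 := by rw [← sq_abs]; gcongr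
    calc (y * u * (x * w')) ^ 2 = y * y * u ^ 2 * (x * w') ^ 2 := by ring
      _ ≤ y * 1 * 4 ^ 2 * K ^ 2 := by gcongr
      _ = _ := by ring
  have b3 : k * (2 * u ^ 2 * y * w) ≤ 32 * y * K := by
    refine abs_le_ks hk ?_
    rw [abs_mul, abs_of_nonneg (by positivity)]
    calc 2 * u ^ 2 * y * |w| ≤ 2 * 4 ^ 2 * y * K := by gcongr
      _ = _ := by ring
  have b4 : u ^ 2 * y ^ 2 * w ^ 2 ≤ 16 * y * K ^ 2 := by
    calc u ^ 2 * y ^ 2 * w ^ 2 = u ^ 2 * (y * y) * w ^ 2 := by ring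
      _ ≤ 4 ^ 2 * (y * 1) * K ^ 2 := by gcongr
      _ = _ := by ring
  have b5 : 4 * (w * x) * (u - 1) ≤ 16 * K * ((1 - r ^ 2) * |x|) := by
    have : w * x ≤ K * |x| := by
      refine (le_abs_self _).trans ?_
      rw [abs_mul]; gcongr
    calc 4 * (w * x) * (u - 1) ≤ 4 * (K * |x|) * (u - 1) := by
          have : 0 ≤ u - 1 := by linarith
          gcongr
      _ ≤ 4 * (K * |x|) * (4 * (1 - r ^ 2)) := by gcongr
      _ = _ := by ring
  have b6 : k * (2 * x * y * w ^ 2 * u) ≤ 4 * K ^ 2 * (y * (1 + x ^ 2)) := by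
    refine abs_le_ks hk ?_
    have : |2 * x * y * w ^ 2 * u| = 2 * |x| * y * w ^ 2 * u := by
      rw [abs_mul, abs_mul, abs_mul, abs_mul, abs_of_nonneg (sq_nonneg w), abs_of_pos y0, abs_of_nonneg (by linarith : 0 ≤ u), abs_of_pos (two_pos)]
    rw [this]
    have hx : 2 * |x| ≤ 1 + x ^ 2 := by rw [← sq_abs]; nlinarith only [sq_nonneg (|x| - 1)]
    calc 2 * |x| * y * w ^ 2 * u ≤ (1 + x ^ 2) * y * K ^ 2 * 4 := by gcongr
      _ = _ := by ring
  rw [e]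
  have hKK : K ≤ K ^ 2 := by nlinarith only [hK]
  have c1 : 32 * y * K ≤ 32 * y * K ^ 2 := by gcongr
  have c2 : 16 * K * ((1 - r ^ 2) * |x|) ≤ 16 * K ^ 2 * ((1 - r ^ 2) * |x|) := by gcongr
  have c3 : 16 * (1 - r ^ 2) ≤ 16 * K ^ 2 * (1 - r ^ 2) := by
    have : 1 ≤ K ^ 2 := by linarith
    have := mul_le_mul_of_nonneg_right this hr2
    linarith
  have p1 : 0 ≤ K ^ 2 * (1 - r ^ 2) := by positivity
  have p2 : 0 ≤ K ^ 2 * ((1 - r ^ 2) * |x|) := by positivity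
  have p3 : 0 ≤ y * K ^ 2 := by positivity
  have p4 : 0 ≤ K ^ 2 * (y * x ^ 2) := by positivity
  linarith

theorem jptA {K y r k w w' x q z z' : ℝ} (hK : 1 ≤ K) (y0 : 0 < y) (y1 : y ≤ 1) (r0 : 1/8 ≤ r)
    (hk : |k| = 1) (hw : |w| ≤ K) (hw' : |w'| ≤ K) (hxw : |x * w'| ≤ K) (hz : |z| ≤ 1) (hz' : |z'| ≤ K) :
    |z * (1 + k * y * w)| ≤ 2 * K ∧ |z' * (1 + k * y * w) - k * (z * (w' * (1 + y * x / r)))| ≤ 11 * K ^ 2 := by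
  have rp : 0 < r := by linarith
  have a1 : |1 + k * y * w| ≤ 2 * K := by
    refine (abs_add_le _ _).trans ?_
    rw [abs_one, abs_mul, abs_mul, hk, abs_of_pos y0]
    have : 1 * y * |w| ≤ 1 * 1 * K := by gcongr
    linarith
  have a2 : |w' * (1 + y * x / r)| ≤ 9 * K := by
    have e : w' * (1 + y * x / r) = w' + y / r * (x * w') := by ring
    rw [e]
    refine (abs_add_le _ _).trans ?_
    rw [abs_mul, abs_of_nonneg (by positivity : 0 ≤ y / r)]
    have : y / r ≤ 8 := by rw [div_le_iff₀ rp]; linarith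
    have : y / r * |x * w'| ≤ 8 * K := by gcongr
    linarith
  constructor
  · rw [abs_mul]
    have : |z| * |1 + k * y * w| ≤ 1 * (2 * K) := by gcongr
    linarith
  · refine (abs_sub _ _).trans ?_
    rw [abs_mul, abs_mul k, abs_mul z, hk]
    have c1 : |z'| * |1 + k * y * w| ≤ K * (2 * K) := by gcongr
    have c2 : |z| * |w' * (1 + y * x / r)| ≤ 1 * (9 * K) := by gcongr
    nlinarith only [c1, c2, hK]

theorem jptA2 {K r k w w' x q z P D : ℝ} (hK : 1 ≤ K) (r0 : 1/8 ≤ r)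
    (hk : |k| = 1) (hw : |w| ≤ K) (hxq : |x| ≤ |q|) (hz : z ^ 2 ≤ 1) (hP : |P| ≤ 2 * K) (hD : |D| ≤ 11 * K ^ 2) :
    D ^ 2 + (-2 * k * q / r + 1 / r ^ 2) * P ^ 2 ≤ 1 + w' ^ 2 + 4 * w * x - 2 * k * (z ^ 2 * (q / r)) + 1000 * K ^ 4 * (1 + q ^ 2) := by
  have rp : 0 < r := by linarith
  set u := 1 / r with hu
  have u0 : 0 < u := by positivity
  have u8 : u ≤ 8 := by rw [hu, div_le_iff₀ rp]; linarith
  have e1 : -2 * k * q / r + 1 / r ^ 2 = -2 * (k * (q * u)) + u ^ 2 := by rw [hu]; ring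
  have e2 : 2 * k * (z ^ 2 * (q / r)) = 2 * (k * (z ^ 2 * (q * u))) := by rw [hu]; ring
  rw [e1, e2]
  have q1 : |q * u| ≤ 8 * |q| := by rw [abs_mul, abs_of_pos u0]; nlinarith only [abs_nonneg q, u8]
  have q2 : 2 * |q| ≤ 1 + q ^ 2 := by rw [← sq_abs]; nlinarith only [sq_nonneg (|q| - 1)]
  have b1 : (-k) * (q * u) ≤ 8 * |q| := abs_le_ks (by rw [abs_neg, hk]) q1
  have b2 : k * (z ^ 2 * (q * u)) ≤ 8 * |q| := by
    refine abs_le_ks hk ?_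
    rw [abs_mul, abs_of_nonneg (sq_nonneg z)]
    nlinarith only [abs_nonneg (q * u), hz, q1]
  have b3 : - (w * x) ≤ K * |q| := by
    refine (neg_le_abs _).trans ?_
    rw [abs_mul]; gcongr
  have P2 : P ^ 2 ≤ 4 * K ^ 2 := by
    have : |P| ^ 2 ≤ (2 * K) ^ 2 := by gcongr
    rw [sq_abs] at this; linarith
  have D2 : D ^ 2 ≤ 121 * K ^ 4 := by
    have : |D| ^ 2 ≤ (11 * K ^ 2) ^ 2 := by gcongr
    rw [sq_abs] at this; linarith
  have u2 : u ^ 2 ≤ 64 := by nlinarith only [u0, u8]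
  have b4 : (-2 * (k * (q * u)) + u ^ 2) * P ^ 2 ≤ (16 * |q| + 64) * (4 * K ^ 2) := by
    have : -2 * (k * (q * u)) + u ^ 2 ≤ 16 * |q| + 64 := by linarith
    calc _ ≤ (16 * |q| + 64) * P ^ 2 := by gcongr
      _ ≤ _ := by gcongr
  have k4 : K ^ 2 ≤ K ^ 4 := by gcongr; norm_num
  have k0 : K ≤ K ^ 2 := by nlinarith only [hK]
  have k3 : K ≤ K ^ 4 := by linarith
  have k1 : 1 ≤ K ^ 4 := by linarith
  have c1 : K * |q| ≤ K ^ 4 * (1 + q ^ 2) := by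
    have : K * |q| ≤ K ^ 4 * |q| := by gcongr
    have h2 : K ^ 4 * |q| ≤ K ^ 4 * (1 + q ^ 2) := by
      have := abs_nonneg q
      exact mul_le_mul_of_nonneg_left (by linarith) (by positivity)
    linarith
  have c2 : (16 * |q| + 64) * (4 * K ^ 2) ≤ 300 * (K ^ 4 * (1 + q ^ 2)) := by
    have : (16 * |q| + 64) * (4 * K ^ 2) ≤ (8 * (1 + q ^ 2) + 64 * (1 + q ^ 2)) * (4 * K ^ 4) := by
      have : 16 * |q| + 64 ≤ 8 * (1 + q ^ 2) + 64 * (1 + q ^ 2) := by linarith [sq_nonneg q]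
      gcongr
    have : 0 ≤ K ^ 4 * (1 + q ^ 2) := by positivity
    linarith
  have c3 : K ^ 4 ≤ K ^ 4 * (1 + q ^ 2) := by linarith [mul_nonneg (show 0 ≤ K ^ 4 by positivity) (sq_nonneg q)]
  have c4 : 1 + q ^ 2 ≤ K ^ 4 * (1 + q ^ 2) := le_mul_of_one_le_left (by positivity) k1
  have := sq_nonneg w'
  linarith

theorem xxm_deriv {B r : ℝ} {m : ℤ} (hB : 0 < B) (hr : r ≠ 0) :
    HasDerivAt (xxm B m) (- √B * (1 + 1 / √B * xxm B m r / r)) r := by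
  unfold xxm
  have h := ((hasDerivAt_id r).sub (((hasDerivAt_const r (max (2 * (m:ℝ) / B) 0)).div (hasDerivAt_id r) hr))).const_mul (-(√B / 2))
  have hs : 0 < √B := sqrt_pos.2 hB
  refine h.congr_deriv ?_
  simp only [id]
  field_simp
  ring

theorem phiCut {B Kz K k : ℝ} {m : ℤ} {ω ζ ζ' w w' : ℝ → ℝ} (z : Zc Kz ω ζ ζ') (hB : 1 ≤ B) (hK : Kz ≤ K) (hk : |k| = 1)
    (wd : ∀ x, HasDerivAt w (w' x) x) (wc : Continuous w') (wb : ∀ x, |w x| ≤ K) (wb' : ∀ x, |w' x| ≤ K ∧ |x * w' x| ≤ K) :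
    Cut (11 * K ^ 2) (fun r => ζ r * (1 + k * (1 / √B) * w (xxm B m r)))
      (fun r => ζ' r * (1 + k * (1 / √B) * w (xxm B m r)) - k * (ζ r * (w' (xxm B m r) * (1 + 1 / √B * xxm B m r / r)))) := by
  have B0 : 0 < B := by linarith
  have hs : 0 < √B := sqrt_pos.2 B0
  have K1 : 1 ≤ K := z.k1.trans hK
  have s1 : 1 ≤ √B := by rw [one_le_sqrt]; exact hB
  have y1 : 1 / √B ≤ 1 := by rw [div_le_one hs]; exact s1
  have z0' : ∀ r, r < 1/8 → ζ' r = 0 := by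
    intro r hr
    have : HasDerivAt ζ 0 r := by
      refine (hasDerivAt_const r (0:ℝ)).congr_of_eventuallyEq ?_
      filter_upwards [gt_mem_nhds hr] with s hs using z.z0 s (le_of_lt hs)
    exact (z.cz.1 r).unique this
  have cw : Continuous w := continuous_iff_continuousAt.2 fun x => (wd x).continuousAt
  have cz := z.cz.c
  have cz' := z.cz.2.1
  have cx : ∀ r, 0 < r → ContinuousAt (xxm B m) r := fun r hr => (xxm_deriv B0 hr.ne').continuousAt
  refine ⟨fun r => ?_, ?_, fun r hr => ?_, fun r => ?_⟩
  · rcases lt_or_ge r (1/8) with hr | hr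
    · dsimp only; rw [z0' r hr, z.z0 r hr.le]
      simp only [zero_mul, mul_zero, sub_zero]
      refine (hasDerivAt_const r (0:ℝ)).congr_of_eventuallyEq ?_
      filter_upwards [gt_mem_nhds hr] with s hs
      rw [z.z0 s (le_of_lt hs), zero_mul]
    · have rp : 0 < r := by linarith
      have h := (z.cz.1 r).mul ((((wd (xxm B m r)).comp r (xxm_deriv B0 rp.ne')).const_mul (k * (1 / √B))).const_add 1)
      refine h.congr_deriv ?_
      simp only [Function.comp]
      field_simp
      ring
  · rw [continuous_iff_continuousAt]
    intro r
    rcases lt_or_ge r (1/8) with hr | hr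
    · refine (continuousAt_const (y := (0:ℝ))).congr ?_
      filter_upwards [gt_mem_nhds hr] with s hs
      rw [z.z0 s (le_of_lt hs), z0' s hs]; simp
    · have rp : 0 < r := by linarith
      have c1 := cx r rp
      have c2 : ContinuousAt (fun r => w (xxm B m r)) r := ContinuousAt.comp (f := xxm B m) (g := w) cw.continuousAt c1
      have c3 : ContinuousAt (fun r => w' (xxm B m r)) r := ContinuousAt.comp (f := xxm B m) (g := w') wc.continuousAt c1
      have c4 : ContinuousAt (fun r => 1 / √B * xxm B m r / r) r := (continuousAt_const.mul c1).div continuousAt_id rp.ne'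
      exact (cz'.continuousAt.mul (continuousAt_const.add (continuousAt_const.mul c2))).sub
        (continuousAt_const.mul (cz.continuousAt.mul (c3.mul (continuousAt_const.add c4))))
  · dsimp only
    rw [z.z0 r hr, z.z0 _ le_rfl]; simp
  · rcases lt_or_ge r (1/8) with hr | hr
    · dsimp only; rw [z.z0 r hr.le, z0' r hr]; simp; positivity
    · have h := jptA (q := 0) (k := k) (x := xxm B m r) (w := w (xxm B m r)) (w' := w' (xxm B m r)) (z := ζ r) (z' := ζ' r) K1
        (by positivity : 0 < 1 / √B) y1 hr hk (wb _) (wb' _).1 (wb' _).2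
        (by rw [abs_of_nonneg (z.z01 r).1]; exact (z.z01 r).2) ((z.cz.2.2.2 r).2.trans hK)
      exact ⟨h.1.trans (by nlinarith), h.2⟩
end

section
section
variable {lam : ℝ → ℝ} {B K τ : ℝ} {m : ℤ} {ν : Measure ℝ}
theorem xxm_sq1 {B r : ℝ} {m : ℤ} (hB : 1 ≤ B) (hr : 0 < r) : xxm B m r ^ 2 ≤ pim B m r ^ 2 := by
  have := xxm_sq (m := m) (by linarith : 0 < B) hr
  nlinarith [sq_nonneg (xxm B m r)]

theorem xxm_abs1 {B r : ℝ} {m : ℤ} (hB : 1 ≤ B) (hr : 0 < r) : |xxm B m r| ≤ 1 + pim B m r ^ 2 := by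
  have := xxm_sq1 (m := m) hB hr
  rw [← sq_abs (xxm B m r)] at this
  nlinarith [sq_nonneg (|xxm B m r| - 1)]

theorem GoodNu.ix2 (g : GoodNu lam B K τ m ν) (hB : 1 ≤ B) : Integrable (fun r => xxm B m r ^ 2) ν := by
  have := xxm_meas B m
  refine g.integ (C := 1) (by fun_prop) fun r h0 _ => ?_
  rw [abs_of_nonneg (sq_nonneg _)]
  linarith [xxm_sq1 (m := m) hB h0]

theorem GoodNu.ixe (g : GoodNu lam B K τ m ν) (hB : 1 ≤ B) : Integrable (fun r => (1 - r ^ 2) * |xxm B m r|) ν := by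
  have := xxm_meas B m
  refine g.integ (C := 1) (by fun_prop) fun r h0 h1 => ?_
  have r2 : 0 ≤ 1 - r ^ 2 := by nlinarith
  rw [abs_of_nonneg (by positivity)]
  nlinarith [xxm_abs1 (m := m) hB h0, abs_nonneg (xxm B m r), sq_nonneg r]
end

variable {lam : ℝ → ℝ} {θ : ℝ} {B K τ : ℕ → ℝ} {m : ℕ → ℤ} {ν : ℕ → Measure ℝ}
variable {Kz : ℝ} {ω ζ ζ' : ℝ → ℝ}

theorem Sq.x2 (S : Sq lam θ B K τ m ν) : ∀ᶠ n in atTop, ∫ r, xxm (B n) (m n) r ^ 2 ∂(ν n) ≤ 2 := by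
  filter_upwards [S.V] with n hV
  have B0 := S.B0 n
  have g := S.good n
  have h : ∫ r, B n * xxm (B n) (m n) r ^ 2 ∂(ν n) ≤ ∫ r, pim (B n) (m n) r ^ 2 ∂(ν n) :=
    g.mono ((g.ix2 (S.hB1 n)).const_mul _) g.int fun r h0 _ => xxm_sq B0 h0
  rw [integral_const_mul] at h
  have := h.trans hV
  rw [mul_comm] at this
  exact le_of_mul_le_mul_right this B0

theorem Sq.xe (S : Sq lam θ B K τ m ν) : Tendsto (fun n => ∫ r, (1 - r ^ 2) * |xxm (B n) (m n) r| ∂(ν n)) atTop (𝓝 0) := by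
  have l : Tendsto (fun n => 3/2 * √((∫ r, (1 - r ^ 2) ∂(ν n)) + 1 / √(B n))) atTop (𝓝 0) := by
    have := ((S.e.add S.y).sqrt).const_mul (3/2)
    simpa using this
  refine squeeze_zero' ?_ ?_ l
  · refine Eventually.of_forall fun n => integral_nonneg_of_ae ?_
    filter_upwards [(S.good n).supp] with r hr
    have : 0 ≤ 1 - r ^ 2 := by nlinarith [hr.1, hr.2]
    simp only [Pi.zero_apply]; positivity
  · filter_upwards [S.x2] with n hx
    have g := S.good n
    have hB := S.hB1 n
    have e0 := g.e0
    have hs : 0 < √(B n) := sqrt_pos.2 (S.B0 n)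
    set e := ∫ r, (1 - r ^ 2) ∂(ν n) with he
    set t := √(e + 1 / √(B n)) with ht
    have y0 : 0 < 1 / √(B n) := by positivity
    have t0 : 0 < t := sqrt_pos.2 (by linarith)
    have t2 : t ^ 2 = e + 1 / √(B n) := sq_sqrt (by linarith)
    have h : ∫ r, (1 - r ^ 2) * |xxm (B n) (m n) r| ∂(ν n) ≤ ∫ r, (1 / (2 * t) * (1 - r ^ 2) + t / 2 * xxm (B n) (m n) r ^ 2) ∂(ν n) := by
      refine g.mono (g.ixe hB) ((g.ir2.const_mul _).add ((g.ix2 hB).const_mul _)) fun r h0 h1 => ?_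
      have a0 : 0 ≤ 1 - r ^ 2 := by nlinarith only [h0, h1]
      have a1 : (1 - r ^ 2) ^ 2 ≤ 1 - r ^ 2 := by nlinarith only [a0, sq_nonneg r]
      rw [← sq_abs (xxm (B n) (m n) r)]
      set X := |xxm (B n) (m n) r|
      have e1 : 1 / (2 * t) * (1 - r ^ 2) ≥ 1 / (2 * t) * (1 - r ^ 2) ^ 2 := by
        have : 0 ≤ 1 / (2 * t) := by positivity
        exact mul_le_mul_of_nonneg_left a1 this
      have e2 : 1 / (2 * t) * (1 - r ^ 2) ^ 2 + t / 2 * X ^ 2 - (1 - r ^ 2) * X = ((1 - r ^ 2) - t * X) ^ 2 / (2 * t) := by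
        field_simp; ring
      have e3 : 0 ≤ ((1 - r ^ 2) - t * X) ^ 2 / (2 * t) := by positivity
      linarith
    rw [integral_add (g.ir2.const_mul _) ((g.ix2 hB).const_mul _), integral_const_mul, integral_const_mul, ← he] at h
    have h2 : 1 / (2 * t) * e ≤ t / 2 := by
      rw [div_mul_eq_mul_div, div_le_iff₀ (by positivity)]; nlinarith only [t2, y0]
    have h3 : t / 2 * ∫ r, xxm (B n) (m n) r ^ 2 ∂(ν n) ≤ t / 2 * 2 := by gcongr
    linarith

def Er (B : ℝ) (m : ℤ) (ω : ℝ → ℝ) (r : ℝ) : ℝ := (1 / √B) * (1 + xxm B m r ^ 2) + (1 - r ^ 2) * (1 + |xxm B m r|) + ω r ^ 2 * (1 + pim B m r ^ 2)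

theorem Sq.Er (S : Sq lam θ B K τ m ν) (z : Zc Kz ω ζ ζ')
    (hW : Tendsto (fun n => ∫ r, ω r ^ 2 * (1 + pim (B n) (m n) r ^ 2) ∂(ν n)) atTop (𝓝 0)) :
    (∀ n, Integrable (Er (B n) (m n) ω) (ν n)) ∧ ∀ ε > 0, ∀ᶠ n in atTop, ∫ r, Er (B n) (m n) ω r ∂(ν n) ≤ ε := by
  have i1 : ∀ n, Integrable (fun r => (1 / √(B n)) * (1 + xxm (B n) (m n) r ^ 2)) (ν n) := fun n => by
    have := (S.good n).prob
    have i0 : Integrable (fun r => 1 + xxm (B n) (m n) r ^ 2) (ν n) := (integrable_const _).add ((S.good n).ix2 (S.hB1 n))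
    exact i0.const_mul _
  have i2 : ∀ n, Integrable (fun r => (1 - r ^ 2) * (1 + |xxm (B n) (m n) r|)) (ν n) := fun n => by
    have : (fun r => (1 - r ^ 2) * (1 + |xxm (B n) (m n) r|)) = fun r => (1 - r ^ 2) + (1 - r ^ 2) * |xxm (B n) (m n) r| := by ext; ring
    rw [this]
    exact (S.good n).ir2.add ((S.good n).ixe (S.hB1 n))
  have i3 := S.iW z
  have i12 : ∀ n, Integrable (fun r => (1 / √(B n)) * (1 + xxm (B n) (m n) r ^ 2) + (1 - r ^ 2) * (1 + |xxm (B n) (m n) r|)) (ν n) :=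
    fun n => (i1 n).add (i2 n)
  refine ⟨fun n => (i12 n).add (i3 n), fun ε hε => ?_⟩
  have l : Tendsto (fun n => (1 / √(B n)) * 3 + ((∫ r, (1 - r ^ 2) ∂(ν n)) + ∫ r, (1 - r ^ 2) * |xxm (B n) (m n) r| ∂(ν n)) + 
      ∫ r, ω r ^ 2 * (1 + pim (B n) (m n) r ^ 2) ∂(ν n)) atTop (𝓝 0) := by
    simpa using ((S.y.mul_const 3).add (S.e.add S.xe)).add hW
  filter_upwards [l.eventually (gt_mem_nhds hε), S.x2] with n hn hx
  refine le_trans ?_ hn.le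
  have := (S.good n).prob
  unfold _root_.Er
  rw [integral_add (i12 n) (i3 n), integral_add (i1 n) (i2 n), integral_const_mul,
    integral_add (integrable_const _) ((S.good n).ix2 (S.hB1 n))]
  have e : ∫ r, (1 - r ^ 2) * (1 + |xxm (B n) (m n) r|) ∂(ν n) = (∫ r, (1 - r ^ 2) ∂(ν n)) + ∫ r, (1 - r ^ 2) * |xxm (B n) (m n) r| ∂(ν n) := by
    rw [← integral_add (S.good n).ir2 ((S.good n).ixe (S.hB1 n))]; congr 1; ext; ring
  rw [e]
  simp only [integral_const, probReal_univ, smul_eq_mul, one_mul]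
  have y0 : 0 ≤ 1 / √(B n) := by positivity
  have : (1 / √(B n)) * (1 + ∫ r, xxm (B n) (m n) r ^ 2 ∂(ν n)) ≤ (1 / √(B n)) * 3 := mul_le_mul_of_nonneg_left (by linarith) y0
  linarith

variable {w w' : ℝ → ℝ} {Kw : ℝ}

theorem Mb1 {K x a b : ℝ} (hK : 1 ≤ K) (ha : |a| ≤ K) (hb : |b| ≤ K) : |1 + b ^ 2 + 4 * a * x| ≤ 6 * K ^ 2 * (1 + |x|) := by
  have : |1 + b ^ 2 + 4 * a * x| ≤ 1 + b ^ 2 + 4 * K * |x| := by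
    refine (abs_add_le _ _).trans ?_
    rw [abs_of_nonneg (by positivity : 0 ≤ 1 + b ^ 2), abs_mul, abs_mul, abs_of_pos (by norm_num : (0:ℝ) < 4)]
    gcongr
  have b2 : b ^ 2 ≤ K ^ 2 := by rw [← sq_abs]; gcongr
  have k2 : K ≤ K ^ 2 := by nlinarith
  nlinarith [abs_nonneg x, mul_le_mul_of_nonneg_right k2 (abs_nonneg x)]

theorem Sq.iM (S : Sq lam θ B K τ m ν) (hKw : 1 ≤ Kw) (cw : Continuous w) (wc : Continuous w') (wb : ∀ x, |w x| ≤ Kw)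
    (wb' : ∀ x, |w' x| ≤ Kw ∧ |x * w' x| ≤ Kw) (n : ℕ) :
    Integrable (fun r => 1 + w' (xxm (B n) (m n) r) ^ 2 + 4 * w (xxm (B n) (m n) r) * xxm (B n) (m n) r) (ν n) := by
  have := xxm_meas (B n) (m n)
  have := cw.measurable
  have := wc.measurable
  refine (S.good n).integ (C := 12 * Kw ^ 2) (by fun_prop) fun r h0 _ => ?_
  have h := Mb1 (x := xxm (B n) (m n) r) hKw (wb (xxm (B n) (m n) r)) (wb' (xxm (B n) (m n) r)).1
  have h2 := xxm_abs1 (m := m n) (S.hB1 n) h0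
  refine h.trans ?_
  have : 6 * Kw ^ 2 * (1 + |xxm (B n) (m n) r|) ≤ 6 * Kw ^ 2 * (1 + (1 + pim (B n) (m n) r ^ 2)) := by gcongr
  nlinarith [sq_nonneg (pim (B n) (m n) r), mul_nonneg (sq_nonneg Kw) (sq_nonneg (pim (B n) (m n) r))]

theorem Sq.Mle (S : Sq lam θ B K τ m ν) (hKw : 1 ≤ Kw) (cw : Continuous w) (wc : Continuous w') (wb : ∀ x, |w x| ≤ Kw)
    (wb' : ∀ x, |w' x| ≤ Kw ∧ |x * w' x| ≤ Kw) {s c KH : ℝ} {H H' : ℝ → ℝ} (hs : 0 < s) (hH : AdmK KH H H')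
    (hG : ∀ x, θ + s * (1 + w' x ^ 2 + 4 * w x * x - c) ≤ x ^ 2 - H' x - H x ^ 2) {ε : ℝ} (hε : 0 < ε) :
    ∀ᶠ n in atTop, ∫ r, (1 + w' (xxm (B n) (m n) r) ^ 2 + 4 * w (xxm (B n) (m n) r) * xxm (B n) (m n) r) ∂(ν n) ≤ c + ε := by
  set C := |θ| + s * (6 * Kw ^ 2 + |c|) with hC
  have Gb : ∀ x, |θ + s * (1 + w' x ^ 2 + 4 * w x * x - c)| ≤ C * (1 + |x|) := by
    intro x
    have h := Mb1 (x := x) hKw (wb x) (wb' x).1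
    have h2 : |1 + w' x ^ 2 + 4 * w x * x - c| ≤ (6 * Kw ^ 2 + |c|) * (1 + |x|) := by
      refine (abs_sub _ _).trans ?_
      nlinarith only [h, mul_nonneg (abs_nonneg c) (abs_nonneg x)]
    refine (abs_add_le _ _).trans ?_
    rw [abs_mul, abs_of_pos hs, hC]
    have h3 := mul_le_mul_of_nonneg_left h2 hs.le
    linarith only [h3, mul_nonneg (abs_nonneg θ) (abs_nonneg x)]
  have C0 : 0 ≤ C := by positivity
  have l0 : Tendsto (fun n => 1 + 10 * (KH + 1) * (1 / √(B n))) atTop (𝓝 1) := by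
    simpa using (S.y.const_mul (10 * (KH + 1))).const_add 1
  have l : Tendsto (fun n => (1 + 10 * (KH + 1) * (1 / √(B n))) * (lam (B n) / B n + τ n / B n) + 10 * (KH + 1) * (1 / √(B n)) +
      (C + 1) * ((∫ r, (1 - r ^ 2) ∂(ν n)) + ∫ r, (1 - r ^ 2) * |xxm (B n) (m n) r| ∂(ν n))) atTop (𝓝 θ) := by
    simpa using ((l0.mul (S.a.add (S.tB S.hτ))).add (S.y.const_mul (10 * (KH + 1)))).add ((S.e.add S.xe).const_mul (C + 1))
  filter_upwards [l.eventually (gt_mem_nhds (show θ < θ + s * ε by linarith only [mul_pos hs hε]))] with n hn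
  have g := S.good n
  have := g.prob
  have B0 := S.B0 n
  have hB := S.hB1 n
  have sb : 0 < √(B n) := sqrt_pos.2 B0
  have iM := S.iM hKw cw wc wb wb' n
  have h := g.star hB hH (G := fun x => θ + s * (1 + w' x ^ 2 + 4 * w x * x - c)) (by fun_prop) (CG := 2 * C) (by positivity)
    (fun x => (Gb x).trans (by
      rw [← sq_abs x]
      have : 1 + |x| ≤ 2 * (1 + |x| ^ 2) := by nlinarith only [sq_nonneg (|x| - 1)]
      have := mul_le_mul_of_nonneg_left this C0
      linarith)) hG (Cut.one.mono (S.hK1 n))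
  simp only [one_pow, mul_one, ne_eq, OfNat.ofNat_ne_zero, not_false_eq_true, zero_pow, integral_zero, add_zero, integral_const, probReal_univ, smul_eq_mul, one_mul] at h
  set M := ∫ r, (1 + w' (xxm (B n) (m n) r) ^ 2 + 4 * w (xxm (B n) (m n) r) * xxm (B n) (m n) r) ∂(ν n) with hM
  set Q := ∫ r, (1 - r ^ 2 + r ^ 2 * (θ + s * (1 + w' (xxm (B n) (m n) r) ^ 2 + 4 * w (xxm (B n) (m n) r) * xxm (B n) (m n) r - c))) ∂(ν n) with hQ
  have cm := cw.measurable
  have cm' := wc.measurable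
  have xm := xxm_meas (B n) (m n)
  have j1 : Integrable (fun r => (θ - s * c) + s * (1 + w' (xxm (B n) (m n) r) ^ 2 + 4 * w (xxm (B n) (m n) r) * xxm (B n) (m n) r)) (ν n) :=
    (integrable_const _).add (iM.const_mul s)
  have j2 : Integrable (fun r => (1 - r ^ 2) + (1 - r ^ 2) * |xxm (B n) (m n) r|) (ν n) := g.ir2.add (g.ixe hB)
  have hlow : ∫ r, ((θ - s * c) + s * (1 + w' (xxm (B n) (m n) r) ^ 2 + 4 * w (xxm (B n) (m n) r) * xxm (B n) (m n) r)
      - (C + 1) * ((1 - r ^ 2) + (1 - r ^ 2) * |xxm (B n) (m n) r|)) ∂(ν n) ≤ Q := by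
    refine g.mono (j1.sub (j2.const_mul _)) ?_ fun r h0 h1 => ?_
    · refine g.integ (C := 1 + 2 * C) (by fun_prop) fun r h0 h1 => ?_
      have hG := Gb (xxm (B n) (m n) r)
      have hx := xxm_abs1 (m := m n) hB h0
      have r2 : r ^ 2 ≤ 1 := by nlinarith only [h0, h1]
      refine (abs_add_le _ _).trans ?_
      rw [abs_of_nonneg (by linarith), abs_mul, abs_of_nonneg (sq_nonneg r)]
      set q2 := pim (B n) (m n) r ^ 2
      have q0 : 0 ≤ q2 := sq_nonneg _
      have a1 := mul_le_mul_of_nonneg_left hx C0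
      have a2 : r ^ 2 * |θ + s * (1 + w' (xxm (B n) (m n) r) ^ 2 + 4 * w (xxm (B n) (m n) r) * xxm (B n) (m n) r - c)| ≤ 1 * (C * (1 + |xxm (B n) (m n) r|)) := by gcongr
      nlinarith only [a1, a2, q0, sq_nonneg r, mul_nonneg C0 q0]
    · have hG := Gb (xxm (B n) (m n) r)
      have r2 : 0 ≤ 1 - r ^ 2 := by nlinarith only [h0, h1]
      set X := |xxm (B n) (m n) r|
      set T := 1 + w' (xxm (B n) (m n) r) ^ 2 + 4 * w (xxm (B n) (m n) r) * xxm (B n) (m n) r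
      have hT := (abs_le.1 hG).2
      have a1 := mul_le_mul_of_nonneg_left hT r2
      have a2 : 0 ≤ (1 - r ^ 2) * X := mul_nonneg r2 (abs_nonneg _)
      linarith only [a1, a2, r2]
  have hl : ∫ r, ((θ - s * c) + s * (1 + w' (xxm (B n) (m n) r) ^ 2 + 4 * w (xxm (B n) (m n) r) * xxm (B n) (m n) r)
      - (C + 1) * ((1 - r ^ 2) + (1 - r ^ 2) * |xxm (B n) (m n) r|)) ∂(ν n) = (θ - s * c) + s * M -
        (C + 1) * ((∫ r, (1 - r ^ 2) ∂(ν n)) + ∫ r, (1 - r ^ 2) * |xxm (B n) (m n) r| ∂(ν n)) := by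
    rw [integral_sub j1 (j2.const_mul _), integral_const_mul, integral_add g.ir2 (g.ixe hB), integral_add (integrable_const _) (iM.const_mul s),
      integral_const_mul]
    simp only [integral_const, probReal_univ, smul_eq_mul, one_mul]
    rw [← hM]
  rw [hl] at hlow
  have h2 : Q ≤ (1 + 10 * (KH + 1) * (1 / √(B n))) * (lam (B n) / B n + τ n / B n) + 10 * (KH + 1) * (1 / √(B n)) := by
    have e : ((1 + 10 * (KH + 1) * (1 / √(B n))) * (lam (B n) / B n + τ n / B n) + 10 * (KH + 1) * (1 / √(B n))) =
      ((1 + 10 * (KH + 1) / √(B n)) * (lam (B n) + τ n) + 10 * (KH + 1) * √(B n)) / B n := by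
      rw [← sqB B0]; ring_nf
      have : (√(B n))⁻¹ = √(B n) * (B n)⁻¹ := by
        have := sqB B0; rw [one_div] at this; rw [← this]; ring
      rw [this]; ring
    rw [e, le_div_iff₀ B0, mul_comm]
    exact h
  have : s * M < s * (c + ε) := by linarith
  exact (lt_of_mul_lt_mul_left this hs.le).le
end

section
variable {lam : ℝ → ℝ} {θ : ℝ} {B K τ : ℕ → ℝ} {m : ℕ → ℤ} {ν : ℕ → Measure ℝ}
variable {Kz : ℝ} {ω ζ ζ' : ℝ → ℝ} {w w' : ℝ → ℝ} {Kw : ℝ}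

theorem Sq.iJ (S : Sq lam θ B K τ m ν) (z : Zc Kz ω ζ ζ') (n : ℕ) :
    Integrable (fun r => ζ r ^ 2 * (pim (B n) (m n) r / r)) (ν n) := by
  have := pim_meas (B n) (m n)
  have := z.cz.c
  refine (S.good n).integ (C := 8) (by fun_prop) fun r h0 _ => ?_
  rcases le_total r (1/8) with h | h
  · rw [z.z0 r h]; simp; positivity
  · rw [abs_mul, abs_div, abs_of_pos h0, abs_of_nonneg (sq_nonneg (ζ r))]
    have z1 : ζ r ^ 2 ≤ 1 := by have := z.z01 r; nlinarith only [this.1, this.2]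
    have : |pim (B n) (m n) r| / r ≤ 8 * |pim (B n) (m n) r| := by
      rw [div_le_iff₀ h0]; nlinarith only [abs_nonneg (pim (B n) (m n) r), h]
    have : |pim (B n) (m n) r| ≤ 1 + pim (B n) (m n) r ^ 2 := by
      rw [← sq_abs]; nlinarith only [sq_nonneg (|pim (B n) (m n) r| - 1)]
    calc _ ≤ 1 * (8 * |pim (B n) (m n) r|) := by gcongr
      _ ≤ _ := by linarith

theorem jpt {K B r k : ℝ} {m : ℤ} (z : Zc Kz ω ζ ζ') (hKK : Kz ≤ K) (hB : 1 ≤ B) (hm : 0 ≤ m) (r0 : 0 < r) (r1 : r ≤ 1) (hk : |k| = 1)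
    (wb : ∀ x, |w x| ≤ K) (wb' : ∀ x, |w' x| ≤ K ∧ |x * w' x| ≤ K) (z0' : ∀ r, r < 1/8 → ζ' r = 0) :
    (ζ' r * (1 + k * (1 / √B) * w (xxm B m r)) - k * (ζ r * (w' (xxm B m r) * (1 + 1 / √B * xxm B m r / r)))) ^ 2 +
     (-2 * k * pim B m r / r + 1 / r ^ 2) * (ζ r * (1 + k * (1 / √B) * w (xxm B m r))) ^ 2 ≤
      1 + w' (xxm B m r) ^ 2 + 4 * w (xxm B m r) * xxm B m r - 2 * k * (ζ r ^ 2 * (pim B m r / r)) + 1000 * K ^ 4 * Er B m ω r := by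
  have B0 : 0 < B := by linarith
  have hs : 0 < √B := sqrt_pos.2 B0
  have K1 : 1 ≤ K := z.k1.trans hKK
  have s1 : 1 ≤ √B := by rw [one_le_sqrt]; exact hB
  have y0 : 0 < 1 / √B := by positivity
  have y1 : 1 / √B ≤ 1 := by rw [div_le_one hs]; exact s1
  have xq := xxm_eq (r := r) B0 hm
  have hq : (1 / √B) * pim B m r = - xxm B m r := by rw [xq]; ring
  have xs : |xxm B m r| ≤ |pim B m r| := by
    have := xxm_sq1 (m := m) hB r0
    exact sq_le_sq.1 this
  set x := xxm B m r
  set q := pim B m r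
  set y := 1 / √B
  have r2 : 0 ≤ 1 - r ^ 2 := by nlinarith only [r0, r1]
  have E0 : ω r ^ 2 * (1 + q ^ 2) ≤ Er B m ω r := by
    have : Er B m ω r = y * (1 + x ^ 2) + (1 - r ^ 2) * (1 + |x|) + ω r ^ 2 * (1 + q ^ 2) := rfl
    rw [this]
    have h1 : 0 ≤ y * (1 + x ^ 2) := by positivity
    have h2 : 0 ≤ (1 - r ^ 2) * (1 + |x|) := by positivity
    linarith
  have E1 : y * (1 + x ^ 2) + (1 - r ^ 2) * (1 + |x|) ≤ Er B m ω r := by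
    have : Er B m ω r = y * (1 + x ^ 2) + (1 - r ^ 2) * (1 + |x|) + ω r ^ 2 * (1 + q ^ 2) := rfl
    rw [this]
    have h1 : 0 ≤ ω r ^ 2 * (1 + q ^ 2) := by positivity
    linarith
  rcases le_total (1/4) r with h4 | h4
  · rw [z.z1 r h4, z.z1' r h4]
    have h := jptB (k := k) K1 y0 y1 h4 r1 hk (wb x) (wb' x).1 (wb' x).2 hq
    have e1 : (0 * (1 + k * y * w x) - k * (1 * (w' x * (1 + y * x / r)))) = -(k * (w' x * (1 + y * x / r))) := by ring
    have e2 : 2 * k * (1 ^ 2 * (q / r)) = 2 * k * q / r := by ring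
    rw [e1, e2, one_mul]
    have k4 : 100 * K ^ 2 * (y * (1 + x ^ 2) + (1 - r ^ 2) * (1 + |x|)) ≤ 1000 * K ^ 4 * Er B m ω r := by
      have : K ^ 2 ≤ K ^ 4 := by gcongr; norm_num
      have : 100 * K ^ 2 ≤ 1000 * K ^ 4 := by linarith [sq_nonneg K]
      have : 0 ≤ y * (1 + x ^ 2) + (1 - r ^ 2) * (1 + |x|) := by positivity
      gcongr
    linarith
  · rw [z.w1 r h4, one_pow, one_mul] at E0
    have k4 : 1000 * K ^ 4 * (1 + q ^ 2) ≤ 1000 * K ^ 4 * Er B m ω r := by gcongr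
    rcases lt_or_ge r (1/8) with h8 | h8
    · rw [z.z0 r h8.le, z0' r h8]
      have h := jptA2 (r := 1/8) (k := k) (w' := w' x) (z := 0) (P := 0) (D := 0) K1 le_rfl hk (wb x) xs (by norm_num) (by rw [abs_zero]; positivity) (by rw [abs_zero]; positivity)
      simp only [zero_mul, mul_zero, sub_zero, ne_eq, OfNat.ofNat_ne_zero, not_false_eq_true, zero_pow, add_zero] at h ⊢
      linarith
    · have h := jptA (q := q) (k := k) (z := ζ r) (z' := ζ' r) K1 y0 y1 h8 hk (wb x) (wb' x).1 (wb' x).2 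
        (by rw [abs_of_nonneg (z.z01 r).1]; exact (z.z01 r).2) ((z.cz.2.2.2 r).2.trans hKK)
      have h2 := jptA2 (k := k) (w' := w' x) (z := ζ r) K1 h8 hk (wb x) xs (by have := z.z01 r; nlinarith only [this.1, this.2]) h.1 h.2
      linarith

theorem Zc.z0' (z : Zc Kz ω ζ ζ') : ∀ r, r < 1/8 → ζ' r = 0 := by
  intro r hr
  have : HasDerivAt ζ 0 r := by
    refine (hasDerivAt_const r (0:ℝ)).congr_of_eventuallyEq ?_
    filter_upwards [gt_mem_nhds hr] with s hs using z.z0 s (le_of_lt hs)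
  exact (z.cz.1 r).unique this

theorem Sq.J (S : Sq lam θ B K τ m ν) (z : Zc Kz ω ζ ζ')
    (hW : Tendsto (fun n => ∫ r, ω r ^ 2 * (1 + pim (B n) (m n) r ^ 2) ∂(ν n)) atTop (𝓝 0)) (hKw : Kz ≤ Kw)
    (wd : ∀ x, HasDerivAt w (w' x) x) (wc : Continuous w') (wb : ∀ x, |w x| ≤ Kw)
    (wb' : ∀ x, |w' x| ≤ Kw ∧ |x * w' x| ≤ Kw) (k : ℤ) (hk : |(k:ℝ)| = 1) {ε : ℝ} (hε : 0 < ε) :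
    ∀ᶠ n in atTop, 2 * k * ∫ r, ζ r ^ 2 * (pim (B n) (m n) r / r) ∂(ν n) ≤ 
      (∫ r, (1 + w' (xxm (B n) (m n) r) ^ 2 + 4 * w (xxm (B n) (m n) r) * xxm (B n) (m n) r) ∂(ν n)) + ε := by
  have K1 : 1 ≤ Kw := z.k1.trans hKw
  have cw : Continuous w := continuous_iff_continuousAt.2 fun x => (wd x).continuousAt
  have hE := (S.Er z hW).2 (ε / 2 / (1000 * Kw ^ 4)) (by positivity)
  filter_upwards [hE, S.hK.eventually_ge_atTop (11 * Kw ^ 2), S.mpos, S.hτ.eventually (gt_mem_nhds (half_pos hε))] with n hEn hK hm hτ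
  have g := S.good n
  have := g.prob
  have B0 := S.B0 n
  have hB := S.hB1 n
  set φ := fun r => ζ r * (1 + k * (1 / √(B n)) * w (xxm (B n) (m n) r)) with hφ
  set φ' := (fun r => ζ' r * (1 + k * (1 / √(B n)) * w (xxm (B n) (m n) r)) - k * (ζ r * (w' (xxm (B n) (m n) r) * (1 + 1 / √(B n) * xxm (B n) (m n) r / r)))) with hφ'
  have cut : Cut (K n) φ φ' := (phiCut (m := m n) z hB hKw hk wd wc wb wb').mono hK
  have hd := g.d φ φ' cut (by rw [hφ]; dsimp only; rw [z.z0 _ le_rfl, zero_mul]) (B n) B0 k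
  have i1 := g.ip' cut
  have k2 : (k:ℝ) ^ 2 = 1 := by rw [← sq_abs, hk, one_pow]
  have pt : ∀ r, ((pim (B n) (m n) r + (B n - B n) * r / 2 - k / r) ^ 2 - pim (B n) (m n) r ^ 2) * φ r ^ 2
      = (-2 * k * pim (B n) (m n) r / r + 1 / r ^ 2) * φ r ^ 2 := by
    intro r
    congr 1
    rw [← k2]; ring
  simp only [pt] at hd
  have pm := pim_meas (B n) (m n)
  have φc := cut.c
  have i2 : Integrable (fun r => (-2 * k * pim (B n) (m n) r / r + 1 / r ^ 2) * φ r ^ 2) (ν n) := by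
    refine g.integ (C := 80 * K n ^ 2) (by fun_prop) fun r h0 h1 => ?_
    rcases le_total r (1/8) with h | h
    · have : φ r = 0 := by rw [hφ]; dsimp only; rw [z.z0 r h, zero_mul]
      rw [this]; simp; positivity
    · rw [abs_mul, abs_of_nonneg (sq_nonneg (φ r))]
      have a1 : φ r ^ 2 ≤ K n ^ 2 := by rw [← sq_abs]; have := (cut.2.2.2 r).1; gcongr
      have u8 : 1 / r ≤ 8 := by rw [div_le_iff₀ h0]; linarith
      have u0 : 0 < 1 / r := by positivity
      have a2 : |-2 * k * pim (B n) (m n) r / r + 1 / r ^ 2| ≤ 16 * |pim (B n) (m n) r| + 64 := by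
        have e : -2 * k * pim (B n) (m n) r / r + 1 / r ^ 2 = (-2 * (1 / r)) * (k * pim (B n) (m n) r) + (1 / r) ^ 2 := by ring
        rw [e]
        refine (abs_add_le _ _).trans ?_
        rw [abs_mul, abs_mul, abs_mul, hk, abs_of_pos u0, abs_of_nonneg (sq_nonneg (1 / r))]
        have b1 : (1 / r) ^ 2 ≤ 64 := by nlinarith only [u0, u8]
        have b2 : |(-2:ℝ)| = 2 := by norm_num
        rw [b2]
        have : 2 * (1 / r) * (1 * |pim (B n) (m n) r|) ≤ 2 * 8 * (1 * |pim (B n) (m n) r|) := by gcongr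
        linarith
      have a3 : 16 * |pim (B n) (m n) r| + 64 ≤ 80 * (1 + pim (B n) (m n) r ^ 2) := by
        rw [← sq_abs (pim (B n) (m n) r)]; nlinarith only [sq_nonneg (|pim (B n) (m n) r| - 1)]
      calc _ ≤ (80 * (1 + pim (B n) (m n) r ^ 2)) * K n ^ 2 := mul_le_mul (a2.trans a3) a1 (sq_nonneg _) (by positivity)
        _ = _ := by ring
  have iM := S.iM K1 cw wc wb wb' n
  have iJ := S.iJ z n
  have iE := (S.Er z hW).1 n
  have j1 : Integrable (fun r => 1 + w' (xxm (B n) (m n) r) ^ 2 + 4 * w (xxm (B n) (m n) r) * xxm (B n) (m n) r - 2 * k * (ζ r ^ 2 * (pim (B n) (m n) r / r))) (ν n) :=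
    iM.sub (iJ.const_mul _)
  have main : ∫ r, (φ' r ^ 2 + (-2 * k * pim (B n) (m n) r / r + 1 / r ^ 2) * φ r ^ 2) ∂(ν n) ≤
      ∫ r, (1 + w' (xxm (B n) (m n) r) ^ 2 + 4 * w (xxm (B n) (m n) r) * xxm (B n) (m n) r - 2 * k * (ζ r ^ 2 * (pim (B n) (m n) r / r)) + 
        1000 * Kw ^ 4 * _root_.Er (B n) (m n) ω r) ∂(ν n) := by
    refine g.mono (i1.add i2) (j1.add (iE.const_mul _)) fun r h0 h1 => ?_
    exact jpt z hKw hB hm.le h0 h1 hk wb wb' z.z0'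
  rw [integral_add i1 i2, integral_add j1 (iE.const_mul _), integral_sub iM (iJ.const_mul _), integral_const_mul, integral_const_mul] at main
  have hEn' : 1000 * Kw ^ 4 * ∫ r, _root_.Er (B n) (m n) ω r ∂(ν n) ≤ ε / 2 := by
    rw [le_div_iff₀ (by positivity)] at hEn; linarith
  linarith

theorem Sq.fin (S : Sq lam θ B K τ m ν) (wd : ∀ x, HasDerivAt w (w' x) x) (wc : Continuous w') (wb : ∃ K, ∀ x, |w x| ≤ K)
    (wb' : ∃ K, ∀ x, |w' x| ≤ K ∧ |x * w' x| ≤ K)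
    {s c KH : ℝ} {H H' : ℝ → ℝ} (hs : 0 < s) (hH : AdmK KH H H') (hc : 0 ≤ c)
    (hG : ∀ x, θ + s * (1 + w' x ^ 2 + 4 * w x * x - c) ≤ x ^ 2 - H' x - H x ^ 2) {ε : ℝ} (hε : 0 < ε) :
    ∀ᶠ n in atTop, |(∫ r, r * pim (B n) (m n) r ∂(ν n)) - θ| ≤ c / 2 + ε := by
  obtain ⟨Kz, ω, ζ, ζ', z, hW⟩ := S.W
  obtain ⟨K1, wb⟩ := wb
  obtain ⟨K2, wb'⟩ := wb'
  have cw : Continuous w := continuous_iff_continuousAt.2 fun x => (wd x).continuousAt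
  set Kw := max Kz (max K1 K2)
  have b1 : ∀ x, |w x| ≤ Kw := fun x => (wb x).trans ((le_max_left _ _).trans (le_max_right _ _))
  have b2 : ∀ x, |w' x| ≤ Kw ∧ |x * w' x| ≤ Kw := fun x => ⟨(wb' x).1.trans ((le_max_right _ _).trans (le_max_right _ _)),
    (wb' x).2.trans ((le_max_right _ _).trans (le_max_right _ _))⟩
  have hKw : Kz ≤ Kw := le_max_left _ _
  have hK1 : 1 ≤ Kw := z.k1.trans hKw
  set h := min (1/2) (ε / 16) with hh
  have h0 : 0 < h := by positivity
  have hl1 : h < 1 := (min_le_left _ _).trans_lt (by norm_num)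
  have hl2 : h ≤ ε / 16 := min_le_right _ _
  have e8 : 0 < ε / 8 := by positivity
  set e' := ε / 8 / (c + 1 + ε) with he'
  have e0 : 0 < e' := by positivity
  have r1 := S.rho.eventually (gt_mem_nhds (show (1:ℝ) < 1 + e' by linarith))
  have r2 := S.rho.eventually (lt_mem_nhds (show (0:ℝ) < 1 by norm_num))
  filter_upwards [S.vir z hW h0 hl1, S.J z hW hKw wd wc b1 b2 1 (by norm_num) e8, S.J z hW hKw wd wc b1 b2 (-1) (by norm_num) e8,
    S.Mle hK1 cw wc b1 b2 hs hH hG e8, r1, r2, hW.eventually (gt_mem_nhds e8), S.hK.eventually_ge_atTop Kz] with n hv hj1 hj2 hM hr1 hr2 hw hK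
  have g := S.good n
  have := g.prob
  have B0 := S.B0 n
  have cz := z.cz.mono hK
  have pm := pim_meas (B n) (m n)
  have zc := z.cz.c
  have i0 := g.ipi cz
  have iJ := S.iJ z n
  have iz : Integrable (fun r => (1 - ζ r ^ 2) * (r * pim (B n) (m n) r)) (ν n) := by
    refine g.integ (C := 1) (by fun_prop) fun r h0 h1 => ?_
    have z1 := z.z01 r
    have : |1 - ζ r ^ 2| ≤ 1 := by rw [abs_le]; constructor <;> nlinarith only [z1.1, z1.2]
    have : |r * pim (B n) (m n) r| ≤ 1 + pim (B n) (m n) r ^ 2 := by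
      rw [abs_mul, abs_of_pos h0, ← sq_abs (pim (B n) (m n) r)]
      nlinarith only [sq_nonneg (|pim (B n) (m n) r| - 1), abs_nonneg (pim (B n) (m n) r), h0, h1]
    rw [abs_mul]; gcongr
  have i12 : Integrable (fun r => 2 / B n * (pim (B n) (m n) r ^ 2 * ζ r ^ 2) + 2 * (m n:ℝ) / B n * (ζ r ^ 2 * (pim (B n) (m n) r / r))) (ν n) :=
    (i0.const_mul _).add (iJ.const_mul _)
  have e1 : ∫ r, r * pim (B n) (m n) r ∂(ν n) = ∫ r, ((1 - ζ r ^ 2) * (r * pim (B n) (m n) r) + (2 / B n * (pim (B n) (m n) r ^ 2 * ζ r ^ 2) + 2 * (m n:ℝ) / B n * (ζ r ^ 2 * (pim (B n) (m n) r / r)))) ∂(ν n) := by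
    refine integral_congr_ae ?_
    filter_upwards [g.supp] with r hr
    have : r ≠ 0 := hr.1.ne'
    unfold pim
    field_simp
    ring
  rw [e1, integral_add iz i12, integral_add (i0.const_mul _) (iJ.const_mul _), integral_const_mul, integral_const_mul]
  have hz : |∫ r, (1 - ζ r ^ 2) * (r * pim (B n) (m n) r) ∂(ν n)| ≤ ∫ r, ω r ^ 2 * (1 + pim (B n) (m n) r ^ 2) ∂(ν n) := by
    refine (abs_integral_le_integral_abs).trans ?_
    refine g.mono iz.abs (S.iW z n) fun r h0 h1 => ?_
    have z1 := z.z01 r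
    have a1 := z.om r
    have a2 : 0 ≤ 1 - ζ r ^ 2 := by nlinarith only [z1.1, z1.2]
    have : |r * pim (B n) (m n) r| ≤ 1 + pim (B n) (m n) r ^ 2 := by
      rw [abs_mul, abs_of_pos h0, ← sq_abs (pim (B n) (m n) r)]
      nlinarith only [sq_nonneg (|pim (B n) (m n) r| - 1), abs_nonneg (pim (B n) (m n) r), h0, h1]
    rw [abs_mul, abs_of_nonneg a2]; gcongr
  set J := ∫ r, ζ r ^ 2 * (pim (B n) (m n) r / r) ∂(ν n)
  set V := ∫ r, pim (B n) (m n) r ^ 2 * ζ r ^ 2 ∂(ν n)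
  set Zi := ∫ r, (1 - ζ r ^ 2) * (r * pim (B n) (m n) r) ∂(ν n)
  set ρ := 2 * (m n:ℝ) / B n
  push_cast at hj1 hj2
  have hJ : |J| ≤ (c + ε / 4) / 2 := by rw [abs_le]; constructor <;> linarith
  have hρ : |ρ * J| ≤ c / 2 + ε / 4 := by
    rw [abs_mul, abs_of_pos hr2]
    have a1 : ρ * |J| ≤ (1 + e') * ((c + ε / 4) / 2) := by gcongr
    have a2 : e' * ((c + ε / 4) / 2) ≤ ε / 8 := by
      rw [he', div_mul_eq_mul_div, div_le_iff₀ (by positivity)]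
      nlinarith
    linarith
  have e2 : 2 / B n * V = 2 * (V / B n) := by ring
  rw [e2]
  rw [abs_le] at hv hz hρ ⊢
  constructor <;> linarith [hv.1, hv.2, hz.1, hz.2, hρ.1, hρ.2]

/-- final abstract statement -/
theorem good_fin {ξ₀ δ₀ : ℝ} (hξ : deGennes ξ₀ = Theta0) (hu : ∀ ξ, deGennes ξ = Theta0 → ξ = ξ₀)
    (hδ : δ₀ = (1/2) * iteratedDeriv 2 deGennes ξ₀) (hlam : Tendsto (fun B => lam B / B) atTop (𝓝 Theta0)) {η : ℝ} (hη : 0 < η) :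
    ∃ N : ℝ, 1 ≤ N ∧ ∀ B ≥ N, ∀ (m : ℤ) (ν : Measure ℝ), GoodNu lam B N (1/N) m ν →
      |(∫ r, r * pim B m r ∂ν) - Theta0| ≤ δ₀ / 2 + η := by
  by_contra hcon
  push Not at hcon
  have hc : ∀ n : ℕ, ∃ B, (n:ℝ) + 1 ≤ B ∧ ∃ m ν, GoodNu lam B ((n:ℝ) + 1) (1 / ((n:ℝ) + 1)) m ν ∧
      δ₀ / 2 + η < |(∫ r, r * pim B m r ∂ν) - Theta0| := by
    intro n
    obtain ⟨B, hB, m, ν, h⟩ := hcon ((n:ℝ) + 1) (by linarith [n.cast_nonneg (α := ℝ)])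
    exact ⟨B, hB, m, ν, h⟩
  choose B hB m ν hg hlt using hc
  obtain ⟨H, H', ⟨a1, a2, a3, KH, a4⟩, hA⟩ := admA hξ
  have hn : Tendsto (fun n : ℕ => (n:ℝ) + 1) atTop atTop := tendsto_atTop_add_const_right _ _ tendsto_natCast_atTop_atTop
  have S : Sq lam Theta0 B (fun n => (n:ℝ) + 1) (fun n => 1 / ((n:ℝ) + 1)) m ν := 
    { th0 := (delta_facts hξ hδ).2.2
      th1 := Theta0_lt_one
      hA := ⟨KH, H, H', ⟨a1, a2, a3, a4⟩, hA⟩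
      hlam := hlam
      hB := tendsto_atTop_mono hB hn
      hB1 := fun n => le_trans (by linarith [n.cast_nonneg (α := ℝ)]) (hB n)
      hK := hn
      hK1 := fun n => by linarith [n.cast_nonneg (α := ℝ)]
      hτ := tendsto_one_div_add_atTop_nhds_zero_nat
      hτ0 := fun n => by positivity
      good := hg }
  obtain ⟨s, hs, w, w', H, H', ⟨a1, a2, a3, KH, a4⟩, wd, wc, wb, wb', hG⟩ := lemD hξ hu hδ hη
  have d0 : 0 ≤ δ₀ := by
    obtain ⟨_, _, h2, h3⟩ := xi0_facts hξ hδ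
    rw [h3]
    have := NE_pos Theta0_lt_one ξ₀
    have : 0 < -ξ₀ := by linarith
    positivity
  have := S.fin wd wc wb wb' hs ⟨a1, a2, a3, a4⟩ (c := δ₀ + η) (by linarith) (fun x => by have := hG x; rw [← sub_sub]; exact this) (half_pos hη)
  obtain ⟨n, hn⟩ := this.exists
  have := hlt n
  linarith
end

section
instance csE3 : ContinuousSMul ℝ E3 := inferInstance
instance csL3 : ContinuousSMul ℝ (E3 →L[ℝ] E3) := inferInstance
instance csLC : ContinuousSMul ℝ (E3 →L[ℝ] ℂ) := inferInstance
def ss (x : E3) : ℝ := x 0 ^ 2 + x 1 ^ 2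
def rr (x : E3) : ℝ := √(ss x)
abbrev ee (j : Fin 3) : E3 := EuclideanSpace.single j 1
def dd (Ψ : E3 → ℂ) (j : Fin 3) (x : E3) : ℂ := fderiv ℝ Ψ x (ee j)
def Mode (m : ℤ) (Φ : E3 → ℂ) : Prop :=
  ∀ x, (x 0 : ℂ) * dd Φ 1 x - (x 1 : ℂ) * dd Φ 0 x = -Complex.I * m * Φ x
def SS (Φ : E3 → ℂ) (x : E3) : ℝ :=
  ‖(x 0 : ℂ) * dd Φ 0 x + (x 1 : ℂ) * dd Φ 1 x‖ ^ 2 / ss x + ‖dd Φ 2 x‖ ^ 2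
abbrev mu3 : Measure E3 := volume.restrict ball3
def qB (B : ℝ) (Ψ : E3 → ℂ) : ℝ := ∫ x in ball3, magEnergyDensity B Ψ x
def n2 (Ψ : E3 → ℂ) : ℝ := ∫ x in ball3, ‖Ψ x‖ ^ 2

theorem ss_nonneg (x : E3) : 0 ≤ ss x := by unfold ss; positivity
theorem rr_sq (x : E3) : rr x ^ 2 = ss x := sq_sqrt (ss_nonneg x)
theorem rr_nonneg (x : E3) : 0 ≤ rr x := sqrt_nonneg _
theorem ss_cont : Continuous ss := by unfold ss; fun_prop
theorem rr_cont : Continuous rr := ss_cont.sqrt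
theorem rr_pos {x : E3} (h : 0 < ss x) : 0 < rr x := sqrt_pos.2 h
theorem nsq (x : E3) : ‖x‖ ^ 2 = ss x + x 2 ^ 2 := by
  rw [EuclideanSpace.norm_sq_eq, Fin.sum_univ_three]; simp [ss]
theorem ball_ss {x : E3} (hx : x ∈ ball3) : ss x + x 2 ^ 2 < 1 := by
  rw [← nsq]; have : ‖x‖ < 1 := by simpa [ball3] using hx
  nlinarith [norm_nonneg x]
theorem rr_lt {x : E3} (hx : x ∈ ball3) : rr x < 1 := by
  have := ball_ss hx
  nlinarith [rr_sq x, rr_nonneg x, sq_nonneg (x 2)]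
theorem ball_meas : MeasurableSet ball3 := measurableSet_ball

instance : IsFiniteMeasure mu3 :=
  ⟨by rw [Measure.restrict_apply_univ]; exact measure_ball_lt_top⟩

theorem ci {F : Type*} [NormedAddCommGroup F] {f : E3 → F} (hf : Continuous f) : IntegrableOn f ball3 :=
  (hf.continuousOn.integrableOn_compact (isCompact_closedBall (0:E3) 1)).mono_set Metric.ball_subset_closedBall

theorem cbd {f : E3 → ℝ} (hf : Continuous f) : ∃ C, 0 ≤ C ∧ ∀ x ∈ ball3, |f x| ≤ C := by
  obtain ⟨C, hC⟩ := (isCompact_closedBall (0:E3) 1).exists_bound_of_continuousOn hf.continuousOn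
  exact ⟨|C|, abs_nonneg _, fun x hx => (hC x (Metric.ball_subset_closedBall hx)).trans (le_abs_self _)⟩

theorem ae_ss : ∀ᵐ x ∂mu3, x ∈ ball3 ∧ 0 < ss x := by
  have h : volume {x : E3 | ss x = 0} = 0 := by
    have hsub : {x : E3 | ss x = 0} ⊆ (LinearMap.ker (EuclideanSpace.proj (𝕜 := ℝ) (0 : Fin 3) : E3 →L[ℝ] ℝ).toLinearMap : Set E3) := by
      intro x hx
      have : x 0 ^ 2 + x 1 ^ 2 = 0 := hx
      have : x 0 = 0 := by nlinarith [sq_nonneg (x 0), sq_nonneg (x 1)]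
      simpa using this
    refine measure_mono_null hsub (Measure.addHaar_submodule _ _ fun h => ?_)
    have : (ee 0 : E3) ∈ (⊤ : Submodule ℝ E3) := trivial
    rw [← h] at this
    simp at this
  have h2 : ∀ᵐ x ∂(volume : Measure E3), ss x ≠ 0 := by
    rw [ae_iff]; simpa using h
  filter_upwards [ae_restrict_mem ball_meas, ae_restrict_of_ae h2] with x h1 h3
  exact ⟨h1, lt_of_le_of_ne (ss_nonneg x) (Ne.symm h3)⟩

theorem dd_cont {Ψ : E3 → ℂ} (h : ContDiff ℝ 1 Ψ) (j : Fin 3) : Continuous (dd Ψ j) := by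
  have := h.continuous_fderiv one_ne_zero
  unfold dd; fun_prop

theorem magD_eq (B : ℝ) (Ψ : E3 → ℂ) (j : Fin 3) (x : E3) :
    magD B Ψ j x = -Complex.I * dd Ψ j x + (Avec B x j : ℂ) * Ψ x := rfl

theorem Avec_cont (B : ℝ) (j : Fin 3) : Continuous fun x => Avec B x j := by
  fin_cases j <;> simp [Avec] <;> fun_prop

theorem magD_cont {Ψ : E3 → ℂ} (h : ContDiff ℝ 1 Ψ) (B : ℝ) (j : Fin 3) : Continuous (magD B Ψ j) := by
  have h1 := dd_cont h j
  have h2 := Avec_cont B j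
  have h3 := h.continuous
  have : magD B Ψ j = fun x => -Complex.I * dd Ψ j x + (Avec B x j : ℂ) * Ψ x := rfl
  rw [this]
  fun_prop

theorem dens_cont {Ψ : E3 → ℂ} (h : ContDiff ℝ 1 Ψ) (B : ℝ) : Continuous (magEnergyDensity B Ψ) := by
  have := fun j => magD_cont h B j
  unfold magEnergyDensity; fun_prop

theorem dens_nonneg (B : ℝ) (Ψ : E3 → ℂ) (x : E3) : 0 ≤ magEnergyDensity B Ψ x :=
  Finset.sum_nonneg fun _ _ => by positivity

theorem qB_nonneg (B : ℝ) (Ψ : E3 → ℂ) : 0 ≤ qB B Ψ := integral_nonneg fun x => dens_nonneg B Ψ x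
theorem n2_nonneg (Ψ : E3 → ℂ) : 0 ≤ n2 Ψ := integral_nonneg fun x => by positivity

theorem lam_le {B : ℝ} {Ψ : E3 → ℂ} (h : ContDiff ℝ 1 Ψ) : lambda1H B * n2 Ψ ≤ qB B Ψ := by
  rcases (n2_nonneg Ψ).eq_or_lt with h0 | h0
  · rw [← h0, mul_zero]; exact qB_nonneg B Ψ
  · rw [← le_div_iff₀ h0]
    refine csInf_le ⟨0, ?_⟩ ⟨Ψ, h, h0, rfl⟩
    rintro q ⟨Ψ, -, h2, rfl⟩
    exact div_nonneg (qB_nonneg B Ψ) h2.le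

theorem one_n2 : 0 < n2 (fun _ => 1) := by
  unfold n2
  simp only [norm_one, one_pow, integral_const, smul_eq_mul, mul_one]
  rw [Measure.real, Measure.restrict_apply_univ]
  exact ENNReal.toReal_pos (Metric.measure_ball_pos _ _ one_pos).ne' measure_ball_lt_top.ne

theorem lam_nonneg (B : ℝ) : 0 ≤ lambda1H B := by
  refine Real.sInf_nonneg ?_
  rintro q ⟨Ψ, -, h2, rfl⟩
  exact div_nonneg (qB_nonneg B Ψ) h2.le

theorem lam_ex (B : ℝ) {c : ℝ} (hc : lambda1H B < c) : ∃ Ψ : E3 → ℂ, ContDiff ℝ 1 Ψ ∧ 0 < n2 Ψ ∧ qB B Ψ < c * n2 Ψ := by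
  obtain ⟨q, ⟨Ψ, h1, h2, rfl⟩, h3⟩ := exists_lt_of_csInf_lt (by exact ⟨_, fun _ => 1, contDiff_const, one_n2, rfl⟩) hc
  exact ⟨Ψ, h1, h2, (div_lt_iff₀ h2).1 h3⟩

theorem dens_eq {B : ℝ} {m : ℤ} {Φ : E3 → ℂ} {x : E3} (hm : Mode m Φ) (hx : 0 < ss x) :
    magEnergyDensity B Φ x = SS Φ x + pim B m (rr x) ^ 2 * ‖Φ x‖ ^ 2 := by
  have h := hm x
  have hr := rr_pos hx
  have hp : pim B m (rr x) ^ 2 = (B / 2 * ss x - m) ^ 2 / ss x := by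
    rw [← rr_sq]; unfold pim; field_simp
  rw [hp, magEnergyDensity, Fin.sum_univ_three, SS]
  simp only [magD_eq, Avec, Matrix.cons_val_zero, Matrix.cons_val_one, Matrix.cons_val]
  generalize dd Φ 0 x = a at *
  generalize dd Φ 1 x = b at *
  generalize dd Φ 2 x = c at *
  generalize Φ x = f at *
  have hre := congrArg Complex.re h
  have him := congrArg Complex.im h
  simp only [Complex.sq_norm, Complex.normSq_apply]
  simp at hre him ⊢
  have hs : ss x = x 0 ^ 2 + x 1 ^ 2 := rfl
  generalize ss x = s at *
  generalize x 0 = u at *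
  generalize x 1 = v at *
  field_simp
  have e1 : (u * b.re - v * a.re) ^ 2 = (m * f.im) ^ 2 := by rw [hre]
  have e2 : (u * b.im - v * a.im) ^ 2 = (m * f.re) ^ 2 := by rw [him]; ring
  subst hs
  linear_combination 4 * e1 + 4 * e2 + 4 * B * (u ^ 2 + v ^ 2) * f.re * him - 4 * B * (u ^ 2 + v ^ 2) * f.im * hre

theorem Mode.bd {m : ℤ} {Φ : E3 → ℂ} (hm : Mode m Φ) (h : ContDiff ℝ 1 Φ) (B : ℝ) :
    ∃ C, 0 ≤ C ∧ ∀ x ∈ ball3, 0 < ss x → (1 + pim B m (rr x) ^ 2) * ‖Φ x‖ ^ 2 ≤ C := by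
  obtain ⟨C, hC, hb⟩ := cbd (f := fun x => ‖Φ x‖ ^ 2 + magEnergyDensity B Φ x)
    ((h.continuous.norm.pow 2).add (dens_cont h B))
  refine ⟨C, hC, fun x hx hs => ?_⟩
  have h1 := (le_abs_self _).trans (hb x hx)
  have h2 := dens_eq (B := B) hm hs
  have h3 : 0 ≤ SS Φ x := by unfold SS; positivity
  linarith

/-- the radial measure -/
def nuM (Φ : E3 → ℂ) : Measure ℝ := (mu3.withDensity fun x => ENNReal.ofReal (‖Φ x‖ ^ 2)).map rr

theorem nuM_int {Φ : E3 → ℂ} (h : Continuous Φ) {f : ℝ → ℝ} (hf : Measurable f) :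
    ∫ r, f r ∂(nuM Φ) = ∫ x in ball3, f (rr x) * ‖Φ x‖ ^ 2 := by
  have hm : Measurable fun x : E3 => (‖Φ x‖ ^ 2).toNNReal := (h.norm.pow 2).measurable.real_toNNReal
  rw [nuM, integral_map rr_cont.measurable.aemeasurable hf.aestronglyMeasurable]
  rw [show (fun x : E3 => ENNReal.ofReal (‖Φ x‖ ^ 2)) = fun x => ((‖Φ x‖ ^ 2).toNNReal : ENNReal) from rfl,
    integral_withDensity_eq_integral_smul hm]
  refine integral_congr_ae (Eventually.of_forall fun x => ?_)
  simp only [NNReal.smul_def, smul_eq_mul]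
  rw [Real.coe_toNNReal _ (by positivity), mul_comm]

theorem nuM_integ {Φ : E3 → ℂ} (h : Continuous Φ) {f : ℝ → ℝ} (hf : Measurable f)
    (hi : Integrable (fun x => f (rr x) * ‖Φ x‖ ^ 2) mu3) : Integrable f (nuM Φ) := by
  have hm : Measurable fun x : E3 => (‖Φ x‖ ^ 2).toNNReal := (h.norm.pow 2).measurable.real_toNNReal
  rw [nuM, integrable_map_measure hf.aestronglyMeasurable rr_cont.measurable.aemeasurable]
  rw [show (fun x : E3 => ENNReal.ofReal (‖Φ x‖ ^ 2)) = fun x => ((‖Φ x‖ ^ 2).toNNReal : ENNReal) from rfl,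
    integrable_withDensity_iff_integrable_smul hm]
  refine hi.congr (Eventually.of_forall fun x => ?_)
  simp only [NNReal.smul_def, smul_eq_mul, Function.comp]
  rw [Real.coe_toNNReal _ (by positivity), mul_comm]

theorem bi {f : E3 → ℝ} {C : ℝ} (hf : AEStronglyMeasurable f mu3) (hb : ∀ x ∈ ball3, 0 < ss x → |f x| ≤ C) :
    Integrable f mu3 := by
  refine Integrable.of_bound hf C ?_
  filter_upwards [ae_ss] with x hx using hb x hx.1 hx.2

theorem nuM_prob {Φ : E3 → ℂ} (h : Continuous Φ) (hn : n2 Φ = 1) : IsProbabilityMeasure (nuM Φ) := by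
  refine ⟨?_⟩
  rw [nuM, Measure.map_apply rr_cont.measurable MeasurableSet.univ, preimage_univ, withDensity_apply _ MeasurableSet.univ,
    Measure.restrict_univ, ← ofReal_integral_eq_lintegral_ofReal (f := fun x => ‖Φ x‖ ^ 2) (ci (h.norm.pow 2)) (Eventually.of_forall fun x => by positivity)]
  rw [show ∫ x in ball3, ‖Φ x‖ ^ 2 = 1 from hn, ENNReal.ofReal_one]

theorem nuM_supp {Φ : E3 → ℂ} : ∀ᵐ r ∂(nuM Φ), 0 < r ∧ r ≤ 1 := by
  rw [nuM, ae_map_iff rr_cont.measurable.aemeasurable (measurableSet_Ioc (a := (0:ℝ)) (b := 1))]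
  refine (withDensity_absolutelyContinuous _ _).ae_le ?_
  filter_upwards [ae_ss] with x hx using ⟨rr_pos hx.2, (rr_lt hx.1).le⟩
end

section
def df (F : E3 → ℝ) (j : Fin 3) (x : E3) : ℝ := fderiv ℝ F x (ee j)
def g2 (F : E3 → ℝ) (x : E3) : ℝ := df F 0 x ^ 2 + df F 1 x ^ 2 + df F 2 x ^ 2

theorem dd_smul {F : E3 → ℝ} {Φ : E3 → ℂ} {x : E3} (hF : DifferentiableAt ℝ F x) (hΦ : DifferentiableAt ℝ Φ x) (j : Fin 3) :
    dd (fun y => F y • Φ y) j x = (F x : ℂ) * dd Φ j x + (df F j x : ℂ) * Φ x := by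
  unfold dd df
  rw [show fderiv ℝ (fun y => F y • Φ y) x = _ from (hF.hasFDerivAt.smul hΦ.hasFDerivAt).fderiv]
  simp

theorem magD_smul {B : ℝ} {F : E3 → ℝ} {Φ : E3 → ℂ} {x : E3} (hF : DifferentiableAt ℝ F x) (hΦ : DifferentiableAt ℝ Φ x) (j : Fin 3) :
    magD B (fun y => F y • Φ y) j x = (F x : ℂ) * magD B Φ j x - Complex.I * (df F j x : ℂ) * Φ x := by
  rw [magD_eq, magD_eq, dd_smul hF hΦ, Complex.real_smul]; ring

theorem cpx1 (M f : ℂ) (F d t : ℝ) :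
    ‖((1 + t * F ^ 2 : ℝ) : ℂ) * M - Complex.I * ((t * (2 * F * d) : ℝ) : ℂ) * f‖ ^ 2 = ‖M‖ ^ 2 + 2 * t * (‖(F:ℂ) * M - Complex.I * d * f‖ ^ 2 - d ^ 2 * ‖f‖ ^ 2)
      + t ^ 2 * ‖((F ^ 2 : ℝ):ℂ) * M - Complex.I * ((2 * F * d : ℝ) : ℂ) * f‖ ^ 2 := by
  simp only [Complex.sq_norm, Complex.normSq_apply]
  simp [pow_two]
  ring

theorem cpx2 (M f : ℂ) (F d K : ℝ) (hF : |F| ≤ K) :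
    ‖((F ^ 2 : ℝ):ℂ) * M - Complex.I * ((2 * F * d : ℝ) : ℂ) * f‖ ^ 2 ≤ 2 * K ^ 4 * ‖M‖ ^ 2 + 8 * K ^ 2 * (d ^ 2 * ‖f‖ ^ 2) := by
  have h1 : ‖((F ^ 2 : ℝ):ℂ) * M - Complex.I * ((2 * F * d : ℝ) : ℂ) * f‖ ≤ F ^ 2 * ‖M‖ + 2 * |F| * |d| * ‖f‖ := by
    refine (norm_sub_le _ _).trans (le_of_eq ?_)
    simp
  have h2 : F ^ 2 ≤ K ^ 2 := sq_le_sq' (by linarith [neg_abs_le F]) ((le_abs_self F).trans hF)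
  have h3 : (F ^ 2) ^ 2 ≤ (K ^ 2) ^ 2 := by gcongr
  calc _ ≤ (F ^ 2 * ‖M‖ + 2 * |F| * |d| * ‖f‖) ^ 2 := by gcongr
    _ ≤ 2 * (F ^ 2 * ‖M‖) ^ 2 + 2 * (2 * |F| * |d| * ‖f‖) ^ 2 := by nlinarith [sq_nonneg (F ^ 2 * ‖M‖ - 2 * |F| * |d| * ‖f‖)]
    _ = 2 * ((F ^ 2) ^ 2 * ‖M‖ ^ 2) + 8 * (F ^ 2 * (d ^ 2 * ‖f‖ ^ 2)) := by
      rw [mul_pow, mul_pow, mul_pow, mul_pow, sq_abs, sq_abs]; ring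
    _ ≤ 2 * ((K ^ 2) ^ 2 * ‖M‖ ^ 2) + 8 * (K ^ 2 * (d ^ 2 * ‖f‖ ^ 2)) := by gcongr
    _ = _ := by ring

theorem df_cont {F : E3 → ℝ} (h : ContDiff ℝ 1 F) (j : Fin 3) : Continuous (df F j) := by
  have := h.continuous_fderiv one_ne_zero
  unfold df; fun_prop

theorem g2_cont {F : E3 → ℝ} (h : ContDiff ℝ 1 F) : Continuous (g2 F) := by
  have := fun j => df_cont h j
  unfold g2; fun_prop

theorem df_sq {F : E3 → ℝ} {x : E3} (hF : DifferentiableAt ℝ F x) (j : Fin 3) :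
    df (fun y => F y ^ 2) j x = 2 * F x * df F j x := by
  unfold df; rw [(hF.hasFDerivAt.pow 2).fderiv]; simp

theorem df_t {F : E3 → ℝ} {x : E3} (hF : DifferentiableAt ℝ F x) (t : ℝ) (j : Fin 3) :
    df (fun y => 1 + t * F y ^ 2) j x = t * (2 * F x * df F j x) := by
  unfold df; rw [(((hF.hasFDerivAt.pow 2).const_mul t).const_add 1).fderiv]; simp

theorem loc {B K κ : ℝ} {Φ : E3 → ℂ} {F : E3 → ℝ} (hΦ : ContDiff ℝ 1 Φ) (hF : ContDiff ℝ 1 F) (hn : n2 Φ = 1)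
    (hκ : 0 < κ) (hκ1 : κ ≤ 1) (hq : qB B Φ ≤ lambda1H B + κ ^ 2) (hK : ∀ x, |F x| ≤ K) (hK' : ∀ x ∈ ball3, 0 < ss x → g2 F x ≤ K ^ 2) :
    qB B (fun x => F x • Φ x) ≤ lambda1H B * (∫ x in ball3, F x ^ 2 * ‖Φ x‖ ^ 2) + (∫ x in ball3, g2 F x * ‖Φ x‖ ^ 2)
      + κ / 2 * (1 + (2 * K ^ 4 * (lambda1H B + 1) + 8 * K ^ 4)) := by
  have dF := fun x => (hF.differentiable one_ne_zero) x
  have dΦ := fun x => (hΦ.differentiable one_ne_zero) x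
  set G : ℝ → E3 → ℂ := fun t x => (1 + t * F x ^ 2) • Φ x with hG
  set F2 : E3 → ℂ := fun x => (F x ^ 2) • Φ x with hF2
  have cG : ContDiff ℝ 1 (G (-κ)) := by simp only [hG]; fun_prop
  have cF2 : ContDiff ℝ 1 F2 := by simp only [hF2]; fun_prop
  have cF : ContDiff ℝ 1 (fun x => F x • Φ x) := by fun_prop
  have cc := hΦ.continuous
  have cf := hF.continuous
  have cg := g2_cont hF
  have iA : Integrable (fun x => F x ^ 2 * ‖Φ x‖ ^ 2) mu3 := ci (by fun_prop)
  have iD : Integrable (fun x => g2 F x * ‖Φ x‖ ^ 2) mu3 := ci (by fun_prop)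
  have iN : Integrable (fun x => ‖Φ x‖ ^ 2) mu3 := ci (by fun_prop)
  have iQ : Integrable (magEnergyDensity B Φ) mu3 := ci (dens_cont hΦ B)
  have iQF : Integrable (magEnergyDensity B fun x => F x • Φ x) mu3 := ci (dens_cont cF B)
  have iQ2 : Integrable (magEnergyDensity B F2) mu3 := ci (dens_cont cF2 B)
  have e1 : qB B (G (-κ)) = qB B Φ + 2 * (-κ) * (qB B (fun x => F x • Φ x) - ∫ x in ball3, g2 F x * ‖Φ x‖ ^ 2) + (-κ) ^ 2 * qB B F2 := by
    unfold qB
    have j1 : Integrable (fun x => 2 * (-κ) * (magEnergyDensity B (fun x => F x • Φ x) x - g2 F x * ‖Φ x‖ ^ 2)) mu3 := (iQF.sub iD).const_mul _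
    have j2 : Integrable (fun x => magEnergyDensity B Φ x + 2 * (-κ) * (magEnergyDensity B (fun x => F x • Φ x) x - g2 F x * ‖Φ x‖ ^ 2)) mu3 := iQ.add j1
    rw [← integral_sub iQF iD, ← integral_const_mul, ← integral_add iQ j1, ← integral_const_mul, ← integral_add j2 (iQ2.const_mul _)]
    refine integral_congr_ae (Eventually.of_forall fun x => ?_)
    simp only [magEnergyDensity, Fin.sum_univ_three, g2]
    have d1 : DifferentiableAt ℝ (fun y => 1 + (-κ) * F y ^ 2) x := by have := dF x; fun_prop
    have d2 : DifferentiableAt ℝ (fun y => F y ^ 2) x := by have := dF x; fun_prop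
    simp only [hG, hF2, magD_smul d1 (dΦ x), magD_smul d2 (dΦ x), magD_smul (dF x) (dΦ x), df_t (dF x), df_sq (dF x), cpx1]
    ring
  have e2 : qB B F2 ≤ 2 * K ^ 4 * (lambda1H B + 1) + 8 * K ^ 4 := by
    have h1 : qB B F2 ≤ ∫ x in ball3, (2 * K ^ 4 * magEnergyDensity B Φ x + 8 * K ^ 4 * ‖Φ x‖ ^ 2) := by
      refine integral_mono_ae iQ2 ((iQ.const_mul _).add (iN.const_mul _)) ?_
      filter_upwards [ae_ss] with x hx
      have d2 : DifferentiableAt ℝ (fun y => F y ^ 2) x := by have := dF x; fun_prop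
      have hg := hK' x hx.1 hx.2
      simp only [magEnergyDensity, Fin.sum_univ_three]
      simp only [hF2, magD_smul d2 (dΦ x), df_sq (dF x)]
      have a0 := cpx2 (magD B Φ 0 x) (Φ x) (F x) (df F 0 x) K (hK x)
      have a1 := cpx2 (magD B Φ 1 x) (Φ x) (F x) (df F 1 x) K (hK x)
      have a2 := cpx2 (magD B Φ 2 x) (Φ x) (F x) (df F 2 x) K (hK x)
      have a3 : 8 * K ^ 2 * (g2 F x * ‖Φ x‖ ^ 2) ≤ 8 * K ^ 2 * (K ^ 2 * ‖Φ x‖ ^ 2) := by gcongr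
      unfold g2 at a3
      linarith
    rw [integral_add (iQ.const_mul _) (iN.const_mul _), integral_const_mul, integral_const_mul] at h1
    change _ ≤ 2 * K ^ 4 * qB B Φ + 8 * K ^ 4 * n2 Φ at h1
    rw [hn] at h1
    have : 2 * K ^ 4 * qB B Φ ≤ 2 * K ^ 4 * (lambda1H B + 1) := by gcongr; nlinarith
    linarith
  have e3 : 1 + 2 * (-κ) * (∫ x in ball3, F x ^ 2 * ‖Φ x‖ ^ 2) ≤ n2 (G (-κ)) := by
    rw [← hn]; unfold n2
    rw [← integral_const_mul, ← integral_add iN (iA.const_mul _)]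
    refine integral_mono_ae (iN.add (iA.const_mul _)) (ci (cG.continuous.norm.pow 2)) (Eventually.of_forall fun x => ?_)
    simp only [hG, norm_smul, mul_pow, norm_eq_abs, sq_abs]
    nlinarith [mul_nonneg (sq_nonneg (κ * F x ^ 2)) (sq_nonneg ‖Φ x‖)]
  have e4 := lam_le (B := B) cG
  have e5 := mul_le_mul_of_nonneg_left e3 (lam_nonneg B)
  set Q := qB B (fun x => F x • Φ x)
  set I1 := ∫ x in ball3, F x ^ 2 * ‖Φ x‖ ^ 2
  set I2 := ∫ x in ball3, g2 F x * ‖Φ x‖ ^ 2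
  have e6 : 2 * κ * (Q - I2 - lambda1H B * I1) ≤ 2 * κ * (κ / 2 * (1 + qB B F2)) := by nlinarith only [e1, e4, e5, hq]
  have e7 := le_of_mul_le_mul_left e6 (by positivity)
  have e8 : κ / 2 * (1 + qB B F2) ≤ κ / 2 * (1 + (2 * K ^ 4 * (lambda1H B + 1) + 8 * K ^ 4)) := by gcongr
  linarith

theorem hasF_ss (x : E3) : HasFDerivAt ss ((2 * x 0) • (EuclideanSpace.proj (𝕜 := ℝ) (0 : Fin 3) : E3 →L[ℝ] ℝ)
    + (2 * x 1) • (EuclideanSpace.proj (𝕜 := ℝ) (1 : Fin 3) : E3 →L[ℝ] ℝ)) x := by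
  have h0 : HasFDerivAt (fun y : E3 => y 0) (EuclideanSpace.proj (𝕜 := ℝ) (0 : Fin 3) : E3 →L[ℝ] ℝ) x :=
    (EuclideanSpace.proj (𝕜 := ℝ) (0 : Fin 3) : E3 →L[ℝ] ℝ).hasFDerivAt
  have h1 : HasFDerivAt (fun y : E3 => y 1) (EuclideanSpace.proj (𝕜 := ℝ) (1 : Fin 3) : E3 →L[ℝ] ℝ) x :=
    (EuclideanSpace.proj (𝕜 := ℝ) (1 : Fin 3) : E3 →L[ℝ] ℝ).hasFDerivAt
  exact ((h0.pow 2).add (h1.pow 2)).congr_fderiv (by ext v; simp)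

theorem ss_cd {n : WithTop ℕ∞} : ContDiff ℝ n ss := by unfold ss; fun_prop

theorem hasF_rr {x : E3} (hx : 0 < ss x) : HasFDerivAt rr ((x 0 / rr x) • (EuclideanSpace.proj (𝕜 := ℝ) (0 : Fin 3) : E3 →L[ℝ] ℝ)
    + (x 1 / rr x) • (EuclideanSpace.proj (𝕜 := ℝ) (1 : Fin 3) : E3 →L[ℝ] ℝ)) x := by
  refine ((hasF_ss x).sqrt hx.ne').congr_fderiv ?_
  have := rr_pos hx
  change (1 / (2 * rr x)) • _ = _
  ext v; simp; field_simp

theorem Cut.cdr {K : ℝ} {p p' : ℝ → ℝ} (h : Cut K p p') : ContDiff ℝ 1 fun x => p (rr x) := by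
  have hp : ContDiff ℝ 1 p := by
    rw [contDiff_one_iff_deriv]
    exact ⟨fun x => (h.1 x).differentiableAt, by rw [show deriv p = p' from funext fun x => (h.1 x).deriv]; exact h.2.1⟩
  rw [contDiff_iff_contDiffAt]
  intro x
  rcases (ss_nonneg x).eq_or_lt with h0 | h0
  · refine (contDiffAt_const (c := p (1/8))).congr_of_eventuallyEq ?_
    have : ∀ᶠ y in 𝓝 x, rr y < 1/8 := rr_cont.continuousAt.eventually_lt_const (by simp [rr, ← h0])
    filter_upwards [this] with y hy using h.2.2.1 _ hy.le
  · exact hp.contDiffAt.comp x ((contDiffAt_sqrt h0.ne').comp x ss_cd.contDiffAt)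

theorem df_rad {K : ℝ} {p p' : ℝ → ℝ} (h : Cut K p p') {x : E3} (hx : 0 < ss x) :
    df (fun x => p (rr x)) 0 x = p' (rr x) * (x 0 / rr x) ∧ df (fun x => p (rr x)) 1 x = p' (rr x) * (x 1 / rr x)
    ∧ df (fun x => p (rr x)) 2 x = 0 := by
  have := ((h.1 (rr x)).comp_hasFDerivAt x (hasF_rr hx)).fderiv
  change fderiv ℝ (fun x => p (rr x)) x = _ at this
  unfold df
  rw [this]
  simp

theorem g2_rad {K : ℝ} {p p' : ℝ → ℝ} (h : Cut K p p') {x : E3} (hx : 0 < ss x) :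
    g2 (fun x => p (rr x)) x = p' (rr x) ^ 2 := by
  obtain ⟨a, b, c⟩ := df_rad h hx
  rw [g2, a, b, c]
  have h1 := rr_pos hx
  have h2 := rr_sq x
  unfold ss at h2
  field_simp
  rw [h2]; ring

/-- near-minimizer in mode form -/
structure NM (B κ : ℝ) (m : ℤ) (Φ : E3 → ℂ) : Prop where
  cd : ContDiff ℝ 1 Φ
  md : Mode m Φ
  n1 : n2 Φ = 1
  hq : qB B Φ ≤ lambda1H B + κ ^ 2

theorem NM.loc {B κ K τ : ℝ} {m : ℤ} {Φ : E3 → ℂ} (h : NM B κ m Φ) (hκ : 0 < κ) (hκ1 : κ ≤ 1)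
    (hτ : κ / 2 * (1 + (2 * K ^ 4 * (lambda1H B + 1) + 8 * K ^ 4)) ≤ τ) {p p' : ℝ → ℝ} (hp : Cut K p p') :
    qB B (fun x => p (rr x) • Φ x) ≤ lambda1H B * (∫ r, p r ^ 2 ∂(nuM Φ)) + (∫ r, p' r ^ 2 ∂(nuM Φ)) + τ := by
  have h1 := _root_.loc h.cd hp.cdr h.n1 hκ hκ1 h.hq (fun x => (hp.2.2.2 (rr x)).1) (fun x _ hx => by
    rw [g2_rad hp hx]; exact sq_le_sq' (by linarith [neg_abs_le (p' (rr x)), (hp.2.2.2 (rr x)).2]) ((le_abs_self _).trans (hp.2.2.2 (rr x)).2))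
  have hc := hp.c
  have hc' := hp.2.1
  rw [nuM_int h.cd.continuous (f := fun r => p r ^ 2) (by fun_prop), nuM_int h.cd.continuous (f := fun r => p' r ^ 2) (by fun_prop)]
  have e : ∫ x in ball3, g2 (fun x => p (rr x)) x * ‖Φ x‖ ^ 2 = ∫ x in ball3, p' (rr x) ^ 2 * ‖Φ x‖ ^ 2 := by
    refine integral_congr_ae ?_
    filter_upwards [ae_ss] with x hx
    rw [g2_rad hp hx.2]
  rw [e] at h1
  linarith

theorem Mode.rad {K : ℝ} {m : ℤ} {Φ : E3 → ℂ} (hm : Mode m Φ) (h : ContDiff ℝ 1 Φ) {p p' : ℝ → ℝ} (hp : Cut K p p') :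
    Mode m fun x => p (rr x) • Φ x := by
  intro x
  have e := fun j => dd_smul (hp.cdr.differentiable one_ne_zero x) (h.differentiable one_ne_zero x) j
  dsimp only
  rw [e, e, Complex.real_smul]
  have h1 := hm x
  have h2 : x 0 * df (fun x => p (rr x)) 1 x - x 1 * df (fun x => p (rr x)) 0 x = 0 := by
    rcases (ss_nonneg x).eq_or_lt with h0 | h0
    · have a : x 0 = 0 := by unfold ss at h0; nlinarith [sq_nonneg (x 0), sq_nonneg (x 1)]
      have b : x 1 = 0 := by unfold ss at h0; nlinarith [sq_nonneg (x 0), sq_nonneg (x 1)]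
      rw [a, b]; ring
    · obtain ⟨a, b, c⟩ := df_rad hp h0
      rw [a, b]; ring
  have h3 := congrArg (fun t : ℝ => (t : ℂ)) h2
  push_cast at h3
  linear_combination (p (rr x) : ℂ) * h1 + Φ x * h3
end

section
def zL : E3 →L[ℝ] ℂ := Complex.ofRealCLM.comp (EuclideanSpace.proj (𝕜 := ℝ) (0 : Fin 3) : E3 →L[ℝ] ℝ)
  - Complex.I • Complex.ofRealCLM.comp (EuclideanSpace.proj (𝕜 := ℝ) (1 : Fin 3) : E3 →L[ℝ] ℝ)
theorem zL_ap (x : E3) : zL x = (x 0 : ℂ) - Complex.I * (x 1 : ℂ) := by simp [zL]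
def ww (x : E3) : ℂ := (rr x)⁻¹ • zL x

theorem zL_norm (x : E3) : ‖zL x‖ = rr x := by
  rw [zL_ap, rr, ss, Complex.norm_def, Complex.normSq_apply]
  congr 1
  simp; ring

theorem ww_norm {x : E3} (hx : 0 < ss x) : ‖ww x‖ = 1 := by
  have := rr_pos hx
  rw [ww, norm_smul, zL_norm, norm_inv, norm_eq_abs, abs_of_pos this, inv_mul_cancel₀ this.ne']

theorem ww_ne {x : E3} (hx : 0 < ss x) : ww x ≠ 0 := by
  intro h; have := ww_norm hx; rw [h] at this; simp at this

theorem ww_cd {x : E3} (hx : 0 < ss x) : ContDiffAt ℝ 1 ww x := by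
  have : ContDiffAt ℝ 1 rr x := (contDiffAt_sqrt hx.ne').comp x ss_cd.contDiffAt
  exact (this.inv (rr_pos hx).ne').smul zL.contDiff.contDiffAt

theorem ww_dd {x : E3} (hx : 0 < ss x) : (x 0 : ℂ) * dd ww 1 x - (x 1 : ℂ) * dd ww 0 x = -Complex.I * ww x ∧
    (x 0 : ℂ) * dd ww 0 x + (x 1 : ℂ) * dd ww 1 x = 0 ∧ dd ww 2 x = 0 := by
  have hr := rr_pos hx
  have h0 := (hasDerivAt_inv hr.ne').comp_hasFDerivAt x (hasF_rr hx)
  change HasFDerivAt (fun y => (rr y)⁻¹) _ x at h0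
  have e := fun j => dd_smul (F := fun y => (rr y)⁻¹) (Φ := zL) h0.differentiableAt zL.differentiableAt j
  have e1 : ∀ j, dd zL j x = zL (ee j) := fun j => by unfold dd; rw [zL.fderiv]
  have e2 : ∀ j, df (fun y => (rr y)⁻¹) j x = _ := fun j => by unfold df; rw [h0.fderiv]
  have e3 : ∀ j, dd ww j x = _ := e
  rw [e3, e3, e3, e1, e1, e1, e2, e2, e2]
  have hs : (x 0 : ℂ) ^ 2 + (x 1 : ℂ) ^ 2 = (rr x : ℂ) ^ 2 := by
    have : x 0 ^ 2 + x 1 ^ 2 = rr x ^ 2 := (rr_sq x).symm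
    exact_mod_cast this
  have hr' : (rr x : ℂ) ≠ 0 := by exact_mod_cast hr.ne'
  simp [zL_ap, ww]
  constructor
  · field_simp; ring_nf; rw [Complex.I_sq]; ring
  · field_simp; linear_combination ((x 0 : ℂ) - Complex.I * (x 1 : ℂ)) * (-hs)

theorem wz_cd {x : E3} (hx : 0 < ss x) (k : ℤ) : ContDiffAt ℝ 1 (fun y => ww y ^ k) x := by
  have h := ww_cd hx
  rcases k with n | n
  · simpa using h.pow n
  · simp only [zpow_negSucc]
    exact (h.pow _).inv (pow_ne_zero _ (ww_ne hx))

theorem wz_dd {x : E3} (hx : 0 < ss x) (k : ℤ) (j : Fin 3) : dd (fun y => ww y ^ k) j x = k * ww x ^ (k - 1) * dd ww j x := by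
  have h1 := (hasDerivAt_zpow k (ww x) (Or.inl (ww_ne hx))).hasFDerivAt.restrictScalars ℝ
  have h2 := h1.comp x ((ww_cd hx).differentiableAt one_ne_zero).hasFDerivAt
  have h3 : fderiv ℝ (fun y => ww y ^ k) x = _ := h2.fderiv
  unfold dd; rw [h3]; simp; ring

theorem dd_mul {F : E3 → ℂ} {Φ : E3 → ℂ} {x : E3} (hF : DifferentiableAt ℝ F x) (hΦ : DifferentiableAt ℝ Φ x) (j : Fin 3) :
    dd (fun y => F y * Φ y) j x = F x * dd Φ j x + dd F j x * Φ x := by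
  unfold dd
  rw [show fderiv ℝ (fun y => F y * Φ y) x = _ from (hF.hasFDerivAt.mul hΦ.hasFDerivAt).fderiv]
  simp; ring

theorem twist {m : ℤ} {Ψ : E3 → ℂ} (hm : Mode m Ψ) (h : ContDiff ℝ 1 Ψ) (h0 : ∀ x, rr x < 1/8 → Ψ x = 0) (k : ℤ) :
    ∃ Ψ' : E3 → ℂ, ContDiff ℝ 1 Ψ' ∧ Mode (m + k) Ψ' ∧ ∀ x, 0 < ss x → ‖Ψ' x‖ = ‖Ψ x‖ ∧ SS Ψ' x = SS Ψ x := by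
  have key : ∀ x, 0 < ss x → ∀ j, dd (fun x => ww x ^ k * Ψ x) j x = ww x ^ k * dd Ψ j x + k * ww x ^ (k - 1) * dd ww j x * Ψ x := by
    intro x hx j
    rw [dd_mul ((wz_cd hx k).differentiableAt one_ne_zero) (h.differentiable one_ne_zero x), wz_dd hx]
  have hz : ∀ x, ss x = 0 → (fun x => ww x ^ k * Ψ x) =ᶠ[𝓝 x] fun _ => 0 := by
    intro x hx
    have : ∀ᶠ y in 𝓝 x, rr y < 1/8 := rr_cont.continuousAt.eventually_lt_const (by simp [rr, hx])
    filter_upwards [this] with y hy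
    rw [h0 y hy, mul_zero]
  have hwn : ∀ x, 0 < ss x → ‖ww x ^ k‖ = 1 := fun x hx => by rw [norm_zpow, ww_norm hx, one_zpow]
  refine ⟨fun x => ww x ^ k * Ψ x, ?_, ?_, ?_⟩
  · rw [contDiff_iff_contDiffAt]
    intro x
    rcases (ss_nonneg x).eq_or_lt with hx | hx
    · exact contDiffAt_const.congr_of_eventuallyEq (hz x hx.symm)
    · exact (wz_cd hx k).mul h.contDiffAt
  · intro x
    rcases (ss_nonneg x).eq_or_lt with hx | hx
    · have e : ∀ j, dd (fun x => ww x ^ k * Ψ x) j x = 0 := fun j => by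
        unfold dd; rw [(hz x hx.symm).fderiv_eq]; simp
      dsimp only
      rw [e, e, show ww x ^ k * Ψ x = 0 from (hz x hx.symm).self_of_nhds]; simp
    · have h1 := hm x
      obtain ⟨a, b, c⟩ := ww_dd hx
      rw [key x hx, key x hx]
      have e : ww x ^ k = ww x ^ (k - 1) * ww x := by rw [← zpow_add_one₀ (ww_ne hx)]; simp
      push_cast
      linear_combination ww x ^ k * h1 + k * ww x ^ (k - 1) * Ψ x * a + (Complex.I * k * Ψ x) * e
  · intro x hx
    obtain ⟨a, b, c⟩ := ww_dd hx
    refine ⟨by rw [norm_mul, hwn x hx, one_mul], ?_⟩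
    have e1 : (x 0 : ℂ) * dd (fun x => ww x ^ k * Ψ x) 0 x + (x 1 : ℂ) * dd (fun x => ww x ^ k * Ψ x) 1 x
        = ww x ^ k * ((x 0 : ℂ) * dd Ψ 0 x + (x 1 : ℂ) * dd Ψ 1 x) := by
      rw [key x hx, key x hx]; linear_combination k * ww x ^ (k - 1) * Ψ x * b
    have e2 : dd (fun x => ww x ^ k * Ψ x) 2 x = ww x ^ k * dd Ψ 2 x := by rw [key x hx, c]; ring
    rw [SS, SS, e1, e2, norm_mul, norm_mul, hwn x hx, one_mul, one_mul]

theorem NM.c2 {B κ K τ : ℝ} {m : ℤ} {Φ : E3 → ℂ} (h : NM B κ m Φ) (hκ : 0 < κ) (hκ1 : κ ≤ 1)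
    (hτ : κ / 2 * (1 + (2 * K ^ 4 * (lambda1H B + 1) + 8 * K ^ 4)) ≤ τ) {p p' : ℝ → ℝ} (hp : Cut K p p') :
    ∫ r, pim B m r ^ 2 * p r ^ 2 ∂(nuM Φ) ≤ lambda1H B * (∫ r, p r ^ 2 ∂(nuM Φ)) + (∫ r, p' r ^ 2 ∂(nuM Φ)) + τ := by
  refine le_trans ?_ (h.loc hκ hκ1 hτ hp)
  have hc := hp.c
  have hpm := pim_meas B m
  rw [nuM_int h.cd.continuous (by fun_prop)]
  have hC : ContDiff ℝ 1 fun x => p (rr x) • Φ x := hp.cdr.smul h.cd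
  refine integral_mono_of_nonneg (Eventually.of_forall fun x => by positivity) (ci (dens_cont hC B)) ?_
  filter_upwards [ae_ss] with x hx
  rw [dens_eq (h.md.rad h.cd hp) hx.2, norm_smul, mul_pow, norm_eq_abs, sq_abs]
  have : 0 ≤ SS (fun x => p (rr x) • Φ x) x := by have := hx.2; unfold SS; positivity
  linarith

theorem NM.fd {B κ K τ : ℝ} {m : ℤ} {Φ : E3 → ℂ} (h : NM B κ m Φ) (hκ : 0 < κ) (hκ1 : κ ≤ 1)
    (hτ : κ / 2 * (1 + (2 * K ^ 4 * (lambda1H B + 1) + 8 * K ^ 4)) ≤ τ) {p p' : ℝ → ℝ} (hp : Cut K p p') (hp0 : p (1/8) = 0)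
    (B' : ℝ) (k : ℤ) : lambda1H B' * (∫ r, p r ^ 2 ∂(nuM Φ)) ≤ lambda1H B * (∫ r, p r ^ 2 ∂(nuM Φ)) + (∫ r, p' r ^ 2 ∂(nuM Φ)) + τ
      + ∫ r, ((pim B m r + (B' - B) * r / 2 - k / r) ^ 2 - pim B m r ^ 2) * p r ^ 2 ∂(nuM Φ) := by
  have h1 := h.loc hκ hκ1 hτ hp
  have hc := hp.c
  have hpm := pim_meas B m
  have hC : ContDiff ℝ 1 fun x => p (rr x) • Φ x := hp.cdr.smul h.cd
  have hM := h.md.rad h.cd hp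
  obtain ⟨Ψ, c1, c2, c3⟩ := twist hM hC (fun x hx => by rw [hp.2.2.1 _ hx.le, hp0, zero_smul]) k
  have e0 : n2 Ψ = ∫ r, p r ^ 2 ∂(nuM Φ) := by
    rw [nuM_int h.cd.continuous (by fun_prop)]
    refine integral_congr_ae ?_
    filter_upwards [ae_ss] with x hx
    rw [(c3 x hx.2).1, norm_smul, mul_pow, norm_eq_abs, sq_abs]
  have e1 : qB B' Ψ - qB B (fun x => p (rr x) • Φ x) = ∫ r, ((pim B m r + (B' - B) * r / 2 - k / r) ^ 2 - pim B m r ^ 2) * p r ^ 2 ∂(nuM Φ) := by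
    rw [nuM_int h.cd.continuous (by fun_prop), qB, qB, ← integral_sub (ci (dens_cont c1 B')) (ci (dens_cont hC B))]
    refine integral_congr_ae ?_
    filter_upwards [ae_ss] with x hx
    rw [dens_eq c2 hx.2, dens_eq hM hx.2, (c3 x hx.2).1, (c3 x hx.2).2, norm_smul, mul_pow, norm_eq_abs, sq_abs]
    have : pim B' (m + k) (rr x) = pim B m (rr x) + (B' - B) * rr x / 2 - k / rr x := by unfold pim; push_cast; ring
    rw [this]; ring
  have h2 := lam_le (B := B') c1
  rw [e0] at h2
  linarith
end

section
theorem sg_ex : ∃ (K : ℝ) (σ σ' : ℝ → ℝ), 0 ≤ K ∧ ContDiff ℝ 1 σ ∧ (∀ x, HasDerivAt σ (σ' x) x) ∧ (∀ t, t ≤ 0 → σ t = 0 ∧ σ' t = 0) ∧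
    (∀ t, 1 ≤ t → σ t = 1 ∧ σ' t = 0) ∧ (∀ t, 0 ≤ σ t ∧ σ t ≤ 1) ∧ ∀ t, 0 ≤ σ' t ∧ σ' t ≤ K := by
  have hc : ContDiff ℝ 1 Real.smoothTransition := Real.smoothTransition.contDiff
  have h0 : ∀ t : ℝ, t ≤ 0 → deriv Real.smoothTransition t = 0 := fun t ht =>
    IsLocalMin.deriv_eq_zero (Eventually.of_forall fun y => by
      rw [Real.smoothTransition.zero_of_nonpos ht]; exact Real.smoothTransition.nonneg y)
  have h1 : ∀ t : ℝ, 1 ≤ t → deriv Real.smoothTransition t = 0 := fun t ht =>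
    IsLocalMax.deriv_eq_zero (Eventually.of_forall fun y => by
      rw [Real.smoothTransition.one_of_one_le ht]; exact Real.smoothTransition.le_one y)
  obtain ⟨K, hK⟩ := (isCompact_Icc (a := (0:ℝ)) (b := 1)).exists_bound_of_continuousOn (hc.continuous_deriv le_rfl).continuousOn
  have hK0 : 0 ≤ K := (norm_nonneg _).trans (hK 0 (by simp))
  refine ⟨K, Real.smoothTransition, deriv Real.smoothTransition, hK0, hc, fun x => (hc.differentiable one_ne_zero x).hasDerivAt,
    fun t ht => ⟨Real.smoothTransition.zero_of_nonpos ht, h0 t ht⟩, fun t ht => ⟨Real.smoothTransition.one_of_one_le ht, h1 t ht⟩,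
    fun t => ⟨Real.smoothTransition.nonneg t, Real.smoothTransition.le_one t⟩,
    fun t => ⟨Real.smoothTransition.monotone.deriv_nonneg, ?_⟩⟩
  rcases le_total t 0 with h | h
  · rw [h0 t h]; exact hK0
  rcases le_total 1 t with h' | h'
  · rw [h1 t h']; exact hK0
  exact (le_abs_self _).trans (hK t ⟨h, h'⟩)

theorem int_df {Y : E3 → ℝ} (hC : ContDiff ℝ 1 Y) (hs : ∀ x, x ∉ ball3 → Y x = 0) (j : Fin 3) :
    Integrable (df Y j) ∧ ∫ x, df Y j x = 0 := by
  have h1 : HasCompactSupport Y := HasCompactSupport.intro (isCompact_closedBall (0:E3) 1)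
    fun x hx => hs x fun h => hx (Metric.ball_subset_closedBall h)
  have i1 : Integrable (df Y j) := (df_cont hC j).integrable_of_hasCompactSupport (h1.fderiv_apply ℝ _)
  have i2 : Integrable Y := hC.continuous.integrable_of_hasCompactSupport h1
  refine ⟨i1, ?_⟩
  have := integral_mul_fderiv_eq_neg_fderiv_mul_of_integrable (μ := (volume : Measure E3)) (f := fun _ : E3 => (1:ℝ)) (g := Y) (v := ee j)
    (by simp) (by simp only [one_mul]; exact i1) (by simpa using i2) (fun x _ => by fun_prop) (fun x _ => hC.differentiable one_ne_zero x)
  simpa [df] using this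

def HG (f : E3 → ℝ) (x : E3) (g : Fin 3 → ℝ) : Prop := DifferentiableAt ℝ f x ∧ ∀ j, df f j x = g j

theorem HG.mul {f h : E3 → ℝ} {x : E3} {f' h' : Fin 3 → ℝ} (hf : HG f x f') (hh : HG h x h') :
    HG (fun y => f y * h y) x fun j => f x * h' j + f' j * h x := by
  have := hf.1.hasFDerivAt.mul hh.1.hasFDerivAt
  refine ⟨this.differentiableAt, fun j => ?_⟩
  dsimp only
  rw [← hf.2 j, ← hh.2 j]; unfold df
  rw [show fderiv ℝ (fun y => f y * h y) x = _ from this.fderiv]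
  simp; ring

theorem HG.add {f h : E3 → ℝ} {x : E3} {f' h' : Fin 3 → ℝ} (hf : HG f x f') (hh : HG h x h') :
    HG (fun y => f y + h y) x fun j => f' j + h' j := by
  have := hf.1.hasFDerivAt.add hh.1.hasFDerivAt
  refine ⟨this.differentiableAt, fun j => ?_⟩
  dsimp only
  rw [← hf.2 j, ← hh.2 j]; unfold df
  rw [show fderiv ℝ (fun y => f y + h y) x = _ from this.fderiv]
  simp

theorem HG.comp {f : E3 → ℝ} {φ : ℝ → ℝ} {c : ℝ} {x : E3} {f' : Fin 3 → ℝ} (hφ : HasDerivAt φ c (f x)) (hf : HG f x f') :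
    HG (fun y => φ (f y)) x fun j => c * f' j := by
  have := hφ.comp_hasFDerivAt x hf.1.hasFDerivAt
  refine ⟨this.differentiableAt, fun j => ?_⟩
  dsimp only
  rw [← hf.2 j]; unfold df
  rw [show fderiv ℝ (fun y => φ (f y)) x = _ from this.fderiv]
  simp

theorem HG.crd (i : Fin 3) (x : E3) : HG (fun y => y i) x fun j => if j = i then 1 else 0 := by
  have : HasFDerivAt (fun y : E3 => y i) (EuclideanSpace.proj (𝕜 := ℝ) i : E3 →L[ℝ] ℝ) x :=
    (EuclideanSpace.proj (𝕜 := ℝ) i : E3 →L[ℝ] ℝ).hasFDerivAt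
  refine ⟨this.differentiableAt, fun j => ?_⟩
  unfold df; rw [this.fderiv]; simp [eq_comm]

theorem HG.ss (x : E3) : HG ss x ![2 * x 0, 2 * x 1, 0] := by
  refine ⟨(hasF_ss x).differentiableAt, fun j => ?_⟩
  unfold df; rw [(hasF_ss x).fderiv]; fin_cases j <;> simp

theorem HG.rr {x : E3} (hx : 0 < _root_.ss x) : HG rr x ![x 0 / _root_.rr x, x 1 / _root_.rr x, 0] := by
  refine ⟨(hasF_rr hx).differentiableAt, fun j => ?_⟩
  unfold df; rw [(hasF_rr hx).fderiv]; fin_cases j <;> simp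

theorem HG.nsq {Ψ : E3 → ℂ} (h : ContDiff ℝ 1 Ψ) (x : E3) :
    HG (fun y => ‖Ψ y‖ ^ 2) x fun j => 2 * ((Ψ x).re * (dd Ψ j x).re + (Ψ x).im * (dd Ψ j x).im) := by
  have := (h.differentiable one_ne_zero x).hasFDerivAt.norm_sq
  refine ⟨this.differentiableAt, fun j => ?_⟩
  unfold df dd; rw [this.fderiv]
  simp [Complex.inner]
  ring

/-- 2 Re(conj Ψ (a V + c W)) bound -/
theorem vb (Ψ V W : ℂ) (a c z s : ℝ) (hs : 0 < s) :
    2 * (Ψ.re * (a * V.re + c * z * W.re) + Ψ.im * (a * V.im + c * z * W.im)) ≤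
      ‖V‖ ^ 2 / s + ‖W‖ ^ 2 + (a ^ 2 * s + c ^ 2 * z ^ 2) * ‖Ψ‖ ^ 2 := by
  have e : ‖V‖ ^ 2 / s + a ^ 2 * s * ‖Ψ‖ ^ 2 - 2 * (Ψ.re * (a * V.re) + Ψ.im * (a * V.im)) =
      ((V.re - a * s * Ψ.re) ^ 2 + (V.im - a * s * Ψ.im) ^ 2) / s := by
    simp only [Complex.sq_norm, Complex.normSq_apply]; field_simp; ring
  have e1 : 0 ≤ ((V.re - a * s * Ψ.re) ^ 2 + (V.im - a * s * Ψ.im) ^ 2) / s := by positivity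
  have e2 : ‖W‖ ^ 2 + c ^ 2 * z ^ 2 * ‖Ψ‖ ^ 2 - 2 * (Ψ.re * (c * z * W.re) + Ψ.im * (c * z * W.im)) =
     (W.re - c * z * Ψ.re) ^ 2 + (W.im - c * z * Ψ.im) ^ 2 := by
    simp only [Complex.sq_norm, Complex.normSq_apply]; ring
  nlinarith [sq_nonneg (W.re - c * z * Ψ.re), sq_nonneg (W.im - c * z * Ψ.im)]

section
variable (B : ℝ) (m : ℤ) (H : ℝ → ℝ)
def Xf (x : E3) : ℝ := xxm B m (rr x)
def qf (x : E3) : ℝ := H (Xf B m x) + Xf B m x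
def cf (x : E3) : ℝ := -√B * rr x * qf B m H x
def af (x : E3) : ℝ := √B * (Xf B m x * (rr x)⁻¹) + cf B m H x
def et (σ : ℝ → ℝ) (ε : ℝ) (x : E3) : ℝ := σ (ss x / ε - 1) * σ ((1 - (ss x + x 2 ^ 2)) / ε)
def Yf (σ : ℝ → ℝ) (ε : ℝ) (Ψ : E3 → ℂ) (j : Fin 3) (x : E3) : ℝ :=
  et σ ε x * (‖Ψ x‖ ^ 2 * (![af B m H x, af B m H x, cf B m H x] j * x j))
end

variable {B : ℝ} {m : ℤ} {H H' : ℝ → ℝ}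

theorem HG.Xf {x : E3} (hB : 0 < B) (hx : 0 < _root_.ss x) : HG (Xf B m) x fun j =>
    (-√B * (1 + 1 / √B * _root_.Xf B m x / _root_.rr x)) * ![x 0 / _root_.rr x, x 1 / _root_.rr x, 0] j :=
  HG.comp (xxm_deriv hB (rr_pos hx).ne') (HG.rr hx)

theorem HG.cst (c : ℝ) (x : E3) : HG (fun _ => c) x fun _ => 0 :=
  ⟨by fun_prop, fun j => by simp [df]⟩

theorem HG.inv {x : E3} (hx : 0 < _root_.ss x) : HG (fun y => (_root_.rr y)⁻¹) x fun j =>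
    (-(_root_.rr x ^ 2)⁻¹) * ![x 0 / _root_.rr x, x 1 / _root_.rr x, 0] j :=
  HG.comp (hasDerivAt_inv (rr_pos hx).ne') (HG.rr hx)

theorem div_f {K : ℝ} (hB : 0 < B) (hH : AdmK K H H') {σ σ' : ℝ → ℝ} (hσ : ∀ t, HasDerivAt σ (σ' t) t) {ε : ℝ} (hε : 0 < ε)
    {Ψ : E3 → ℂ} (h : ContDiff ℝ 1 Ψ) {x : E3} (hx : 0 < ss x) :
    df (Yf B m H σ ε Ψ 0) 0 x + df (Yf B m H σ ε Ψ 1) 1 x + df (Yf B m H σ ε Ψ 2) 2 x =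
     (σ' (ss x / ε - 1) * σ ((1 - (ss x + x 2 ^ 2)) / ε) * (2 * (ss x / ε) * af B m H x) -
      σ (ss x / ε - 1) * σ' ((1 - (ss x + x 2 ^ 2)) / ε) * (2 / ε * (√B * rr x * (-H (Xf B m x) + qf B m H x * (1 - (ss x + x 2 ^ 2)))))) * ‖Ψ x‖ ^ 2
     + et σ ε x * (2 * ((Ψ x).re * (af B m H x * ((x 0 : ℂ) * dd Ψ 0 x + (x 1 : ℂ) * dd Ψ 1 x).re + cf B m H x * x 2 * (dd Ψ 2 x).re)
        + (Ψ x).im * (af B m H x * ((x 0 : ℂ) * dd Ψ 0 x + (x 1 : ℂ) * dd Ψ 1 x).im + cf B m H x * x 2 * (dd Ψ 2 x).im)))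
     + et σ ε x * ‖Ψ x‖ ^ 2 * (-B - 4 * √B * rr x * qf B m H x + B * rr x ^ 2 * (H' (Xf B m x) + 1) + √B * rr x * Xf B m x * (H' (Xf B m x) + 1)) := by
  have hr := rr_pos hx
  have hX := HG.Xf (m := m) hB hx
  have hq := (HG.comp (φ := H) (hH.1 (Xf B m x)) hX).add hX
  have hc := ((HG.rr hx).mul hq).mul (HG.cst (-√B) x)
  have ha := ((hX.mul (HG.inv hx)).mul (HG.cst (√B) x)).add hc
  have d1 : HasDerivAt (fun s => σ (s / ε - 1)) (σ' (ss x / ε - 1) * (1 / ε)) (ss x) :=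
    HasDerivAt.comp (h₂ := σ) (h := fun s => s / ε - 1) (ss x) (hσ _) (((hasDerivAt_id (ss x)).div_const ε).sub_const 1)
  have d2 : HasDerivAt (fun s => σ ((1 - s) / ε)) (σ' ((1 - (ss x + x 2 * x 2)) / ε) * (-1 / ε)) (ss x + x 2 * x 2) :=
    HasDerivAt.comp (h₂ := σ) (h := fun s => (1 - s) / ε) (ss x + x 2 * x 2) (hσ _) (((hasDerivAt_id (ss x + x 2 * x 2)).const_sub 1).div_const ε)
  have h1 := HG.comp (φ := fun s => σ (s / ε - 1)) d1 (HG.ss x)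
  have h2 := HG.comp (φ := fun s => σ ((1 - s) / ε)) d2 ((HG.ss x).add ((HG.crd 2 x).mul (HG.crd 2 x)))
  have he := h1.mul h2
  have hN := HG.nsq h x
  have k : ∀ A : E3 → ℝ, ∀ j : Fin 3, (fun y : E3 => et σ ε y * (‖Ψ y‖ ^ 2 * (A y * y j))) = fun y => (σ (ss y / ε - 1) * σ ((1 - (ss y + y 2 * y 2)) / ε)) * (‖Ψ y‖ ^ 2 * (A y * y j)) := by
    intro A j; ext y; rw [et, pow_two (y 2)]
  have ec : cf B m H = _ := funext fun y => show cf B m H y = rr y * (H (Xf B m y) + Xf B m y) * (-√B) by unfold cf qf; ring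
  have ea : af B m H = _ := funext fun y => show af B m H y = Xf B m y * (rr y)⁻¹ * √B + rr y * (H (Xf B m y) + Xf B m y) * (-√B) by unfold af cf qf; ring
  have k0 := (he.mul (hN.mul (ha.mul (HG.crd 0 x)))).2 0
  have k1 := (he.mul (hN.mul (ha.mul (HG.crd 1 x)))).2 1
  have k2 := (he.mul (hN.mul (hc.mul (HG.crd 2 x)))).2 2
  rw [← k] at k0 k1 k2
  rw [show Yf B m H σ ε Ψ 0 = fun y : E3 => et σ ε y * (‖Ψ y‖ ^ 2 * (af B m H y * y 0)) from rfl,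
    show Yf B m H σ ε Ψ 1 = fun y : E3 => et σ ε y * (‖Ψ y‖ ^ 2 * (af B m H y * y 1)) from rfl,
    show Yf B m H σ ε Ψ 2 = fun y : E3 => et σ ε y * (‖Ψ y‖ ^ 2 * (cf B m H y * y 2)) from rfl, ea, ec]
  rw [k0, k1, k2]
  simp only [et, pow_two (x 2)]
  unfold qf
  generalize σ ((1 - (ss x + x 2 * x 2)) / ε) = s1
  generalize σ' ((1 - (ss x + x 2 * x 2)) / ε) = s2
  generalize σ (ss x / ε - 1) = s3
  generalize σ' (ss x / ε - 1) = s4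
  generalize H' (Xf B m x) = q'
  generalize H (Xf B m x) = q
  generalize Xf B m x = X
  generalize ‖Ψ x‖ = N
  rw [← rr_sq x]
  have e2 : x 0 ^ 2 = rr x ^ 2 - x 1 ^ 2 := by rw [rr_sq]; unfold ss; ring
  generalize rr x = r at *
  generalize x 0 = u at *
  generalize x 1 = v at *
  generalize x 2 = w at *
  have hs : 0 < √B := sqrt_pos.2 hB
  have hB2 : B = √B ^ 2 := (sq_sqrt hB.le).symm
  generalize √B = b at *
  subst hB2
  simp
  linear_combination (norm := (field_simp; ring)) (N ^ 2 * (X / r * b - r * (q + X) * b) * (2 * s4 * s1 / ε - 2 * s3 * s2 / ε)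
    + s3 * s1 * N ^ 2 * (b * (-b * (1 + X / (b * r)) / r - X / r ^ 2) - b * ((q + X) + r * (q' + 1) * (-b - X / r))) / r) * e2
end

section
section
variable {B : ℝ} {m : ℤ} {H H' : ℝ → ℝ} {K : ℝ}

theorem Y_cd (hH : AdmK K H H') {σ : ℝ → ℝ} (hσ : ContDiff ℝ 1 σ) (h0 : ∀ t, t ≤ 0 → σ t = 0) {ε : ℝ} (hε : 0 < ε)
    {Ψ : E3 → ℂ} (h : ContDiff ℝ 1 Ψ) (j : Fin 3) : ContDiff ℝ 1 (Yf B m H σ ε Ψ j) := by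
  have cH : ContDiff ℝ 1 H := by
    rw [contDiff_one_iff_deriv]
    exact ⟨fun x => (hH.1 x).differentiableAt, by rw [show deriv H = H' from funext fun x => (hH.1 x).deriv]; exact hH.2.1⟩
  rw [contDiff_iff_contDiffAt]
  intro x
  rcases (ss_nonneg x).eq_or_lt with hx | hx
  · refine (contDiffAt_const (c := (0:ℝ))).congr_of_eventuallyEq ?_
    have : ∀ᶠ y in 𝓝 x, ss y < ε := ss_cont.continuousAt.eventually_lt_const (by rw [← hx]; exact hε)
    filter_upwards [this] with y hy
    rw [Yf, et, h0 _ (by rw [sub_nonpos, div_le_one hε]; exact hy.le)]; ring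
  · have r1 : ContDiffAt ℝ 1 rr x := (contDiffAt_sqrt hx.ne').comp x ss_cd.contDiffAt
    have r2 : ContDiffAt ℝ 1 (fun y => (rr y)⁻¹) x := r1.inv (rr_pos hx).ne'
    have hX : ContDiffAt ℝ 1 (Xf B m) x := by
      have : Xf B m = fun y => -(√B / 2) * (rr y - max (2 * m / B) 0 * (rr y)⁻¹) := by
        ext y; simp only [Xf, xxm, div_eq_mul_inv]
      rw [this]; fun_prop
    have hq : ContDiffAt ℝ 1 (qf B m H) x := (cH.contDiffAt.comp x hX).add hX
    have hc : ContDiffAt ℝ 1 (cf B m H) x := (contDiffAt_const.mul r1).mul hq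
    have ha : ContDiffAt ℝ 1 (af B m H) x := (contDiffAt_const.mul (hX.mul r2)).add hc
    have he : ContDiffAt ℝ 1 (et σ ε) x := by
      have := ss_cd (n := 1)
      unfold et
      exact ContDiff.contDiffAt (by fun_prop)
    have hN : ContDiffAt ℝ 1 (fun y => ‖Ψ y‖ ^ 2) x := (h.norm_sq ℝ).contDiffAt
    have hA : ContDiffAt ℝ 1 (fun y => ![af B m H y, af B m H y, cf B m H y] j) x := by
      fin_cases j
      exacts [ha, ha, hc]
    have hj : ContDiffAt ℝ 1 (fun y : E3 => y j) x := ContDiff.contDiffAt (by fun_prop)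
    exact he.mul (hN.mul (hA.mul hj))

def Wr (B : ℝ) (m : ℤ) (H H' : ℝ → ℝ) (K r : ℝ) : ℝ :=
  B * ((1 - r ^ 2) + r ^ 2 * (xxm B m r ^ 2 - H' (xxm B m r) - H (xxm B m r) ^ 2)) - 10 * (K + 1) * √B * (1 + xxm B m r ^ 2)

theorem algW {B b r z q X H H' K : ℝ} (hb : B = b ^ 2) (hb0 : 0 ≤ b) (hr : 0 < r) (hR : r ^ 2 + z ^ 2 < 1) (hq : q = H + X) (hK : 0 ≤ K) (h1 : |H| ≤ K * (1 + |X|)) (h2 : |H'| ≤ K * (1 + |X|)) :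
    B * ((1 - r ^ 2) + r ^ 2 * (X ^ 2 - H' - H ^ 2)) - 10 * (K + 1) * b * (1 + X ^ 2) - B * X ^ 2 ≤
     -(-B - 4 * b * r * q + B * r ^ 2 * (H' + 1) + b * r * X * (H' + 1)) - ((b * (X * r⁻¹) + -b * r * q) ^ 2 * r ^ 2 + (-b * r * q) ^ 2 * z ^ 2) := by
  have e1 : (b * (X * r⁻¹) + -b * r * q) ^ 2 * r ^ 2 = B * (X - r ^ 2 * q) ^ 2 := by rw [hb]; field_simp; ring
  rw [e1]
  have a1 : |4 * q - X * (H' + 1)| ≤ 10 * (K + 1) * (1 + X ^ 2) := by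
    rw [hq]
    have : |4 * (H + X) - X * (H' + 1)| ≤ 4 * |H| + 5 * |X| + |X| * |H'| := by
      rw [← abs_mul, abs_le]
      constructor <;> linarith [le_abs_self H, neg_abs_le H, le_abs_self X, neg_abs_le X, le_abs_self (X * H'), neg_abs_le (X * H')]
    have h3 : |X| * |H'| ≤ |X| * (K * (1 + |X|)) := by gcongr
    nlinarith [sq_abs X, sq_nonneg (|X| - 1), abs_nonneg X, mul_nonneg hK (sq_nonneg (|X| - 1)), mul_nonneg hK (abs_nonneg X)]
  have hr1 : r ≤ 1 := by nlinarith [sq_nonneg z]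
  have a2 : -(b * (10 * (K + 1) * (1 + X ^ 2))) ≤ b * r * (4 * q - X * (H' + 1)) := by
    have h4 : |b * r * (4 * q - X * (H' + 1))| ≤ b * (10 * (K + 1) * (1 + X ^ 2)) := by
      rw [abs_mul, abs_of_nonneg (by positivity)]
      calc _ ≤ b * 1 * (10 * (K + 1) * (1 + X ^ 2)) := by gcongr
        _ = _ := by ring
    linarith [neg_abs_le (b * r * (4 * q - X * (H' + 1)))]
  have a3 : 0 ≤ B * (r ^ 2 * q ^ 2 * (1 - (r ^ 2 + z ^ 2))) := by
    rw [hb]; have : 0 ≤ 1 - (r ^ 2 + z ^ 2) := by linarith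
    positivity
  have e2 : B * (X - r ^ 2 * q) ^ 2 + (-b * r * q) ^ 2 * z ^ 2 = B * (X ^ 2 - 2 * r ^ 2 * X * q + r ^ 2 * q ^ 2 * (r ^ 2 + z ^ 2)) := by rw [hb]; ring
  rw [e2]
  have e3 : 2 * X * q - q ^ 2 = X ^ 2 - H ^ 2 := by rw [hq]; ring
  have e4 : B * r ^ 2 * (2 * X * q - q ^ 2) = B * r ^ 2 * (X ^ 2 - H ^ 2) := by rw [e3]
  linarith

theorem pw (hB : 0 < B) (hH : AdmK K H H') {Kσ : ℝ} {σ σ' : ℝ → ℝ} (hσ : ∀ t, HasDerivAt σ (σ' t) t)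
    (s0 : ∀ t, t ≤ 0 → σ t = 0 ∧ σ' t = 0) (s1 : ∀ t, 1 ≤ t → σ t = 1 ∧ σ' t = 0) (s2 : ∀ t, 0 ≤ σ t ∧ σ t ≤ 1)
    (s3 : ∀ t, 0 ≤ σ' t ∧ σ' t ≤ Kσ) {ε : ℝ} (hε : 0 < ε) {Ψ : E3 → ℂ} (h : ContDiff ℝ 1 Ψ) {x : E3} (hx : 0 < ss x) (hxb : x ∈ ball3)
    {Ca Cq : ℝ} (hCa : |af B m H x| * ‖Ψ x‖ ^ 2 ≤ Ca) (hCq : |qf B m H x| * ‖Ψ x‖ ^ 2 ≤ Cq) :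
    et σ ε x * ((Wr B m H H' K (rr x) - B * Xf B m x ^ 2) * ‖Ψ x‖ ^ 2 - SS Ψ x) ≤
     -(df (Yf B m H σ ε Ψ 0) 0 x + df (Yf B m H σ ε Ψ 1) 1 x + df (Yf B m H σ ε Ψ 2) 2 x)
      + {x : E3 | ss x ≤ 2 * ε ∨ 1 - (ss x + x 2 ^ 2) ≤ ε}.indicator (fun _ => Kσ * (4 * Ca + 2 * √B * Cq)) x := by
  have hr := rr_pos hx
  have hr1 := rr_lt hxb
  have hR := ball_ss hxb
  have hKs : 0 ≤ Kσ := (s3 0).1.trans (s3 0).2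
  have b0 := sqrt_nonneg B
  have N0 : 0 ≤ ‖Ψ x‖ ^ 2 := by positivity
  have Ca0 : 0 ≤ Ca := le_trans (by positivity) hCa
  have Cq0 : 0 ≤ Cq := le_trans (by positivity) hCq
  rw [div_f hB hH hσ hε h hx]
  have e0 : 0 ≤ et σ ε x := mul_nonneg (s2 _).1 (s2 _).1
  have a1 := vb (Ψ x) ((x 0 : ℂ) * dd Ψ 0 x + (x 1 : ℂ) * dd Ψ 1 x) (dd Ψ 2 x) (af B m H x) (cf B m H x) (x 2) (ss x) hx
  have a2 := algW (B := B) (b := √B) (r := rr x) (z := x 2) (q := qf B m H x) (X := Xf B m x) (H := H (Xf B m x)) (H' := H' (Xf B m x))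
    (K := K) (sq_sqrt hB.le).symm b0 hr (by rw [rr_sq]; exact hR) rfl hH.pos (hH.2.2.2 _).1 (hH.2.2.2 _).2
  rw [rr_sq x] at a2
  have a3 := mul_le_mul_of_nonneg_right a2 N0
  have ew : Wr B m H H' K (rr x) = B * (1 - ss x + ss x * (Xf B m x ^ 2 - H' (Xf B m x) - H (Xf B m x) ^ 2)) - 10 * (K + 1) * √B * (1 + Xf B m x ^ 2) := by
    rw [← rr_sq]; rfl
  rw [← ew] at a3
  change _ ≤ SS Ψ x + _ at a1
  change _ ≤ (-(-B - 4 * √B * rr x * qf B m H x + B * ss x * (H' (Xf B m x) + 1) + √B * rr x * Xf B m x * (H' (Xf B m x) + 1)) - (af B m H x ^ 2 * ss x + cf B m H x ^ 2 * x 2 ^ 2)) * ‖Ψ x‖ ^ 2 at a3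
  have a4 : (Wr B m H H' K (rr x) - B * Xf B m x ^ 2) * ‖Ψ x‖ ^ 2 - SS Ψ x ≤
     -(2 * ((Ψ x).re * (af B m H x * ((x 0 : ℂ) * dd Ψ 0 x + (x 1 : ℂ) * dd Ψ 1 x).re + cf B m H x * x 2 * (dd Ψ 2 x).re)
        + (Ψ x).im * (af B m H x * ((x 0 : ℂ) * dd Ψ 0 x + (x 1 : ℂ) * dd Ψ 1 x).im + cf B m H x * x 2 * (dd Ψ 2 x).im)))
     - ‖Ψ x‖ ^ 2 * (-B - 4 * √B * rr x * qf B m H x + B * ss x * (H' (Xf B m x) + 1) + √B * rr x * Xf B m x * (H' (Xf B m x) + 1)) := by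
    linarith
  have a5 := mul_le_mul_of_nonneg_left a4 e0
  rw [rr_sq x]
  set T1 := σ' (ss x / ε - 1) * σ ((1 - (ss x + x 2 ^ 2)) / ε) * (2 * (ss x / ε) * af B m H x) with hT1
  set T2 := σ (ss x / ε - 1) * σ' ((1 - (ss x + x 2 ^ 2)) / ε) * (2 / ε * (√B * rr x * (-H (Xf B m x) + qf B m H x * (1 - (ss x + x 2 ^ 2))))) with hT2
  have b1 : T1 * ‖Ψ x‖ ^ 2 ≤ Kσ * (4 * Ca) ∧ (2 * ε < ss x → T1 * ‖Ψ x‖ ^ 2 ≤ 0) := by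
    have c2 : 2 * ε ≤ ss x → T1 * ‖Ψ x‖ ^ 2 ≤ 0 := fun hs => by
      rw [hT1, (s1 (ss x / ε - 1) (by rw [le_sub_iff_add_le, le_div_iff₀ hε]; linarith)).2]; simp
    refine ⟨?_, fun hs => c2 hs.le⟩
    rcases le_total (2 * ε) (ss x) with hs | hs
    · exact (c2 hs).trans (by positivity)
    have c3 : ss x / ε ≤ 2 := by rw [div_le_iff₀ hε]; exact hs
    have c4 : 0 ≤ ss x / ε := by positivity
    calc T1 * ‖Ψ x‖ ^ 2 = σ' (ss x / ε - 1) * σ ((1 - (ss x + x 2 ^ 2)) / ε) * (2 * (ss x / ε)) * (af B m H x * ‖Ψ x‖ ^ 2) := by rw [hT1]; ring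
      _ ≤ σ' (ss x / ε - 1) * σ ((1 - (ss x + x 2 ^ 2)) / ε) * (2 * (ss x / ε)) * Ca := by
        refine mul_le_mul_of_nonneg_left (le_trans (mul_le_mul_of_nonneg_right (le_abs_self _) N0) hCa) ?_
        exact mul_nonneg (mul_nonneg (s3 _).1 (s2 _).1) (by positivity)
      _ ≤ Kσ * 1 * (2 * 2) * Ca := by
        have := (s3 (ss x / ε - 1)).2; have := (s2 ((1 - (ss x + x 2 ^ 2)) / ε)).2; have := (s2 ((1 - (ss x + x 2 ^ 2)) / ε)).1
        gcongr
      _ = _ := by ring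
  have b2 : -T2 * ‖Ψ x‖ ^ 2 ≤ Kσ * (2 * √B * Cq) ∧ (ε < 1 - (ss x + x 2 ^ 2) → -T2 * ‖Ψ x‖ ^ 2 ≤ 0) := by
    have c2 : ε ≤ 1 - (ss x + x 2 ^ 2) → -T2 * ‖Ψ x‖ ^ 2 ≤ 0 := fun hs => by
      rw [hT2, (s1 ((1 - (ss x + x 2 ^ 2)) / ε) (by rw [le_div_iff₀ hε]; linarith)).2]; simp
    refine ⟨?_, fun hs => c2 hs.le⟩
    rcases le_total ε (1 - (ss x + x 2 ^ 2)) with hs | hs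
    · exact (c2 hs).trans (by positivity)
    set t := (1 - (ss x + x 2 ^ 2)) / ε with ht
    have c3 : t ≤ 1 := by rw [ht, div_le_one hε]; exact hs
    have c4 : 0 ≤ t := by rw [ht]; have : 0 ≤ 1 - (ss x + x 2 ^ 2) := by linarith
                          positivity
    have p1 := (s2 (ss x / ε - 1)).1
    have p2 := (s3 t).1
    have p3 : 0 ≤ -H (Xf B m x) := by linarith [hH.2.2.1 (Xf B m x)]
    have e1 : -T2 * ‖Ψ x‖ ^ 2 = σ (ss x / ε - 1) * σ' t * (2 * √B * rr x * t) * (-(qf B m H x) * ‖Ψ x‖ ^ 2)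
       - σ (ss x / ε - 1) * σ' t * (2 / ε * (√B * rr x * (-H (Xf B m x)))) * ‖Ψ x‖ ^ 2 := by rw [hT2]; rw [ht]; field_simp; ring
    have e2 : 0 ≤ σ (ss x / ε - 1) * σ' t * (2 / ε * (√B * rr x * (-H (Xf B m x)))) * ‖Ψ x‖ ^ 2 := by positivity
    calc _ ≤ σ (ss x / ε - 1) * σ' t * (2 * √B * rr x * t) * (-(qf B m H x) * ‖Ψ x‖ ^ 2) := by linarith
      _ ≤ σ (ss x / ε - 1) * σ' t * (2 * √B * rr x * t) * Cq := by
        refine mul_le_mul_of_nonneg_left (le_trans (mul_le_mul_of_nonneg_right (neg_le_abs _) N0) hCq) (by positivity)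
      _ ≤ 1 * Kσ * (2 * √B * 1 * 1) * Cq := by
        have := (s2 (ss x / ε - 1)).2; have := (s3 t).2
        gcongr
      _ = _ := by ring
  have b3 : (T1 - T2) * ‖Ψ x‖ ^ 2 ≤ {x : E3 | ss x ≤ 2 * ε ∨ 1 - (ss x + x 2 ^ 2) ≤ ε}.indicator (fun _ => Kσ * (4 * Ca + 2 * √B * Cq)) x := by
    by_cases hS : x ∈ {x : E3 | ss x ≤ 2 * ε ∨ 1 - (ss x + x 2 ^ 2) ≤ ε}
    · rw [indicator_of_mem hS]; linarith [b1.1, b2.1]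
    · rw [indicator_of_notMem hS]
      simp only [mem_setOf_eq, not_or, not_le] at hS
      linarith [b1.2 hS.1, b2.2 hS.2]
  linarith
end
end

section
section
variable {B : ℝ} {m : ℤ} {H H' : ℝ → ℝ} {K : ℝ}

theorem bnds (hB : 0 < B) (hH : AdmK K H H') {Ψ : E3 → ℂ} (hm : Mode m Ψ) (h : ContDiff ℝ 1 Ψ) :
    ∃ Ca Cq Cw : ℝ, ∀ x ∈ ball3, 0 < ss x → |af B m H x| * ‖Ψ x‖ ^ 2 ≤ Ca ∧ |qf B m H x| * ‖Ψ x‖ ^ 2 ≤ Cq ∧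
      |Wr B m H H' K (rr x) - B * Xf B m x ^ 2| * ‖Ψ x‖ ^ 2 ≤ Cw := by
  obtain ⟨C1, p1, h1⟩ := hm.bd h B
  obtain ⟨C2, p2, h2⟩ := hm.bd h 0
  have K0 := hH.pos
  have b0 := sqrt_nonneg B
  set D := C1 + C1 / B with hD
  refine ⟨B / 2 * C2 + C2 + √B * (2 * (K + 1) * D), 2 * (K + 1) * D, (B + B * (1 + 2 * K + 2 * K ^ 2) + 10 * (K + 1) * √B + B) * D, fun x hx hs => ?_⟩
  have hr := rr_pos hs
  have hr1 := rr_lt hx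
  have k1 := h1 x hx hs
  have k2 := h2 x hx hs
  have hX := xxm_sq (m := m) hB hr
  have N0 : 0 ≤ ‖Ψ x‖ ^ 2 := by positivity
  set N := ‖Ψ x‖ ^ 2
  set X := Xf B m x with hXd
  change B * X ^ 2 ≤ _ at hX
  have kX : (1 + X ^ 2) * N ≤ D := by
    have i1 := mul_le_mul_of_nonneg_right hX N0
    have i2 : B * (X ^ 2 * N) ≤ C1 := by linarith
    have i3 : X ^ 2 * N ≤ C1 / B := by rw [le_div_iff₀ hB]; linarith
    have i4 : 0 ≤ pim B m (rr x) ^ 2 * N := by positivity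
    linarith
  have aq : |qf B m H x| ≤ 2 * (K + 1) * (1 + X ^ 2) := by
    have i1 : |qf B m H x| ≤ |H X| + |X| := abs_add_le _ _
    have i2 := (hH.2.2.2 X).1
    nlinarith [sq_abs X, sq_nonneg (|X| - 1), abs_nonneg X, mul_nonneg K0 (sq_nonneg (|X| - 1))]
  have aqN : |qf B m H x| * N ≤ 2 * (K + 1) * D := by
    calc _ ≤ 2 * (K + 1) * (1 + X ^ 2) * N := by gcongr
      _ = 2 * (K + 1) * ((1 + X ^ 2) * N) := by ring
      _ ≤ _ := by gcongr
  refine ⟨?_, aqN, ?_⟩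
  · have e1 : √B * (X * (rr x)⁻¹) = -(B / 2) + max (m:ℝ) 0 / ss x := by
      rw [hXd, Xf, xxm, ← rr_sq]
      have e2 : max (2 * (m:ℝ) / B) 0 = 2 / B * max (m:ℝ) 0 := by
        rw [mul_max_of_nonneg _ _ (by positivity)]; congr 1 <;> ring
      rw [e2]
      have : B = √B ^ 2 := (sq_sqrt hB.le).symm
      have hb : 0 < √B := sqrt_pos.2 hB
      generalize √B = b at *
      subst this
      field_simp; ring
    have e3 : max (m:ℝ) 0 ≤ (m:ℝ) ^ 2 := by
      refine max_le ?_ (by positivity)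
      exact_mod_cast (Int.le_self_sq m)
    have e4 : max (m:ℝ) 0 / ss x ≤ pim 0 m (rr x) ^ 2 := by
      have : pim 0 m (rr x) ^ 2 = (m:ℝ) ^ 2 / ss x := by rw [← rr_sq]; unfold pim; field_simp; ring
      rw [this]; gcongr
    have e5 : |af B m H x| ≤ B / 2 + pim 0 m (rr x) ^ 2 + √B * |qf B m H x| := by
      have i1 : |af B m H x| ≤ |√B * (X * (rr x)⁻¹)| + |cf B m H x| := abs_add_le _ _
      have i2 : |√B * (X * (rr x)⁻¹)| ≤ B / 2 + max (m:ℝ) 0 / ss x := by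
        rw [e1]; have : 0 ≤ max (m:ℝ) 0 / ss x := by positivity
        rw [abs_le]; constructor <;> linarith
      have i3 : |cf B m H x| ≤ √B * |qf B m H x| := by
        rw [cf, abs_mul, abs_mul, abs_neg, abs_of_nonneg b0, abs_of_pos hr]
        have : √B * rr x ≤ √B * 1 := by gcongr
        have := mul_le_mul_of_nonneg_right this (abs_nonneg (qf B m H x))
        linarith
      linarith
    have e6 := mul_le_mul_of_nonneg_right e5 N0
    have e7 : 0 ≤ pim 0 m (rr x) ^ 2 * N := by positivity
    have e8 : N ≤ C2 := by linarith
    have e9 : B / 2 * N ≤ B / 2 * C2 := by gcongr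
    have e10 := mul_le_mul_of_nonneg_left aqN b0
    linarith
  · have i1 := hH.Pb X
    have i2 : |Wr B m H H' K (rr x) - B * X ^ 2| ≤ (B + B * (1 + 2 * K + 2 * K ^ 2) + 10 * (K + 1) * √B + B) * (1 + X ^ 2) := by
      have e : Wr B m H H' K (rr x) - B * X ^ 2 = B * (1 - rr x ^ 2) + B * (rr x ^ 2 * (X ^ 2 - H' X - H X ^ 2)) - 10 * (K + 1) * √B * (1 + X ^ 2) - B * X ^ 2 := by
        rw [hXd, Wr, Xf]; ring
      have r2 : rr x ^ 2 ≤ 1 := by nlinarith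
      have j1 : |rr x ^ 2 * (X ^ 2 - H' X - H X ^ 2)| ≤ 1 * ((1 + 2 * K + 2 * K ^ 2) * (1 + X ^ 2)) := by
        rw [abs_mul, abs_of_nonneg (sq_nonneg _)]; gcongr
      obtain ⟨j2, j3⟩ := abs_le.1 j1
      have j4 := mul_le_mul_of_nonneg_left j3 hB.le
      have j5 := mul_le_mul_of_nonneg_left j2 hB.le
      have j6 : 0 ≤ B * rr x ^ 2 := by positivity
      have j7 : 0 ≤ 10 * (K + 1) * √B * (1 + X ^ 2) := by positivity
      have j8 : B * rr x ^ 2 ≤ B * 1 := by gcongr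
      have j9 : 0 ≤ B * X ^ 2 := by positivity
      rw [e, abs_le]; constructor <;> linarith
    calc _ ≤ (B + B * (1 + 2 * K + 2 * K ^ 2) + 10 * (K + 1) * √B + B) * (1 + X ^ 2) * N := by gcongr
      _ = (B + B * (1 + 2 * K + 2 * K ^ 2) + 10 * (K + 1) * √B + B) * ((1 + X ^ 2) * N) := by ring
      _ ≤ _ := by gcongr

theorem df_out {Y : E3 → ℝ} (hC : ContDiff ℝ 1 Y) (hs : ∀ x, x ∉ ball3 → Y x = 0) (j : Fin 3) :
    IntegrableOn (df Y j) ball3 ∧ ∫ x in ball3, df Y j x = 0 := by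
  obtain ⟨a, b⟩ := int_df hC hs j
  refine ⟨a.integrableOn, ?_⟩
  rw [← b]
  refine setIntegral_eq_integral_of_ae_compl_eq_zero ?_
  have h0 : ∀ᵐ x ∂(volume : Measure E3), x ∉ Metric.sphere (0:E3) 1 := by
    rw [ae_iff]; simp only [not_not]; exact Measure.addHaar_sphere _ _ _
  filter_upwards [h0] with x hx hxb
  have h1 : 1 < ‖x‖ := by
    simp only [ball3, Metric.mem_ball, dist_zero_right, not_lt] at hxb
    simp only [mem_sphere_iff_norm, sub_zero] at hx
    exact lt_of_le_of_ne hxb (Ne.symm hx)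
  have h2 : Y =ᶠ[𝓝 x] fun _ => 0 := by
    filter_upwards [(isOpen_lt continuous_const continuous_norm).mem_nhds h1] with y hy
    refine hs y ?_
    simp only [ball3, Metric.mem_ball, dist_zero_right, not_lt]
    exact le_of_lt hy
  rw [df, h2.fderiv_eq]; simp

theorem c1_core (hB : 0 < B) (hH : AdmK K H H') {Ψ : E3 → ℂ} (hm : Mode m Ψ) (h : ContDiff ℝ 1 Ψ) :
    ∫ x in ball3, Wr B m H H' K (rr x) * ‖Ψ x‖ ^ 2 ≤ qB B Ψ := by
  obtain ⟨Ca, Cq, Cw, hb⟩ := bnds (K := K) hB hH hm h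
  obtain ⟨Kσ, σ, σ', -, hσc, hσ, s0, s1, s2, s3⟩ := sg_ex
  have hHc : Continuous H := continuous_iff_continuousAt.2 fun x => (hH.1 x).continuousAt
  have hH'c := hH.2.1
  have hxm := xxm_meas B m
  have hpm := pim_meas B m
  have hrm := rr_cont.measurable
  have hWm : Measurable fun r => Wr B m H H' K r := by
    unfold Wr
    have a1 : Measurable fun r => H (xxm B m r) := hHc.measurable.comp hxm
    have a2 : Measurable fun r => H' (xxm B m r) := hH'c.measurable.comp hxm
    fun_prop
  have hN : Measurable fun x => ‖Ψ x‖ ^ 2 := (h.continuous.norm.pow 2).measurable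
  have hXm : Measurable fun x => Xf B m x := hxm.comp hrm
  have mW : Measurable fun x => (Wr B m H H' K (rr x) - B * Xf B m x ^ 2) * ‖Ψ x‖ ^ 2 := by
    have := hWm.comp hrm
    exact (this.sub ((hXm.pow_const 2).const_mul B)).mul hN
  have iW : Integrable (fun x => (Wr B m H H' K (rr x) - B * Xf B m x ^ 2) * ‖Ψ x‖ ^ 2) mu3 := by
    refine bi (C := Cw) mW.aestronglyMeasurable fun x hx hs => ?_
    rw [abs_mul, abs_of_nonneg (by positivity : 0 ≤ ‖Ψ x‖ ^ 2)]
    exact (hb x hx hs).2.2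
  obtain ⟨C1, p1, h1⟩ := hm.bd h B
  have iP : Integrable (fun x => pim B m (rr x) ^ 2 * ‖Ψ x‖ ^ 2) mu3 := by
    refine bi (C := C1) (((hpm.comp hrm).pow_const 2).mul hN).aestronglyMeasurable fun x hx hs => ?_
    rw [abs_of_nonneg (by positivity)]
    have : 0 ≤ ‖Ψ x‖ ^ 2 := by positivity
    linarith [h1 x hx hs]
  have iX : Integrable (fun x => B * Xf B m x ^ 2 * ‖Ψ x‖ ^ 2) mu3 := by
    refine bi (C := C1) (((hXm.pow_const 2).const_mul B).mul hN).aestronglyMeasurable fun x hx hs => ?_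
    rw [abs_of_nonneg (by positivity)]
    have : 0 ≤ ‖Ψ x‖ ^ 2 := by positivity
    have := mul_le_mul_of_nonneg_right (xxm_sq (m := m) hB (rr_pos hs)) this
    refine (show _ ≤ _ from this).trans ?_
    linarith [h1 x hx hs]
  have iS : Integrable (fun x => SS Ψ x) mu3 := by
    refine ((ci (dens_cont h B)).sub iP).congr ?_
    filter_upwards [ae_ss] with x hx
    rw [Pi.sub_apply, dens_eq (B := B) hm hx.2]; ring
  have iF : Integrable (fun x => (Wr B m H H' K (rr x) - B * Xf B m x ^ 2) * ‖Ψ x‖ ^ 2 - SS Ψ x) mu3 := iW.sub iS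
  set F : E3 → ℝ := fun x => (Wr B m H H' K (rr x) - B * Xf B m x ^ 2) * ‖Ψ x‖ ^ 2 - SS Ψ x with hF
  set C0 := Kσ * (4 * Ca + 2 * √B * Cq) with hC0
  let S : ℕ → Set E3 := fun n => {x : E3 | ss x ≤ 2 * (1 / ((n:ℝ) + 1)) ∨ 1 - (ss x + x 2 ^ 2) ≤ 1 / ((n:ℝ) + 1)}
  have hSm : ∀ n, MeasurableSet (S n) := fun n => by
    have a1 : MeasurableSet {x : E3 | ss x ≤ 2 * (1 / ((n:ℝ) + 1))} := measurableSet_le ss_cont.measurable measurable_const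
    have a2 : MeasurableSet {x : E3 | 1 - (ss x + x 2 ^ 2) ≤ 1 / ((n:ℝ) + 1)} := measurableSet_le (by have := ss_cont; fun_prop) measurable_const
    exact a1.union a2
  have etc : ∀ n : ℕ, Continuous (et σ (1 / ((n:ℝ) + 1))) := fun n => by
    have := ss_cont; have := hσc.continuous; unfold et; fun_prop
  have et0 : ∀ n : ℕ, ∀ x, 0 ≤ et σ (1 / ((n:ℝ) + 1)) x ∧ et σ (1 / ((n:ℝ) + 1)) x ≤ 1 := fun n x =>
    ⟨mul_nonneg (s2 _).1 (s2 _).1, mul_le_one₀ (s2 _).2 (s2 _).1 (s2 _).2⟩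
  have hle : ∀ n : ℕ, ∫ x in ball3, (et σ (1 / ((n:ℝ) + 1)) x * F x - (S n).indicator (fun _ => C0) x) ≤ 0 := by
    intro n
    have hε : 0 < 1 / ((n:ℝ) + 1) := by positivity
    have yo : ∀ j, ∀ x, x ∉ ball3 → Yf B m H σ (1 / ((n:ℝ) + 1)) Ψ j x = 0 := by
      intro j x hx
      have : 1 ≤ ‖x‖ := by simpa [ball3] using hx
      have : 1 - (ss x + x 2 ^ 2) ≤ 0 := by rw [← nsq]; nlinarith
      rw [Yf, et, (s0 _ (div_nonpos_of_nonpos_of_nonneg this hε.le)).1]; ring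
    have d := fun j => df_out (Y_cd (B := B) (m := m) hH hσc (fun t ht => (s0 t ht).1) hε h j) (yo j) j
    have j1 : Integrable (fun x => df (Yf B m H σ (1 / ((n:ℝ) + 1)) Ψ 0) 0 x + df (Yf B m H σ (1 / ((n:ℝ) + 1)) Ψ 1) 1 x) mu3 := (d 0).1.add (d 1).1
    have j2 : Integrable (fun x => df (Yf B m H σ (1 / ((n:ℝ) + 1)) Ψ 0) 0 x + df (Yf B m H σ (1 / ((n:ℝ) + 1)) Ψ 1) 1 x + df (Yf B m H σ (1 / ((n:ℝ) + 1)) Ψ 2) 2 x) mu3 := j1.add (d 2).1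
    have e : ∫ x in ball3, -(df (Yf B m H σ (1 / ((n:ℝ) + 1)) Ψ 0) 0 x + df (Yf B m H σ (1 / ((n:ℝ) + 1)) Ψ 1) 1 x + df (Yf B m H σ (1 / ((n:ℝ) + 1)) Ψ 2) 2 x) = 0 := by
      rw [integral_neg, integral_add j1 (d 2).1, integral_add (d 0).1 (d 1).1, (d 0).2, (d 1).2, (d 2).2]; simp
    rw [← e]
    refine integral_mono_ae ?_ j2.neg ?_
    · refine Integrable.sub ?_ ((integrable_const C0).indicator (hSm n))
      exact iF.bdd_mul (c := 1) (etc n).aestronglyMeasurable (Eventually.of_forall fun x => by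
        rw [norm_eq_abs, abs_of_nonneg (et0 n x).1]; exact (et0 n x).2)
    · filter_upwards [ae_ss] with x hx
      have := pw (K := K) hB hH hσ s0 s1 s2 s3 hε h hx.2 hx.1 (hb x hx.1 hx.2).1 (hb x hx.1 hx.2).2.1
      exact sub_le_iff_le_add.2 this
  have hlim : Tendsto (fun n : ℕ => ∫ x in ball3, (et σ (1 / ((n:ℝ) + 1)) x * F x - (S n).indicator (fun _ => C0) x)) atTop (𝓝 (∫ x in ball3, F x)) := by
    refine tendsto_integral_of_dominated_convergence (fun x => |F x| + |C0|) (fun n => ?_) (iF.abs.add (integrable_const _)) (fun n => ?_) ?_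
    · exact ((etc n).aestronglyMeasurable.mul iF.1).sub ((integrable_const C0).indicator (hSm n)).1
    · refine Eventually.of_forall fun x => ?_
      have i1 : |et σ (1 / ((n:ℝ) + 1)) x * F x| ≤ 1 * |F x| := by
        rw [abs_mul, abs_of_nonneg (et0 n x).1]; gcongr; exact (et0 n x).2
      have i2 : |(S n).indicator (fun _ => C0) x| ≤ |C0| := by
        by_cases hx : x ∈ S n <;> simp [hx]
      rw [norm_eq_abs]
      exact (abs_sub _ _).trans (by linarith)
    · filter_upwards [ae_ss] with x hx
      refine tendsto_const_nhds.congr' ?_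
      have l0 : Tendsto (fun n : ℕ => 1 / ((n:ℝ) + 1)) atTop (𝓝 0) := tendsto_one_div_add_atTop_nhds_zero_nat
      have hR := ball_ss hx.1
      filter_upwards [l0.eventually (gt_mem_nhds (show (0:ℝ) < ss x / 2 by have := hx.2; positivity)),
        l0.eventually (gt_mem_nhds (show (0:ℝ) < 1 - (ss x + x 2 ^ 2) by linarith))] with n n1 n2
      have hε : 0 < 1 / ((n:ℝ) + 1) := by positivity
      have : x ∉ S n := by
        rintro (h | h) <;> linarith
      rw [indicator_of_notMem this, et, (s1 _ _).1, (s1 _ _).1]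
      · ring
      · rw [le_div_iff₀ hε]; linarith
      · rw [le_sub_iff_add_le, le_div_iff₀ hε]; linarith
  have hfin : ∫ x in ball3, F x ≤ 0 := le_of_tendsto' hlim hle
  have e1 : ∫ x in ball3, F x = (∫ x in ball3, (Wr B m H H' K (rr x) - B * Xf B m x ^ 2) * ‖Ψ x‖ ^ 2) - ∫ x in ball3, SS Ψ x := by
    rw [← integral_sub iW iS]
  have e2 : ∫ x in ball3, Wr B m H H' K (rr x) * ‖Ψ x‖ ^ 2 = (∫ x in ball3, (Wr B m H H' K (rr x) - B * Xf B m x ^ 2) * ‖Ψ x‖ ^ 2) + ∫ x in ball3, B * Xf B m x ^ 2 * ‖Ψ x‖ ^ 2 := by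
    rw [← integral_add iW iX]; congr 1; ext x; ring
  have e3 : (∫ x in ball3, SS Ψ x) + ∫ x in ball3, B * Xf B m x ^ 2 * ‖Ψ x‖ ^ 2 ≤ qB B Ψ := by
    rw [← integral_add iS iX]
    refine integral_mono_ae (iS.add iX) (ci (dens_cont h B)) ?_
    filter_upwards [ae_ss] with x hx
    rw [dens_eq (B := B) hm hx.2]
    have := mul_le_mul_of_nonneg_right (xxm_sq (m := m) hB (rr_pos hx.2)) (by positivity : 0 ≤ ‖Ψ x‖ ^ 2)
    exact add_le_add_right this _
  linarith
end

theorem NM.good {B κ K τ : ℝ} {m : ℤ} {Φ : E3 → ℂ} (hB : 0 < B) (h : NM B κ m Φ) (hκ : 0 < κ) (hκ1 : κ ≤ 1)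
    (hτ : κ / 2 * (1 + (2 * K ^ 4 * (lambda1H B + 1) + 8 * K ^ 4)) ≤ τ) : GoodNu lambda1H B K τ m (nuM Φ) where
  prob := nuM_prob h.cd.continuous h.n1
  supp := nuM_supp
  int := by
    obtain ⟨C1, p1, h1⟩ := h.md.bd h.cd B
    have hpm := pim_meas B m
    refine nuM_integ h.cd.continuous (by fun_prop) (bi (C := C1) ?_ fun x hx hs => ?_)
    · exact (((hpm.comp rr_cont.measurable).pow_const 2).mul (h.cd.continuous.norm.pow 2).measurable).aestronglyMeasurable
    · rw [abs_of_nonneg (by positivity)]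
      have : 0 ≤ ‖Φ x‖ ^ 2 := by positivity
      linarith [h1 x hx hs]
  c1 := by
    intro KH H H' hH p p' hp
    have hHc : Continuous H := continuous_iff_continuousAt.2 fun x => (hH.1 x).continuousAt
    have hxm := xxm_meas B m
    have a1 : Measurable fun r => H (xxm B m r) := hHc.measurable.comp hxm
    have a2 : Measurable fun r => H' (xxm B m r) := hH.2.1.measurable.comp hxm
    have hc := hp.c
    have hH'c := hH.2.1
    have e := c1_core (K := KH) hB hH (h.md.rad h.cd hp) (hp.cdr.smul h.cd)
    refine le_trans (le_of_eq ?_) (e.trans (h.loc hκ hκ1 hτ hp))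
    rw [nuM_int h.cd.continuous (by fun_prop)]
    congr 1; ext x
    rw [norm_smul, mul_pow, norm_eq_abs, sq_abs, Wr]; ring
  c2 := fun p p' hp => h.c2 hκ hκ1 hτ hp
  d := fun p p' hp hp0 B' _ k => h.fd hκ hκ1 hτ hp hp0 B' k
end

section
def pr (j : Fin 3) : E3 →L[ℝ] ℝ := EuclideanSpace.proj (𝕜 := ℝ) j
def LP : E3 →L[ℝ] E3 := (pr 0).smulRight (ee 0) + (pr 1).smulRight (ee 1)
def LJ : E3 →L[ℝ] E3 := (pr 0).smulRight (ee 1) - (pr 1).smulRight (ee 0)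
def LQ : E3 →L[ℝ] E3 := (pr 2).smulRight (ee 2)
def RL (θ : ℝ) : E3 →L[ℝ] E3 := cos θ • LP + sin θ • LJ + LQ

theorem RL_c : Continuous RL := by unfold RL; fun_prop
theorem RL0 (θ : ℝ) (x : E3) : RL θ x 0 = cos θ * x 0 - sin θ * x 1 := by
  simp [RL, LP, LJ, LQ, pr, EuclideanSpace.single_apply]; ring
theorem RL1 (θ : ℝ) (x : E3) : RL θ x 1 = sin θ * x 0 + cos θ * x 1 := by
  simp [RL, LP, LJ, LQ, pr, EuclideanSpace.single_apply]; ring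
theorem RL2 (θ : ℝ) (x : E3) : RL θ x 2 = x 2 := by
  simp [RL, LP, LJ, LQ, pr, EuclideanSpace.single_apply]

theorem e3ext {x y : E3} (h0 : x 0 = y 0) (h1 : x 1 = y 1) (h2 : x 2 = y 2) : x = y := by
  ext j; fin_cases j <;> assumption

theorem RL_add (θ α : ℝ) (x : E3) : RL θ (RL α x) = RL (θ + α) x := by
  refine e3ext ?_ ?_ ?_ <;> simp only [RL0, RL1, RL2, cos_add, sin_add] <;> ring
theorem RL_per (θ : ℝ) : RL (θ + 2 * π) = RL θ := by unfold RL; rw [cos_add_two_pi, sin_add_two_pi]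
theorem RL_zero (x : E3) : RL 0 x = x := by refine e3ext ?_ ?_ ?_ <;> simp [RL0, RL1, RL2]
theorem RL_norm (θ : ℝ) (x : E3) : ‖RL θ x‖ = ‖x‖ := by
  have : ‖RL θ x‖ ^ 2 = ‖x‖ ^ 2 := by
    rw [nsq, nsq, ss, ss, RL0, RL1, RL2]; linear_combination (x 0 ^ 2 + x 1 ^ 2) * sin_sq_add_cos_sq θ
  exact (sq_eq_sq₀ (norm_nonneg _) (norm_nonneg _)).1 this
def RI (θ : ℝ) : E3 ≃ₗᵢ[ℝ] E3 :=
  LinearIsometry.toLinearIsometryEquiv ⟨(RL θ).toLinearMap, RL_norm θ⟩ rfl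
theorem RI_ap (θ : ℝ) (x : E3) : RI θ x = RL θ x := rfl

theorem RL_int (θ : ℝ) (f : E3 → ℝ) : ∫ x in ball3, f (RL θ x) = ∫ x in ball3, f x := by
  have h := (RI θ).measurePreserving.setIntegral_preimage_emb (RI θ).toHomeomorph.measurableEmbedding f ball3
  have e : (RI θ) ⁻¹' ball3 = ball3 := by
    ext x; simp [ball3]
  rw [e] at h
  exact h

theorem RL_fub {f : E3 → ℝ} (hf : Continuous f) : ∫ x in ball3, ∫ θ in (0:ℝ)..(2 * π), f (RL θ x) = 2 * π * ∫ x in ball3, f x := by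
  have hp : (0:ℝ) ≤ 2 * π := by positivity
  simp_rw [intervalIntegral.integral_of_le hp]
  have hc : Continuous fun p : E3 × ℝ => f (RL p.2 p.1) := by
    have := RL_c; fun_prop
  rw [integral_integral_swap]
  · simp_rw [RL_int]; simp
    left; positivity
  · change Integrable _ (mu3.prod _)
    rw [Measure.prod_restrict]
    exact (hc.continuousOn.integrableOn_compact ((isCompact_closedBall (0:E3) 1).prod (isCompact_Icc (a := (0:ℝ)) (b := 2 * π)))).mono_set
      (prod_mono Metric.ball_subset_closedBall Ioc_subset_Icc_self)

def ex (m : ℤ) (θ : ℝ) : ℂ := Complex.exp (Complex.I * m * θ)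
theorem ex_c (m : ℤ) : Continuous (ex m) := by unfold ex; fun_prop
theorem ex_per (m : ℤ) (θ : ℝ) : ex m (θ + 2 * π) = ex m θ := by
  unfold ex
  rw [show Complex.I * m * ((θ + 2 * π : ℝ) : ℂ) = Complex.I * m * θ + m * (2 * π * Complex.I) by push_cast; ring, Complex.exp_add,
    Complex.exp_int_mul_two_pi_mul_I, mul_one]
theorem ex_add (m : ℤ) (a b : ℝ) : ex m (a + b) = ex m a * ex m b := by
  unfold ex; rw [← Complex.exp_add]; congr 1; push_cast; ring

section
variable {E : Type*} [NormedAddCommGroup E] [NormedSpace ℝ E] [NormedSpace ℂ E]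
def fc (m : ℤ) (g : ℝ → E) : E := (1 / (2 * π)) • ∫ θ in (0:ℝ)..(2 * π), ex m θ • g θ
end

theorem fc_sum {g : ℝ → ℂ} (hg : Continuous g) : HasSum (fun m => ‖fc m g‖ ^ 2) (1 / (2 * π) * ∫ θ in (0:ℝ)..(2 * π), ‖g θ‖ ^ 2) := by
  have hab : (0:ℝ) < 2 * π := by positivity
  have h2 : MemLp g 2 (volume.restrict (Ioc 0 (2 * π))) := by
    obtain ⟨C, hC⟩ := (isCompact_Icc (a := (0:ℝ)) (b := 2 * π)).exists_bound_of_continuousOn hg.continuousOn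
    refine MemLp.of_bound hg.aestronglyMeasurable C ?_
    filter_upwards [ae_restrict_mem measurableSet_Ioc] with x hx using hC x (Ioc_subset_Icc_self hx)
  have h := hasSum_sq_fourierCoeffOn hab h2
  have e : (fun m => ‖fc m g‖ ^ 2) = (fun i => ‖fourierCoeffOn hab g i‖ ^ 2) ∘ (Equiv.neg ℤ) := by
    funext m
    simp only [Function.comp, Equiv.neg_apply, fourierCoeffOn_eq_integral, neg_neg, fc, sub_zero]
    congr 4
    ext θ
    rw [fourier_coe_apply, ex]
    congr 2
    have : (π:ℂ) ≠ 0 := by exact_mod_cast pi_ne_zero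
    rw [sub_zero]; push_cast; field_simp
  rw [e, (Equiv.neg ℤ).hasSum_iff]
  simpa using h

theorem fc_c {g : E3 → ℝ → ℂ} (hg : Continuous (Function.uncurry g)) (m : ℤ) : Continuous fun x => fc m (g x) := by
  have := ex_c m
  unfold fc
  refine Continuous.const_smul ?_ _
  exact intervalIntegral.continuous_parametric_intervalIntegral_of_continuous' (by fun_prop) _ _

theorem fc_sum2 {g : E3 → ℝ → ℂ} (hg : Continuous (Function.uncurry g)) :
    HasSum (fun m => ∫ x in ball3, ‖fc m (g x)‖ ^ 2) (1 / (2 * π) * ∫ x in ball3, ∫ θ in (0:ℝ)..(2 * π), ‖g x θ‖ ^ 2) := by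
  have hG : Continuous fun x => ∫ θ in (0:ℝ)..(2 * π), ‖g x θ‖ ^ 2 :=
    intervalIntegral.continuous_parametric_intervalIntegral_of_continuous' (by fun_prop) _ _
  have hs := fun x => fc_sum (g := g x) (by fun_prop)
  rw [← integral_const_mul]
  unfold HasSum
  have e : ∀ F : Finset ℤ, ∑ m ∈ F, ∫ x in ball3, ‖fc m (g x)‖ ^ 2 = ∫ x in ball3, ∑ m ∈ F, ‖fc m (g x)‖ ^ 2 := fun F => by
    rw [integral_finset_sum]; exact fun m _ => ci ((fc_c hg m).norm.pow 2)
  simp only [SummationFilter.unconditional_filter, e]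
  refine tendsto_integral_filter_of_dominated_convergence (fun x => 1 / (2 * π) * ∫ θ in (0:ℝ)..(2 * π), ‖g x θ‖ ^ 2) ?_ ?_ ?_ ?_
  · refine Eventually.of_forall fun F => ?_
    exact (continuous_finset_sum _ fun m _ => (fc_c hg m).norm.pow 2).aestronglyMeasurable
  · refine Eventually.of_forall fun F => Eventually.of_forall fun x => ?_
    rw [norm_of_nonneg (Finset.sum_nonneg fun _ _ => by positivity)]
    exact sum_le_hasSum _ (fun _ _ => by positivity) (hs x)
  · exact ci (hG.const_mul _)
  · exact Eventually.of_forall fun x => hs x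

def Pm (m : ℤ) (Ψ : E3 → ℂ) (x : E3) : ℂ := fc m fun θ => Ψ (RL θ x)

theorem Pm_d {Ψ : E3 → ℂ} (h : ContDiff ℝ 1 Ψ) (m : ℤ) (x : E3) :
    HasFDerivAt (Pm m Ψ) (fc m fun θ => (fderiv ℝ Ψ (RL θ x)).comp (RL θ)) x := by
  have c1 := RL_c
  have c2 := ex_c m
  have c3 := h.continuous
  have c4 := h.continuous_fderiv one_ne_zero
  have cF : Continuous fun p : E3 × ℝ => ex m p.2 • (fderiv ℝ Ψ (RL p.2 p.1)).comp (RL p.2) := by fun_prop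
  refine HasFDerivAt.const_smul ?_ _
  obtain ⟨C, hC⟩ := ((isCompact_closedBall x 1).prod (isCompact_Icc (a := (0:ℝ)) (b := 2 * π))).exists_bound_of_continuousOn cF.continuousOn
  refine intervalIntegral.hasFDerivAt_integral_of_dominated_of_fderiv_le (F' := fun x θ => ex m θ • (fderiv ℝ Ψ (RL θ x)).comp (RL θ)) (bound := fun _ => C)
    (Metric.ball_mem_nhds x one_pos) ?_ ?_ ?_ ?_ ?_ ?_
  · refine Eventually.of_forall fun y => Continuous.aestronglyMeasurable (by fun_prop)
  · exact Continuous.intervalIntegrable (by fun_prop) _ _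
  · exact Continuous.aestronglyMeasurable (by fun_prop)
  · refine Eventually.of_forall fun θ hθ y hy => ?_
    rw [uIoc_of_le (by positivity)] at hθ
    exact hC (y, θ) ⟨Metric.ball_subset_closedBall hy, Ioc_subset_Icc_self hθ⟩
  · exact intervalIntegrable_const
  · refine Eventually.of_forall fun θ hθ y hy => ?_
    have := (h.differentiable one_ne_zero (RL θ y)).hasFDerivAt.comp y (RL θ).hasFDerivAt
    exact this.const_smul (ex m θ)

theorem Pm_cd {Ψ : E3 → ℂ} (h : ContDiff ℝ 1 Ψ) (m : ℤ) : ContDiff ℝ 1 (Pm m Ψ) := by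
  have c1 := RL_c
  have c2 := ex_c m
  have c4 := h.continuous_fderiv one_ne_zero
  refine contDiff_one_iff_hasFDerivAt.2 ⟨fun x => fc m fun θ => (fderiv ℝ Ψ (RL θ x)).comp (RL θ), ?_, Pm_d h m⟩
  have c5 : Continuous fun x : E3 => ∫ θ in (0:ℝ)..(2 * π), ex m θ • (fderiv ℝ Ψ (RL θ x)).comp (RL θ) :=
    intervalIntegral.continuous_parametric_intervalIntegral_of_continuous' (by unfold Function.uncurry; fun_prop) _ _
  exact c5.const_smul (1 / (2 * π))

theorem Pm_dd {Ψ : E3 → ℂ} (h : ContDiff ℝ 1 Ψ) (m : ℤ) (x : E3) (j : Fin 3) :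
    dd (Pm m Ψ) j x = fc m fun θ => dd (fun y => Ψ (RL θ y)) j x := by
  have c1 := RL_c
  have c2 := ex_c m
  have c4 := h.continuous_fderiv one_ne_zero
  rw [dd, (Pm_d h m x).fderiv, fc, fc, ContinuousLinearMap.smul_apply]
  rw [ContinuousLinearMap.intervalIntegral_apply (Continuous.intervalIntegrable (by fun_prop) _ _)]
  congr 2; ext θ
  have := (h.differentiable one_ne_zero (RL θ x)).hasFDerivAt.comp x (RL θ).hasFDerivAt
  rw [dd, show (fun y => Ψ (RL θ y)) = Ψ ∘ RL θ from rfl, this.fderiv]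
  rfl

theorem Pm_rot {Ψ : E3 → ℂ} (m : ℤ) (α : ℝ) (x : E3) : Pm m Ψ (RL α x) = ex m (-α) * Pm m Ψ x := by
  have hp : Function.Periodic (fun θ => ex m θ • Ψ (RL θ x)) (2 * π) := fun θ => by
    dsimp only; rw [ex_per, RL_per]
  have h := hp.intervalIntegral_add_eq α 0
  rw [zero_add] at h
  unfold Pm fc
  rw [← h, mul_smul_comm]
  congr 1
  have e : ∀ θ, ex m θ • Ψ (RL θ (RL α x)) = ex m (-α) * (ex m (θ + α) • Ψ (RL (θ + α) x)) := fun θ => by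
    rw [RL_add, smul_eq_mul, smul_eq_mul, ← mul_assoc, ← ex_add]; congr 2; ring
  simp_rw [e]
  rw [intervalIntegral.integral_const_mul, intervalIntegral.integral_comp_add_right (fun θ => ex m θ • Ψ (RL θ x))]
  rw [zero_add, add_comm α]

theorem Pm_mode {Ψ : E3 → ℂ} (h : ContDiff ℝ 1 Ψ) (m : ℤ) : Mode m (Pm m Ψ) := by
  intro x
  have d1 : HasDerivAt (fun α : ℝ => RL α x) (LJ x) 0 := by
    have a := (((hasDerivAt_cos (0:ℝ)).smul_const (LP x)).add ((hasDerivAt_sin (0:ℝ)).smul_const (LJ x))).add_const (LQ x)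
    have e : (-sin 0) • LP x + (cos 0) • LJ x = LJ x := by simp
    rw [e] at a
    exact a
  have d2 : HasFDerivAt (Pm m Ψ) (fderiv ℝ (Pm m Ψ) x) (RL 0 x) := by
    rw [RL_zero]; exact ((Pm_cd h m).differentiable one_ne_zero x).hasFDerivAt
  have d3 := d2.comp_hasDerivAt (0:ℝ) d1
  have d4 : HasDerivAt (fun α : ℝ => ex m (-α) * Pm m Ψ x) (-Complex.I * m * Pm m Ψ x) 0 := by
    have b : HasDerivAt (fun α : ℝ => Complex.I * m * ((-α : ℝ) : ℂ)) (Complex.I * m * ((-1 : ℝ) : ℂ)) 0 :=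
      ((hasDerivAt_neg (0:ℝ)).ofReal_comp).const_mul _
    have b2 := b.cexp.mul_const (Pm m Ψ x)
    refine b2.congr_deriv ?_
    simp
  have e : (Pm m Ψ) ∘ (fun α : ℝ => RL α x) = fun α : ℝ => ex m (-α) * Pm m Ψ x := funext fun α => Pm_rot m α x
  rw [e] at d3
  have := d3.unique d4
  rw [← this, LJ]
  simp [dd, pr]

theorem Pm_magD {B : ℝ} {Ψ : E3 → ℂ} (h : ContDiff ℝ 1 Ψ) (m : ℤ) (x : E3) (j : Fin 3) :
    magD B (Pm m Ψ) j x = fc m fun θ => magD B (fun y => Ψ (RL θ y)) j x := by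
  have c1 := RL_c
  have c2 := ex_c m
  have c3 := h.continuous
  have c4 := h.continuous_fderiv one_ne_zero
  have c5 : Continuous fun θ => dd (fun y => Ψ (RL θ y)) j x := by
    have : (fun θ => dd (fun y => Ψ (RL θ y)) j x) = fun θ => fderiv ℝ Ψ (RL θ x) (RL θ (ee j)) := by
      ext θ
      have := (h.differentiable one_ne_zero (RL θ x)).hasFDerivAt.comp x (RL θ).hasFDerivAt
      rw [dd, show (fun y => Ψ (RL θ y)) = Ψ ∘ RL θ from rfl, this.fderiv]
      rfl
    rw [this]; fun_prop
  rw [magD_eq, Pm_dd h, Pm]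
  simp only [magD_eq, fc]
  rw [mul_smul_comm, mul_smul_comm, ← smul_add, ← intervalIntegral.integral_const_mul, ← intervalIntegral.integral_const_mul, ← intervalIntegral.integral_add]
  · congr 2; ext θ; simp only [smul_eq_mul]; ring
  · exact Continuous.intervalIntegrable (by fun_prop) _ _
  · exact Continuous.intervalIntegrable (by fun_prop) _ _

theorem dd_rot {Ψ : E3 → ℂ} (h : ContDiff ℝ 1 Ψ) (θ : ℝ) (x : E3) :
    dd (fun y => Ψ (RL θ y)) 0 x = cos θ * dd Ψ 0 (RL θ x) + sin θ * dd Ψ 1 (RL θ x) ∧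
    dd (fun y => Ψ (RL θ y)) 1 x = -sin θ * dd Ψ 0 (RL θ x) + cos θ * dd Ψ 1 (RL θ x) ∧
    dd (fun y => Ψ (RL θ y)) 2 x = dd Ψ 2 (RL θ x) := by
  have := (h.differentiable one_ne_zero (RL θ x)).hasFDerivAt.comp x (RL θ).hasFDerivAt
  have e : ∀ j, dd (fun y => Ψ (RL θ y)) j x = fderiv ℝ Ψ (RL θ x) (RL θ (ee j)) := fun j => by
    rw [dd, show (fun y => Ψ (RL θ y)) = Ψ ∘ RL θ from rfl, this.fderiv]; rfl
  have r0 : RL θ (ee 0) = cos θ • ee 0 + sin θ • ee 1 := by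
    refine e3ext ?_ ?_ ?_ <;> simp [RL0, RL1, RL2]
  have r1 : RL θ (ee 1) = -sin θ • ee 0 + cos θ • ee 1 := by
    refine e3ext ?_ ?_ ?_ <;> simp [RL0, RL1, RL2]
  have r2 : RL θ (ee 2) = ee 2 := by
    refine e3ext ?_ ?_ ?_ <;> simp [RL0, RL1, RL2]
  refine ⟨?_, ?_, ?_⟩
  · rw [e, r0]; simp [dd]
  · rw [e, r1]; simp [dd]
  · rw [e, r2]; rfl

theorem dens_rot {B : ℝ} {Ψ : E3 → ℂ} (h : ContDiff ℝ 1 Ψ) (θ : ℝ) (x : E3) :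
    magEnergyDensity B (fun y => Ψ (RL θ y)) x = magEnergyDensity B Ψ (RL θ x) := by
  obtain ⟨d0, d1, d2⟩ := dd_rot h θ x
  have cs : (cos θ : ℂ) ^ 2 + (sin θ : ℂ) ^ 2 = 1 := by exact_mod_cast cos_sq_add_sin_sq θ
  have cs' := cos_sq_add_sin_sq θ
  have m0 : magD B (fun y => Ψ (RL θ y)) 0 x = cos θ * magD B Ψ 0 (RL θ x) + sin θ * magD B Ψ 1 (RL θ x) := by
    simp only [magD_eq, d0, Avec, Matrix.cons_val_zero, Matrix.cons_val_one, RL0, RL1]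
    generalize cos θ = c at cs ⊢
    generalize sin θ = s at cs ⊢
    push_cast
    linear_combination (B / 2 * x 1 * Ψ (RL θ x)) * cs
  have m1 : magD B (fun y => Ψ (RL θ y)) 1 x = -sin θ * magD B Ψ 0 (RL θ x) + cos θ * magD B Ψ 1 (RL θ x) := by
    simp only [magD_eq, d1, Avec, Matrix.cons_val_zero, Matrix.cons_val_one, RL0, RL1]
    generalize cos θ = c at cs ⊢
    generalize sin θ = s at cs ⊢
    push_cast
    linear_combination (-B / 2 * x 0 * Ψ (RL θ x)) * cs
  have m2 : magD B (fun y => Ψ (RL θ y)) 2 x = magD B Ψ 2 (RL θ x) := by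
    simp [magD_eq, d2, Avec]
  rw [magEnergyDensity, magEnergyDensity, Fin.sum_univ_three, Fin.sum_univ_three, m0, m1, m2]
  congr 1
  simp only [← Complex.normSq_eq_norm_sq, Complex.normSq_apply]
  generalize cos θ = c at cs' ⊢
  generalize sin θ = s at cs' ⊢
  simp
  linear_combination ((magD B Ψ 0 (RL θ x)).re ^ 2 + (magD B Ψ 0 (RL θ x)).im ^ 2 + (magD B Ψ 1 (RL θ x)).re ^ 2 + (magD B Ψ 1 (RL θ x)).im ^ 2) * cs'

theorem Pm_n2 {Ψ : E3 → ℂ} (h : Continuous Ψ) : HasSum (fun m => n2 (Pm m Ψ)) (n2 Ψ) := by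
  have c1 := RL_c
  have := fc_sum2 (g := fun x θ => Ψ (RL θ x)) (by unfold Function.uncurry; fun_prop)
  rw [RL_fub (f := fun x => ‖Ψ x‖ ^ 2) (by fun_prop)] at this
  have e : 1 / (2 * π) * (2 * π * ∫ x in ball3, ‖Ψ x‖ ^ 2) = n2 Ψ := by rw [n2]; field_simp
  rw [e] at this
  exact this

theorem Pm_q {B : ℝ} {Ψ : E3 → ℂ} (h : ContDiff ℝ 1 Ψ) : HasSum (fun m => qB B (Pm m Ψ)) (qB B Ψ) := by
  have c1 := RL_c
  have c3 := h.continuous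
  have c4 := h.continuous_fderiv one_ne_zero
  have cg : ∀ j : Fin 3, Continuous (Function.uncurry fun x θ => magD B (fun y => Ψ (RL θ y)) j x) := by
    intro j
    have c6 := Avec_cont B j
    have : (Function.uncurry fun x θ => magD B (fun y => Ψ (RL θ y)) j x) = fun p : E3 × ℝ =>
        -Complex.I * fderiv ℝ Ψ (RL p.2 p.1) (RL p.2 (ee j)) + (Avec B p.1 j : ℂ) * Ψ (RL p.2 p.1) := by
      ext ⟨x, θ⟩
      have := (h.differentiable one_ne_zero (RL θ x)).hasFDerivAt.comp x (RL θ).hasFDerivAt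
      rw [Function.uncurry_apply_pair, magD_eq, dd, show (fun y => Ψ (RL θ y)) = Ψ ∘ RL θ from rfl, this.fderiv]
      rfl
    rw [this]
    have c7 : Continuous fun p : E3 × ℝ => Avec B p.1 j := c6.comp continuous_fst
    fun_prop
  obtain ⟨G, hG⟩ : ∃ G : Fin 3 → E3 → ℝ → ℂ, G = fun j x θ => magD B (fun y => Ψ (RL θ y)) j x := ⟨_, rfl⟩
  have cg' : ∀ j, Continuous (Function.uncurry (G j)) := by rw [hG]; exact cg
  have s3 := ((fc_sum2 (cg' 0)).add (fc_sum2 (cg' 1))).add (fc_sum2 (cg' 2))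
  have cx : ∀ j x, Continuous (G j x) := fun j x => (cg' j).comp (by fun_prop : Continuous fun θ : ℝ => (x, θ))
  have cG : ∀ j, IntegrableOn (fun x => ∫ θ in (0:ℝ)..(2 * π), ‖G j x θ‖ ^ 2) ball3 := fun j =>
    ci (intervalIntegral.continuous_parametric_intervalIntegral_of_continuous' (f := fun x θ => ‖G j x θ‖ ^ 2) (by have := cg' j; unfold Function.uncurry at *; fun_prop) _ _)
  have E1 : ∀ m, qB B (Pm m Ψ) = (∫ x in ball3, ‖fc m (G 0 x)‖ ^ 2) + (∫ x in ball3, ‖fc m (G 1 x)‖ ^ 2) + ∫ x in ball3, ‖fc m (G 2 x)‖ ^ 2 := by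
    intro m
    have i : ∀ j, IntegrableOn (fun x => ‖fc m (G j x)‖ ^ 2) ball3 := fun j => ci ((fc_c (cg' j) m).norm.pow 2)
    have i2 : IntegrableOn (fun x => ‖fc m (G 0 x)‖ ^ 2 + ‖fc m (G 1 x)‖ ^ 2) ball3 := (i 0).add (i 1)
    rw [← integral_add (i 0) (i 1), ← integral_add i2 (i 2), qB]
    congr 1; ext x
    rw [magEnergyDensity, Fin.sum_univ_three, hG]
    simp only [Pm_magD h]
  have E2 : qB B Ψ = 1 / (2 * π) * (∫ x in ball3, ∫ θ in (0:ℝ)..(2 * π), ‖G 0 x θ‖ ^ 2) + 1 / (2 * π) * (∫ x in ball3, ∫ θ in (0:ℝ)..(2 * π), ‖G 1 x θ‖ ^ 2)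
      + 1 / (2 * π) * (∫ x in ball3, ∫ θ in (0:ℝ)..(2 * π), ‖G 2 x θ‖ ^ 2) := by
    have i2 : IntegrableOn (fun x => (∫ θ in (0:ℝ)..(2 * π), ‖G 0 x θ‖ ^ 2) + ∫ θ in (0:ℝ)..(2 * π), ‖G 1 x θ‖ ^ 2) ball3 := (cG 0).add (cG 1)
    rw [← mul_add, ← mul_add, ← integral_add (cG 0) (cG 1), ← integral_add i2 (cG 2)]
    have e := RL_fub (dens_cont h B)
    have e2 : ∀ x, ∫ θ in (0:ℝ)..(2 * π), magEnergyDensity B Ψ (RL θ x) = (∫ θ in (0:ℝ)..(2 * π), ‖G 0 x θ‖ ^ 2) + (∫ θ in (0:ℝ)..(2 * π), ‖G 1 x θ‖ ^ 2) + ∫ θ in (0:ℝ)..(2 * π), ‖G 2 x θ‖ ^ 2 := by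
      intro x
      have k : ∀ j, IntervalIntegrable (fun θ => ‖G j x θ‖ ^ 2) volume 0 (2 * π) := fun j => ((cx j x).norm.pow 2).intervalIntegrable _ _
      have k2 : IntervalIntegrable (fun θ => ‖G 0 x θ‖ ^ 2 + ‖G 1 x θ‖ ^ 2) volume 0 (2 * π) := (k 0).add (k 1)
      rw [← intervalIntegral.integral_add (k 0) (k 1), ← intervalIntegral.integral_add k2 (k 2)]
      congr 1; ext θ
      rw [← dens_rot h, magEnergyDensity, Fin.sum_univ_three, hG]
    simp_rw [e2] at e
    rw [e, qB]; field_simp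
  rw [E2, funext E1]
  exact s3

theorem n2_smul (t : ℝ) (Ψ : E3 → ℂ) : n2 (fun x => t • Ψ x) = t ^ 2 * n2 Ψ := by
  unfold n2; rw [← integral_const_mul]; congr 1; ext x; rw [norm_smul, mul_pow, norm_eq_abs, sq_abs]

theorem NM_ex {B κ : ℝ} (hκ : 0 < κ) : ∃ m Φ, NM B κ m Φ := by
  obtain ⟨Ψ, h, hn, hq⟩ := lam_ex B (c := lambda1H B + κ ^ 2) (by nlinarith [sq_pos_of_pos hκ])
  have : ∃ m, qB B (Pm m Ψ) < (lambda1H B + κ ^ 2) * n2 (Pm m Ψ) := by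
    by_contra! hc
    have := hasSum_le hc ((Pm_n2 h.continuous).mul_left (lambda1H B + κ ^ 2)) (Pm_q (B := B) h)
    linarith
  obtain ⟨m, hm⟩ := this
  have hC := Pm_cd h m
  have hM := Pm_mode h m
  set Φ := Pm m Ψ with hΦ
  have hn0 : 0 < n2 Φ := by
    rcases (n2_nonneg Φ).eq_or_lt with h0 | h0
    · rw [← h0] at hm; linarith [qB_nonneg B Φ]
    · exact h0
  set t := (√(n2 Φ))⁻¹ with ht
  have ht2 : t ^ 2 * n2 Φ = 1 := by
    rw [ht, inv_pow, sq_sqrt hn0.le]; field_simp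
  have e := fun x j => dd_smul (x := x) (differentiableAt_const t) (hC.differentiable one_ne_zero x) j
  have e2 := fun x j => magD_smul (B := B) (x := x) (differentiableAt_const t) (hC.differentiable one_ne_zero x) j
  refine ⟨m, fun x => t • Φ x, ⟨hC.const_smul t, ?_, ?_, ?_⟩⟩
  · intro x
    have h1 := hM x
    rw [e, e]
    simp only [df, fderiv_fun_const, Pi.zero_apply, ContinuousLinearMap.zero_apply, Complex.real_smul]
    push_cast
    linear_combination (t:ℂ) * h1
  · rw [n2_smul, ht2]
  · have : qB B (fun x => t • Φ x) = t ^ 2 * qB B Φ := by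
      unfold qB; rw [← integral_const_mul]; congr 1; ext x
      rw [magEnergyDensity, magEnergyDensity, Finset.mul_sum]
      refine Finset.sum_congr rfl fun j _ => ?_
      rw [e2]
      simp only [df, fderiv_fun_const, Pi.zero_apply, ContinuousLinearMap.zero_apply]
      simp [mul_pow]
    rw [this]
    have := mul_lt_mul_of_pos_left hm (show 0 < t ^ 2 by positivity)
    have e5 : t ^ 2 * ((lambda1H B + κ ^ 2) * n2 Φ) = lambda1H B + κ ^ 2 := by linear_combination (lambda1H B + κ ^ 2) * ht2
    linarith
end

section
theorem prod3 {f g h : ℝ → ℝ} (hf : Integrable f) (hg : Integrable g) (hh : Integrable h) :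
    Integrable (fun x : E3 => f (x 0) * g (x 1) * h (x 2)) ∧
    ∫ x : E3, f (x 0) * g (x 1) * h (x 2) = (∫ t, f t) * (∫ t, g t) * ∫ t, h t := by
  have e := EuclideanSpace.volume_preserving_symm_measurableEquiv_toLp (Fin 3)
  let F : Fin 3 → ℝ → ℝ := ![f, g, h]
  have hF : ∀ i, Integrable (F i) := by intro i; fin_cases i <;> assumption
  have h1 : (fun x : E3 => f (x 0) * g (x 1) * h (x 2)) =
      (fun y : Fin 3 → ℝ => ∏ i, F i (y i)) ∘ (MeasurableEquiv.toLp 2 (Fin 3 → ℝ)).symm := by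
    ext x; simp [Fin.prod_univ_three, F]
  have h2 := Integrable.fintype_prod hF
  constructor
  · rw [h1]; exact (e.integrable_comp_emb (MeasurableEquiv.measurableEmbedding _)).2 h2
  · rw [h1]
    have := e.integral_comp (MeasurableEquiv.measurableEmbedding _) (fun y : Fin 3 → ℝ => ∏ i, F i (y i))
    simp only [Function.comp_def]
    rw [this, integral_fintype_prod_volume_eq_prod, Fin.prod_univ_three]
    simp [F]

theorem sc1 {β : ℝ} (hβ : 0 < β) {F : ℝ → ℝ} {S : Set ℝ} (hS : MeasurableSet S) (hF : IntegrableOn F S) :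
    Integrable (fun x => S.indicator F (β * (1 - x))) ∧
    ∫ x, S.indicator F (β * (1 - x)) = β⁻¹ * ∫ t in S, F t := by
  have h1 := (integrable_indicator_iff hS).2 hF
  constructor
  · exact (h1.comp_mul_left' hβ.ne').comp_sub_left 1
  · rw [integral_sub_left_eq_self (fun x => S.indicator F (β * x)) volume 1,
      Measure.integral_comp_mul_left, integral_indicator hS, abs_of_pos (by positivity), smul_eq_mul]

theorem sc2 {L : ℝ} (hL : 0 < L) {F : ℝ → ℝ} (hF : Integrable F) :
    Integrable (fun x => F (x / L)) ∧ ∫ x, F (x / L) = L * ∫ t, F t := by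
  refine ⟨hF.comp_div hL.ne', ?_⟩
  rw [Measure.integral_comp_div, abs_of_pos hL, smul_eq_mul]

theorem dd_line {Ψ : E3 → ℂ} {x : E3} {j : Fin 3} {d : ℂ} (h : DifferentiableAt ℝ Ψ x)
    (hd : HasDerivAt (fun t : ℝ => Ψ (x + t • ee j)) d 0) : dd Ψ j x = d := by
  have h2 : HasDerivAt (fun t : ℝ => x + t • ee j) (ee j) 0 :=
    (((hasDerivAt_id (0:ℝ)).smul_const (ee j)).const_add x).congr_deriv (by simp)
  have h1 : HasFDerivAt Ψ (fderiv ℝ Ψ x) (x + (0:ℝ) • ee j) := by simpa using h.hasFDerivAt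
  exact (h1.comp_hasDerivAt (0:ℝ) h2).unique hd

theorem ph_deriv {φ : ℝ → ℝ} {v : ℝ → ℂ} {φ' : ℝ} {v' : ℂ} (h : HasDerivAt φ φ' 0) (hv : HasDerivAt v v' 0) :
    HasDerivAt (fun t => Complex.exp (Complex.I * φ t) * v t)
      (Complex.exp (Complex.I * φ 0) * (Complex.I * φ' * v 0 + v')) 0 := by
  refine (((h.ofReal_comp.const_mul Complex.I).cexp).mul hv).congr_deriv ?_
  ring

theorem ph_norm (φ a φ' : ℝ) (v v' : ℂ) :
    ‖-Complex.I * (Complex.exp (Complex.I * φ) * (Complex.I * φ' * v + v')) +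
      a * (Complex.exp (Complex.I * φ) * v)‖ = ‖((φ' + a : ℝ) : ℂ) * v - Complex.I * v'‖ := by
  have : -Complex.I * (Complex.exp (Complex.I * φ) * (Complex.I * φ' * v + v')) +
      a * (Complex.exp (Complex.I * φ) * v) = Complex.exp (Complex.I * φ) *
        (((φ' + a : ℝ) : ℂ) * v - Complex.I * v') := by
    push_cast
    linear_combination (-Complex.exp (Complex.I * φ) * φ' * v) * Complex.I_sq
  rw [this, norm_mul, mul_comm Complex.I, Complex.norm_exp_ofReal_mul_I, one_mul]

def tph (β ξ : ℝ) (x : E3) : ℝ := β ^ 2 * x 0 * x 1 / 2 - (β ^ 2 + β * ξ) * x 1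
def tU (β L : ℝ) (u : ℝ → ℂ) (χ : ℝ → ℝ) (x : E3) : ℂ :=
  u (β * (1 - x 0)) * ((χ (x 1 / L) : ℝ) : ℂ) * ((χ (x 2 / L) : ℝ) : ℂ)
def tr (β L ξ : ℝ) (u : ℝ → ℂ) (χ : ℝ → ℝ) (x : E3) : ℂ :=
  Complex.exp (Complex.I * tph β ξ x) * tU β L u χ x

theorem tr_cd {β L ξ : ℝ} {u : ℝ → ℂ} {χ : ℝ → ℝ} (hu : ContDiff ℝ 1 u) (hχ : ContDiff ℝ 1 χ) :
    ContDiff ℝ 1 (tr β L ξ u χ) := by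
  unfold tr tU tph
  have e : ∀ i : Fin 3, ContDiff ℝ 1 (fun x : E3 => x i) := fun i => by fun_prop
  have e0 := e 0
  have e1 := e 1
  have e2 := e 2
  have o : ContDiff ℝ 1 (fun x : ℝ => (x : ℂ)) := Complex.ofRealCLM.contDiff
  have k1 : ContDiff ℝ 1 (fun x : E3 => ((χ (x 1 / L) : ℝ) : ℂ)) := o.comp (hχ.comp (e1.div_const L))
  have k2 : ContDiff ℝ 1 (fun x : E3 => ((χ (x 2 / L) : ℝ) : ℂ)) := o.comp (hχ.comp (e2.div_const L))
  have k0 : ContDiff ℝ 1 (fun x : E3 => u (β * (1 - x 0))) :=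
    hu.comp (contDiff_const.mul (contDiff_const.sub e0))
  have k3 : ContDiff ℝ 1 (fun x : E3 => ((β ^ 2 * x 0 * x 1 / 2 - (β ^ 2 + β * ξ) * x 1 : ℝ) : ℂ)) :=
    o.comp (by fun_prop)
  exact ((contDiff_const.mul k3).cexp).mul ((k0.mul k1).mul k2)

theorem tr_norm (β L ξ : ℝ) (u : ℝ → ℂ) (χ : ℝ → ℝ) (x : E3) :
    ‖tr β L ξ u χ x‖ ^ 2 = ‖u (β * (1 - x 0))‖ ^ 2 * χ (x 1 / L) ^ 2 * χ (x 2 / L) ^ 2 := by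
  unfold tr tU
  rw [norm_mul, mul_comm Complex.I, Complex.norm_exp_ofReal_mul_I, one_mul]
  simp [mul_pow]

theorem cx1 (a b : ℝ) (w : ℂ) : ‖(a:ℂ) * w - Complex.I * (w * b)‖ ^ 2 = ‖w‖ ^ 2 * (a ^ 2 + b ^ 2) := by
  simp only [Complex.sq_norm, Complex.normSq_apply]; simp; ring

theorem tr_dens {β L ξ : ℝ} {u : ℝ → ℂ} {χ : ℝ → ℝ} (hu : ContDiff ℝ 1 u) (hχ : ContDiff ℝ 1 χ) (x : E3) :
    magEnergyDensity (β ^ 2) (tr β L ξ u χ) x =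
      β ^ 2 * (‖deriv u (β * (1 - x 0))‖ ^ 2 + (β * (1 - x 0) + ξ) ^ 2 * ‖u (β * (1 - x 0))‖ ^ 2)
        * χ (x 1 / L) ^ 2 * χ (x 2 / L) ^ 2
      + ‖u (β * (1 - x 0))‖ ^ 2 * (deriv χ (x 1 / L) / L) ^ 2 * χ (x 2 / L) ^ 2
      + ‖u (β * (1 - x 0))‖ ^ 2 * χ (x 1 / L) ^ 2 * (deriv χ (x 2 / L) / L) ^ 2 := by
  have hd : DifferentiableAt ℝ (tr β L ξ u χ) x := (tr_cd hu hχ).differentiable one_ne_zero x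
  have du : HasDerivAt u (deriv u (β * (1 - x 0))) (β * (1 - (x 0 + 0))) := by
    rw [add_zero]; exact (hu.differentiable one_ne_zero _).hasDerivAt
  have dχ : ∀ s, HasDerivAt χ (deriv χ (s / L)) ((s + 0) / L) := fun s => by
    rw [add_zero]; exact (hχ.differentiable one_ne_zero _).hasDerivAt
  have dq : ∀ s, HasDerivAt (fun t : ℝ => ((χ ((s + t) / L) : ℝ) : ℂ)) ((deriv χ (s / L) / L : ℝ) : ℂ) 0 := fun s => by
    have : HasDerivAt (fun t : ℝ => (s + t) / L) (1 / L) 0 := ((hasDerivAt_id (0:ℝ)).const_add s).div_const L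
    have := (HasDerivAt.comp (h₂ := χ) (h := fun t : ℝ => (s + t) / L) 0 (dχ s) this).ofReal_comp
    exact this.congr_deriv (by push_cast; ring)
  have dv : HasDerivAt (fun t : ℝ => u (β * (1 - (x 0 + t)))) (-β * deriv u (β * (1 - x 0))) 0 := by
    have h1 : HasDerivAt (fun t : ℝ => β * (1 - (x 0 + t))) (-β) 0 :=
      ((((hasDerivAt_id (0:ℝ)).const_add (x 0)).const_sub 1).const_mul β).congr_deriv (by ring)
    have := HasDerivAt.scomp (𝕜' := ℝ) (h := fun t : ℝ => β * (1 - (x 0 + t))) (g₁ := u) 0 du h1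
    exact this.congr_deriv (by simp)
  set U := u (β * (1 - x 0)) with hU
  set V := deriv u (β * (1 - x 0))
  set p := χ (x 1 / L)
  set q := χ (x 2 / L)
  set p' := deriv χ (x 1 / L)
  set q' := deriv χ (x 2 / L)
  have v0 : tU β L u χ x = U * p * q := rfl
  have D0 : dd (tr β L ξ u χ) 0 x = Complex.exp (Complex.I * tph β ξ x) *
      (Complex.I * ((β ^ 2 * x 1 / 2 : ℝ) : ℂ) * (U * p * q) + (-β * V) * p * q) := by
    refine dd_line hd ?_
    have a : HasDerivAt (fun t : ℝ => tph β ξ (x + t • ee 0)) (β ^ 2 * x 1 / 2) 0 := by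
      have : (fun t : ℝ => tph β ξ (x + t • ee 0)) = fun t => tph β ξ x + (β ^ 2 * x 1 / 2) * t := by
        ext t; simp [tph]; ring
      rw [this]; exact (((hasDerivAt_id (0:ℝ)).const_mul _).const_add _).congr_deriv (by simp)
    have b : HasDerivAt (fun t : ℝ => tU β L u χ (x + t • ee 0)) ((-β * V) * p * q) 0 := by
      have : (fun t : ℝ => tU β L u χ (x + t • ee 0)) = fun t => u (β * (1 - (x 0 + t))) * p * q := by
        ext t; simp [tU, p, q]
      rw [this]; exact (dv.mul_const _).mul_const _
    refine (ph_deriv a b).congr_deriv ?_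
    simp [v0]
  have D1 : dd (tr β L ξ u χ) 1 x = Complex.exp (Complex.I * tph β ξ x) *
      (Complex.I * ((β ^ 2 * x 0 / 2 - (β ^ 2 + β * ξ) : ℝ) : ℂ) * (U * p * q) + U * ((p' / L : ℝ) : ℂ) * q) := by
    refine dd_line hd ?_
    have a : HasDerivAt (fun t : ℝ => tph β ξ (x + t • ee 1)) (β ^ 2 * x 0 / 2 - (β ^ 2 + β * ξ)) 0 := by
      have : (fun t : ℝ => tph β ξ (x + t • ee 1)) = fun t => tph β ξ x + (β ^ 2 * x 0 / 2 - (β ^ 2 + β * ξ)) * t := by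
        ext t; simp [tph]; ring
      rw [this]; exact (((hasDerivAt_id (0:ℝ)).const_mul _).const_add _).congr_deriv (by simp)
    have b : HasDerivAt (fun t : ℝ => tU β L u χ (x + t • ee 1)) (U * ((p' / L : ℝ) : ℂ) * q) 0 := by
      have : (fun t : ℝ => tU β L u χ (x + t • ee 1)) = fun t => U * ((χ ((x 1 + t) / L) : ℝ) : ℂ) * q := by
        ext t; simp [tU, U, q]
      rw [this]; exact ((dq (x 1)).const_mul _).mul_const _
    refine (ph_deriv a b).congr_deriv ?_
    simp [v0]
  have D2 : dd (tr β L ξ u χ) 2 x = Complex.exp (Complex.I * tph β ξ x) *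
      (Complex.I * ((0 : ℝ) : ℂ) * (U * p * q) + U * p * ((q' / L : ℝ) : ℂ)) := by
    refine dd_line hd ?_
    have a : HasDerivAt (fun t : ℝ => tph β ξ (x + t • ee 2)) 0 0 := by
      have : (fun t : ℝ => tph β ξ (x + t • ee 2)) = fun t => tph β ξ x := by
        ext t; simp [tph]
      rw [this]; exact hasDerivAt_const _ _
    have b : HasDerivAt (fun t : ℝ => tU β L u χ (x + t • ee 2)) (U * p * ((q' / L : ℝ) : ℂ)) 0 := by
      have : (fun t : ℝ => tU β L u χ (x + t • ee 2)) = fun t => U * p * ((χ ((x 2 + t) / L) : ℝ) : ℂ) := by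
        ext t; simp [tU, U, p]
      rw [this]; exact (dq (x 2)).const_mul _
    refine (ph_deriv a b).congr_deriv ?_
    simp [v0]
  have T : tr β L ξ u χ x = Complex.exp (Complex.I * tph β ξ x) * (U * p * q) := rfl
  rw [magEnergyDensity, Fin.sum_univ_three]
  simp only [magD_eq, D0, D1, D2, T, ph_norm]
  simp only [Avec, Matrix.cons_val_zero, Matrix.cons_val_one, Matrix.cons_val]
  have n0 : ‖((β ^ 2 * x 1 / 2 + -(β ^ 2 / 2) * x 1 : ℝ) : ℂ) * (U * p * q) - Complex.I * (-β * V * p * q)‖ ^ 2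
      = β ^ 2 * ‖V‖ ^ 2 * p ^ 2 * q ^ 2 := by
    have : β ^ 2 * x 1 / 2 + -(β ^ 2 / 2) * x 1 = 0 := by ring
    rw [this]; simp [mul_pow]
  have n1 : ‖((β ^ 2 * x 0 / 2 - (β ^ 2 + β * ξ) + β ^ 2 / 2 * x 0 : ℝ) : ℂ) * (U * p * q) - Complex.I * (U * ((p' / L : ℝ) : ℂ) * q)‖ ^ 2
      = ‖U‖ ^ 2 * (β ^ 2 * (β * (1 - x 0) + ξ) ^ 2 * p ^ 2 + (p' / L) ^ 2) * q ^ 2 := by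
    have e : ((β ^ 2 * x 0 / 2 - (β ^ 2 + β * ξ) + β ^ 2 / 2 * x 0 : ℝ) : ℂ) * (U * p * q) - Complex.I * (U * ((p' / L : ℝ) : ℂ) * q)
      = (((-β * (β * (1 - x 0) + ξ) * p : ℝ) : ℂ) * U - Complex.I * (U * ((p' / L : ℝ) : ℂ))) * q := by
      push_cast; ring
    rw [e, norm_mul, mul_pow, cx1, Complex.norm_real, Real.norm_eq_abs, sq_abs]; ring
  have n2' : ‖((0 + 0 : ℝ) : ℂ) * (U * p * q) - Complex.I * (U * p * ((q' / L : ℝ) : ℂ))‖ ^ 2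
      = ‖U‖ ^ 2 * p ^ 2 * (q' / L) ^ 2 := by
    simp [mul_pow, div_pow]
  rw [n0, n1, n2']
  ring
end

section
theorem chi_ex : ∃ χ : ℝ → ℝ, ContDiff ℝ 1 χ ∧ (∀ s, 1/2 ≤ |s| → χ s = 0) ∧
    Integrable (fun s => χ s ^ 2) ∧ Integrable (fun s => deriv χ s ^ 2) ∧ 0 < ∫ s, χ s ^ 2 := by
  let b : ContDiffBump (0:ℝ) := ⟨1/4, 1/2, by norm_num, by norm_num⟩
  have h1 : ContDiff ℝ 1 b := b.contDiff
  have hc : HasCompactSupport b := b.hasCompactSupport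
  have hc2 : HasCompactSupport (fun s => b s ^ 2) := hc.comp_left (g := fun t : ℝ => t ^ 2) (by simp)
  have hc3 : HasCompactSupport (fun s => deriv b s ^ 2) := hc.deriv.comp_left (g := fun t : ℝ => t ^ 2) (by simp)
  have c2 : Continuous (fun s => b s ^ 2) := h1.continuous.pow 2
  refine ⟨b, h1, fun s hs => ?_, c2.integrable_of_hasCompactSupport hc2,
    ((h1.continuous_deriv le_rfl).pow 2).integrable_of_hasCompactSupport hc3, ?_⟩
  · exact b.zero_of_le_dist (by simpa [b] using hs)
  · refine c2.integral_pos_of_hasCompactSupport_nonneg_nonzero (x := 0) hc2 (fun s => by positivity) ?_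
    have : b 0 = 1 := b.one_of_mem_closedBall (by simp [b.rIn_pos.le])
    simp [this]

theorem add3 {f g h : E3 → ℝ} (hf : Integrable f) (hg : Integrable g) (hh : Integrable h) :
    Integrable (fun x => f x + g x + h x) ∧ ∫ x, (f x + g x + h x) = (∫ x, f x) + (∫ x, g x) + ∫ x, h x := by
  have h1 : Integrable (fun x => f x + g x) := hf.add hg
  exact ⟨h1.add hh, by rw [integral_add h1 hh, integral_add hf hg]⟩

theorem chi_sq {χ : ℝ → ℝ} (h0 : ∀ s, 1/2 ≤ |s| → χ s = 0) {L : ℝ} (hL : 0 < L) (s : ℝ) (hs : χ (s / L) ^ 2 ≠ 0) :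
    s ^ 2 ≤ L ^ 2 / 4 := by
  by_contra h
  refine hs ?_
  rw [h0, zero_pow two_ne_zero]
  rw [abs_div, abs_of_pos hL, le_div_iff₀ hL]
  push Not at h
  by_contra h'
  push Not at h'
  nlinarith [abs_nonneg s, sq_abs s]

theorem box_ball {L : ℝ} {x : E3} (u1 : L ^ 2 < 1 - x 0) (u2 : 1 - x 0 < 1)
    (t1 : x 1 ^ 2 ≤ L ^ 2 / 4) (t2 : x 2 ^ 2 ≤ L ^ 2 / 4) : x ∈ ball3 := by
  have : ‖x‖ ^ 2 < 1 := by
    rw [nsq, ss]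
    nlinarith
  simp only [ball3, mem_ball_zero_iff]
  nlinarith [norm_nonneg x]

theorem ball_x0 {x : E3} (hx : x ∈ ball3) : 0 < 1 - x 0 := by
  have := ball_ss hx
  unfold ss at this; nlinarith [sq_nonneg (x 1), sq_nonneg (x 2)]

theorem lam_up {β L ξ : ℝ} (hβ : 0 < β) (hL : 0 < L) {u : ℝ → ℂ} {χ : ℝ → ℝ} (hu : ContDiff ℝ 1 u)
    (hχ : ContDiff ℝ 1 χ) (h0 : ∀ s, 1/2 ≤ |s| → χ s = 0) (i1 : Integrable fun s => χ s ^ 2)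
    (i2 : Integrable fun s => deriv χ s ^ 2)
    (j1 : IntegrableOn (fun t => ‖u t‖ ^ 2) (Ioi 0))
    (j2 : IntegrableOn (fun t => ‖deriv u t‖ ^ 2 + (t + ξ) ^ 2 * ‖u t‖ ^ 2) (Ioi 0)) :
    lambda1H (β ^ 2) * ((β⁻¹ * ∫ t in Ioo (β * L ^ 2) β, ‖u t‖ ^ 2) * (L * ∫ s, χ s ^ 2) * (L * ∫ s, χ s ^ 2)) ≤
      (β⁻¹ * (β ^ 2 * ∫ t in Ioi 0, (‖deriv u t‖ ^ 2 + (t + ξ) ^ 2 * ‖u t‖ ^ 2))) * (L * ∫ s, χ s ^ 2) * (L * ∫ s, χ s ^ 2)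
      + (β⁻¹ * ∫ t in Ioi 0, ‖u t‖ ^ 2) * (L * ((L⁻¹) ^ 2 * ∫ s, deriv χ s ^ 2)) * (L * ∫ s, χ s ^ 2)
      + (β⁻¹ * ∫ t in Ioi 0, ‖u t‖ ^ 2) * (L * ∫ s, χ s ^ 2) * (L * ((L⁻¹) ^ 2 * ∫ s, deriv χ s ^ 2)) := by
  have hcd := tr_cd (β := β) (L := L) (ξ := ξ) hu hχ
  have a0 := sc2 hL i1
  have a1 := sc2 hL (i2.const_mul ((L⁻¹) ^ 2))
  have a12 := a1.2
  rw [integral_const_mul (L⁻¹ ^ 2) (fun s => deriv χ s ^ 2)] at a12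
  have b0 := sc1 hβ measurableSet_Ioo (j1.mono_set (s := Ioo (β * L ^ 2) β) fun t ht => lt_trans (by positivity) ht.1)
  have b1 := sc1 hβ measurableSet_Ioi j1
  have b2 := sc1 hβ measurableSet_Ioi (Integrable.const_mul j2 (β ^ 2))
  rw [integral_const_mul] at b2
  have p0 := prod3 b0.1 a0.1 a0.1
  have p1 := prod3 b2.1 a0.1 a0.1
  have p2 := prod3 b1.1 a1.1 a0.1
  have p3 := prod3 b1.1 a0.1 a1.1
  rw [← b0.2, ← a0.2, ← b1.2, ← b2.2, ← a12, ← p0.2, ← p1.2, ← p2.2, ← p3.2,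
    ← (add3 p1.1 p2.1 p3.1).2]
  have p123 := (add3 p1.1 p2.1 p3.1).1
  refine le_trans (mul_le_mul_of_nonneg_left ?_ (lam_nonneg _)) ((lam_le hcd).trans ?_)
  · rw [n2, ← integral_indicator ball_meas]
    refine integral_mono p0.1 ((integrable_indicator_iff ball_meas).2 (ci (hcd.continuous.norm.pow 2))) fun x => ?_
    dsimp only
    by_cases hx : x ∈ ball3
    · rw [indicator_of_mem hx, tr_norm]
      gcongr
      exact indicator_le_self' (fun _ _ => by positivity) _
    · rw [indicator_of_notMem hx]
      by_contra hcon
      have hne : (Ioo (β * L ^ 2) β).indicator (fun t => ‖u t‖ ^ 2) (β * (1 - x 0)) * χ (x 1 / L) ^ 2 * χ (x 2 / L) ^ 2 ≠ 0 := by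
        intro h; exact hcon h.le
      have m0 := left_ne_zero_of_mul (left_ne_zero_of_mul hne)
      have m1 := right_ne_zero_of_mul (left_ne_zero_of_mul hne)
      have m2 := right_ne_zero_of_mul hne
      have t0 := mem_of_indicator_ne_zero m0
      have t1 := chi_sq h0 hL _ m1
      have t2 := chi_sq h0 hL _ m2
      have u1 : L ^ 2 < 1 - x 0 := lt_of_mul_lt_mul_left t0.1 hβ.le
      have u2 : 1 - x 0 < 1 := by
        refine lt_of_mul_lt_mul_left ?_ hβ.le
        rw [mul_one]; exact t0.2
      exact hx (box_ball u1 u2 t1 t2)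
  · rw [qB, ← integral_indicator ball_meas]
    refine integral_mono ((integrable_indicator_iff ball_meas).2 (ci (dens_cont hcd _))) p123 fun x => ?_
    have pos : ∀ (S : Set ℝ) (F : ℝ → ℝ), (∀ t, 0 ≤ F t) → ∀ t, 0 ≤ S.indicator F t :=
      fun S F h t => indicator_nonneg (fun t _ => h t) t
    have P1 := pos (Ioi 0) (fun t => ‖u t‖ ^ 2) (fun t => by positivity) (β * (1 - x 0))
    have P2 := pos (Ioi 0) (fun t => β ^ 2 * (‖deriv u t‖ ^ 2 + (t + ξ) ^ 2 * ‖u t‖ ^ 2)) (fun t => by positivity) (β * (1 - x 0))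
    dsimp only [Pi.add_apply]
    by_cases hx : x ∈ ball3
    · rw [indicator_of_mem hx, tr_dens hu hχ]
      have hm : β * (1 - x 0) ∈ Ioi (0:ℝ) := mul_pos hβ (ball_x0 hx)
      rw [indicator_of_mem hm, indicator_of_mem hm]
      have e : ∀ a : ℝ, (a / L) ^ 2 = L⁻¹ ^ 2 * a ^ 2 := fun a => by rw [div_eq_mul_inv, mul_pow, mul_comm]
      rw [e (deriv χ (x 1 / L)), e (deriv χ (x 2 / L))]
    · rw [indicator_of_notMem hx]
      positivity

theorem lam_up2 {ξ₀ : ℝ} (hξ : deGennes ξ₀ = Theta0) {η : ℝ} (hη : 0 < η) :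
    ∀ᶠ B in atTop, lambda1H B / B < Theta0 + η := by
  obtain ⟨χ, hχ, h0, i1, i2, hC⟩ := chi_ex
  have hlt : deGennes ξ₀ < Theta0 + η / 2 := by rw [hξ]; linarith
  obtain ⟨q, ⟨u, hu, j1, j2, hN, rfl⟩, hq⟩ := exists_lt_of_csInf_lt
    (by obtain ⟨u, a, b, c, d⟩ := (dg_trial Theta0_lt_one ξ₀ ξ₀).1; exact ⟨_, u, a, b, c, d, rfl⟩) hlt
  rw [div_lt_iff₀ hN] at hq
  set N := ∫ t in Ioi (0:ℝ), ‖u t‖ ^ 2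
  set E := ∫ t in Ioi (0:ℝ), (‖deriv u t‖ ^ 2 + (t + ξ₀) ^ 2 * ‖u t‖ ^ 2)
  set C := ∫ s, χ s ^ 2
  set D := ∫ s, deriv χ s ^ 2
  have hΘ : 0 ≤ Theta0 := (delta_facts hξ rfl).2.2.le
  -- truncated integral tends to N
  have hT : Tendsto (fun ρ : ℝ => ∫ t in Ioo ((ρ ^ 2)⁻¹) (ρ ^ 4), ‖u t‖ ^ 2) atTop (𝓝 N) := by
    have r1 : Tendsto (fun ρ : ℝ => (ρ ^ 2)⁻¹) atTop (𝓝 0) := (tendsto_pow_atTop two_ne_zero).inv_tendsto_atTop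
    have r2 : Tendsto (fun ρ : ℝ => ρ ^ 4) atTop atTop := tendsto_pow_atTop four_ne_zero
    have c := (aecover_Ioi_of_Ioi (μ := (volume : Measure ℝ)) r1).inter (aecover_Iio (μ := (volume.restrict (Ioi 0))) r2)
    have := c.integral_tendsto_of_countably_generated j1
    refine this.congr' ?_
    filter_upwards [eventually_gt_atTop 0] with ρ hρ
    rw [Measure.restrict_restrict (measurableSet_Ioi.inter measurableSet_Iio), Ioi_inter_Iio,
      inter_eq_left.2 (show Ioo ((ρ ^ 2)⁻¹) (ρ ^ 4) ⊆ Ioi 0 from fun t ht => lt_trans (by positivity) ht.1)]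
  have hR : Tendsto (fun ρ : ℝ => (Theta0 + η) * (∫ t in Ioo ((ρ ^ 2)⁻¹) (ρ ^ 4), ‖u t‖ ^ 2) - 2 * N * D / C * (ρ ^ 2)⁻¹) atTop (𝓝 ((Theta0 + η) * N - 2 * N * D / C * 0)) :=
    (hT.const_mul _).sub ((tendsto_pow_atTop two_ne_zero).inv_tendsto_atTop.const_mul _)
  have hev := (hR.eventually (lt_mem_nhds (show E < _ by nlinarith))).and (hT.eventually (lt_mem_nhds hN))
  have hrt : Tendsto (fun B : ℝ => √(√(√B))) atTop atTop :=
    tendsto_sqrt_atTop.comp (tendsto_sqrt_atTop.comp tendsto_sqrt_atTop)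
  filter_upwards [hrt.eventually hev, eventually_ge_atTop 1] with B hB hB1
  set ρ := √(√(√B)) with hρ
  have hρ1 : 1 ≤ ρ := by rw [hρ, one_le_sqrt, one_le_sqrt, one_le_sqrt]; exact hB1
  have hρ0 : 0 < ρ := by linarith
  have e4 : ρ ^ 4 = √B := by
    rw [show ρ ^ 4 = (ρ ^ 2) ^ 2 by ring, hρ, sq_sqrt (by positivity), sq_sqrt (by positivity)]
  have eB : B = (ρ ^ 4) ^ 2 := by rw [e4, sq_sqrt (by linarith)]
  have key := lam_up (β := ρ ^ 4) (L := (ρ ^ 3)⁻¹) (ξ := ξ₀) (by positivity) (by positivity)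
    hu hχ h0 i1 i2 j1 j2
  have e5 : ρ ^ 4 * ((ρ ^ 3)⁻¹) ^ 2 = (ρ ^ 2)⁻¹ := by field_simp
  rw [e5, ← eB] at key
  obtain ⟨g1, g2⟩ := hB
  change lambda1H B * ((_ * ∫ t in Ioo ((ρ ^ 2)⁻¹) (ρ ^ 4), ‖u t‖ ^ 2) * (_ * C) * (_ * C)) ≤ (_ * (_ * E)) * (_ * C) * (_ * C)
    + (_ * N) * (_ * (_ * D)) * (_ * C) + (_ * N) * (_ * C) * (_ * (_ * D)) at key
  generalize (∫ t in Ioo ((ρ ^ 2)⁻¹) (ρ ^ 4), ‖u t‖ ^ 2) = T at *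
  have k2 : lambda1H B * T ≤ B * (E + 2 * N * D / C * (ρ ^ 2)⁻¹) := by
    have hpos : 0 < (ρ ^ 4)⁻¹ * (ρ ^ 3)⁻¹ ^ 2 * C ^ 2 := by positivity
    refine le_of_mul_le_mul_left ?_ hpos
    refine le_trans (le_of_eq ?_) (key.trans (le_of_eq ?_))
    · ring
    · rw [eB]; field_simp; ring
  have hB0 : 0 < B := by linarith
  rw [div_lt_iff₀ hB0]
  refine lt_of_mul_lt_mul_right (k2.trans_lt ?_) g2.le
  have := mul_lt_mul_of_pos_left g1 hB0
  linarith

theorem lam_low {ξ₀ : ℝ} (hξ : deGennes ξ₀ = Theta0) {η : ℝ} (hη : 0 < η) :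
    ∀ᶠ B in atTop, Theta0 - η < lambda1H B / B := by
  obtain ⟨H, H', ⟨h1, h2, h3, KH, h4⟩, hG⟩ := admA hξ
  have hK : AdmK KH H H' := ⟨h1, h2, h3, h4⟩
  have hK0 := hK.pos
  set c := 10 * (KH + 1)
  have hev : Tendsto (fun B : ℝ => Theta0 - c * (√B)⁻¹ - (1 + c * (√B)⁻¹) * B⁻¹ - η * (c * (√B)⁻¹ + 1) * 0 - (Theta0 - η) * (1 + c * (√B)⁻¹)) atTop
      (𝓝 (Theta0 - c * 0 - (1 + c * 0) * 0 - η * (c * 0 + 1) * 0 - (Theta0 - η) * (1 + c * 0))) := by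
    have a := (tendsto_sqrt_atTop.inv_tendsto_atTop).const_mul c
    have b := tendsto_inv_atTop_zero (𝕜 := ℝ)
    exact (((a.const_sub _).sub ((a.const_add 1).mul b)).sub (((a.add_const 1).const_mul η).mul_const 0)).sub ((a.const_add 1).const_mul _)
  have e0 := hev.eventually (lt_mem_nhds (show (0:ℝ) < _ by ring_nf; exact hη))
  filter_upwards [e0, eventually_ge_atTop 1] with B hB hB1
  have hB0 : 0 < B := by linarith
  have hl := lam_nonneg B
  set κ := 2 / (1 + (2 * (lambda1H B + 1) + 8)) with hκ
  have hκ0 : 0 < κ := by positivity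
  have hκ1 : κ ≤ 1 := by rw [hκ, div_le_one (by positivity)]; linarith
  obtain ⟨m, Φ, hΦ⟩ := NM_ex (B := B) hκ0
  have g := hΦ.good (K := 1) (τ := 1) hB0 hκ0 hκ1 (by rw [hκ]; apply le_of_eq; field_simp)
  have k := g.one_star hB1 le_rfl hK hG
  have e := g.e0
  have : B * Theta0 ≤ (1 + c / √B) * (lambda1H B + 1) + c * √B := by
    refine le_trans ?_ k
    have := mul_nonneg (sub_nonneg.2 Theta0_lt_one.le) e
    nlinarith
  have hs : 0 < √B := by positivity
  rw [lt_div_iff₀ hB0]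
  have hc : 0 < 1 + c * (√B)⁻¹ := by positivity
  refine lt_of_mul_lt_mul_left ?_ hc.le
  have hm := mul_pos hB0 hB
  have e1 : B * (√B)⁻¹ = √B := by rw [← div_eq_mul_inv, div_sqrt]
  have e2 : B * B⁻¹ = 1 := mul_inv_cancel₀ hB0.ne'
  rw [div_eq_mul_inv] at this
  have e3 : B * (Theta0 - c * (√B)⁻¹ - (1 + c * (√B)⁻¹) * B⁻¹ - η * (c * (√B)⁻¹ + 1) * 0 - (Theta0 - η) * (1 + c * (√B)⁻¹))
    = B * Theta0 - c * √B - (1 + c * (√B)⁻¹) - (1 + c * (√B)⁻¹) * ((Theta0 - η) * B) := by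
    linear_combination (-c) * e1 - (1 + c * (√B)⁻¹) * e2
  rw [e3] at hm
  linarith

theorem hlam {ξ₀ : ℝ} (hξ : deGennes ξ₀ = Theta0) : Tendsto (fun B => lambda1H B / B) atTop (𝓝 Theta0) := by
  rw [tendsto_order]
  constructor
  · intro a ha
    filter_upwards [lam_low hξ (sub_pos.2 ha)] with B hB
    linarith
  · intro a ha
    filter_upwards [lam_up2 hξ (sub_pos.2 ha)] with B hB
    linarith
end

section
def bq (B : ℝ) (Ψ : E3 → ℂ) (x : E3) : ℝ :=
  ∑ j : Fin 3, 2 * Avec 1 x j * (magD B Ψ j x * (starRingEnd ℂ) (Ψ x)).re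

theorem dens_shift (B ε : ℝ) (Ψ : E3 → ℂ) (x : E3) :
    magEnergyDensity (B + ε) Ψ x = magEnergyDensity B Ψ x + (ε * bq B Ψ x + ε ^ 2 * (ss x / 4 * ‖Ψ x‖ ^ 2)) := by
  have h : ∀ (p f : ℂ) (a : ℝ), ‖p + ε * a * f‖ ^ 2 = ‖p‖ ^ 2 + ε * (2 * a * (p * (starRingEnd ℂ) f).re) + ε ^ 2 * (a ^ 2 * ‖f‖ ^ 2) := by
    intro p f a
    simp only [Complex.sq_norm, Complex.normSq_apply]
    simp
    ring
  have hm : ∀ j, magD (B + ε) Ψ j x = magD B Ψ j x + ε * (Avec 1 x j : ℝ) * Ψ x := by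
    intro j
    have : Avec (B + ε) x j = Avec B x j + ε * Avec 1 x j := by
      fin_cases j <;> simp [Avec] <;> ring
    rw [magD_eq, magD_eq, this]; push_cast; ring
  unfold magEnergyDensity bq
  simp only [hm, h, Fin.sum_univ_three]
  simp only [Avec, Matrix.cons_val_zero, Matrix.cons_val_one, Matrix.cons_val, ss]
  ring

theorem bq_cont {Ψ : E3 → ℂ} (h : ContDiff ℝ 1 Ψ) (B : ℝ) : Continuous (bq B Ψ) := by
  have h1 := fun j => magD_cont h B j
  have h2 := fun j => Avec_cont 1 j
  have h3 := h.continuous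
  unfold bq
  refine continuous_finset_sum _ fun j _ => ?_
  exact (continuous_const.mul (h2 j)).mul (Complex.continuous_re.comp ((h1 j).mul (Complex.continuous_conj.comp h3)))

theorem q_shift {Ψ : E3 → ℂ} (h : ContDiff ℝ 1 Ψ) (B ε : ℝ) :
    qB (B + ε) Ψ = qB B Ψ + (ε * (∫ x in ball3, bq B Ψ x) + ε ^ 2 * ∫ x in ball3, ss x / 4 * ‖Ψ x‖ ^ 2) := by
  have c1 := ci (dens_cont h B)
  have c2 := ci (bq_cont h B)
  have c3 : IntegrableOn (fun x => ss x / 4 * ‖Ψ x‖ ^ 2) ball3 := ci ((ss_cont.div_const 4).mul (h.continuous.norm.pow 2))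
  have c4 : IntegrableOn (fun x => ε * bq B Ψ x + ε ^ 2 * (ss x / 4 * ‖Ψ x‖ ^ 2)) ball3 :=
    (c2.const_mul ε).add (c3.const_mul (ε ^ 2))
  unfold qB
  simp only [dens_shift]
  rw [integral_add c1 c4, integral_add (c2.const_mul ε) (c3.const_mul (ε ^ 2)), integral_const_mul, integral_const_mul]

theorem c_le {Ψ : E3 → ℂ} (h : Continuous Ψ) : ∫ x in ball3, ss x / 4 * ‖Ψ x‖ ^ 2 ≤ n2 Ψ / 4 := by
  have : n2 Ψ / 4 = ∫ x in ball3, ‖Ψ x‖ ^ 2 / 4 := by rw [integral_div]; rfl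
  rw [this]
  refine setIntegral_mono_on (ci ((ss_cont.div_const 4).mul (h.norm.pow 2))) (ci ((h.norm.pow 2).div_const 4)) ball_meas
    fun x hx => ?_
  have := ball_ss hx
  have : ss x ≤ 1 := by nlinarith [sq_nonneg (x 2)]
  have := mul_le_mul_of_nonneg_right this (sq_nonneg ‖Ψ x‖)
  linarith

theorem NM.ell {B κ : ℝ} {m : ℤ} {Φ : E3 → ℂ} (h : NM B κ m Φ) :
    ∫ x in ball3, bq B Φ x = ∫ r, r * pim B m r ∂(nuM Φ) := by
  rw [nuM_int h.cd.continuous (f := fun r => r * pim B m r) (measurable_id.mul (pim_meas B m))]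
  refine integral_congr_ae ?_
  filter_upwards [ae_ss] with x hx
  have e1 := dens_shift B 1 Φ x
  have hr := rr_pos hx.2
  rw [dens_eq h.md hx.2, dens_eq h.md hx.2] at e1
  have e2 : pim (B + 1) m (rr x) = pim B m (rr x) + rr x / 2 := by unfold pim; ring
  rw [e2] at e1
  have e3 := rr_sq x
  linear_combination (-1 : ℝ) * e1 + ‖Φ x‖ ^ 2 / 4 * e3

theorem keyP {ξ₀ δ₀ : ℝ} (hξ : deGennes ξ₀ = Theta0) (hu : ∀ ξ, deGennes ξ = Theta0 → ξ = ξ₀)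
    (hδ : δ₀ = (1/2) * iteratedDeriv 2 deGennes ξ₀) {η : ℝ} (hη : 0 < η) :
    ∃ N : ℝ, 1 ≤ N ∧ ∀ B ≥ N, ∀ ε, lambda1H (B + ε) ≤ lambda1H B + ε * Theta0 + |ε| * (δ₀ / 2 + η) + ε ^ 2 / 4 := by
  obtain ⟨N, hN, h⟩ := good_fin hξ hu hδ (hlam hξ) hη
  refine ⟨N, hN, fun B hB ε => le_of_forall_pos_le_add fun t ht => ?_⟩
  have hB0 : 0 < B := by linarith
  have hl := lam_nonneg B
  set M := 1 + (2 * N ^ 4 * (lambda1H B + 1) + 8 * N ^ 4) with hM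
  have hM0 : 0 < M := by positivity
  have hN0 : 0 < N := by linarith
  set κ := min (min 1 t) (2 / (N * M)) with hκ
  have k0 : 0 < κ := lt_min (lt_min one_pos ht) (by positivity)
  have k1 : κ ≤ 1 := (min_le_left _ _).trans (min_le_left _ _)
  have k2 : κ ≤ t := (min_le_left _ _).trans (min_le_right _ _)
  have k3 : κ ≤ 2 / (N * M) := min_le_right _ _
  obtain ⟨m, Φ, hΦ⟩ := NM_ex (B := B) k0
  have g := hΦ.good (K := N) (τ := 1 / N) hB0 k0 k1 (by
    have := mul_le_mul_of_nonneg_right k3 hM0.le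
    have e : 2 / (N * M) * M = 2 * (1 / N) := by field_simp
    rw [e] at this
    linarith)
  have b := h B hB m _ g
  rw [← hΦ.ell] at b
  have q := q_shift hΦ.cd B ε
  have l := lam_le (B := B + ε) hΦ.cd
  have c := c_le hΦ.cd.continuous
  rw [hΦ.n1] at l c
  have q0 := hΦ.hq
  generalize (∫ x in ball3, bq B Φ x) = ℓ at *
  generalize (∫ x in ball3, ss x / 4 * ‖Φ x‖ ^ 2) = C at *
  have b2 : ε * (ℓ - Theta0) ≤ |ε| * (δ₀ / 2 + η) := by
    refine (le_abs_self _).trans ?_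
    rw [abs_mul]; gcongr
  have c2 : ε ^ 2 * C ≤ ε ^ 2 * (1 / 4) := by gcongr
  have kk : κ ^ 2 ≤ κ := by nlinarith
  linarith

theorem lam_conv : ConvexOn ℝ univ (fun B => B ^ 2 / 4 - lambda1H B) := by
  refine ⟨convex_univ, fun x _ y _ a b ha hb hab => ?_⟩
  simp only [smul_eq_mul]
  set z := a * x + b * y with hz
  suffices a * lambda1H x + b * lambda1H y ≤ lambda1H z + (a * x ^ 2 + b * y ^ 2 - z ^ 2) / 4 by linarith
  by_contra hcon
  push Not at hcon
  obtain ⟨Ψ, hc, h0, hq⟩ := lam_ex z (c := a * lambda1H x + b * lambda1H y - (a * x ^ 2 + b * y ^ 2 - z ^ 2) / 4) (by linarith)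
  have lx := lam_le (B := x) hc
  have ly := lam_le (B := y) hc
  have qx := q_shift hc z (x - z)
  have qy := q_shift hc z (y - z)
  have c := c_le hc.continuous
  rw [add_sub_cancel] at qx qy
  rw [qx] at lx
  rw [qy] at ly
  generalize (∫ x in ball3, bq z Ψ x) = ℓ at *
  generalize (∫ x in ball3, ss x / 4 * ‖Ψ x‖ ^ 2) = C at *
  have m1 := mul_le_mul_of_nonneg_left lx ha
  have m2 := mul_le_mul_of_nonneg_left ly hb
  have e1 : a * (x - z) + b * (y - z) = 0 := by linear_combination (-z) * hab - hz
  have e2 : a * (x - z) ^ 2 + b * (y - z) ^ 2 = a * x ^ 2 + b * y ^ 2 - z ^ 2 := by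
    linear_combination z ^ 2 * hab + 2 * z * hz
  have e3 : 0 ≤ a * (x - z) ^ 2 + b * (y - z) ^ 2 := by positivity
  have m3 := mul_le_mul_of_nonneg_left c e3
  have e4 : a * (qB z Ψ + ((x - z) * ℓ + (x - z) ^ 2 * C)) + b * (qB z Ψ + ((y - z) * ℓ + (y - z) ^ 2 * C))
      = qB z Ψ + (a * (x - z) ^ 2 + b * (y - z) ^ 2) * C := by
    linear_combination (qB z Ψ) * hab + ℓ * e1
  rw [e2] at m3 e4
  nlinarith only [m1, m2, m3, e4, hq]

theorem lam_der (B : ℝ) {S : Set ℝ} {d : ℝ} (h : HasDerivWithinAt (fun B => B ^ 2 / 4 - lambda1H B) d S B) :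
    HasDerivWithinAt lambda1H (B / 2 - d) S B := by
  have h1 : HasDerivWithinAt (fun B : ℝ => B ^ 2 / 4) (B / 2) S B :=
    (((hasDerivAt_id B).pow 2).div_const 4).hasDerivWithinAt.congr_deriv (by simp; ring)
  have := h1.sub h
  refine this.congr (fun x _ => ?_) ?_ <;> simp

theorem main_all {ξ₀ δ₀ : ℝ} (hξ : deGennes ξ₀ = Theta0) (hu : ∀ ξ, deGennes ξ = Theta0 → ξ = ξ₀)
    (hδ : δ₀ = (1/2) * iteratedDeriv 2 deGennes ξ₀) :
    ∃ dplus dminus : ℝ → ℝ,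
      (∀ B : ℝ, 0 < B →
        Tendsto (fun ε : ℝ => (lambda1H (B + ε) - lambda1H B) / ε) (𝓝[>] 0) (𝓝 (dplus B)) ∧
        Tendsto (fun ε : ℝ => (lambda1H (B + ε) - lambda1H B) / ε) (𝓝[<] 0) (𝓝 (dminus B)) ∧
        dplus B ≤ dminus B) ∧
      0 < Theta0 - δ₀ / 2 ∧
      Theta0 - δ₀ / 2 ≤ Filter.liminf dplus Filter.atTop ∧
      Filter.limsup dminus Filter.atTop ≤ Theta0 + δ₀ / 2 ∧
      ∃ B₀ : ℝ, 0 < B₀ ∧ MonotoneOn lambda1H (Ioi B₀) := by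
  have hpos := (delta_facts hξ hδ).2.1
  let g : ℝ → ℝ := fun B => B ^ 2 / 4 - lambda1H B
  have hc : ConvexOn ℝ univ g := lam_conv
  have hin : ∀ B : ℝ, B ∈ interior (univ : Set ℝ) := fun B => by simp
  let dp : ℝ → ℝ := fun B => B / 2 - derivWithin g (Ioi B) B
  let dm : ℝ → ℝ := fun B => B / 2 - derivWithin g (Iio B) B
  have tp : ∀ B, Tendsto (fun ε : ℝ => (lambda1H (B + ε) - lambda1H B) / ε) (𝓝[>] 0) (𝓝 (dp B)) := by
    intro B
    have h := lam_der B (hc.hasDerivWithinAt_rightDeriv_of_mem_interior (hin B))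
    rw [hasDerivWithinAt_iff_tendsto_slope' (by simp)] at h
    have t : Tendsto (fun ε : ℝ => B + ε) (𝓝[>] 0) (𝓝[>] B) := by
      refine tendsto_nhdsWithin_iff.2 ⟨?_, ?_⟩
      · have : Tendsto (fun ε : ℝ => B + ε) (𝓝 0) (𝓝 (B + 0)) := (continuous_const.add continuous_id).tendsto 0
        rw [add_zero] at this
        exact this.mono_left nhdsWithin_le_nhds
      · filter_upwards [self_mem_nhdsWithin] with ε hε
        simpa using hε
    refine (h.comp t).congr fun ε => ?_
    simp [slope_def_field]
  have tm : ∀ B, Tendsto (fun ε : ℝ => (lambda1H (B + ε) - lambda1H B) / ε) (𝓝[<] 0) (𝓝 (dm B)) := by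
    intro B
    have h := lam_der B (hc.hasDerivWithinAt_leftDeriv_of_mem_interior (hin B))
    rw [hasDerivWithinAt_iff_tendsto_slope' (by simp)] at h
    have t : Tendsto (fun ε : ℝ => B + ε) (𝓝[<] 0) (𝓝[<] B) := by
      refine tendsto_nhdsWithin_iff.2 ⟨?_, ?_⟩
      · have : Tendsto (fun ε : ℝ => B + ε) (𝓝 0) (𝓝 (B + 0)) := (continuous_const.add continuous_id).tendsto 0
        rw [add_zero] at this
        exact this.mono_left nhdsWithin_le_nhds
      · filter_upwards [self_mem_nhdsWithin] with ε hε
        simpa using hε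
    refine (h.comp t).congr fun ε => ?_
    simp [slope_def_field]
  have hpm : ∀ B, dp B ≤ dm B := fun B => by
    have := hc.leftDeriv_le_rightDeriv_of_mem_interior (hin B)
    simp only [dp, dm]; linarith
  have lo : ∀ η > 0, ∀ᶠ B in atTop, Theta0 - δ₀ / 2 - η ≤ dp B := by
    intro η hη
    obtain ⟨N, hN, h⟩ := keyP hξ hu hδ hη
    filter_upwards [eventually_ge_atTop N] with B hB
    have t2 : Tendsto (fun ε : ℝ => Theta0 - δ₀ / 2 - η - ε / 4) (𝓝[>] 0) (𝓝 (Theta0 - δ₀ / 2 - η - 0 / 4)) :=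
      ((continuous_const.sub (continuous_id.div_const 4)).tendsto 0).mono_left nhdsWithin_le_nhds
    rw [zero_div, sub_zero] at t2
    refine le_of_tendsto_of_tendsto t2 (tp B) ?_
    filter_upwards [self_mem_nhdsWithin] with ε hε
    have hε : 0 < ε := hε
    have := h (B + ε) (by linarith) (-ε)
    rw [add_neg_cancel_right, abs_neg, abs_of_pos hε] at this
    rw [le_div_iff₀ hε]
    linarith
  have up : ∀ η > 0, ∀ᶠ B in atTop, dm B ≤ Theta0 + δ₀ / 2 + η := by
    intro η hη
    obtain ⟨N, hN, h⟩ := keyP hξ hu hδ hη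
    filter_upwards [eventually_gt_atTop N] with B hB
    have t2 : Tendsto (fun ε : ℝ => Theta0 + δ₀ / 2 + η - ε / 4) (𝓝[<] 0) (𝓝 (Theta0 + δ₀ / 2 + η - 0 / 4)) :=
      ((continuous_const.sub (continuous_id.div_const 4)).tendsto 0).mono_left nhdsWithin_le_nhds
    rw [zero_div, sub_zero] at t2
    refine le_of_tendsto_of_tendsto (tm B) t2 ?_
    have : ∀ᶠ ε in 𝓝[<] (0:ℝ), N - B < ε := mem_nhdsWithin_of_mem_nhds (Ioi_mem_nhds (by linarith))
    filter_upwards [self_mem_nhdsWithin, this] with ε hε hε2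
    have hε : ε < 0 := hε
    have := h (B + ε) (by linarith) (-ε)
    rw [add_neg_cancel_right, abs_neg, abs_of_neg hε] at this
    rw [div_le_iff_of_neg hε]
    linarith
  refine ⟨dp, dm, fun B _ => ⟨tp B, tm B, hpm B⟩, hpos, ?_, ?_, ?_⟩
  · refine le_of_forall_pos_le_add fun η hη => ?_
    have : Theta0 - δ₀ / 2 - η ≤ liminf dp atTop := by
      refine le_liminf_of_le ?_ (lo η hη)
      exact isCoboundedUnder_ge_of_eventually_le _ (x := Theta0 + δ₀ / 2 + 1) ((up 1 one_pos).mono fun B hB => (hpm B).trans hB)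
    linarith
  · refine le_of_forall_pos_le_add fun η hη => ?_
    refine limsup_le_of_le ?_ (up η hη)
    exact isCoboundedUnder_le_of_eventually_le _ (x := Theta0 - δ₀ / 2 - 1) ((lo 1 one_pos).mono fun B hB => hB.trans (hpm B))
  · obtain ⟨N, hN, h⟩ := keyP hξ hu hδ (half_pos hpos)
    refine ⟨N, by linarith, fun x hx y hy hxy => ?_⟩
    have hx : N < x := hx
    set c := Theta0 - δ₀ / 2
    have st : ∀ z ≥ N, ∀ s, 0 ≤ s → s ≤ 2 * c → lambda1H z ≤ lambda1H (z + s) := by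
      intro z hz s hs hs2
      have := h (z + s) (by linarith) (-s)
      rw [add_neg_cancel_right, abs_neg, abs_of_nonneg hs] at this
      have e : Theta0 - δ₀ / 2 = c := rfl
      nlinarith
    obtain ⟨n, hn⟩ := exists_nat_gt ((y - x) / (2 * c))
    have hn0 : (0:ℝ) < n := lt_of_le_of_lt (div_nonneg (by linarith) (by linarith)) hn
    set s := (y - x) / n
    have hs : 0 ≤ s := div_nonneg (by linarith) hn0.le
    have hs2 : s ≤ 2 * c := by
      rw [div_lt_iff₀ (by linarith)] at hn
      rw [div_le_iff₀ hn0]; linarith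
    have ind : ∀ k : ℕ, lambda1H x ≤ lambda1H (x + k * s) := by
      intro k
      induction k with
      | zero => simp
      | succ k ih =>
        refine ih.trans ?_
        have := st (x + k * s) (by have : 0 ≤ (k:ℝ) * s := by positivity
                                   linarith) s hs hs2
        rw [show x + ((k + 1 : ℕ) : ℝ) * s = x + k * s + s by push_cast; ring]
        exact this
    have := ind n
    rwa [show x + n * s = y by simp only [s]; field_simp; ring] at this
end

/-- Theorem 1.3: existence of one-sided derivatives of the ground-state
energy, bounds on them at large field, and monotonicity for large `B`. -/
theorem statement1
    (ξ₀ : ℝ) (hξ₀ : deGennes ξ₀ = Theta0)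
    (hξ₀uniq : ∀ ξ : ℝ, deGennes ξ = Theta0 → ξ = ξ₀)
    (δ₀ : ℝ) (hδ₀ : δ₀ = (1 / 2) * iteratedDeriv 2 deGennes ξ₀) :
    ∃ dplus dminus : ℝ → ℝ,
      (∀ B : ℝ, 0 < B →
        Tendsto (fun ε : ℝ => (lambda1H (B + ε) - lambda1H B) / ε) (𝓝[>] 0) (𝓝 (dplus B)) ∧
        Tendsto (fun ε : ℝ => (lambda1H (B + ε) - lambda1H B) / ε) (𝓝[<] 0) (𝓝 (dminus B)) ∧
        dplus B ≤ dminus B) ∧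
      0 < Theta0 - δ₀ / 2 ∧
      Theta0 - δ₀ / 2 ≤ Filter.liminf dplus Filter.atTop ∧
      Filter.limsup dminus Filter.atTop ≤ Theta0 + δ₀ / 2 ∧
      ∃ B₀ : ℝ, 0 < B₀ ∧ MonotoneOn lambda1H (Ioi B₀) := by
  exact main_all hξ₀ hξ₀uniq hδ₀
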